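/- The assignment e_{i,r} ↦ x_{i,1}^r ∈ S_{1_i} (for i∈I, r∈ℤ, where 1_i∈ℕ^n is the i-th coordinate vector) extends to a well-defined ℚ(v)-algebra homomorphism Ψ: U_v^>(Lsp_{2n}) → S, and Ψ is an algebra isomorphism. -/

import Mathlib

noncomputable section
open scoped BigOperators DirectSum

/-! ### Base field ℚ(v) and quantum numbers -/

/-- the base field `ℚ(v)`. -/
abbrev KK : Type := RatFunc ℚ
/-- the variable `v ∈ ℚ(v)`. -/
def vv : KK := RatFunc.X
/-- integer powers of `v`. -/
def vpow (m : ℤ) : KK := vv ^ m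
/-- the quantum integer `[m]_u = (uᵐ - u⁻ᵐ)/(u - u⁻¹)`. -/
def qInt (u : KK) (m : ℕ) : KK := (u ^ (m : ℤ) - u ^ (-(m : ℤ))) / (u - u⁻¹)
/-- the quantum factorial `[m]_u!`. -/
def qFact (u : KK) (m : ℕ) : KK := ∏ k ∈ Finset.range m, qInt u (k + 1)
/-- the quantum binomial coefficient. -/
def qBinom (u : KK) (m k : ℕ) : KK := qFact u m / (qFact u k * qFact u (m - k))
/-- `⟨m⟩_v = vᵐ - v⁻ᵐ`. -/
def qBrack (m : ℕ) : KK := vpow (m : ℤ) - vpow (-(m : ℤ))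
/-- the sign `ε ∈ {+,-}` as `±1`. -/
def sgn (ε : Bool) : ℤ := if ε then 1 else -1
/-- `l` is an integer power of `v`. -/
def IsVpow (l : KK) : Prop := ∃ m : ℤ, l = vpow m

/-! ### Cartan data of types `C_n` and `D_n` (1-based indices) -/

/-- the Cartan matrix of type `C_n` (1-based indices). -/
def aC (n i j : ℕ) : ℤ :=
  if i = j then 2 else if i + 1 = n ∧ j = n then -2
  else if i + 1 = j ∨ j + 1 = i then -1 else 0
/-- the symmetrizing integers `d_i` of type `C_n`. -/
def dC (n i : ℕ) : ℕ := if i = n then 2 else 1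
/-- the Cartan matrix of type `D_n` (1-based indices). -/
def aD (n i j : ℕ) : ℤ :=
  if i = j then 2
  else if (i + 1 = j ∧ j + 1 ≤ n) ∨ (j + 1 = i ∧ i + 1 ≤ n) then -1
  else if (i + 2 = n ∧ j = n) ∨ (j + 2 = n ∧ i = n) then -1 else 0
/-- the symmetrizing integers `d_i` of type `D_n` (all equal to `1`). -/
def dD (n i : ℕ) : ℕ := 1

/-! ### The positive subalgebra of the quantum loop algebra, for Cartan data `(A, Dd)` -/

section Ualg
variable (n : ℕ) (A : ℕ → ℕ → ℤ) (Dd : ℕ → ℕ)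

/-- the free `ℚ(v)`-algebra on generators `e_{i,r}`, `i ∈ I`, `r ∈ ℤ`. -/
abbrev FA := FreeAlgebra KK (Fin n × ℤ)
/-- the free generator `e_{i,r}`. -/
def fg (i : Fin n) (r : ℤ) : FA n := FreeAlgebra.ι KK (i, r)

/-- the `z^{-r₁}⋯z^{-r_m}w^{-t}`-coefficient of the Serre relation between colors `i ≠ j`. -/
def serreElt (i j : Fin n) (m : ℕ) (r : Fin m → ℤ) (t : ℤ) : FA n :=
  ∑ σ : Equiv.Perm (Fin m), ∑ k ∈ Finset.range (m + 1),
    ((-1 : KK) ^ k * qBinom (vpow (Dd (i.1 + 1))) m k) •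
      (((List.ofFn fun l => fg n i (r (σ l))).take k
        ++ fg n j t :: (List.ofFn fun l => fg n i (r (σ l))).drop k).prod)

/-- the defining relations of `U_v^>(Lg)` in the new Drinfeld realization: the coefficients of
`(z - v_i^{a_ij} w) e_i(z) e_j(w) = (v_i^{a_ij} z - w) e_j(w) e_i(z)` and of the Serre relations. -/
inductive URel : FA n → FA n → Prop
  | loop (i j : Fin n) (r s : ℤ) :
      URel (fg n i (r + 1) * fg n j s
             - vpow ((Dd (i.1 + 1) : ℤ) * A (i.1 + 1) (j.1 + 1)) • (fg n i r * fg n j (s + 1)))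
           (vpow ((Dd (i.1 + 1) : ℤ) * A (i.1 + 1) (j.1 + 1)) • (fg n j s * fg n i (r + 1))
             - fg n j (s + 1) * fg n i r)
  | serre (i j : Fin n) (hij : i ≠ j) (r : Fin (1 - A (i.1 + 1) (j.1 + 1)).toNat → ℤ) (t : ℤ) :
      URel (serreElt n Dd i j _ r t) 0

/-- the positive subalgebra `U_v^>(Lg)` of the quantum loop algebra. -/
abbrev UA := RingQuot (URel n A Dd)
/-- the generator `e_{i,r}` of `U_v^>(Lg)`. -/
def ug (i : Fin n) (r : ℤ) : UA n A Dd := RingQuot.mkAlgHom KK (URel n A Dd) (fg n i r)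
/-- the generator `e_{i,r}` with a 1-based index `1 ≤ i ≤ n` (and junk value `0` otherwise). -/
def g1 (i : ℕ) (r : ℤ) : UA n A Dd := if h : 1 ≤ i ∧ i ≤ n then ug n A Dd ⟨i - 1, by omega⟩ r else 0

end Ualg

/-! ### `q`-brackets, ordered monomials, and ℤ[v,v⁻¹]-forms -/

section Aux
variable {B : Type} [Ring B] [Module KK B]

/-- the `u`-commutator `[x,y]_u = xy - u · yx`. -/
def qcm (u : KK) (x y : B) : B := x * y - u • (y * x)

/-- the iterated `q`-bracket `[⋯[[g i₁ s₁, g i₂ s₂]_{λ₁}, g i₃ s₃]_{λ₂}, ⋯]_{λ_{ℓ-1}}`. -/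
def chainE (g : ℕ → ℤ → B) (w : List ℕ) (ss : List ℤ) (ls : List KK) : B :=
  match w, ss with
  | i :: w', s :: ss' =>
      ((w'.zip ss').zip ls).foldl
        (fun acc p => acc * g p.1.1 p.1.2 - p.2 • (g p.1.1 p.1.2 * acc)) (g i s)
  | _, _ => 0
end Aux

section Mon
variable {B : Type} [Ring B] {ι : Type} [LinearOrder ι]
/-- the ordered monomial `∏→ (E p)^(h p)`, the product taken in increasing order of `p`. -/
def ordMon (E : ι → B) (h : ι →₀ ℕ) : B := ((h.support.sort (· ≤ ·)).map (fun p => E p ^ h p)).prod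
end Mon

/-- the subring `ℤ[v,v⁻¹] ⊆ ℚ(v)`. -/
def Rint : Subring KK := Subring.closure {vv, vv⁻¹}

section Forms
variable {B : Type} [Ring B] [Algebra KK B]
/-- the `ℤ[v,v⁻¹]`-subalgebra of a `ℚ(v)`-algebra generated by a set `X`, realized as the subring
generated by `X` together with the central scalars `v^{±1}`. -/
def zvForm (X : Set B) : Subring B :=
  Subring.closure ({algebraMap KK B vv, algebraMap KK B vv⁻¹} ∪ X)
end Forms

section Shuffle
variable (n : ℕ) (A : ℕ → ℕ → ℤ) (Dd : ℕ → ℕ)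

abbrev Vars (k : Fin n → ℕ) : Type := Σ i : Fin n, Fin (k i)
abbrev Pk (k : Fin n → ℕ) := MvPolynomial (Vars n k) KK
abbrev Fk (k : Fin n → ℕ) := FractionRing (Pk n k)

def xvr {k : Fin n → ℕ} (u : Vars n k) : Fk n k := algebraMap (Pk n k) (Fk n k) (MvPolynomial.X u)
def cf {k : Fin n → ℕ} (a : KK) : Fk n k := algebraMap KK (Fk n k) a

def emb1f (k l : Fin n → ℕ) : Vars n k → Vars n (k + l) :=
  fun u => ⟨u.1, ⟨u.2.1, by have h := u.2.2; show u.2.1 < k u.1 + l u.1; omega⟩⟩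
def emb2f (k l : Fin n → ℕ) : Vars n l → Vars n (k + l) :=
  fun u => ⟨u.1, ⟨k u.1 + u.2.1, by have h := u.2.2; show k u.1 + u.2.1 < k u.1 + l u.1; omega⟩⟩

lemma emb1f_inj (k l : Fin n → ℕ) : Function.Injective (emb1f n k l) := by
  rintro ⟨i, r⟩ ⟨j, s⟩ h
  simp only [emb1f, Sigma.mk.inj_iff] at h
  obtain ⟨rfl, h2⟩ := h
  rw [heq_iff_eq, Fin.mk.injEq] at h2
  exact congrArg _ (Fin.ext h2)

lemma emb2f_inj (k l : Fin n → ℕ) : Function.Injective (emb2f n k l) := by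
  rintro ⟨i, r⟩ ⟨j, s⟩ h
  simp only [emb2f, Sigma.mk.inj_iff] at h
  obtain ⟨rfl, h2⟩ := h
  rw [heq_iff_eq, Fin.mk.injEq] at h2
  exact congrArg _ (Fin.ext (by omega))

def permVf {m : Fin n → ℕ} (σ : ∀ i, Equiv.Perm (Fin (m i))) : Vars n m → Vars n m :=
  fun u => ⟨u.1, σ u.1 u.2⟩

lemma permVf_inj {m : Fin n → ℕ} (σ : ∀ i, Equiv.Perm (Fin (m i))) :
    Function.Injective (permVf n σ) := by
  rintro ⟨i, r⟩ ⟨j, s⟩ h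
  simp only [permVf, Sigma.mk.inj_iff] at h
  obtain ⟨rfl, h2⟩ := h
  rw [heq_iff_eq] at h2
  exact congrArg _ ((σ i).injective h2)

/-- extension of an (injective) renaming of variables to fraction fields. -/
def liftHom {k m : Fin n → ℕ} (f : Vars n k → Vars n m) (hf : Function.Injective f) :
    Fk n k →+* Fk n m :=
  IsFractionRing.lift (g := (algebraMap (Pk n m) (Fk n m)).comp
      (MvPolynomial.rename f).toRingHom)
    (by
      rw [RingHom.coe_comp]
      exact Function.Injective.comp (IsFractionRing.injective _ _)
        (by simpa using MvPolynomial.rename_injective (R := KK) f hf))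

def emb1 (k l : Fin n → ℕ) : Fk n k →+* Fk n (k + l) := liftHom n (emb1f n k l) (emb1f_inj n k l)
def emb2 (k l : Fin n → ℕ) : Fk n l →+* Fk n (k + l) := liftHom n (emb2f n k l) (emb2f_inj n k l)
def permF {m : Fin n → ℕ} (σ : ∀ i, Equiv.Perm (Fin (m i))) : Fk n m →+* Fk n m :=
  liftHom n (permVf n σ) (permVf_inj n σ)

/-- the product of `ζ`-factors in the shuffle product. -/
def zfac (k l : Fin n → ℕ) : Fk n (k + l) :=
  ∏ i : Fin n, ∏ j : Fin n, ∏ r : Fin (k i), ∏ s : Fin (l j),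
    (xvr n (emb1f n k l ⟨i, r⟩) -
        cf n (vpow (-((Dd (i.1 + 1) : ℤ) * A (i.1 + 1) (j.1 + 1)))) * xvr n (emb2f n k l ⟨j, s⟩)) /
      (xvr n (emb1f n k l ⟨i, r⟩) - xvr n (emb2f n k l ⟨j, s⟩))

/-- the shuffle product on homogeneous components. -/
def shufMul (k l : Fin n → ℕ) (F : Fk n k) (G : Fk n l) : Fk n (k + l) :=
  (((∏ i, Nat.factorial (k i)) * (∏ i, Nat.factorial (l i)) : ℕ) : KK)⁻¹ •
    ∑ σ : ∀ i : Fin n, Equiv.Perm (Fin ((k + l) i)),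
      permF n σ (emb1 n k l F * emb2 n k l G * zfac n A Dd k l)

abbrev BigS := ⨁ k : Fin n → ℕ, Fk n k

open Classical in
/-- the shuffle product, extended bilinearly to the direct sum. -/
def bstar (x y : BigS n) : BigS n :=
  DFinsupp.sum x fun k xk => DFinsupp.sum y fun l yl =>
    DirectSum.of (fun k => Fk n k) (k + l) (shufMul n A Dd k l xk yl)

def Dpoly (k : Fin n → ℕ) : Pk n k :=
  ∏ i : Fin n, ∏ j : Fin n,
    if i < j ∧ A (i.1 + 1) (j.1 + 1) ≠ 0 then
      ∏ r : Fin (k i), ∏ s : Fin (k j), (MvPolynomial.X ⟨i, r⟩ - MvPolynomial.X (⟨j, s⟩ : Vars n k))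
    else 1

def xProd (k : Fin n → ℕ) : Pk n k := ∏ u : Vars n k, MvPolynomial.X u

/-- `f` is symmetric in the variables of each color. -/
def symmQ {k : Fin n → ℕ} (f : Pk n k) : Prop :=
  ∀ σ : ∀ i, Equiv.Perm (Fin (k i)), MvPolynomial.rename (permVf n σ) f = f

def wheelSub {k : Fin n → ℕ} (i j : Fin n) (m : ℕ) (hm : 0 < m)
    (s : Fin m → Fin (k i)) (r : Fin (k j)) : Vars n k → Pk n k := fun u =>
  if u = ⟨j, r⟩ then
    MvPolynomial.C (vpow ((Dd (i.1 + 1) : ℤ) * A (i.1 + 1) (j.1 + 1))) *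
      MvPolynomial.X ⟨i, s ⟨0, hm⟩⟩
  else if h : ∃ t : Fin m, u = ⟨i, s t⟩ then
    MvPolynomial.C (vpow ((Dd (i.1 + 1) : ℤ) * (-2 * (h.choose.1 : ℤ)))) *
      MvPolynomial.X ⟨i, s ⟨0, hm⟩⟩
  else MvPolynomial.X u

/-- the wheel conditions. -/
def wheelQ {k : Fin n → ℕ} (f : Pk n k) : Prop :=
  ∀ (i j : Fin n), i ≠ j → ∀ hA : A (i.1 + 1) (j.1 + 1) < 0,
    ∀ s : Fin (1 - A (i.1 + 1) (j.1 + 1)).toNat → Fin (k i), Function.Injective s →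
      ∀ r : Fin (k j),
        MvPolynomial.aeval (wheelSub n A Dd i j _ (by omega) s r) f = 0

/-- membership in the component `S_k` of the shuffle algebra: `F = f / (denominator)` with `f`
a symmetric Laurent polynomial satisfying the wheel conditions. -/
def inS {k : Fin n → ℕ} (F : Fk n k) : Prop :=
  ∃ (f : Pk n k) (m : ℕ), symmQ n f ∧ wheelQ n A Dd f ∧
    F * algebraMap (Pk n k) (Fk n k) (Dpoly n A k * xProd n k ^ m) = algebraMap (Pk n k) (Fk n k) f

end Shuffle

/-- the `i`-th coordinate vector `1_i ∈ ℕ^n`. -/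
def unitVec {n : ℕ} (i : Fin n) : Fin n → ℕ := fun j => if j = i then 1 else 0

/-! ### The loop Lie algebra of type `C` with colours numbered from the long node -/

section LoopLie
set_option linter.unusedSectionVars false
variable {T L : Type*} [AddCommMonoid T] [LieRing L] [LieAlgebra ℚ L]

structure LoopRel (e : ℕ → T → L) : Prop where
  loop : ∀ i j r s u, ⁅e i (r + u), e j s⁆ = ⁅e i r, e j (s + u)⁆
  same : ∀ i r s, ⁅e i r, e i s⁆ = 0
  far : ∀ i j r s, i + 2 ≤ j → ⁅e i r, e j s⁆ = 0
  serre_down : ∀ i t r s, ⁅⁅e (i + 1) t, e i r⁆, e i s⁆ = 0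
  serre_up : ∀ i t r s, ⁅⁅e (i + 1) t, e (i + 2) r⁆, e (i + 2) s⁆ = 0
  serre_long : ∀ t r s u, ⁅⁅⁅e 0 t, e 1 r⁆, e 1 s⁆, e 1 u⁆ = 0

lemma lie_right_leibniz (a b c : L) : ⁅⁅a, b⁆, c⁆ = ⁅⁅a, c⁆, b⁆ + ⁅a, ⁅b, c⁆⁆ := by
  rw [lie_lie a b c, ← lie_skew b ⁅a, c⁆]; abel

lemma lie_right_comm {a b c : L} (h : ⁅b, c⁆ = 0) : ⁅⁅a, b⁆, c⁆ = ⁅⁅a, c⁆, b⁆ := by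
  rw [lie_right_leibniz, h, lie_zero, add_zero]

lemma lie_zero_of_swap {a b : L} (h : ⁅a, b⁆ = 0) : ⁅b, a⁆ = 0 := by
  rw [← lie_skew, h, neg_zero]

lemma eq_zero_of_add_self {a : L} (h : a + a = 0) : a = 0 := by
  have h2 : (2 : ℚ) • a = 0 := by rw [two_smul]; exact h
  exact (smul_eq_zero.mp h2).resolve_left (by norm_num)

lemma eq_zero_of_eq_neg {a : L} (h : a = -a) : a = 0 := by
  apply eq_zero_of_add_self; nth_rewrite 2 [h]; simp

def chainA (e : ℕ → T → L) (t : ℕ) : ℕ → T → L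
  | 0, r => e t r
  | d + 1, r => ⁅chainA e t d r, e (t + d + 1) 0⁆

def chainZ (e : ℕ → T → L) (d d' : ℕ) (r : T) : L := ⁅chainA e 0 (d + 1) r, chainA e 1 d' 0⁆

variable {e : ℕ → T → L} (he : LoopRel e)
include he

namespace LoopRel

lemma mode (i j : ℕ) (r s : T) : ⁅e i r, e j s⁆ = ⁅e i (r + s), e j 0⁆ := by
  rw [he.loop, zero_add]

lemma far' (i j : ℕ) (r s : T) (h : i + 2 ≤ j ∨ j + 2 ≤ i ∨ i = j) : ⁅e i r, e j s⁆ = 0 := by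
  rcases h with h | h | rfl
  · exact he.far _ _ _ _ h
  · exact lie_zero_of_swap (he.far _ _ _ _ h)
  · exact he.same _ _ _

lemma chain_far (t d m : ℕ) (r s : T) (h : t + d + 2 ≤ m ∨ m + 2 ≤ t) :
    ⁅chainA e t d r, e m s⁆ = 0 := by
  induction d with
  | zero => exact he.far' _ _ _ _ (by omega)
  | succ d ih =>
    rw [chainA, lie_right_leibniz, ih (by omega), he.far' _ _ _ _ (by omega)]
    simp

lemma chain_step (t d : ℕ) (r s : T) :
    ⁅chainA e t d r, e (t + d + 1) s⁆ = chainA e t (d + 1) (r + s) := by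
  induction d generalizing r s with
  | zero => exact he.mode _ _ _ _
  | succ d ih =>
    have h1 : ∀ r s, ⁅chainA e t d r, e (t + (d + 1) + 1) s⁆ = 0 := fun r s =>
      he.chain_far _ _ _ _ _ (by omega)
    have h2 : ∀ r u s, ⁅⁅chainA e t d r, e (t + d + 1) u⁆, e (t + (d + 1) + 1) s⁆ =
        ⁅chainA e t d r, ⁅e (t + d + 1) u, e (t + (d + 1) + 1) s⁆⁆ := by
      intro r u s
      rw [lie_right_leibniz, h1, zero_lie, zero_add]
    conv_lhs => rw [chainA, h2, he.mode, ← h2, ih]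
    rw [zero_add]; rfl

lemma chain_succ_eq (t d : ℕ) (r s : T) :
    ⁅e t r, chainA e (t + 1) d s⁆ = chainA e t (d + 1) (r + s) := by
  induction d generalizing r s with
  | zero => rw [chainA, chainA, chainA, he.mode]
  | succ d ih =>
    have h1 : ⁅e t r, e (t + 1 + d + 1) 0⁆ = 0 := he.far' _ _ _ _ (by omega)
    have := lie_right_leibniz (e t r) (chainA e (t + 1) d s) (e (t + 1 + d + 1) 0)
    rw [h1, zero_lie, zero_add, ih] at this
    rw [chainA, ← this, show t + 1 + d + 1 = t + (d + 1) + 1 by omega]; rfl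

lemma chain_pred (t d : ℕ) (r s : T) :
    ⁅chainA e (t + 1) d r, e t s⁆ = - chainA e t (d + 1) (r + s) := by
  rw [← lie_skew, he.chain_succ_eq, add_comm s r]

lemma chain_end (t d : ℕ) (r u s : T) (h : 1 ≤ t ∨ 1 ≤ d) :
    ⁅⁅chainA e t d r, e (t + d + 1) u⁆, e (t + d + 1) s⁆ = 0 := by
  cases d with
  | zero =>
    obtain ⟨t, rfl⟩ : ∃ k, t = k + 1 := ⟨t - 1, by omega⟩
    exact he.serre_up _ _ _ _
  | succ d =>
    have h1 : ∀ s, ⁅chainA e t d r, e (t + (d + 1) + 1) s⁆ = 0 := fun s =>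
      he.chain_far _ _ _ _ _ (by omega)
    have h2 : ∀ b : L, ∀ s, ⁅⁅chainA e t d r, b⁆, e (t + (d + 1) + 1) s⁆ =
        ⁅chainA e t d r, ⁅b, e (t + (d + 1) + 1) s⁆⁆ := by
      intro b s
      rw [lie_right_leibniz, h1, zero_lie, zero_add]
    rw [chainA, h2, h2, show t + (d + 1) + 1 = t + d + 2 from rfl, he.serre_up, lie_zero]

lemma mid_zero (a : L) (m : ℕ) (hab : ∀ s s', ⁅⁅a, e m s⁆, e m s'⁆ = 0)
    (hac : ∀ s, ⁅a, e (m + 1) s⁆ = 0) (s s' u : T) :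
    ⁅⁅⁅a, e m s⁆, e (m + 1) u⁆, e m s'⁆ = 0 := by
  set b := e m with hb
  set c := e (m + 1) with hc
  have hbcb : ∀ s u s', ⁅⁅b s, c u⁆, b s'⁆ = 0 := by
    intro s u s'
    rw [← lie_skew (b s), neg_lie]
    exact neg_eq_zero.mpr (he.serre_down m u s s')
  have hY : ∀ s u, ⁅⁅a, b s⁆, c u⁆ = ⁅a, ⁅b s, c u⁆⁆ := by
    intro s u; rw [lie_right_leibniz, hac, zero_lie, zero_add]
  have e1 : ∀ s u s', ⁅⁅⁅a, b s⁆, c u⁆, b s'⁆ = ⁅⁅a, b s'⁆, ⁅b s, c u⁆⁆ := by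
    intro s u s'
    rw [hY, lie_right_leibniz, hbcb, lie_zero, add_zero]
  have e2 : ∀ s u s', ⁅⁅⁅a, b s⁆, c u⁆, b s'⁆ = -⁅⁅a, b s⁆, ⁅b s', c u⁆⁆ := by
    intro s u s'
    rw [lie_right_leibniz, hab, zero_lie, zero_add, ← lie_skew (c u), lie_neg]
  have k1 : ∀ x y z : T, ⁅⁅a, b x⁆, ⁅b y, c z⁆⁆ = -⁅⁅a, b y⁆, ⁅b x, c z⁆⁆ := by
    intro x y z; rw [← e2, e1]
  have m1 : ∀ x y, ⁅b x, c y⁆ = ⁅b 0, c (y + x)⁆ := by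
    intro x y
    have := he.loop m (m + 1) 0 y x; rw [zero_add] at this; exact this
  have e3 : ∀ s u s', ⁅⁅a, b s⁆, ⁅b s', c u⁆⁆ = -⁅⁅a, b 0⁆, ⁅b 0, c (u + s' + s)⁆⁆ := by
    intro s u s'
    rw [m1, k1, m1]
  have e4 : ∀ w, ⁅⁅a, b 0⁆, ⁅b 0, c w⁆⁆ = 0 := fun w => eq_zero_of_eq_neg (k1 0 0 w)
  rw [e1, e3, e4, neg_zero]

lemma chain_zero (t d m : ℕ) (ht : 1 ≤ t) (h1 : t ≤ m) (h2 : m ≤ t + d) (r s : T) :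
    ⁅chainA e t d r, e m s⁆ = 0 := by
  induction d with
  | zero => exact he.far' _ _ _ _ (by omega)
  | succ d ih =>
    rcases (by omega : m = t + d + 1 ∨ m = t + d ∨ m + 1 ≤ t + d) with rfl | rfl | h
    · rw [chainA]; exact he.chain_end _ _ _ _ _ (by omega)
    · cases d with
      | zero =>
        rw [chainA, chainA]
        have := he.serre_down t 0 r s
        rw [← lie_skew (e t r), neg_lie]
        exact neg_eq_zero.mpr this
      | succ d =>
        rw [chainA]
        exact he.mid_zero (chainA e t d r) (t + d + 1)
          (fun s s' => he.chain_end _ _ _ _ _ (by omega))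
          (fun s => he.chain_far _ _ _ _ _ (by omega)) _ _ _
    · rw [chainA, lie_right_comm (he.far' _ _ _ _ (by omega)), ih (by omega), zero_lie]

lemma chain_zero_long (d : ℕ) (r s : T) : ⁅chainA e 0 d r, e 0 s⁆ = 0 := by
  induction d with
  | zero => exact he.same _ _ _
  | succ d ih =>
    cases d with
    | zero =>
      have := he.serre_down 0 0 r s
      rw [chainA, chainA, ← lie_skew (e 0 r), neg_lie, this, neg_zero]
    | succ d => rw [chainA, lie_right_comm (he.far' _ _ _ _ (by omega)), ih, zero_lie]

lemma chain_zero_inner (d m : ℕ) (h1 : 2 ≤ m) (h2 : m ≤ d) (r s : T) :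
    ⁅chainA e 0 d r, e m s⁆ = 0 := by
  obtain ⟨d, rfl⟩ : ∃ k, d = k + 1 := ⟨d - 1, by omega⟩
  have := he.chain_succ_eq 0 d 0 r
  rw [zero_add r] at this
  rw [← this, lie_right_leibniz, he.far' _ _ _ _ (by omega),
    he.chain_zero _ _ _ le_rfl (by omega) (by omega)]
  simp

lemma chain_comm_of_le (t d d' : ℕ) (ht : 1 ≤ t) (h : d' ≤ d) (r s : T) :
    ⁅chainA e t d r, chainA e t d' s⁆ = 0 := by
  induction d' with
  | zero => exact he.chain_zero _ _ _ ht le_rfl (by omega) _ _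
  | succ d' ih =>
    rw [chainA]
    have := lie_right_leibniz (chainA e t d r) (chainA e t d' s) (e (t + d' + 1) 0)
    rw [ih (by omega), he.chain_zero _ _ _ ht (by omega) (by omega)] at this
    simpa using this.symm

lemma chain_comm (t d d' : ℕ) (ht : 1 ≤ t) (r s : T) :
    ⁅chainA e t d r, chainA e t d' s⁆ = 0 := by
  rcases le_total d' d with h | h
  · exact he.chain_comm_of_le _ _ _ ht h _ _
  · exact lie_zero_of_swap (he.chain_comm_of_le _ _ _ ht h _ _)

lemma pair_swap (d d' : ℕ) (a b c : T) :
    ⁅chainA e 0 (d + 1) (a + b), chainA e 1 d' c⁆ =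
      ⁅chainA e 0 (d' + 1) (a + c), chainA e 1 d b⁆ := by
  rw [← he.chain_succ_eq 0 d, lie_right_comm (he.chain_comm _ _ _ le_rfl _ _),
    he.chain_succ_eq 0 d']

lemma pair_eq (d d' : ℕ) (r s : T) :
    ⁅chainA e 0 (d + 1) r, chainA e 1 d' s⁆ = chainZ e d d' (r + s) := by
  have h1 := he.pair_swap d d' 0 r s
  have h2 := he.pair_swap d' d s 0 r
  rw [zero_add, zero_add] at h1
  rw [add_zero] at h2
  rw [h1, h2, add_comm s]; rfl

lemma chainZ_symm (d d' : ℕ) (r : T) : chainZ e d d' r = chainZ e d' d r := by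
  have h1 := he.pair_swap d d' 0 r 0
  rw [zero_add, zero_add, he.pair_eq d' d, zero_add] at h1
  exact h1

lemma chain_end_eq (d m : ℕ) (hm : 1 ≤ m) (r s : T) :
    ⁅chainA e 1 d r, e m s⁆ = if m = d + 2 then chainA e 1 (d + 1) (r + s) else 0 := by
  split_ifs with h
  · subst h
    rw [show d + 2 = 1 + d + 1 by omega, he.chain_step]
  · rcases (by omega : m ≤ 1 + d ∨ 1 + d + 2 ≤ m) with h | h
    · exact he.chain_zero _ _ _ le_rfl hm h _ _
    · exact he.chain_far _ _ _ _ _ (by omega)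

lemma chain_end_eq_long (d m : ℕ) (hm : 2 ≤ m) (r s : T) :
    ⁅chainA e 0 (d + 1) r, e m s⁆ = if m = d + 2 then chainA e 0 (d + 2) (r + s) else 0 := by
  split_ifs with h
  · subst h
    rw [show d + 2 = 0 + (d + 1) + 1 by omega, he.chain_step]; simp
  · rcases (by omega : m ≤ d + 1 ∨ 0 + (d + 1) + 2 ≤ m) with h | h
    · exact he.chain_zero_inner _ _ hm h _ _
    · exact he.chain_far _ _ _ _ _ (by omega)

lemma chainZ_step (d d' m : ℕ) (hm : 2 ≤ m) (r s : T) :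
    ⁅chainZ e d d' r, e m s⁆ = (if m = d + 2 then chainZ e (d + 1) d' (r + s) else 0) +
      if m = d' + 2 then chainZ e d (d' + 1) (r + s) else 0 := by
  rw [chainZ, lie_right_leibniz, he.chain_end_eq_long _ _ hm, he.chain_end_eq _ _ (by omega)]
  congr 1
  · split_ifs
    · rw [he.pair_eq]; simp
    · simp
  · split_ifs
    · rw [he.pair_eq]; simp
    · simp

lemma triple_swap (x y z : ℕ) (r c s : T) :
    ⁅chainZ e x y (r + c), chainA e 1 z s⁆ = ⁅chainZ e x z (r + s), chainA e 1 y c⁆ := by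
  rw [← he.pair_eq, ← he.pair_eq, lie_right_comm (he.chain_comm _ _ _ le_rfl _ _)]

lemma triple_mode (x y z : ℕ) (r s : T) :
    ⁅chainZ e x y r, chainA e 1 z s⁆ = ⁅chainZ e x y (r + s), chainA e 1 z 0⁆ := by
  have h1 := he.triple_swap x y z r 0 s
  have h2 := he.triple_swap z x y (r + s) 0 0
  have h3 := he.triple_swap y z x (r + s) 0 0
  rw [add_zero] at h1 h2 h3
  rw [h1, he.chainZ_symm x z, h2, he.chainZ_symm z y, h3, he.chainZ_symm y x]

lemma triple_zero : ∀ (N x y z : ℕ), x + y + z = N → x ≤ z → y ≤ z → ∀ r : T,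
    ⁅chainZ e x y r, chainA e 1 z 0⁆ = 0 := by
  intro N
  induction N with
  | zero =>
    intro x y z h _ _ r
    obtain rfl : x = 0 := by omega
    obtain rfl : y = 0 := by omega
    obtain rfl : z = 0 := by omega
    exact he.serre_long _ _ _ _
  | succ N ih =>
    intro x y z h hx hy r
    have S1 : ∀ x y z, ⁅chainZ e x y r, chainA e 1 z 0⁆ = ⁅chainZ e x z r, chainA e 1 y 0⁆ := by
      intro x y z
      have := he.triple_swap x y z r 0 0
      rwa [add_zero] at this
    have S2 : ∀ x y z, ⁅chainZ e x y r, chainA e 1 z 0⁆ = ⁅chainZ e y x r, chainA e 1 z 0⁆ := by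
      intro x y z; rw [he.chainZ_symm]
    obtain ⟨z, rfl⟩ : ∃ k, z = k + 1 := ⟨z - 1, by omega⟩
    have h0 : ⁅chainZ e x y r, chainA e 1 z 0⁆ = 0 := by
      rcases (by omega : (x ≤ z ∧ y ≤ z) ∨ (x = z + 1 ∧ y ≤ x ∧ z ≤ x) ∨
        (y = z + 1 ∧ x ≤ y ∧ z ≤ y)) with h | h | h
      · exact ih x y z (by omega) h.1 h.2 r
      · rw [S2, S1, S2]; exact ih z y x (by omega) (by omega) (by omega) r
      · rw [S1]; exact ih x z y (by omega) (by omega) (by omega) r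
    have hD := lie_right_leibniz (chainZ e x y r) (chainA e 1 z 0) (e (z + 2) 0)
    rw [h0, zero_lie, he.chainZ_step _ _ _ (by omega), he.chain_end_eq _ _ (by omega),
      if_pos rfl, add_zero, add_zero, add_lie] at hD
    have h1 : ⁅(if z + 2 = x + 2 then chainZ e (x + 1) y r else 0), chainA e 1 z 0⁆ =
        (if z = x then (1 : ℚ) else 0) • ⁅chainZ e x y r, chainA e 1 (z + 1) 0⁆ := by
      by_cases hzx : z = x
      · subst hzx; rw [if_pos rfl, if_pos rfl, one_smul, S2, S1, S2]
      · rw [if_neg (by omega), if_neg hzx, zero_lie, zero_smul]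
    have h2 : ⁅(if z + 2 = y + 2 then chainZ e x (y + 1) r else 0), chainA e 1 z 0⁆ =
        (if z = y then (1 : ℚ) else 0) • ⁅chainZ e x y r, chainA e 1 (z + 1) 0⁆ := by
      by_cases hzx : z = y
      · subst hzx; rw [if_pos rfl, if_pos rfl, one_smul, S1]
      · rw [if_neg (by omega), if_neg hzx, zero_lie, zero_smul]
    rw [h1, h2, ← add_smul] at hD
    set K := ⁅chainZ e x y r, chainA e 1 (z + 1) 0⁆
    have h3 : ((if z = x then (1 : ℚ) else 0) + (if z = y then (1 : ℚ) else 0) + 1) • K = 0 := by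
      rw [add_smul, one_smul]; exact hD.symm
    refine (smul_eq_zero.mp h3).resolve_left ?_
    split_ifs <;> norm_num

lemma chainZ_chain (x y z : ℕ) (r s : T) : ⁅chainZ e x y r, chainA e 1 z s⁆ = 0 := by
  rw [he.triple_mode]
  set u := r + s
  have S1 : ∀ x y z, ⁅chainZ e x y u, chainA e 1 z 0⁆ = ⁅chainZ e x z u, chainA e 1 y 0⁆ := by
    intro x y z
    have := he.triple_swap x y z u 0 0
    rwa [add_zero] at this
  rcases (by omega : (x ≤ z ∧ y ≤ z) ∨ (x ≤ y ∧ z ≤ y) ∨ (y ≤ x ∧ z ≤ x)) with h | h | h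
  · exact he.triple_zero _ x y z rfl h.1 h.2 _
  · rw [S1]; exact he.triple_zero _ x z y rfl h.1 h.2 _
  · rw [he.chainZ_symm, S1]; exact he.triple_zero _ y z x rfl h.1 h.2 _

lemma chainZ_long (p q : ℕ) (r s : T) : ⁅chainZ e p q r, e 0 s⁆ = 0 := by
  have k1 : ∀ r s, ⁅chainZ e p q r, e 0 s⁆ = -⁅chainA e 0 (p + 1) r, chainA e 0 (q + 1) s⁆ := by
    intro r s
    have := he.chain_pred 0 q 0 s
    rw [chainZ, lie_right_leibniz, he.chain_zero_long, zero_lie, zero_add]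
    rw [this, lie_neg, zero_add s]
  have k2 : ∀ a b s, ⁅chainZ e p q (s + b), e 0 a⁆ =
      ⁅chainA e 0 (p + 1) (a + b), chainA e 0 (q + 1) s⁆ := by
    intro a b s
    rw [← he.chain_succ_eq, lie_right_leibniz, lie_zero_of_swap (he.chain_zero_long _ _ _),
      zero_lie, zero_add, ← lie_skew (chainA e (0 + 1) p b), zero_add, he.pair_eq, lie_neg,
      lie_skew, he.chainZ_symm]
  have k3 : ∀ b s, ⁅chainZ e p q (s + b), e 0 0⁆ = -⁅chainZ e p q b, e 0 s⁆ := by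
    intro b s; rw [k2, k1, neg_neg, zero_add]
  have k4 : ∀ a s, ⁅chainZ e p q s, e 0 a⁆ = -⁅chainZ e p q a, e 0 s⁆ := by
    intro a s
    have := k2 a 0 s
    rw [add_zero, add_zero] at this
    rw [this, k1, neg_neg]
  have k5 : ⁅chainZ e p q r, e 0 s⁆ = ⁅chainZ e p q s, e 0 r⁆ := by
    rw [← neg_inj, ← k3, ← k3, add_comm]
  exact eq_zero_of_eq_neg (k5.trans (k4 _ _))

variable (e) in
omit he in
def rootSpan : Submodule ℚ L :=
  Submodule.span ℚ ({x | ∃ t d r, x = chainA e t d r} ∪ {x | ∃ d d' r, x = chainZ e d d' r})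

omit he in
lemma chainA_mem (t d : ℕ) (r : T) : chainA e t d r ∈ rootSpan e :=
  Submodule.subset_span (Or.inl ⟨t, d, r, rfl⟩)

omit he in
lemma chainZ_mem (d d' : ℕ) (r : T) : chainZ e d d' r ∈ rootSpan e :=
  Submodule.subset_span (Or.inr ⟨d, d', r, rfl⟩)

lemma chainA_lie_mem (t d m : ℕ) (r s : T) : ⁅chainA e t d r, e m s⁆ ∈ rootSpan e := by
  rcases (by omega : t + d + 2 ≤ m ∨ m + 2 ≤ t ∨ m = t + d + 1 ∨ (t = m + 1) ∨
    (1 ≤ t ∧ t ≤ m ∧ m ≤ t + d) ∨ (t = 0 ∧ m ≤ d)) with h | h | rfl | rfl | h | ⟨rfl, h⟩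
  · rw [he.chain_far _ _ _ _ _ (Or.inl h)]; exact zero_mem _
  · rw [he.chain_far _ _ _ _ _ (Or.inr h)]; exact zero_mem _
  · rw [he.chain_step]; exact chainA_mem _ _ _
  · rw [he.chain_pred]; exact neg_mem (chainA_mem _ _ _)
  · rw [he.chain_zero _ _ _ h.1 h.2.1 h.2.2]; exact zero_mem _
  · rcases (by omega : m = 0 ∨ m = 1 ∨ 2 ≤ m) with rfl | rfl | hm
    · rw [he.chain_zero_long]; exact zero_mem _
    · obtain ⟨d, rfl⟩ : ∃ k, d = k + 1 := ⟨d - 1, by omega⟩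
      have := he.pair_eq d 0 r s
      rw [chainA.eq_1 e 1] at this
      rw [this]; exact chainZ_mem _ _ _
    · rw [he.chain_zero_inner _ _ hm h]; exact zero_mem _

lemma chainZ_lie_mem (d d' m : ℕ) (r s : T) : ⁅chainZ e d d' r, e m s⁆ ∈ rootSpan e := by
  rcases (by omega : m = 0 ∨ m = 1 ∨ 2 ≤ m) with rfl | rfl | hm
  · rw [he.chainZ_long]; exact zero_mem _
  · have := he.chainZ_chain d d' 0 r s
    rw [chainA.eq_1 e 1] at this
    rw [this]; exact zero_mem _
  · rw [he.chainZ_step _ _ _ hm]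
    refine add_mem ?_ ?_ <;> split_ifs <;> first | exact zero_mem _ | exact chainZ_mem _ _ _

lemma rootSpan_lie_mem {x y : L} (hx : x ∈ rootSpan e) (hy : y ∈ rootSpan e) :
    ⁅x, y⁆ ∈ rootSpan e := by
  have gen : ∀ m s, ∀ x ∈ rootSpan e, ⁅x, e m s⁆ ∈ rootSpan e := by
    intro m s x hx
    induction hx using Submodule.span_induction with
    | mem x h =>
      rcases h with ⟨t, d, r, rfl⟩ | ⟨d, d', r, rfl⟩
      · exact he.chainA_lie_mem _ _ _ _ _
      · exact he.chainZ_lie_mem _ _ _ _ _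
    | zero => rw [zero_lie]; exact zero_mem _
    | add x y _ _ h1 h2 => rw [add_lie]; exact add_mem h1 h2
    | smul c x _ h => rw [smul_lie]; exact Submodule.smul_mem _ _ h
  have clo : ∀ y z : L, (∀ x ∈ rootSpan e, ⁅x, y⁆ ∈ rootSpan e) →
      (∀ x ∈ rootSpan e, ⁅x, z⁆ ∈ rootSpan e) → ∀ x ∈ rootSpan e, ⁅x, ⁅y, z⁆⁆ ∈ rootSpan e := by
    intro y z h1 h2 x hx
    have := lie_right_leibniz x y z
    rw [← sub_eq_iff_eq_add'.mpr this]
    exact sub_mem (h2 _ (h1 _ hx)) (h1 _ (h2 _ hx))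
  have hA : ∀ t d r, ∀ x ∈ rootSpan e, ⁅x, chainA e t d r⁆ ∈ rootSpan e := by
    intro t d r
    induction d with
    | zero => exact gen _ _
    | succ d ih => exact clo _ _ ih (gen _ _)
  induction hy using Submodule.span_induction with
  | mem y h =>
    rcases h with ⟨t, d, r, rfl⟩ | ⟨d, d', r, rfl⟩
    · exact hA _ _ _ _ hx
    · exact clo _ _ (hA _ _ _) (hA _ _ _) _ hx
  | zero => rw [lie_zero]; exact zero_mem _
  | add x y _ _ h1 h2 => rw [lie_add]; exact add_mem h1 h2
  | smul c x _ h => rw [lie_smul]; exact Submodule.smul_mem _ _ h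

end LoopRel
end LoopLie

section RootWords
set_option linter.unusedSectionVars false
variable {T L : Type*} [AddCommMonoid T] [LieRing L] [LieAlgebra ℚ L]

/-- The tail of the root word `t, t+1, …, t+d` in which the letters `t+1, …, t+c` are doubled. -/
def rtail (t c : ℕ) : ℕ → List ℕ
  | 0 => []
  | d + 1 => rtail t c d ++ (if d < c then [t + d + 1, t + d + 1] else [t + d + 1])

def lnc (x : L) (l : List L) : L := l.foldl (fun a b => ⁅a, b⁆) x

lemma lnc_append (x : L) (l l' : List L) : lnc x (l ++ l') = lnc (lnc x l) l' := by
  simp [lnc]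

def rootVec (e : ℕ → T → L) (t c d : ℕ) (r : T) : L :=
  if c = 0 then chainA e t d r else chainZ e (c - 1) (d - 1) r

def rootLnc (e : ℕ → T → L) (t c d : ℕ) (m : ℕ → T) : L :=
  lnc (e t (m t)) ((rtail t c d).map fun a => e a (m a))

def modeSum (t c d : ℕ) (m : ℕ → T) : T := ((t :: rtail t c d).map m).sum

lemma lnc_smul (q : ℚ) (x : L) (l : List L) : lnc (q • x) l = q • lnc x l := by
  induction l generalizing x with
  | nil => rfl
  | cons a l ih => simp only [lnc, List.foldl_cons, smul_lie] at ih ⊢; exact ih _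

lemma rootLnc_eq {e : ℕ → T → L} (he : LoopRel e) (t c d : ℕ) (h : t = 0 ∨ c = 0) :
    ∃ q : ℚ, q ≠ 0 ∧ ∀ m : ℕ → T,
      rootLnc e t c d m = q • rootVec e t (min c d) d (modeSum t c d m) := by
  induction d with
  | zero => exact ⟨1, one_ne_zero, fun m => by simp [rootLnc, rtail, lnc, rootVec, modeSum, chainA]⟩
  | succ d ih =>
    obtain ⟨q, hq, ih⟩ := ih
    have hstep : ∀ m, rootLnc e t c (d + 1) m = q • lnc (rootVec e t (min c d) d (modeSum t c d m))
        ((if d < c then [t + d + 1, t + d + 1] else [t + d + 1]).map fun a => e a (m a)) := by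
      intro m
      rw [rootLnc, rtail, List.map_append, lnc_append, ← lnc_smul, ← ih]; rfl
    have hsum : ∀ m : ℕ → T, modeSum t c (d + 1) m = modeSum t c d m +
        ((if d < c then [t + d + 1, t + d + 1] else [t + d + 1]).map m).sum := by
      intro m
      simp only [modeSum, rtail, List.map_cons, List.sum_cons, List.map_append, List.sum_append,
        add_assoc]
    rcases Nat.eq_zero_or_pos c with rfl | hc
    · refine ⟨q, hq, fun m => ?_⟩
      rw [hstep, hsum]
      simp [rootVec, lnc, he.chain_step]
    obtain rfl : t = 0 := by omega
    by_cases hdc : d < c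
    · rcases Nat.eq_zero_or_pos d with rfl | hd
      · refine ⟨q, hq, fun m => ?_⟩
        rw [hstep, hsum, if_pos hdc]
        have h1 : min c (0 + 1) = 1 := by omega
        have := he.pair_eq 0 0 (modeSum 0 c 0 m + m 1) (m 1)
        rw [chainA.eq_1 e 1, ← he.chain_step] at this
        simp only [rootVec, lnc, h1]
        simp only [zero_add, min_zero, if_true, List.map_cons, List.map_nil, List.foldl_cons,
          List.foldl_nil, one_ne_zero, if_false, List.sum_cons, List.sum_nil, add_zero,
          tsub_self] at this ⊢
        rw [this, add_assoc]
      · obtain ⟨d, rfl⟩ : ∃ k, d = k + 1 := ⟨d - 1, by omega⟩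
        refine ⟨q * 2, by simpa using hq, fun m => ?_⟩
        rw [hstep, hsum, if_pos hdc]
        have h1 : min c (d + 1) = d + 1 := by omega
        have h2 : min c (d + 1 + 1) = d + 2 := by omega
        simp only [rootVec, lnc, h1, h2]
        simp only [zero_add, Nat.add_one_ne_zero, if_false, List.map_cons, List.map_nil,
          List.foldl_cons, List.foldl_nil, List.sum_cons, List.sum_nil, add_zero,
          show d + 2 - 1 = d + 1 by omega, show d + 1 - 1 = d by omega]
        rw [he.chainZ_step _ _ _ (by omega), if_pos rfl, if_pos rfl, he.chainZ_symm d (d + 1),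
          add_lie, he.chainZ_step _ _ _ (by omega), if_neg (by omega), if_pos rfl, zero_add,
          ← two_smul ℚ, smul_smul, add_assoc]
    · have h1 : min c d = c := by omega
      have h2 : min c (d + 1) = c := by omega
      have hc0 : c ≠ 0 := by omega
      obtain ⟨d, rfl⟩ : ∃ k, d = k + 1 := ⟨d - 1, by omega⟩
      by_cases hcd : c = d + 1
      · refine ⟨q * 2, by simpa using hq, fun m => ?_⟩
        rw [hstep, hsum, if_neg hdc]
        simp only [rootVec, lnc, h1, h2, hc0]
        simp only [zero_add, if_false, List.map_cons, List.map_nil,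
          List.foldl_cons, List.foldl_nil, List.sum_cons, List.sum_nil, add_zero,
          show d + 1 - 1 = d by omega, show d + 1 + 1 - 1 = d + 1 by omega]
        subst hcd
        simp only [show d + 1 - 1 = d by omega]
        rw [he.chainZ_step _ _ _ (by omega), if_pos rfl, if_pos rfl, he.chainZ_symm (d + 1) d,
          ← two_smul ℚ, smul_smul]
      · refine ⟨q, hq, fun m => ?_⟩
        rw [hstep, hsum, if_neg hdc]
        simp only [rootVec, lnc, h1, h2, hc0]
        simp only [zero_add, if_false, List.map_cons, List.map_nil,
          List.foldl_cons, List.foldl_nil, List.sum_cons, List.sum_nil, add_zero,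
          show d + 1 - 1 = d by omega, show d + 1 + 1 - 1 = d + 1 by omega]
        rw [he.chainZ_step _ _ _ (by omega), if_neg (by omega), if_pos rfl, zero_add]

lemma rootVec_eq_zero {e : ℕ → T → L} {n : ℕ} (hz : ∀ c, n ≤ c → ∀ r, e c r = 0)
    (t c d : ℕ) (hcd : c ≤ d) (h : t = 0 ∨ c = 0) (hn : n ≤ t + d) (r : T) :
    rootVec e t c d r = 0 := by
  have hA : ∀ t d r, n ≤ t + d → chainA e t d r = 0 := by
    intro t d r h
    cases d with
    | zero => exact hz _ h _
    | succ d => rw [chainA, hz _ (by omega), lie_zero]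
  rw [rootVec]
  split_ifs with hc
  · exact hA _ _ _ hn
  · rw [chainZ, hA 1 (d - 1) 0 (by omega), lie_zero]

end RootWords

/-- The positive roots of type `C_n`, encoded by their words. -/
abbrev Rt (n : ℕ) := {p : ℕ × ℕ × ℕ // p.1 + p.2.1 < n ∧ p.2.2 ≤ p.2.1 ∧ (p.1 = 0 ∨ p.2.2 = 0)}

section PBW
attribute [local instance] LieRing.ofAssociativeRing
variable {B ι : Type*} [Ring B] [Algebra ℚ B]

lemma perm_prod_sub_mem (x : ι → B)
    (hx : ∀ i j, x i * x j - x j * x i ∈ Submodule.span ℚ (Set.range x)) {l l' : List ι}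
    (h : l.Perm l') : (l.map x).prod - (l'.map x).prod ∈
      Submodule.span ℚ {y | ∃ m : List ι, m.length < l.length ∧ y = (m.map x).prod} := by
  induction h with
  | nil => simp
  | @cons a l l' h ih =>
    simp only [List.map_cons, List.prod_cons, ← mul_sub]
    have : Submodule.span ℚ {y | ∃ m : List ι, m.length < l.length ∧ y = (m.map x).prod} ≤
        (Submodule.span ℚ {y | ∃ m : List ι, m.length < (a :: l).length ∧ y = (m.map x).prod}).comap
          (LinearMap.mulLeft ℚ (x a)) := by
      rw [Submodule.span_le]
      rintro _ ⟨m, hm, rfl⟩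
      exact Submodule.subset_span ⟨a :: m, by simpa using hm, by simp⟩
    exact this ih
  | swap a b l =>
    simp only [List.map_cons, List.prod_cons, ← mul_assoc, ← sub_mul]
    have : Submodule.span ℚ (Set.range x) ≤
        (Submodule.span ℚ {y | ∃ m : List ι, m.length < (b :: a :: l).length ∧
          y = (m.map x).prod}).comap (LinearMap.mulRight ℚ (l.map x).prod) := by
      rw [Submodule.span_le]
      rintro _ ⟨i, rfl⟩
      exact Submodule.subset_span ⟨i :: l, by simp, by simp⟩
    exact this (hx b a)
  | trans h1 _ ih1 ih2 =>
    rw [h1.length_eq] at ih1 ⊢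
    simpa using add_mem ih1 ih2

lemma pbw_span (x : ι → B)
    (hx : ∀ i j, x i * x j - x j * x i ∈ Submodule.span ℚ (Set.range x))
    (hgen : Algebra.adjoin ℚ (Set.range x) = ⊤)
    (srt : Multiset ι → List ι) (hs : ∀ b, (srt b : Multiset ι) = b) :
    Submodule.span ℚ (Set.range fun b => ((srt b).map x).prod) = ⊤ := by
  have key : ∀ N, ∀ l : List ι, l.length = N →
      (l.map x).prod ∈ Submodule.span ℚ (Set.range fun b => ((srt b).map x).prod) := by
    intro N
    induction N using Nat.strong_induction_on with
    | _ N ih =>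
      rintro l rfl
      have hp : l.Perm (srt (l : Multiset ι)) := Multiset.coe_eq_coe.mp (hs _).symm
      have := perm_prod_sub_mem x hx hp
      have h2 : Submodule.span ℚ {y | ∃ m : List ι, m.length < l.length ∧ y = (m.map x).prod} ≤
          Submodule.span ℚ (Set.range fun b => ((srt b).map x).prod) := by
        rw [Submodule.span_le]
        rintro _ ⟨m, hm, rfl⟩
        exact ih _ hm m rfl
      have h3 := add_mem (h2 this) (Submodule.subset_span ⟨(l : Multiset ι), rfl⟩)
      simpa using h3
  rw [eq_top_iff, ← Algebra.top_toSubmodule, ← hgen, Algebra.adjoin_eq_span, Submodule.span_le]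
  intro y hy
  obtain ⟨l, hl, rfl⟩ := Submonoid.exists_list_of_mem_closure hy
  obtain ⟨m, rfl⟩ : ∃ m : List ι, m.map x = l := by
    have : l ∈ Set.range (List.map x) := by rw [Set.range_list_map]; exact hl
    exact this
  exact key _ _ rfl

lemma loop_pbw {T : Type*} [AddCommMonoid T] {n : ℕ} (e : ℕ → T → B) (he : LoopRel e)
    (hz : ∀ c, n ≤ c → ∀ r, e c r = 0)
    (hgen : Algebra.adjoin ℚ {x | ∃ c r, x = e c r} = ⊤)
    (μ : Rt n × T → ℕ → T) (hμ : ∀ p, modeSum p.1.1.1 p.1.1.2.2 p.1.1.2.1 (μ p) = p.2)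
    (srt : Multiset (Rt n × T) → List (Rt n × T)) (hs : ∀ b, (srt b : Multiset _) = b) :
    Submodule.span ℚ (Set.range fun b =>
      ((srt b).map fun p => rootLnc e p.1.1.1 p.1.1.2.2 p.1.1.2.1 (μ p)).prod) = ⊤ := by
  set x : Rt n × T → B := fun p => rootLnc e p.1.1.1 p.1.1.2.2 p.1.1.2.1 (μ p) with hx
  have hq : ∀ p : Rt n × T, ∃ q : ℚ, q ≠ 0 ∧
      x p = q • rootVec e p.1.1.1 p.1.1.2.2 p.1.1.2.1 p.2 := by
    intro p
    obtain ⟨q, h0, h⟩ := rootLnc_eq he p.1.1.1 p.1.1.2.2 p.1.1.2.1 p.1.2.2.2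
    refine ⟨q, h0, ?_⟩
    rw [hx]; simp only
    rw [h, hμ, min_eq_left p.1.2.2.1]
  have hv : ∀ t c d, c ≤ d → (t = 0 ∨ c = 0) → ∀ r,
      rootVec e t c d r ∈ Submodule.span ℚ (Set.range x) := by
    intro t c d hcd h r
    by_cases hn : t + d < n
    · obtain ⟨q, h0, hq⟩ := hq (⟨(t, d, c), hn, hcd, h⟩, r)
      rw [show rootVec e t c d r = q⁻¹ • x (⟨(t, d, c), hn, hcd, h⟩, r) by
        rw [hq, smul_smul, inv_mul_cancel₀ h0, one_smul]]
      exact Submodule.smul_mem _ _ (Submodule.subset_span ⟨_, rfl⟩)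
    · rw [rootVec_eq_zero hz _ _ _ hcd h (by omega)]; exact zero_mem _
  have hle : LoopRel.rootSpan e ≤ Submodule.span ℚ (Set.range x) := by
    rw [LoopRel.rootSpan, Submodule.span_le]
    rintro _ (⟨t, d, r, rfl⟩ | ⟨d, d', r, rfl⟩)
    · have := hv t 0 d (by omega) (Or.inr rfl) r
      rwa [rootVec, if_pos rfl] at this
    · have h1 : ∀ d d', d ≤ d' → chainZ e d d' r ∈ Submodule.span ℚ (Set.range x) := by
        intro d d' h
        have := hv 0 (d + 1) (d' + 1) (by omega) (Or.inl rfl) r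
        rwa [rootVec, if_neg (by omega)] at this
      rcases le_total d d' with h | h
      · exact h1 _ _ h
      · rw [he.chainZ_symm]; exact h1 _ _ h
  have hge : ∀ p, x p ∈ LoopRel.rootSpan e := by
    intro p
    obtain ⟨q, h0, hq⟩ := hq p
    rw [hq, rootVec]
    apply Submodule.smul_mem
    split_ifs
    · exact LoopRel.chainA_mem _ _ _
    · exact LoopRel.chainZ_mem _ _ _
  refine pbw_span x (fun i j => hle ?_) ?_ srt hs
  · exact he.rootSpan_lie_mem (hge i) (hge j)
  · rw [eq_top_iff, ← hgen]
    apply Algebra.adjoin_le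
    rintro _ ⟨c, r, rfl⟩
    have h1 : e c r ∈ Submodule.span ℚ (Set.range x) := hle (LoopRel.chainA_mem c 0 r)
    exact Algebra.span_le_adjoin ℚ _ h1


/-- If a linear functional kills the two-sided ideal generated by the loop relations and all ordered
products of root vectors, then it vanishes. -/
lemma functional_eq_zero {F : Type*} [Ring F] [Algebra ℚ F] {T : Type*} [AddCommMonoid T] {n : ℕ}
    (g : ℕ → T → F) (hz : ∀ c, n ≤ c → ∀ r, g c r = 0)
    (hgen : Algebra.adjoin ℚ {x | ∃ c r, x = g c r} = ⊤) (φ : F →ₗ[ℚ] ℚ)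
    (loop : ∀ i j r s u a b, φ (a * (⁅g i (r + u), g j s⁆ - ⁅g i r, g j (s + u)⁆) * b) = 0)
    (same : ∀ i r s a b, φ (a * ⁅g i r, g i s⁆ * b) = 0)
    (far : ∀ i j r s, i + 2 ≤ j → ∀ a b, φ (a * ⁅g i r, g j s⁆ * b) = 0)
    (serre_down : ∀ i t r s a b, φ (a * ⁅⁅g (i + 1) t, g i r⁆, g i s⁆ * b) = 0)
    (serre_up : ∀ i t r s a b, φ (a * ⁅⁅g (i + 1) t, g (i + 2) r⁆, g (i + 2) s⁆ * b) = 0)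
    (serre_long : ∀ t r s u a b, φ (a * ⁅⁅⁅g 0 t, g 1 r⁆, g 1 s⁆, g 1 u⁆ * b) = 0)
    (μ : Rt n × T → ℕ → T) (hμ : ∀ p, modeSum p.1.1.1 p.1.1.2.2 p.1.1.2.1 (μ p) = p.2)
    (srt : Multiset (Rt n × T) → List (Rt n × T)) (hs : ∀ b, (srt b : Multiset _) = b)
    (hφ : ∀ b, φ ((srt b).map fun p => rootLnc g p.1.1.1 p.1.1.2.2 p.1.1.2.1 (μ p)).prod = 0) :
    φ = 0 := by
  let con : RingCon F :=
    { r := fun x y => ∀ a b, φ (a * (x - y) * b) = 0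
      iseqv := ⟨fun x a b => by simp, fun {x y} h a b => by
          rw [← neg_sub, mul_neg, neg_mul, map_neg, h, neg_zero],
        fun {x y z} h1 h2 a b => by
          rw [← sub_add_sub_cancel x y z, mul_add, add_mul, map_add, h1, h2, add_zero]⟩
      mul' := fun {w x y z} h1 h2 a b => by
        have : a * (w * y - x * z) * b = a * (w - x) * (y * b) + a * x * (y - z) * b := by
          noncomm_ring
        rw [this, map_add, h1, h2, add_zero]
      add' := fun {w x y z} h1 h2 a b => by
        have : a * (w + y - (x + z)) * b = a * (w - x) * b + a * (y - z) * b := by noncomm_ring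
        rw [this, map_add, h1, h2, add_zero] }
  let π : F →ₐ[ℚ] con.Quotient := { con.mk' with commutes' := fun _ => rfl }
  have hπs : Function.Surjective π := con.mk'_surjective
  have hπ : ∀ x, (∀ a b, φ (a * x * b) = 0) → π x = 0 := by
    intro x h
    have : (x : con.Quotient) = (0 : F) := (RingCon.eq _).mpr (fun a b => by simpa using h a b)
    exact this
  have hπφ : ∀ x, π x = 0 → φ x = 0 := by
    intro x h
    have h2 : (x : con.Quotient) = ((0 : F) : con.Quotient) := h
    simpa using (RingCon.eq _).mp h2 1 1
  have hlie : ∀ x y, π ⁅x, y⁆ = ⁅π x, π y⁆ := by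
    intro x y; simp [LieRing.of_associative_ring_bracket]
  have hrel : LoopRel fun c r => π (g c r) := by
    constructor
    · intro i j r s u
      rw [← hlie, ← hlie, ← sub_eq_zero, ← map_sub]; exact hπ _ (loop i j r s u)
    · intro i r s; rw [← hlie]; exact hπ _ (same i r s)
    · intro i j r s h; rw [← hlie]; exact hπ _ (far i j r s h)
    · intro i t r s; rw [← hlie, ← hlie]; exact hπ _ (serre_down i t r s)
    · intro i t r s; rw [← hlie, ← hlie]; exact hπ _ (serre_up i t r s)
    · intro t r s u; rw [← hlie, ← hlie, ← hlie]; exact hπ _ (serre_long t r s u)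
  have hlnc : ∀ x l, π (lnc x l) = lnc (π x) (l.map π) := by
    intro x l
    induction l generalizing x with
    | nil => rfl
    | cons a l ih => simp only [lnc, List.foldl_cons, List.map_cons] at ih ⊢; rw [ih, hlie]
  have hE : ∀ t c d m, π (rootLnc g t c d m) = rootLnc (fun c r => π (g c r)) t c d m := by
    intro t c d m
    rw [rootLnc, hlnc, List.map_map]; rfl
  have hspan := loop_pbw (n := n) (fun c r => π (g c r)) hrel
    (fun c hc r => by simp only [hz c hc, map_zero]) (by
      have := (Algebra.map_top π).trans ((AlgHom.range_eq_top π).mpr hπs)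
      rw [← hgen, AlgHom.map_adjoin] at this
      rw [← this]
      congr 1
      ext x
      constructor
      · rintro ⟨c, r, rfl⟩; exact ⟨_, ⟨c, r, rfl⟩, rfl⟩
      · rintro ⟨_, ⟨c, r, rfl⟩, rfl⟩; exact ⟨c, r, rfl⟩) μ hμ srt hs
  ext x
  have hx : π x ∈ Submodule.span ℚ (Set.range fun b => ((srt b).map fun p =>
      rootLnc (fun c r => π (g c r)) p.1.1.1 p.1.1.2.2 p.1.1.2.1 (μ p)).prod) := by
    rw [hspan]; trivial
  have hle : Submodule.span ℚ (Set.range fun b => ((srt b).map fun p =>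
      rootLnc (fun c r => π (g c r)) p.1.1.1 p.1.1.2.2 p.1.1.2.1 (μ p)).prod) ≤
      (LinearMap.ker φ).map π.toLinearMap := by
    rw [Submodule.span_le]
    rintro _ ⟨b, rfl⟩
    refine ⟨_, hφ b, ?_⟩
    simp only [AlgHom.toLinearMap_apply, map_list_prod, List.map_map]
    congr 1
    exact List.map_congr_left fun p _ => hE _ _ _ _
  obtain ⟨y, hy, hxy⟩ := hle hx
  have h0 : φ (x - y) = 0 := hπφ _ (by rw [map_sub, sub_eq_zero]; exact hxy.symm)
  rw [map_sub, sub_eq_zero] at h0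
  rw [h0]; exact hy

end PBW

/-! ### Coefficient operators of Laurent expansions -/

section Coefficients
set_option linter.unusedSectionVars false

/-- Rational functions over `ℚ` in variables indexed by `V`. -/
def Fr (V : Type*) : Type _ := FractionRing (MvPolynomial V ℚ)

namespace Fr
variable {V : Type*}

instance : Field (Fr V) := inferInstanceAs (Field (FractionRing (MvPolynomial V ℚ)))
instance : Algebra (MvPolynomial V ℚ) (Fr V) :=
  inferInstanceAs (Algebra (MvPolynomial V ℚ) (FractionRing (MvPolynomial V ℚ)))
instance : IsFractionRing (MvPolynomial V ℚ) (Fr V) :=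
  inferInstanceAs (IsFractionRing (MvPolynomial V ℚ) (FractionRing (MvPolynomial V ℚ)))
instance : CharZero (Fr V) :=
  ((IsFractionRing.injective (MvPolynomial V ℚ) (Fr V)).comp
    (MvPolynomial.C_injective V ℚ)).comp (Nat.cast_injective (R := ℚ)) |> fun h =>
    ⟨fun _ _ hab => h (by simpa using hab)⟩

/-- The variables, as rational functions. -/
def x (u : V) : Fr V := algebraMap (MvPolynomial V ℚ) (Fr V) (MvPolynomial.X u)

lemma x_injective : Function.Injective (x : V → Fr V) := fun a b h =>
  MvPolynomial.X_injective ((IsFractionRing.injective (MvPolynomial V ℚ) (Fr V)) h)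

lemma x_ne_zero (u : V) : (x u : Fr V) ≠ 0 := by
  intro h
  exact MvPolynomial.X_ne_zero (R := ℚ) u
    ((IsFractionRing.injective (MvPolynomial V ℚ) (Fr V)) (by rw [map_zero]; exact h))

lemma x_sub_ne_zero {a b : V} (h : a ≠ b) : (x a - x b : Fr V) ≠ 0 :=
  sub_ne_zero.mpr fun h' => h (x_injective h')

lemma algebraMap_C (q : ℚ) : algebraMap (MvPolynomial V ℚ) (Fr V) (MvPolynomial.C q)
    = algebraMap ℚ (Fr V) q :=
  RingHom.congr_fun (Subsingleton.elim ((algebraMap (MvPolynomial V ℚ) (Fr V)).comp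
    MvPolynomial.C) (algebraMap ℚ (Fr V))) q

variable [DecidableEq V]

def toPoly (v : V) : MvPolynomial V ℚ →+* Polynomial (Fr V) :=
  MvPolynomial.eval₂Hom (Polynomial.C.comp (algebraMap ℚ (Fr V)))
    (fun u => if u = v then Polynomial.X else Polynomial.C (x u))

lemma eval_toPoly (v : V) (p : MvPolynomial V ℚ) :
    (toPoly v p).eval (x v) = algebraMap _ (Fr V) p := by
  have : (Polynomial.evalRingHom (x v)).comp (toPoly v) = algebraMap _ (Fr V) := by
    apply MvPolynomial.ringHom_ext
    · intro q; simp [toPoly, algebraMap_C]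
    · intro u
      by_cases h : u = v <;> simp [toPoly, h, x]
  exact RingHom.congr_fun this p

lemma toPoly_injective (v : V) : Function.Injective (toPoly v) := by
  intro p q h
  apply IsFractionRing.injective (MvPolynomial V ℚ) (Fr V)
  rw [← eval_toPoly v, h, eval_toPoly]

def polyLaurent (F : Type*) [Field F] : Polynomial F →+* LaurentSeries F :=
  (HahnSeries.ofPowerSeries ℤ F).comp Polynomial.coeToPowerSeries.ringHom

lemma polyLaurent_injective (F : Type*) [Field F] : Function.Injective (polyLaurent F) :=
  HahnSeries.ofPowerSeries_injective.comp (Polynomial.coe_injective F)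

def expand (v : V) : Fr V →+* LaurentSeries (Fr V) :=
  IsFractionRing.lift (A := MvPolynomial V ℚ) (g := (polyLaurent (Fr V)).comp (toPoly v))
    ((polyLaurent_injective _).comp (toPoly_injective v))

lemma expand_algebraMap (v : V) (p : MvPolynomial V ℚ) :
    expand v (algebraMap _ _ p) = polyLaurent _ (toPoly v p) := by
  simp [expand]

lemma expand_x_self (v : V) : expand v (x v) = HahnSeries.single 1 1 := by
  rw [x, expand_algebraMap]; simp [toPoly, polyLaurent]

lemma expand_x (v u : V) (h : u ≠ v) : expand v (x u) = HahnSeries.C (x u) := by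
  nth_rewrite 1 [x]
  rw [expand_algebraMap]; simp [toPoly, polyLaurent, h]

lemma expand_injective (v : V) : Function.Injective (expand v) := (expand v).injective

/-- The coefficient of `x v ^ r` in the expansion at `x v = 0`. -/
def γ (v : V) (r : ℤ) : Fr V →ₗ[ℚ] Fr V :=
  AddMonoidHom.toRatLinearMap
    ((HahnSeries.coeff.addMonoidHom r).comp (expand v).toAddMonoidHom)

lemma γ_apply (v : V) (r : ℤ) (F : Fr V) : γ v r F = (expand v F).coeff r := rfl

lemma γ_x_self_mul (v : V) (r : ℤ) (F : Fr V) : γ v r (x v * F) = γ v (r - 1) F := by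
  rw [γ_apply, map_mul, expand_x_self, HahnSeries.coeff_single_mul, one_mul, γ_apply]

lemma γ_x_mul {v u : V} (h : u ≠ v) (r : ℤ) (F : Fr V) :
    γ v r (x u * F) = x u * γ v r F := by
  rw [γ_apply, map_mul, expand_x _ _ h, HahnSeries.C_mul_eq_smul]; rfl

lemma γ_one (v : V) (r : ℤ) : γ v r 1 = if r = 0 then 1 else 0 := by
  rw [γ_apply, map_one, HahnSeries.coeff_one]; congr

lemma γ_bound (v : V) (F : Fr V) : ∃ N : ℤ, ∀ r < N, γ v r F = 0 :=
  ⟨(expand v F).order, fun _ hr => HahnSeries.coeff_eq_zero_of_lt_order hr⟩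

lemma eq_zero_of_γ (v : V) (F : Fr V) (h : ∀ r, γ v r F = 0) : F = 0 := by
  apply expand_injective v
  rw [map_zero]; ext r; exact h r

lemma γ_x_self_inv_mul (v : V) (r : ℤ) (F : Fr V) : γ v r ((x v)⁻¹ * F) = γ v (r + 1) F := by
  have h := γ_x_self_mul v (r + 1) ((x v)⁻¹ * F)
  rw [mul_inv_cancel_left₀ (x_ne_zero v)] at h
  rw [h]; congr 2; ring

/-- The subfield of functions not depending on `x v`. -/
def indep (v : V) : Subfield (Fr V) := (expand v).eqLocusField HahnSeries.C

lemma x_mem_indep {v u : V} (h : u ≠ v) : x u ∈ indep v := expand_x v u h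

lemma γ_mul_of_indep {v : V} {G : Fr V} (hG : G ∈ indep v) (r : ℤ) (F : Fr V) :
    γ v r (G * F) = G * γ v r F := by
  have h : expand v G = HahnSeries.C G := hG
  rw [γ_apply, map_mul, h, HahnSeries.C_mul_eq_smul]; rfl

lemma γ_of_indep {v : V} {G : Fr V} (hG : G ∈ indep v) (r : ℤ) :
    γ v r G = if r = 0 then G else 0 := by
  have := γ_mul_of_indep hG r 1
  rw [mul_one, γ_one] at this
  rw [this]; split_ifs <;> simp

lemma x_sub_mul_γ {v a b : V} (ha : a ≠ v) (hb : b ≠ v) (r : ℤ) (F : Fr V) :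
    γ v r ((x a - x b)⁻¹ * F) = (x a - x b)⁻¹ * γ v r F :=
  γ_mul_of_indep (inv_mem (sub_mem (x_mem_indep ha) (x_mem_indep hb))) r F

lemma γ_pole_self {a b : V} (h : a ≠ b) (r : ℤ) (F : Fr V) :
    γ a r ((x a - x b)⁻¹ * F) =
      (x b)⁻¹ * (γ a (r - 1) ((x a - x b)⁻¹ * F) - γ a r F) := by
  have h1 : γ a r F = γ a (r - 1) ((x a - x b)⁻¹ * F) - x b * γ a r ((x a - x b)⁻¹ * F) := by
    rw [← γ_x_self_mul, ← γ_x_mul h.symm, ← map_sub, ← sub_mul,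
      mul_inv_cancel_left₀ (x_sub_ne_zero h)]
  rw [h1, sub_sub_cancel, inv_mul_cancel_left₀ (x_ne_zero b)]

lemma pole_swap (a b : V) (F : Fr V) : (x a - x b)⁻¹ * F = -((x b - x a)⁻¹ * F) := by
  rw [← neg_mul, ← inv_neg, neg_sub]

lemma int_induction {P : ℤ → Prop} (N : ℤ) (h0 : ∀ r < N, P r) (h1 : ∀ r, P (r - 1) → P r)
    (r : ℤ) : P r := by
  have key : ∀ k : ℕ, P (N - 1 + k) := by
    intro k
    induction k with
    | zero => exact h0 _ (by simp)
    | succ k ih => apply h1; convert ih using 1; push_cast; ring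
  by_cases h : r < N
  · exact h0 r h
  · convert key (r - N + 1).toNat using 1
    have : ((r - N + 1).toNat : ℤ) = r - N + 1 := Int.toNat_of_nonneg (by omega)
    rw [this]; ring

/-- Laurent polynomials in the variables of `S` with additional poles along the diagonals
prescribed by `E`. -/
def RatAlg (E : V → V → Prop) (S : Finset V) : Subalgebra ℚ (Fr V) :=
  Algebra.adjoin ℚ ({y | ∃ a ∈ S, y = x a ∨ y = (x a)⁻¹} ∪
    {y | ∃ a ∈ S, ∃ b ∈ S, a ≠ b ∧ E a b ∧ y = (x a - x b)⁻¹})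

variable {E : V → V → Prop} {S : Finset V}

lemma x_mem_RatAlg {a : V} (h : a ∈ S) : x a ∈ RatAlg E S :=
  Algebra.subset_adjoin (Or.inl ⟨a, h, Or.inl rfl⟩)

lemma x_inv_mem_RatAlg {a : V} (h : a ∈ S) : (x a)⁻¹ ∈ RatAlg E S :=
  Algebra.subset_adjoin (Or.inl ⟨a, h, Or.inr rfl⟩)

lemma pole_mem_RatAlg {a b : V} (ha : a ∈ S) (hb : b ∈ S) (hab : a ≠ b) (h : E a b) :
    (x a - x b)⁻¹ ∈ RatAlg E S :=
  Algebra.subset_adjoin (Or.inr ⟨a, ha, b, hb, hab, h, rfl⟩)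

lemma RatAlg_mono {E' : V → V → Prop} {S' : Finset V} (hS : S ⊆ S')
    (h : ∀ a ∈ S, ∀ b ∈ S, E a b → E' a b) : RatAlg E S ≤ RatAlg E' S' := by
  apply Algebra.adjoin_mono
  rintro y (⟨a, ha, h'⟩ | ⟨a, ha, b, hb, hab, hE, rfl⟩)
  · exact Or.inl ⟨a, hS ha, h'⟩
  · exact Or.inr ⟨a, hS ha, b, hS hb, hab, h a ha b hb hE, rfl⟩

lemma RatAlg_induction {P : Fr V → Prop} (one : P 1) (add : ∀ F G, P F → P G → P (F + G))
    (smul : ∀ (q : ℚ) F, P F → P (q • F))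
    (mulX : ∀ a ∈ S, ∀ F, P F → P (x a * F)) (invX : ∀ a ∈ S, ∀ F, P F → P ((x a)⁻¹ * F))
    (pole : ∀ a ∈ S, ∀ b ∈ S, a ≠ b → E a b → ∀ F, P F → P ((x a - x b)⁻¹ * F))
    {F : Fr V} (hF : F ∈ RatAlg E S) : P F := by
  have h2 : F ∈ Subalgebra.toSubmodule (RatAlg E S) := hF
  rw [RatAlg, Algebra.adjoin_eq_span] at h2
  induction h2 using Submodule.span_induction with
  | zero => simpa using smul 0 1 one
  | add F G _ _ h1 h2 => exact add F G (h1 (by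
      rw [RatAlg]; rw [← Subalgebra.mem_toSubmodule, Algebra.adjoin_eq_span]; assumption)) (h2 (by
      rw [RatAlg]; rw [← Subalgebra.mem_toSubmodule, Algebra.adjoin_eq_span]; assumption))
  | smul q F _ h => exact smul q F (h (by
      rw [RatAlg]; rw [← Subalgebra.mem_toSubmodule, Algebra.adjoin_eq_span]; assumption))
  | mem F h =>
    clear hF
    induction h using Submonoid.closure_induction_left with
    | one => exact one
    | mul_left y hy z _ ih =>
      rcases hy with ⟨a, ha, rfl | rfl⟩ | ⟨a, ha, b, hb, hab, hE, rfl⟩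
      · exact mulX a ha _ ih
      · exact invX a ha _ ih
      · exact pole a ha b hb hab hE _ ih

lemma γ_mem_RatAlg (v : V) {F : Fr V} (hF : F ∈ RatAlg E S) (r : ℤ) :
    γ v r F ∈ RatAlg E (S.erase v) := by
  revert r
  refine RatAlg_induction (E := E) (S := S) (P := fun F => ∀ r, γ v r F ∈ RatAlg E (S.erase v))
    ?_ ?_ ?_ ?_ ?_ ?_ hF
  · intro r; rw [γ_one]; split_ifs
    exacts [one_mem _, zero_mem _]
  · intro F G h1 h2 r; rw [map_add]; exact add_mem (h1 r) (h2 r)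
  · intro q F h r; rw [map_smul]; exact Subalgebra.smul_mem _ (h r) q
  · intro a ha F h r
    by_cases hav : a = v
    · subst hav; rw [γ_x_self_mul]; exact h _
    · rw [γ_x_mul hav]; exact mul_mem (x_mem_RatAlg (by simp [*])) (h r)
  · intro a ha F h r
    by_cases hav : a = v
    · subst hav; rw [γ_x_self_inv_mul]; exact h _
    · rw [γ_mul_of_indep (inv_mem (x_mem_indep hav))]
      exact mul_mem (x_inv_mem_RatAlg (by simp [*])) (h r)
  · have key : ∀ b ∈ S, v ≠ b → ∀ F, (∀ r, γ v r F ∈ RatAlg E (S.erase v)) →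
        ∀ r, γ v r ((x v - x b)⁻¹ * F) ∈ RatAlg E (S.erase v) := by
      intro b hb hab F h
      obtain ⟨N, hN⟩ := γ_bound v ((x v - x b)⁻¹ * F)
      refine int_induction N (fun r hr => by rw [hN r hr]; exact zero_mem _) fun r ih => ?_
      rw [γ_pole_self hab]
      exact mul_mem (x_inv_mem_RatAlg (by simp [hb, hab.symm])) (sub_mem ih (h r))
    intro a ha b hb hab hE F h r
    by_cases hav : a = v
    · subst hav; exact key b hb hab F h r
    · by_cases hbv : b = v
      · subst hbv; rw [pole_swap, map_neg]; exact neg_mem (key a ha hab.symm F h r)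
      · rw [x_sub_mul_γ hav hbv]
        exact mul_mem (pole_mem_RatAlg (by simp [*]) (by simp [*]) hab hE) (h r)

lemma γ_comm {p q : V} (hpq : p ≠ q) (h1 : ¬ E p q) (h2 : ¬ E q p) {F : Fr V}
    (hF : F ∈ RatAlg E S) (r s : ℤ) : γ p r (γ q s F) = γ q s (γ p r F) := by
  revert r s
  refine RatAlg_induction (E := E) (S := S)
    (P := fun F => ∀ r s, γ p r (γ q s F) = γ q s (γ p r F)) ?_ ?_ ?_ ?_ ?_ ?_ hF
  · intro r s
    rw [γ_one, γ_one]; split_ifs <;> simp [γ_one, *]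
  · intro F G h1 h2 r s; simp only [map_add, h1, h2]
  · intro c F h r s; simp only [map_smul, h]
  · intro a _ F h r s
    by_cases hap : a = p
    · subst hap; rw [γ_x_self_mul, γ_x_mul hpq, γ_x_self_mul, h]
    · by_cases haq : a = q
      · subst haq; rw [γ_x_self_mul, γ_x_mul hap, γ_x_self_mul, h]
      · rw [γ_x_mul haq, γ_x_mul hap, γ_x_mul hap, γ_x_mul haq, h]
  · intro a _ F h r s
    have hh : ∀ {u v : V}, u ≠ v → ∀ r F, γ v r ((x u)⁻¹ * F) = (x u)⁻¹ * γ v r F :=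
      fun huv r F => γ_mul_of_indep (inv_mem (x_mem_indep huv)) r F
    by_cases hap : a = p
    · subst hap; rw [γ_x_self_inv_mul, hh hpq, γ_x_self_inv_mul, h]
    · by_cases haq : a = q
      · subst haq; rw [γ_x_self_inv_mul, hh hap, γ_x_self_inv_mul, h]
      · rw [hh haq, hh hap, hh hap, hh haq, h]
  · have key : ∀ {p q b : V}, p ≠ b → q ≠ b → p ≠ q → ∀ F : Fr V,
        (∀ r s, γ p r (γ q s F) = γ q s (γ p r F)) → ∀ r s,
        γ p r (γ q s ((x p - x b)⁻¹ * F)) = γ q s (γ p r ((x p - x b)⁻¹ * F)) := by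
      intro p q b hpb hqb hpq F h r s
      rw [x_sub_mul_γ hpq hqb.symm]
      obtain ⟨N, hN⟩ := γ_bound p ((x p - x b)⁻¹ * F)
      obtain ⟨N', hN'⟩ := γ_bound p ((x p - x b)⁻¹ * γ q s F)
      refine int_induction (P := fun r => γ p r ((x p - x b)⁻¹ * γ q s F) =
        γ q s (γ p r ((x p - x b)⁻¹ * F))) (min N N') (fun r hr => ?_) (fun r ih => ?_) r
      · rw [hN r (by omega), hN' r (by omega), map_zero]
      · rw [γ_pole_self hpb, γ_pole_self (r := r) (F := F) hpb,
          γ_mul_of_indep (inv_mem (x_mem_indep hqb.symm)), map_sub, ih, h]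
    intro a _ b _ hab hE F h r s
    by_cases hap : a = p
    · subst hap
      exact key hab (by rintro rfl; exact h1 hE) hpq F h r s
    by_cases hbp : b = p
    · subst hbp
      rw [pole_swap, map_neg, map_neg, map_neg, map_neg,
        key hab.symm (by rintro rfl; exact h2 hE) hpq F h r s]
    by_cases haq : a = q
    · subst haq
      exact (key hab (Ne.symm hbp) hpq.symm F (fun r s => (h s r).symm) s r).symm
    by_cases hbq : b = q
    · subst hbq
      rw [pole_swap, map_neg, map_neg, map_neg, map_neg,
        key hab.symm (Ne.symm hap) hpq.symm F (fun r s => (h s r).symm) s r]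
    rw [x_sub_mul_γ haq hbq, x_sub_mul_γ hap hbp, x_sub_mul_γ hap hbp, x_sub_mul_γ haq hbq, h]

lemma RatAlg_le_indep {v : V} (hv : v ∉ S) {F : Fr V} (hF : F ∈ RatAlg E S) : F ∈ indep v := by
  refine RatAlg_induction (E := E) (S := S) (P := fun F => F ∈ indep v)
    (one_mem _) (fun _ _ => add_mem) ?_ ?_ ?_ ?_ hF
  · intro q F h
    rw [Algebra.smul_def]; refine mul_mem ?_ h
    exact SubfieldClass.ratCast_mem _ q
  · intro a ha F h
    exact mul_mem (x_mem_indep (by rintro rfl; exact hv ha)) h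
  · intro a ha F h
    exact mul_mem (inv_mem (x_mem_indep (by rintro rfl; exact hv ha))) h
  · intro a ha b hb hab _ F h
    exact mul_mem (inv_mem (sub_mem (x_mem_indep (by rintro rfl; exact hv ha))
      (x_mem_indep (by rintro rfl; exact hv hb)))) h

lemma mem_RatAlg_empty {F : Fr V} (hF : F ∈ RatAlg E ∅) : ∃ q : ℚ, F = algebraMap ℚ (Fr V) q := by
  have h : RatAlg E (∅ : Finset V) = ⊥ := by simp [RatAlg]
  rw [h, Algebra.mem_bot] at hF
  obtain ⟨q, hq⟩ := hF
  exact ⟨q, hq.symm⟩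

end Fr
end Coefficients

/-! ### Removal operators and their relations -/

section Removal
set_option linter.unusedSectionVars false
attribute [local instance] LieRing.ofAssociativeRing

namespace Fr

section CommOn
variable {M : Type*} [AddCommGroup M] [Module ℚ M]

/-- Two endomorphisms commute on `W`. -/
def CommOn (W : Submodule ℚ M) (f g : Module.End ℚ M) : Prop := ∀ X ∈ W, f (g X) = g (f X)
/-- An endomorphism preserves `W`. -/
def Pres (W : Submodule ℚ M) (f : Module.End ℚ M) : Prop := ∀ X ∈ W, f X ∈ W

variable {W : Submodule ℚ M} {f g h : Module.End ℚ M}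

lemma lie_end_apply (f g : Module.End ℚ M) (X : M) : ⁅f, g⁆ X = f (g X) - g (f X) := rfl

lemma Pres.lie (hf : Pres W f) (hg : Pres W g) : Pres W ⁅f, g⁆ := fun X hX =>
  sub_mem (hf _ (hg _ hX)) (hg _ (hf _ hX))

lemma CommOn.lie (hf : Pres W f) (hg : Pres W g) (h1 : CommOn W f h) (h2 : CommOn W g h) :
    CommOn W ⁅f, g⁆ h := by
  intro X hX
  simp only [lie_end_apply, map_sub]
  rw [h2 X hX, h1 _ (hg _ hX), h1 X hX, h2 _ (hf _ hX)]

lemma CommOn.lie_apply (h1 : CommOn W f h) {X : M} (hX : X ∈ W) : ⁅f, h⁆ X = 0 := by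
  rw [lie_end_apply, h1 X hX, sub_self]

lemma CommOn.lie_apply₂ (h1 : CommOn W f g) (hh : Pres W h) {X : M} (hX : X ∈ W) :
    ⁅⁅f, g⁆, h⁆ X = 0 := by
  rw [lie_end_apply, h1.lie_apply hX, h1.lie_apply (hh _ hX), map_zero, sub_zero]

lemma CommOn.lie_apply₃ {k : Module.End ℚ M} (h1 : CommOn W f g) (hh : Pres W h)
    (hk : Pres W k) {X : M} (hX : X ∈ W) :
    ⁅⁅⁅f, g⁆, h⁆, k⁆ X = 0 := by
  rw [lie_end_apply, h1.lie_apply₂ hh hX, h1.lie_apply₂ hh (hk _ hX), map_zero, sub_zero]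

end CommOn

variable {V : Type*} [DecidableEq V] (c : V → ℕ)

/-- Variables of neighbouring colours. -/
def Adj (p q : V) : Prop := c p + 1 = c q ∨ c q + 1 = c p

/-- Neighbouring pairs other than `p, q`. -/
def AdjX (p q : V) (a b : V) : Prop := Adj c a b ∧ ¬ (a = p ∧ b = q) ∧ ¬ (a = q ∧ b = p)

variable {c}

lemma AdjX_symm (p q : V) : AdjX c p q = AdjX c q p := by
  ext a b; simp only [AdjX]; tauto

variable (c) in
/-- Functions with simple poles satisfying the classical wheel conditions. -/
def Good (S : Finset V) : Submodule ℚ (Fr V) where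
  carrier := {F | F ∈ RatAlg (Adj c) S ∧
    (∀ p ∈ S, ∀ q ∈ S, p ≠ q → (x p - x q) * F ∈ RatAlg (AdjX c p q) S) ∧
    (∀ w ∈ S, ∀ p ∈ S, ∀ q ∈ S, p ≠ q → c p = c q → Adj c w p → ¬ (c w = 0 ∧ c p = 1) →
      F ∈ Subalgebra.toSubmodule (RatAlg (AdjX c w p) S) ⊔
        Subalgebra.toSubmodule (RatAlg (AdjX c w q) S)) ∧
    (∀ w ∈ S, ∀ p ∈ S, ∀ q ∈ S, ∀ u ∈ S, p ≠ q → p ≠ u → q ≠ u → c w = 0 → c p = 1 → c q = 1 →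
      c u = 1 → F ∈ Subalgebra.toSubmodule (RatAlg (AdjX c w p) S) ⊔
        Subalgebra.toSubmodule (RatAlg (AdjX c w q) S) ⊔
        Subalgebra.toSubmodule (RatAlg (AdjX c w u) S))}
  zero_mem' := ⟨zero_mem _, fun _ _ _ _ _ => by rw [mul_zero]; exact zero_mem _,
    fun _ _ _ _ _ _ _ _ _ _ => zero_mem _,
    fun _ _ _ _ _ _ _ _ _ _ _ _ _ _ _ => zero_mem _⟩
  add_mem' := fun ⟨a1, a2, a3, a4⟩ ⟨b1, b2, b3, b4⟩ => ⟨add_mem a1 b1,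
    fun p hp q hq h => by rw [mul_add]; exact add_mem (a2 p hp q hq h) (b2 p hp q hq h),
    fun w hw p hp q hq h h1 h2 h3 => add_mem (a3 w hw p hp q hq h h1 h2 h3)
      (b3 w hw p hp q hq h h1 h2 h3),
    fun w hw p hp q hq u hu h1 h2 h3 h4 h5 h6 h7 =>
      add_mem (a4 w hw p hp q hq u hu h1 h2 h3 h4 h5 h6 h7)
        (b4 w hw p hp q hq u hu h1 h2 h3 h4 h5 h6 h7)⟩
  smul_mem' := fun t _ ⟨a1, a2, a3, a4⟩ => ⟨Subalgebra.smul_mem _ a1 t,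
    fun p hp q hq h => by
      rw [mul_smul_comm]; exact Subalgebra.smul_mem _ (a2 p hp q hq h) t,
    fun w hw p hp q hq h h1 h2 h3 => Submodule.smul_mem _ t (a3 w hw p hp q hq h h1 h2 h3),
    fun w hw p hp q hq u hu h1 h2 h3 h4 h5 h6 h7 =>
      Submodule.smul_mem _ t (a4 w hw p hp q hq u hu h1 h2 h3 h4 h5 h6 h7)⟩

lemma γ_mem_RatAlg_insert {E : V → V → Prop} {S : Finset V} {v : V} (hv : v ∉ S) {F : Fr V}
    (hF : F ∈ RatAlg E (insert v S)) (r : ℤ) : γ v r F ∈ RatAlg E S := by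
  have := γ_mem_RatAlg v hF r
  rwa [Finset.erase_insert hv] at this

lemma γ_mem_Good {S : Finset V} {v : V} (hv : v ∉ S) {F : Fr V} (hF : F ∈ Good c (insert v S))
    (r : ℤ) : γ v r F ∈ Good c S := by
  obtain ⟨a1, a2, a3, a4⟩ := hF
  have ins : ∀ {p}, p ∈ S → p ∈ insert v S := fun h => Finset.mem_insert_of_mem h
  have ne : ∀ {p}, p ∈ S → p ≠ v := by rintro p h rfl; exact hv h
  have le : ∀ E : V → V → Prop, (Subalgebra.toSubmodule (RatAlg E (insert v S))).map (γ v r) ≤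
      Subalgebra.toSubmodule (RatAlg E S) := by
    rintro E _ ⟨F, hF, rfl⟩; exact γ_mem_RatAlg_insert hv hF r
  refine ⟨γ_mem_RatAlg_insert hv a1 r, fun p hp q hq h => ?_, fun w hw p hp q hq h h1 h2 h3 => ?_,
    fun w hw p hp q hq u hu h1 h2 h3 h4 h5 h6 h7 => ?_⟩
  · rw [← γ_mul_of_indep (sub_mem (x_mem_indep (ne hp)) (x_mem_indep (ne hq)))]
    exact γ_mem_RatAlg_insert hv (a2 p (ins hp) q (ins hq) h) r
  · have := Submodule.mem_map_of_mem (f := γ v r)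
      (a3 w (ins hw) p (ins hp) q (ins hq) h h1 h2 h3)
    rw [Submodule.map_sup] at this
    exact sup_le_sup (le _) (le _) this
  · have := Submodule.mem_map_of_mem (f := γ v r)
      (a4 w (ins hw) p (ins hp) q (ins hq) u (ins hu) h1 h2 h3 h4 h5 h6 h7)
    rw [Submodule.map_sup, Submodule.map_sup] at this
    exact sup_le_sup (sup_le_sup (le _) (le _)) (le _) this

lemma pres_RatAlg {E : V → V → Prop} {S : Finset V} (v : V) (r : ℤ) :
    Pres (Subalgebra.toSubmodule (RatAlg E S)) (γ v r) := fun _ hX =>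
  RatAlg_mono (Finset.erase_subset _ _) (fun _ _ _ _ h => h) (γ_mem_RatAlg v hX r)

lemma commOn_RatAlg {E : V → V → Prop} {S : Finset V} {p q : V} (hpq : p ≠ q) (h1 : ¬ E p q)
    (h2 : ¬ E q p) (r s : ℤ) :
    CommOn (Subalgebra.toSubmodule (RatAlg E S)) (γ p r) (γ q s) :=
  fun _ hX => γ_comm hpq h1 h2 hX r s

lemma γ_loop {S : Finset V} {p q : V} (hp : p ∈ S) (hq : q ∈ S) (hpq : p ≠ q) {F : Fr V}
    (hF : F ∈ Good c S) (r s u : ℤ) :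
    ⁅γ p (r - u), γ q s⁆ F = ⁅γ p r, γ q (s - u)⁆ F := by
  have h1 : ∀ r s, ⁅γ p (r - 1), γ q s⁆ F = ⁅γ p r, γ q (s - 1)⁆ F := by
    intro r s
    have h := (commOn_RatAlg hpq (fun h => h.2.1 ⟨rfl, rfl⟩) (fun h => h.2.2 ⟨rfl, rfl⟩) r
      s).lie_apply (hF.2.1 p hp q hq hpq)
    have e1 : ⁅γ p r, γ q s⁆ (x p * F) = ⁅γ p (r - 1), γ q s⁆ F := by
      rw [lie_end_apply, γ_x_mul hpq, γ_x_self_mul, γ_x_self_mul, lie_end_apply]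
    have e2 : ⁅γ p r, γ q s⁆ (x q * F) = ⁅γ p r, γ q (s - 1)⁆ F := by
      rw [lie_end_apply, γ_x_self_mul, γ_x_mul hpq.symm, γ_x_self_mul, lie_end_apply]
    rw [sub_mul, map_sub, e1, e2, sub_eq_zero] at h
    exact h
  induction u using Int.induction_on generalizing r s with
  | zero => simp
  | succ i ih =>
    rw [show r - (i + 1 : ℤ) = (r - i) - 1 by ring, h1, ih, sub_sub, add_comm 1 (i : ℤ)]
  | pred i ih =>
    have h2 := h1 (r - (-(i:ℤ) - 1)) (s + 1)
    rw [show r - (-(i:ℤ) - 1) - 1 = r - -(i : ℤ) by ring, ih, add_sub_cancel_right] at h2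
    rw [← h2, show s + 1 - -(i : ℤ) = s - (-(i : ℤ) - 1) by ring]

lemma not_adj_of_eq {p q : V} (h : c p = c q) : ¬ Adj c p q := by
  rintro (h' | h') <;> omega

lemma γ_serre_two {S : Finset V} {w p q : V} (hw : w ∈ S) (hp : p ∈ S) (hq : q ∈ S) (hpq : p ≠ q)
    (hc : c p = c q) (ha : Adj c w p) (h0 : ¬ (c w = 0 ∧ c p = 1)) {F : Fr V}
    (hF : F ∈ Good c S) (r s t : ℤ) : ⁅⁅γ w r, γ p s⁆, γ q t⁆ F = 0 := by
  obtain ⟨F1, h1, F2, h2, rfl⟩ := Submodule.mem_sup.mp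
    (hF.2.2.1 w hw p hp q hq hpq hc ha h0)
  have hwp : w ≠ p := by rintro rfl; exact not_adj_of_eq rfl ha
  have hwq : w ≠ q := by rintro rfl; exact not_adj_of_eq hc.symm ha
  rw [map_add, (commOn_RatAlg hwp (fun h => h.2.1 ⟨rfl, rfl⟩) (fun h => h.2.2 ⟨rfl, rfl⟩) r
      s).lie_apply₂ (pres_RatAlg q t) h1, zero_add]
  refine (CommOn.lie (pres_RatAlg w r) (pres_RatAlg p s) ?_ ?_).lie_apply h2
  · exact commOn_RatAlg hwq (fun h => h.2.1 ⟨rfl, rfl⟩) (fun h => h.2.2 ⟨rfl, rfl⟩) r t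
  · exact commOn_RatAlg hpq (fun h => not_adj_of_eq hc h.1) (fun h => not_adj_of_eq hc.symm h.1) s t

lemma γ_serre_three {S : Finset V} {w p q u : V} (hw : w ∈ S) (hp : p ∈ S) (hq : q ∈ S)
    (hu : u ∈ S) (hpq : p ≠ q) (hpu : p ≠ u) (hqu : q ≠ u) (hcw : c w = 0) (hcp : c p = 1)
    (hcq : c q = 1) (hcu : c u = 1) {F : Fr V}
    (hF : F ∈ Good c S) (r s t k : ℤ) : ⁅⁅⁅γ w r, γ p s⁆, γ q t⁆, γ u k⁆ F = 0 := by
  obtain ⟨F', h', F3, h3, rfl⟩ := Submodule.mem_sup.mp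
    (hF.2.2.2 w hw p hp q hq u hu hpq hpu hqu hcw hcp hcq hcu)
  obtain ⟨F1, h1, F2, h2, rfl⟩ := Submodule.mem_sup.mp h'
  have hne : ∀ {z}, c z = 1 → w ≠ z := by rintro z hz rfl; omega
  have hna : ∀ {E' : V → V → Prop} {a b : V}, c a = 1 → c b = 1 → ¬ (Adj c a b ∧ E' a b) :=
    fun ha hb h => not_adj_of_eq (ha.trans hb.symm) h.1
  have key : ∀ z, c z = 1 → ∀ r t : ℤ,
      CommOn (Subalgebra.toSubmodule (RatAlg (AdjX c w z) S)) (γ w r) (γ z t) :=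
    fun z hz r t => commOn_RatAlg (hne hz) (fun h => h.2.1 ⟨rfl, rfl⟩)
      (fun h => h.2.2 ⟨rfl, rfl⟩) r t
  have key2 : ∀ z a b, c a = 1 → c b = 1 → a ≠ b → ∀ r t : ℤ,
      CommOn (Subalgebra.toSubmodule (RatAlg (AdjX c w z) S)) (γ a r) (γ b t) :=
    fun z a b ha hb hab r t => commOn_RatAlg hab (fun h => not_adj_of_eq (ha.trans hb.symm) h.1)
      (fun h => not_adj_of_eq (hb.trans ha.symm) h.1) r t
  rw [map_add, map_add, (key p hcp r s).lie_apply₃ (pres_RatAlg q t) (pres_RatAlg u k) h1, zero_add,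
    (CommOn.lie (pres_RatAlg w r) (pres_RatAlg p s) (key q hcq r t)
      (key2 q p q hcp hcq hpq s t)).lie_apply₂ (pres_RatAlg u k) h2, zero_add]
  refine (CommOn.lie (Pres.lie (pres_RatAlg w r) (pres_RatAlg p s)) (pres_RatAlg q t)
    (CommOn.lie (pres_RatAlg w r) (pres_RatAlg p s) (key u hcu r k)
      (key2 u p u hcp hcu hpu s k)) (key2 u q u hcq hcu hqu t k)).lie_apply h3

/-- Removal of the variable `v`. -/
def τ (v : V) (r : ℤ) : Module.End ℚ (Finset V → Fr V) where
  toFun G S := if v ∈ S then 0 else γ v r (G (insert v S))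
  map_add' G H := by ext S; by_cases h : v ∈ S <;> simp [h]
  map_smul' q G := by ext S; by_cases h : v ∈ S <;> simp [h]

lemma τ_apply (v : V) (r : ℤ) (G : Finset V → Fr V) (S : Finset V) :
    τ v r G S = if v ∈ S then 0 else γ v r (G (insert v S)) := rfl

variable (c) in
/-- Families of good functions. -/
def GoodFam : Submodule ℚ (Finset V → Fr V) := Submodule.pi Set.univ (Good c)

lemma mem_GoodFam {G : Finset V → Fr V} : G ∈ GoodFam c ↔ ∀ S, G S ∈ Good c S := by
  simp [GoodFam, Submodule.mem_pi]

lemma pres_τ (v : V) (r : ℤ) : Pres (GoodFam c) (τ v r) := by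
  intro G hG
  rw [mem_GoodFam] at hG ⊢
  intro S
  rw [τ_apply]; split_ifs with h
  · exact zero_mem _
  · exact γ_mem_Good h (hG _) r

/-- `f` removes the variables of `A`, acting on coefficients by `g`. -/
def Removes (A : Finset V) (f : Module.End ℚ (Finset V → Fr V)) (g : Module.End ℚ (Fr V)) : Prop :=
  ∀ G S, f G S = if Disjoint A S then g (G (A ∪ S)) else 0

lemma removes_τ (v : V) (r : ℤ) : Removes {v} (τ v r) (γ v r) := by
  intro G S
  rw [τ_apply]
  by_cases h : v ∈ S <;> simp [h]

section Removes
variable {A B : Finset V} {f f' : Module.End ℚ (Finset V → Fr V)} {g g' : Module.End ℚ (Fr V)}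

lemma Removes.mul_apply (h : Removes A f g) (h' : Removes B f' g') (G : Finset V → Fr V)
    (S : Finset V) : f (f' G) S =
      if Disjoint A B ∧ Disjoint (A ∪ B) S then g (g' (G (A ∪ B ∪ S))) else 0 := by
  rw [h, h', Finset.union_assoc, Finset.union_left_comm A B S]
  have e : Disjoint B (A ∪ S) ↔ Disjoint A B ∧ Disjoint B S := by
    rw [Finset.disjoint_union_right, disjoint_comm]
  by_cases h1 : Disjoint A S <;> by_cases h2 : Disjoint B S <;> by_cases h3 : Disjoint A B <;>
    simp [h1, h2, h3, e]

lemma Removes.lie (h : Removes A f g) (h' : Removes B f' g') (hd : Disjoint A B) :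
    Removes (A ∪ B) ⁅f, f'⁆ ⁅g, g'⁆ := by
  intro G S
  rw [lie_end_apply, Pi.sub_apply, h.mul_apply h', h'.mul_apply h, lie_end_apply,
    Finset.union_comm B A]
  by_cases h1 : Disjoint (A ∪ B) S <;> simp [h1, hd, hd.symm]

lemma Removes.lie_zero (h : Removes A f g) (h' : Removes B f' g') (hd : ¬ Disjoint A B) :
    ⁅f, f'⁆ = 0 := by
  ext G S : 2
  rw [lie_end_apply, Pi.sub_apply, h.mul_apply h', h'.mul_apply h]
  simp [hd, disjoint_comm (a := B)]

lemma Removes.apply_eq (h : Removes A f g) (h' : Removes A f' g') {G : Finset V → Fr V}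
    (hG : ∀ S, g (G (A ∪ S)) = g' (G (A ∪ S))) : f G = f' G := by
  ext S
  rw [h, h', hG]

lemma Removes.apply_zero (h : Removes A f g) {G : Finset V → Fr V}
    (hG : ∀ S, g (G (A ∪ S)) = 0) : f G = 0 := by
  ext S
  rw [h, hG]; simp

end Removes

lemma τ_loop {G : Finset V → Fr V} (hG : G ∈ GoodFam c) (p q : V) (r s u : ℤ) :
    ⁅τ p (r - u), τ q s⁆ G = ⁅τ p r, τ q (s - u)⁆ G := by
  by_cases h : p = q
  · subst h
    rw [(removes_τ p _).lie_zero (removes_τ p _) (by simp),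
      (removes_τ p _).lie_zero (removes_τ p _) (by simp)]
  · refine ((removes_τ p _).lie (removes_τ q _) (by simpa using h)).apply_eq
      ((removes_τ p _).lie (removes_τ q _) (by simpa using h)) fun S => ?_
    exact γ_loop (by simp) (by simp) h (mem_GoodFam.mp hG _) r s u

lemma τ_comm {G : Finset V → Fr V} (hG : G ∈ GoodFam c) (p q : V) (h1 : ¬ Adj c p q)
    (r s : ℤ) : ⁅τ p r, τ q s⁆ G = 0 := by
  by_cases h : p = q
  · subst h
    rw [(removes_τ p _).lie_zero (removes_τ p _) (by simp)]; rfl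
  · refine ((removes_τ p _).lie (removes_τ q _) (by simpa using h)).apply_zero fun S => ?_
    exact (commOn_RatAlg h h1 (fun h => h1 (Or.symm h)) r s).lie_apply (mem_GoodFam.mp hG _).1

lemma τ_serre_two {G : Finset V → Fr V} (hG : G ∈ GoodFam c) (w p q : V)
    (hc : c p = c q) (ha : Adj c w p) (h0 : ¬ (c w = 0 ∧ c p = 1)) (r s t : ℤ) :
    ⁅⁅τ w r, τ p s⁆, τ q t⁆ G = 0 := by
  have hwp : w ≠ p := by rintro rfl; exact not_adj_of_eq rfl ha
  have hwq : w ≠ q := by rintro rfl; exact not_adj_of_eq hc.symm ha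
  have h1 := (removes_τ w r).lie (removes_τ p s) (by simpa using hwp)
  by_cases hpq : p = q
  · subst hpq
    rw [h1.lie_zero (removes_τ p _) (by simp)]; rfl
  · refine (h1.lie (removes_τ q t) (by simp [Ne.symm hwq, Ne.symm hpq])).apply_zero fun S => ?_
    exact γ_serre_two (by simp) (by simp) (by simp) hpq hc ha h0 (mem_GoodFam.mp hG _) r s t

lemma τ_serre_three {G : Finset V → Fr V} (hG : G ∈ GoodFam c) (w p q u : V)
    (hcw : c w = 0) (hcp : c p = 1)
    (hcq : c q = 1) (hcu : c u = 1) (r s t k : ℤ) :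
    ⁅⁅⁅τ w r, τ p s⁆, τ q t⁆, τ u k⁆ G = 0 := by
  have hne : ∀ {z}, c z = 1 → w ≠ z := by rintro z hz rfl; omega
  have hwp := hne hcp
  have hwq := hne hcq
  have hwu := hne hcu
  have h1 := (removes_τ w r).lie (removes_τ p s) (by simpa using hwp)
  by_cases hpq : p = q
  · subst hpq
    rw [h1.lie_zero (removes_τ p _) (by simp), zero_lie]; rfl
  have h2 := h1.lie (removes_τ q t) (by simp [Ne.symm hwq, Ne.symm hpq])
  by_cases hpu : p = u
  · subst hpu
    rw [h2.lie_zero (removes_τ p _) (by simp)]; rfl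
  by_cases hqu : q = u
  · subst hqu
    rw [h2.lie_zero (removes_τ q _) (by simp)]; rfl
  refine (h2.lie (removes_τ u k) (by simp [Ne.symm hwu, Ne.symm hpu, Ne.symm hqu])).apply_zero
    fun S => ?_
  exact γ_serre_three (by simp) (by simp)
      (by simp) (by simp) hpq hpu hqu hcw hcp hcq hcu (mem_GoodFam.mp hG _) r s t k

end Fr
end Removal

/-! ### The action of words on families of functions -/

section Action
set_option linter.unusedSectionVars false
attribute [local instance] LieRing.ofAssociativeRing

lemma functional_eq_zero_of_module {F : Type*} [Ring F] [Algebra ℚ F] {T : Type*} [AddCommMonoid T]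
    {N : Type*} [AddCommGroup N] [Module ℚ N] {n : ℕ}
    (g : ℕ → T → F) (hz : ∀ c, n ≤ c → ∀ r, g c r = 0)
    (hgen : Algebra.adjoin ℚ {x | ∃ c r, x = g c r} = ⊤) (φ : F →ₗ[ℚ] N)
    (loop : ∀ i j r s u a b, φ (a * (⁅g i (r + u), g j s⁆ - ⁅g i r, g j (s + u)⁆) * b) = 0)
    (same : ∀ i r s a b, φ (a * ⁅g i r, g i s⁆ * b) = 0)
    (far : ∀ i j r s, i + 2 ≤ j → ∀ a b, φ (a * ⁅g i r, g j s⁆ * b) = 0)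
    (serre_down : ∀ i t r s a b, φ (a * ⁅⁅g (i + 1) t, g i r⁆, g i s⁆ * b) = 0)
    (serre_up : ∀ i t r s a b, φ (a * ⁅⁅g (i + 1) t, g (i + 2) r⁆, g (i + 2) s⁆ * b) = 0)
    (serre_long : ∀ t r s u a b, φ (a * ⁅⁅⁅g 0 t, g 1 r⁆, g 1 s⁆, g 1 u⁆ * b) = 0)
    (μ : Rt n × T → ℕ → T) (hμ : ∀ p, modeSum p.1.1.1 p.1.1.2.2 p.1.1.2.1 (μ p) = p.2)
    (srt : Multiset (Rt n × T) → List (Rt n × T)) (hs : ∀ b, (srt b : Multiset _) = b)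
    (hφ : ∀ b, φ ((srt b).map fun p => rootLnc g p.1.1.1 p.1.1.2.2 p.1.1.2.1 (μ p)).prod = 0) :
    φ = 0 := by
  ext x
  rw [LinearMap.zero_apply, ← Module.forall_dual_apply_eq_zero_iff ℚ]
  intro ψ
  have := functional_eq_zero g hz hgen (ψ.comp φ)
    (by intros; simp only [LinearMap.comp_apply, loop, map_zero])
    (by intros; simp only [LinearMap.comp_apply, same, map_zero])
    (by intro i j r s h a b; simp only [LinearMap.comp_apply, far i j r s h, map_zero])
    (by intros; simp only [LinearMap.comp_apply, serre_down, map_zero])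
    (by intros; simp only [LinearMap.comp_apply, serre_up, map_zero])
    (by intros; simp only [LinearMap.comp_apply, serre_long, map_zero])
    μ hμ srt hs (by intros; simp only [LinearMap.comp_apply, hφ, map_zero])
  exact LinearMap.congr_fun this x

/-- The free generator of colour `i`, zero outside the Dynkin diagram. -/
def genF (n : ℕ) (T : Type*) (i : ℕ) (r : T) : FreeAlgebra ℚ (Fin n × T) :=
  if h : i < n then FreeAlgebra.ι ℚ (⟨i, h⟩, r) else 0

lemma genF_of_le {n : ℕ} {T : Type*} (i : ℕ) (h : n ≤ i) (r : T) : genF n T i r = 0 := by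
  simp [genF, h]

lemma genF_val {n : ℕ} {T : Type*} (i : Fin n) (r : T) :
    genF n T i r = FreeAlgebra.ι ℚ (i, r) := by
  simp [genF]

lemma adjoin_genF (n : ℕ) (T : Type*) :
    Algebra.adjoin ℚ {x | ∃ c r, x = genF n T c r} = ⊤ := by
  rw [eq_top_iff, ← FreeAlgebra.adjoin_range_ι]
  apply Algebra.adjoin_mono
  rintro _ ⟨⟨i, r⟩, rfl⟩
  exact ⟨i, r, (genF_val i r).symm⟩

namespace Fr
variable {V : Type*} [DecidableEq V] [Fintype V] (c : V → ℕ)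

/-- Removal of a variable of colour `i`, extracting the coefficient of exponent `-r`. -/
def colorOp (i : ℕ) (r : ℤ) : Module.End ℚ (Finset V → Fr V) :=
  ∑ v with c v = i, τ v (-r)

lemma colorOp_lie (i j : ℕ) (r s : ℤ) : ⁅colorOp c i r, colorOp c j s⁆ =
    ∑ p with c p = i, ∑ q with c q = j, ⁅τ p (-r), τ q (-s)⁆ := by
  simp only [colorOp, LieRing.of_associative_ring_bracket, Finset.sum_mul, Finset.mul_sum,
    Finset.sum_sub_distrib]
  congr 1
  rw [Finset.sum_comm]

lemma sum_lie_colorOp {ι : Type*} (A : Finset ι) (f : ι → Module.End ℚ (Finset V → Fr V)) (j : ℕ)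
    (s : ℤ) : ⁅∑ p ∈ A, f p, colorOp c j s⁆ = ∑ p ∈ A, ∑ q with c q = j, ⁅f p, τ q (-s)⁆ := by
  simp only [colorOp, LieRing.of_associative_ring_bracket, Finset.sum_mul, Finset.mul_sum,
    Finset.sum_sub_distrib]
  congr 1
  rw [Finset.sum_comm]

variable {c}

lemma pres_colorOp (i : ℕ) (r : ℤ) : Pres (GoodFam c) (colorOp c i r) := by
  intro G hG
  rw [colorOp, LinearMap.sum_apply]
  exact sum_mem fun v _ => pres_τ v _ G hG

lemma colorOp_of_le {n : ℕ} (hc : ∀ v, c v < n) (i : ℕ) (h : n ≤ i) (r : ℤ) :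
    colorOp c i r = 0 := by
  rw [colorOp, Finset.filter_eq_empty_iff.mpr, Finset.sum_empty]
  intro v _ hv; have := hc v; omega

section Relations
variable {G : Finset V → Fr V} (hG : G ∈ GoodFam c)
include hG

lemma colorOp_loop (i j : ℕ) (r s u : ℤ) :
    ⁅colorOp c i (r + u), colorOp c j s⁆ G = ⁅colorOp c i r, colorOp c j (s + u)⁆ G := by
  rw [colorOp_lie, colorOp_lie]
  simp only [LinearMap.sum_apply]
  refine Finset.sum_congr rfl fun p _ => Finset.sum_congr rfl fun q _ => ?_
  rw [show -(r + u) = -r - u by ring, show -(s + u) = -s - u by ring, τ_loop hG]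

lemma colorOp_comm (i j : ℕ) (h : ¬ (i + 1 = j ∨ j + 1 = i)) (r s : ℤ) :
    ⁅colorOp c i r, colorOp c j s⁆ G = 0 := by
  rw [colorOp_lie]
  simp only [LinearMap.sum_apply]
  refine Finset.sum_eq_zero fun p hp => Finset.sum_eq_zero fun q hq => ?_
  simp only [Finset.mem_filter] at hp hq
  exact τ_comm hG p q (by rw [Adj, hp.2, hq.2]; exact h) _ _

lemma colorOp_serre_two (i j : ℕ) (h : i + 1 = j ∨ j + 1 = i) (h0 : ¬ (i = 0 ∧ j = 1))
    (r s t : ℤ) : ⁅⁅colorOp c i r, colorOp c j s⁆, colorOp c j t⁆ G = 0 := by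
  rw [colorOp_lie, ← Finset.sum_product', sum_lie_colorOp]
  simp only [LinearMap.sum_apply]
  refine Finset.sum_eq_zero fun ⟨w, p⟩ hw => Finset.sum_eq_zero fun q hq => ?_
  simp only [Finset.mem_filter, Finset.mem_product] at hw hq
  exact τ_serre_two hG w p q (by rw [hw.2.2, hq.2]) (by rw [Adj, hw.1.2, hw.2.2]; exact h)
    (by rw [hw.1.2, hw.2.2]; exact h0) _ _ _

lemma colorOp_serre_three (r s t k : ℤ) :
    ⁅⁅⁅colorOp c 0 r, colorOp c 1 s⁆, colorOp c 1 t⁆, colorOp c 1 k⁆ G = 0 := by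
  rw [colorOp_lie, ← Finset.sum_product', sum_lie_colorOp, ← Finset.sum_product', sum_lie_colorOp]
  simp only [LinearMap.sum_apply]
  refine Finset.sum_eq_zero fun ⟨⟨w, p⟩, q⟩ hw => Finset.sum_eq_zero fun u hu => ?_
  simp only [Finset.mem_filter, Finset.mem_product] at hw hu
  exact τ_serre_three hG w p q u hw.1.1.2 hw.1.2.2 hw.2.2 hu.2 _ _ _ _

end Relations

variable (c) in
/-- The right action of words on families of functions. -/
def act (n : ℕ) : FreeAlgebra ℚ (Fin n × ℤ) →ₐ[ℚ] (Module.End ℚ (Finset V → Fr V))ᵐᵒᵖ :=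
  FreeAlgebra.lift ℚ fun p => MulOpposite.op (colorOp c p.1 p.2)

variable (c) in
/-- The endomorphism attached to an element of the free algebra. -/
def actE (n : ℕ) : FreeAlgebra ℚ (Fin n × ℤ) →ₗ[ℚ] Module.End ℚ (Finset V → Fr V) :=
  (MulOpposite.opLinearEquiv ℚ).symm.toLinearMap.comp (act c n).toLinearMap

variable {n : ℕ}

lemma actE_mul (a b : FreeAlgebra ℚ (Fin n × ℤ)) : actE c n (a * b) = actE c n b * actE c n a := by
  simp [actE]

lemma actE_mul_apply (a b : FreeAlgebra ℚ (Fin n × ℤ)) (G : Finset V → Fr V) :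
    actE c n (a * b) G = actE c n b (actE c n a G) := by
  rw [actE_mul]; rfl

lemma actE_one : actE c n 1 = 1 := by simp [actE]

lemma actE_ι (i : Fin n) (r : ℤ) : actE c n (FreeAlgebra.ι ℚ (i, r)) = colorOp c i r := by
  simp [actE, act]

lemma actE_lie (a b : FreeAlgebra ℚ (Fin n × ℤ)) :
    actE c n ⁅a, b⁆ = -⁅actE c n a, actE c n b⁆ := by
  rw [LieRing.of_associative_ring_bracket, LieRing.of_associative_ring_bracket, map_sub, actE_mul,
    actE_mul, neg_sub]

lemma actE_genF (hc : ∀ v, c v < n) (i : ℕ) (r : ℤ) :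
    actE c n (genF n ℤ i r) = colorOp c i r := by
  by_cases h : i < n
  · rw [genF, dif_pos h, actE_ι]
  · rw [genF_of_le _ (not_lt.mp h), map_zero, colorOp_of_le hc _ (not_lt.mp h)]

lemma pres_actE (a : FreeAlgebra ℚ (Fin n × ℤ)) : Pres (GoodFam c) (actE c n a) := by
  induction a using FreeAlgebra.induction with
  | grade0 q =>
    intro G hG
    rw [Algebra.algebraMap_eq_smul_one, map_smul, actE_one]
    exact Submodule.smul_mem _ _ hG
  | grade1 p => rw [actE_ι]; exact pres_colorOp _ _
  | mul a b ha hb => intro G hG; rw [actE_mul_apply]; exact hb _ (ha _ hG)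
  | add a b ha hb => intro G hG; rw [map_add]; exact add_mem (ha _ hG) (hb _ hG)

lemma actE_mul_mul_eq_zero {y : FreeAlgebra ℚ (Fin n × ℤ)}
    (hy : ∀ G ∈ GoodFam c, actE c n y G = 0) {G : Finset V → Fr V} (hG : G ∈ GoodFam c)
    (a b : FreeAlgebra ℚ (Fin n × ℤ)) : actE c n (a * y * b) G = 0 := by
  rw [actE_mul_apply, actE_mul_apply, hy _ (pres_actE a G hG), map_zero]

/-- The functional on words defined by a family of functions. -/
def pairing (n : ℕ) (c : V → ℕ) (G : Finset V → Fr V) : FreeAlgebra ℚ (Fin n × ℤ) →ₗ[ℚ] Fr V :=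
  (LinearMap.proj (R := ℚ) (φ := fun _ : Finset V => Fr V) ∅).comp
    ((LinearMap.applyₗ (R := ℚ) G).comp (actE c n))

lemma pairing_apply (G : Finset V → Fr V) (a : FreeAlgebra ℚ (Fin n × ℤ)) :
    pairing n c G a = actE c n a G ∅ := rfl

lemma pairing_eq_zero (hc : ∀ v, c v < n) {G : Finset V → Fr V} (hG : G ∈ GoodFam c)
    (μ : Rt n × ℤ → ℕ → ℤ) (hμ : ∀ p, modeSum p.1.1.1 p.1.1.2.2 p.1.1.2.1 (μ p) = p.2)
    (srt : Multiset (Rt n × ℤ) → List (Rt n × ℤ)) (hs : ∀ b, (srt b : Multiset _) = b)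
    (hφ : ∀ b, pairing n c G ((srt b).map fun p =>
      rootLnc (genF n ℤ) p.1.1.1 p.1.1.2.2 p.1.1.2.1 (μ p)).prod = 0) :
    pairing n c G = 0 := by
  refine functional_eq_zero_of_module (genF n ℤ) (fun c h r => genF_of_le c h r) (adjoin_genF n ℤ) _
    ?_ ?_ ?_ ?_ ?_ ?_ μ hμ srt hs hφ
  · intro i j r s u a b
    rw [pairing_apply, actE_mul_mul_eq_zero _ hG, Pi.zero_apply]
    intro G hG
    rw [map_sub, actE_lie, actE_lie]
    simp only [actE_genF hc, LinearMap.sub_apply, LinearMap.neg_apply, colorOp_loop hG, sub_self]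
  · intro i r s a b
    rw [pairing_apply, actE_mul_mul_eq_zero _ hG, Pi.zero_apply]
    intro G hG
    rw [actE_lie, actE_genF hc, actE_genF hc, LinearMap.neg_apply, colorOp_comm hG _ _ (by omega),
      neg_zero]
  · intro i j r s h a b
    rw [pairing_apply, actE_mul_mul_eq_zero _ hG, Pi.zero_apply]
    intro G hG
    rw [actE_lie, actE_genF hc, actE_genF hc, LinearMap.neg_apply, colorOp_comm hG _ _ (by omega),
      neg_zero]
  · intro i t r s a b
    rw [pairing_apply, actE_mul_mul_eq_zero _ hG, Pi.zero_apply]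
    intro G hG
    rw [actE_lie, actE_lie, actE_genF hc, actE_genF hc, actE_genF hc, neg_lie, neg_neg,
      colorOp_serre_two hG _ _ (by omega) (by omega)]
  · intro i t r s a b
    rw [pairing_apply, actE_mul_mul_eq_zero _ hG, Pi.zero_apply]
    intro G hG
    rw [actE_lie, actE_lie, actE_genF hc, actE_genF hc, actE_genF hc, neg_lie, neg_neg,
      colorOp_serre_two hG _ _ (by omega) (by omega)]
  · intro t r s u a b
    rw [pairing_apply, actE_mul_mul_eq_zero _ hG, Pi.zero_apply]
    intro G hG
    rw [actE_lie, actE_lie, actE_lie, actE_genF hc, actE_genF hc, actE_genF hc, actE_genF hc,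
      neg_lie, neg_lie, neg_lie, neg_neg, LinearMap.neg_apply, colorOp_serre_three hG, neg_zero]

lemma pairing_const {G : Finset V → Fr V} (hG : G ∈ GoodFam c) (a : FreeAlgebra ℚ (Fin n × ℤ)) :
    ∃ q : ℚ, pairing n c G a = algebraMap ℚ (Fr V) q :=
  mem_RatAlg_empty (mem_GoodFam.mp (pres_actE a G hG) ∅).1

end Fr
end Action

/-! ### Bounds on exponents of iterated expansions -/

section Window
set_option linter.unusedSectionVars false
attribute [local instance] LieRing.ofAssociativeRing

namespace Fr
variable {V : Type*} [DecidableEq V]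

/-- Iterated coefficients. -/
def γl : List V → (V → ℤ) → Fr V →ₗ[ℚ] Fr V
  | [], _ => LinearMap.id
  | v :: l, e => (γl l e).comp (γ v (e v))

lemma γl_cons (v : V) (l : List V) (e : V → ℤ) (F : Fr V) :
    γl (v :: l) e F = γl l e (γ v (e v) F) := rfl

lemma γl_congr {l : List V} {e e' : V → ℤ} (h : ∀ v ∈ l, e v = e' v) : γl l e = γl l e' := by
  induction l with
  | nil => rfl
  | cons v l ih =>
    rw [γl, γl, ih fun u hu => h u (List.mem_cons_of_mem _ hu), h v List.mem_cons_self]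

lemma γl_indep_mul {l : List V} {e : V → ℤ} {K : Fr V} (h : ∀ v ∈ l, K ∈ indep v) (F : Fr V) :
    γl l e (K * F) = K * γl l e F := by
  induction l generalizing F with
  | nil => rfl
  | cons v l ih =>
    rw [γl_cons, γ_mul_of_indep (h v List.mem_cons_self),
      ih (fun u hu => h u (List.mem_cons_of_mem _ hu)), γl_cons]

lemma γl_x_mul {l : List V} (hl : l.Nodup) {a : V} (ha : a ∈ l) (e : V → ℤ) (F : Fr V) :
    γl l e (x a * F) = γl l (Function.update e a (e a - 1)) F := by
  induction l generalizing F with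
  | nil => simp at ha
  | cons v l ih =>
    rw [List.nodup_cons] at hl
    rw [γl_cons, γl_cons]
    by_cases hav : a = v
    · subst hav
      rw [γ_x_self_mul, Function.update_self]
      rw [γl_congr (l := l) (e := Function.update e a (e a - 1)) (e' := e)]
      intro u hu
      rw [Function.update_of_ne]
      rintro rfl; exact hl.1 hu
    · rw [γ_x_mul hav, ih hl.2 (by simpa [hav] using ha), Function.update_of_ne (Ne.symm hav)]

lemma γl_x_inv_mul {l : List V} (hl : l.Nodup) {a : V} (ha : a ∈ l) (e : V → ℤ) (F : Fr V) :
    γl l e ((x a)⁻¹ * F) = γl l (Function.update e a (e a + 1)) F := by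
  have h := γl_x_mul hl ha (Function.update e a (e a + 1)) ((x a)⁻¹ * F)
  rw [mul_inv_cancel_left₀ (x_ne_zero a)] at h
  refine Eq.trans (congrArg (fun φ : Fr V →ₗ[ℚ] Fr V => φ ((x a)⁻¹ * F))
    (γl_congr fun v _ => ?_)) h.symm
  by_cases hv : v = a
  · subst hv; simp
  · simp [hv]

/-- Coefficients of weighted degree less than `δ` vanish. -/
def Ord (wt : V → ℤ) (l : List V) (F : Fr V) (δ : ℤ) : Prop :=
  ∀ e : V → ℤ, (l.map fun v => wt v * e v).sum < δ → γl l e F = 0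

variable {wt : V → ℤ} {l : List V} {F G : Fr V} {δ : ℤ}

lemma Ord.mono {δ' : ℤ} (h : Ord wt l F δ) (h' : δ' ≤ δ) : Ord wt l F δ' :=
  fun e he => h e (he.trans_le h')

lemma Ord.add (hF : Ord wt l F δ) (hG : Ord wt l G δ) : Ord wt l (F + G) δ := fun e he => by
  rw [map_add, hF e he, hG e he, add_zero]

lemma Ord.neg (hF : Ord wt l F δ) : Ord wt l (-F) δ := fun e he => by
  rw [map_neg, hF e he, neg_zero]

lemma Ord.smul (q : ℚ) (hF : Ord wt l F δ) : Ord wt l (q • F) δ := fun e he => by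
  rw [map_smul, hF e he, smul_zero]

lemma ord_zero : Ord wt l 0 δ := fun e _ => map_zero _

lemma Ord.sub (hF : Ord wt l F δ) (hG : Ord wt l G δ) : Ord wt l (F - G) δ := by
  rw [sub_eq_add_neg]; exact hF.add hG.neg

lemma ord_sum {ι : Type*} (s : Finset ι) (f : ι → Fr V) (h : ∀ i ∈ s, Ord wt l (f i) δ) :
    Ord wt l (∑ i ∈ s, f i) δ := fun e he => by
  rw [map_sum]; exact Finset.sum_eq_zero fun i hi => h i hi e he

lemma sum_update {l : List V} (hl : l.Nodup) {a : V} (ha : a ∈ l) (e : V → ℤ) (k : ℤ) :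
    (l.map fun v => wt v * Function.update e a (e a + k) v).sum =
      (l.map fun v => wt v * e v).sum + wt a * k := by
  induction l with
  | nil => simp at ha
  | cons v l ih =>
    rw [List.nodup_cons] at hl
    simp only [List.map_cons, List.sum_cons]
    by_cases hav : a = v
    · subst hav
      rw [Function.update_self, List.map_congr_left (g := fun v => wt v * e v)]
      · ring
      · intro u hu
        rw [Function.update_of_ne]
        rintro rfl; exact hl.1 hu
    · rw [ih hl.2 (by simpa [hav] using ha), Function.update_of_ne (Ne.symm hav)]; ring

lemma Ord.x_mul (hl : l.Nodup) {a : V} (ha : a ∈ l) (h : Ord wt l F δ) :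
    Ord wt l (x a * F) (δ + wt a) := by
  intro e he
  rw [γl_x_mul hl ha]
  apply h
  rw [sub_eq_add_neg, sum_update hl ha]; linarith

lemma Ord.x_inv_mul (hl : l.Nodup) {a : V} (ha : a ∈ l) (h : Ord wt l F δ) :
    Ord wt l ((x a)⁻¹ * F) (δ - wt a) := by
  intro e he
  rw [γl_x_inv_mul hl ha]
  apply h
  rw [sum_update hl ha]; linarith

lemma ord_cons {v : V} (hv : v ∉ l) :
    Ord wt (v :: l) F δ ↔ ∀ r, Ord wt l (γ v r F) (δ - wt v * r) := by
  constructor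
  · intro h r e he
    have := h (Function.update e v r)
    rw [γl_cons, Function.update_self] at this
    have hc : ∀ u ∈ l, Function.update e v r u = e u := fun u hu =>
      Function.update_of_ne (by rintro rfl; exact hv hu) _ _
    rw [γl_congr (l := l) (e' := e) hc] at this
    apply this
    simp only [List.map_cons, List.sum_cons, Function.update_self]
    rw [List.map_congr_left (g := fun v => wt v * e v)]
    · linarith
    · intro u hu; rw [hc u hu]
  · intro h e he
    rw [γl_cons]
    apply h
    simp only [List.map_cons, List.sum_cons] at he
    linarith

lemma Ord.pole (hl : l.Nodup) (hw : l.Pairwise fun a b => wt b ≤ wt a) {a b : V} (ha : a ∈ l)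
    (hb : b ∈ l) (hab : a ≠ b) (h : Ord wt l F δ) :
    Ord wt l ((x a - x b)⁻¹ * F) (δ - min (wt a) (wt b)) := by
  induction l generalizing F δ with
  | nil => simp at ha
  | cons v l ih =>
    rw [List.nodup_cons] at hl
    rw [List.pairwise_cons] at hw
    have key : ∀ {b}, b ∈ l → ∀ {F δ}, Ord wt (v :: l) F δ →
        Ord wt (v :: l) ((x v - x b)⁻¹ * F) (δ - wt b) := by
      intro b hb F δ h
      rw [ord_cons hl.1] at h ⊢
      have hne : v ≠ b := by rintro rfl; exact hl.1 hb
      obtain ⟨N, hN⟩ := γ_bound v ((x v - x b)⁻¹ * F)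
      refine int_induction N (fun r hr => by rw [hN r hr]; exact ord_zero) fun r ih' => ?_
      rw [γ_pole_self hne]
      have hwb := hw.1 b hb
      refine Ord.mono ((Ord.sub (δ := δ - wt v * r) (ih'.mono ?_) (h r)).x_inv_mul hl.2 hb) ?_
      · nlinarith
      · nlinarith
    by_cases hav : a = v
    · subst hav
      have hb' : b ∈ l := by simpa [hab.symm] using hb
      rw [min_eq_right (hw.1 b hb')]
      exact key hb' h
    by_cases hbv : b = v
    · subst hbv
      have ha' : a ∈ l := by simpa [hab] using ha
      rw [min_eq_left (hw.1 a ha'), pole_swap]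
      exact (key ha' h).neg
    · have ha' : a ∈ l := by simpa [hav] using ha
      have hb' : b ∈ l := by simpa [hbv] using hb
      rw [ord_cons hl.1] at h ⊢
      intro r
      rw [x_sub_mul_γ hav hbv]
      exact (ih hl.2 hw.2 ha' hb' (h r)).mono (by linarith)

lemma Ord.prod_pole (hl : l.Nodup) (hw : l.Pairwise fun a b => wt b ≤ wt a) (hm : ∀ v, v ∈ l)
    (P : Finset (V × V)) (hP : ∀ p ∈ P, p.1 ≠ p.2) (h : Ord wt l F δ) :
    Ord wt l ((∏ p ∈ P, (x p.1 - x p.2))⁻¹ * F) (δ - ∑ p ∈ P, min (wt p.1) (wt p.2)) := by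
  induction P using Finset.induction_on with
  | empty => simpa using h
  | insert p P hp ih =>
    rw [Finset.prod_insert hp, mul_inv, mul_assoc, Finset.sum_insert hp]
    exact ((ih fun q hq => hP q (Finset.mem_insert_of_mem hq)).pole hl hw (hm _) (hm _)
      (hP p (Finset.mem_insert_self _ _))).mono (by linarith)

lemma ord_one (hl : l.Nodup) : Ord wt l (1 : Fr V) 0 := by
  induction l with
  | nil => intro e he; simp at he
  | cons v l ih =>
    rw [List.nodup_cons] at hl
    rw [ord_cons hl.1]
    intro r
    rw [γ_one]
    split_ifs with h
    · subst h; simpa using ih hl.2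
    · exact ord_zero

lemma Ord.pow_mul (hl : l.Nodup) {a : V} (ha : a ∈ l) (h : Ord wt l F δ) (k : ℕ) :
    Ord wt l (x a ^ k * F) (δ + wt a * k) := by
  induction k with
  | zero => simpa using h
  | succ k ih =>
    rw [pow_succ', mul_assoc]
    exact (ih.x_mul hl ha).mono (by push_cast; linarith)

lemma ord_monomial [Fintype V] (hl : l.Nodup) (hm : ∀ v, v ∈ l) (d : V →₀ ℕ) (q : ℚ) :
    Ord wt l (algebraMap (MvPolynomial V ℚ) (Fr V) (MvPolynomial.monomial d q))
      (∑ v, wt v * d v) := by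
  have key : ∀ s : Finset V, Ord wt l (∏ v ∈ s, x v ^ d v) (∑ v ∈ s, wt v * d v) := by
    intro s
    induction s using Finset.induction_on with
    | empty => simpa using ord_one hl
    | insert v s hv ih =>
      rw [Finset.prod_insert hv, Finset.sum_insert hv]
      exact (ih.pow_mul hl (hm v) (d v)).mono (by linarith)
  rw [MvPolynomial.monomial_eq, map_mul, algebraMap_C, ← Algebra.smul_def]
  refine Ord.smul q ?_
  rw [Finsupp.prod_fintype _ _ (fun _ => pow_zero _), map_prod]
  simpa [x] using key Finset.univ

lemma ord_poly [Fintype V] (hl : l.Nodup) (hm : ∀ v, v ∈ l) (f : MvPolynomial V ℚ)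
    (h : ∀ d ∈ f.support, δ ≤ ∑ v, wt v * d v) :
    Ord wt l (algebraMap (MvPolynomial V ℚ) (Fr V) f) δ := by
  rw [f.as_sum, map_sum]
  exact ord_sum _ _ fun d hd => (ord_monomial hl hm d _).mono (h d hd)

end Fr
end Window

/-! ### Words acting on functions of a fixed set of variables -/

section WordAction
set_option linter.unusedSectionVars false
attribute [local instance] LieRing.ofAssociativeRing

/-- The word in the free generators spelled by a list. -/
def word {X : Type*} (w : List X) : FreeAlgebra ℚ X := (w.map (FreeAlgebra.ι ℚ)).prod

lemma word_nil {X : Type*} : word ([] : List X) = 1 := rfl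

lemma word_cons {X : Type*} (p : X) (w : List X) :
    word (p :: w) = FreeAlgebra.ι ℚ p * word w := rfl

lemma word_append {X : Type*} (w w' : List X) : word (w ++ w') = word w * word w' := by
  simp [word]

lemma span_word {X : Type*} : Submodule.span ℚ (Set.range (word (X := X))) = ⊤ := by
  rw [eq_top_iff]
  rintro a -
  induction a using FreeAlgebra.induction with
  | grade0 q =>
    rw [Algebra.algebraMap_eq_smul_one]
    exact Submodule.smul_mem _ _ (Submodule.subset_span ⟨[], rfl⟩)
  | grade1 p => exact Submodule.subset_span ⟨[p], by simp [word]⟩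
  | add a b ha hb => exact add_mem ha hb
  | mul a b ha hb =>
    have := Submodule.mul_mem_mul ha hb
    rw [Submodule.span_mul_span] at this
    refine Submodule.span_mono ?_ this
    rintro _ ⟨_, ⟨w, rfl⟩, _, ⟨w', rfl⟩, rfl⟩
    exact ⟨w ++ w', word_append w w'⟩

variable {n : ℕ}

/-- Elements of the free algebra of given weight and total mode. -/
def Hgr (n : ℕ) (κ : Multiset ℕ) (s : ℤ) : Submodule ℚ (FreeAlgebra ℚ (Fin n × ℤ)) :=
  Submodule.span ℚ {a | ∃ w : List (Fin n × ℤ), a = word w ∧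
    ((w.map fun p => p.1.val : List ℕ) : Multiset ℕ) = κ ∧ (w.map Prod.snd).sum = s}

lemma one_mem_Hgr : (1 : FreeAlgebra ℚ (Fin n × ℤ)) ∈ Hgr n 0 0 :=
  Submodule.subset_span ⟨[], rfl, rfl, rfl⟩

lemma mul_mem_Hgr {κ κ' : Multiset ℕ} {s s' : ℤ} {a b : FreeAlgebra ℚ (Fin n × ℤ)}
    (ha : a ∈ Hgr n κ s) (hb : b ∈ Hgr n κ' s') : a * b ∈ Hgr n (κ + κ') (s + s') := by
  have := Submodule.mul_mem_mul ha hb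
  rw [Hgr, Hgr, Submodule.span_mul_span] at this
  refine Submodule.span_mono ?_ this
  rintro _ ⟨_, ⟨w, rfl, rfl, rfl⟩, _, ⟨w', rfl, rfl, rfl⟩, rfl⟩
  exact ⟨w ++ w', (word_append w w').symm, by simp, by simp⟩

lemma lie_mem_Hgr {κ κ' : Multiset ℕ} {s s' : ℤ} {a b : FreeAlgebra ℚ (Fin n × ℤ)}
    (ha : a ∈ Hgr n κ s) (hb : b ∈ Hgr n κ' s') : ⁅a, b⁆ ∈ Hgr n (κ + κ') (s + s') := by
  rw [LieRing.of_associative_ring_bracket]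
  refine sub_mem (mul_mem_Hgr ha hb) ?_
  rw [add_comm κ, add_comm s]
  exact mul_mem_Hgr hb ha

lemma genF_mem_Hgr (i : ℕ) (r : ℤ) : genF n ℤ i r ∈ Hgr n {i} r := by
  by_cases h : i < n
  · rw [genF, dif_pos h]
    exact Submodule.subset_span ⟨[(⟨i, h⟩, r)], by simp [word], rfl, by simp⟩
  · rw [genF, dif_neg h]; exact zero_mem _

lemma lnc_mem_Hgr {κ : Multiset ℕ} {s : ℤ} {a : FreeAlgebra ℚ (Fin n × ℤ)} (ha : a ∈ Hgr n κ s)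
    (l : List ℕ) (m : ℕ → ℤ) :
    lnc a (l.map fun i => genF n ℤ i (m i)) ∈ Hgr n (κ + (l : Multiset ℕ)) (s + (l.map m).sum) := by
  induction l generalizing a κ s with
  | nil => simpa [lnc] using ha
  | cons i l ih =>
    have := ih (lie_mem_Hgr ha (genF_mem_Hgr i (m i)))
    rw [add_assoc, add_assoc, Multiset.singleton_add, Multiset.cons_coe] at this
    simpa [lnc] using this

lemma rootLnc_mem_Hgr (t c d : ℕ) (m : ℕ → ℤ) :
    rootLnc (genF n ℤ) t c d m ∈ Hgr n (t :: rtail t c d : List ℕ) (modeSum t c d m) := by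
  have := lnc_mem_Hgr (genF_mem_Hgr (n := n) t (m t)) (rtail t c d) m
  rw [Multiset.singleton_add, Multiset.cons_coe] at this
  simpa [rootLnc, modeSum] using this

namespace Fr
variable {V : Type*} [DecidableEq V] [Fintype V] {c : V → ℕ}

lemma colorOp_apply (i : ℕ) (r : ℤ) (G : Finset V → Fr V) (S : Finset V) :
    colorOp c i r G S = ∑ v with c v = i, if v ∈ S then 0 else γ v (-r) (G (insert v S)) := by
  simp [colorOp, LinearMap.sum_apply, Finset.sum_apply, τ_apply]

lemma actE_word_eq_zero (w : List (Fin n × ℤ)) (G : Finset V → Fr V) (S : Finset V)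
    (h : ∀ (l : List V) (e : V → ℤ), l.Nodup → (∀ v ∈ l, v ∉ S) →
      l.map (fun v => (c v, e v)) = w.map (fun p => (p.1.val, -p.2)) →
      γl l e (G (S ∪ l.toFinset)) = 0) : actE c n (word w) G S = 0 := by
  induction w generalizing G S with
  | nil =>
    rw [word_nil, actE_one]
    have := h [] 0 (by simp) (by simp) rfl
    rwa [List.toFinset_nil, Finset.union_empty] at this
  | cons p w ih =>
    rw [word_cons, actE_mul_apply]
    apply ih
    intro l e hl hlS hlw
    rw [actE_ι, colorOp_apply, map_sum]
    refine Finset.sum_eq_zero fun v hv => ?_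
    split_ifs with hvS
    · exact map_zero _
    simp only [Finset.mem_union, List.mem_toFinset, not_or] at hvS
    have hc : ∀ u ∈ l, Function.update e v (-p.2) u = e u := fun u hu =>
      Function.update_of_ne (by rintro rfl; exact hvS.2 hu) _ _
    have := h (v :: l) (Function.update e v (-p.2)) (List.nodup_cons.mpr ⟨hvS.2, hl⟩)
      (by rintro u hu; rcases List.mem_cons.mp hu with rfl | hu; exacts [hvS.1, hlS u hu])
      (by
        simp only [List.map_cons, Function.update_self, List.cons.injEq]
        refine ⟨by rw [(Finset.mem_filter.mp hv).2], ?_⟩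
        rw [← hlw]
        exact List.map_congr_left fun u hu => by rw [hc u hu])
    rw [γl_cons, Function.update_self, γl_congr hc] at this
    rwa [List.toFinset_cons, Finset.union_insert] at this

variable (n c) in
/-- The functional on words defined by a function of all variables. -/
def pairU (F : Fr V) : FreeAlgebra ℚ (Fin n × ℤ) →ₗ[ℚ] Fr V := pairing n c (Pi.single Finset.univ F)

lemma pairU_word_eq_zero (w : List (Fin n × ℤ)) (F : Fr V)
    (h : ∀ (l : List V) (e : V → ℤ), l.Nodup → (∀ v, v ∈ l) →
      l.map (fun v => (c v, e v)) = w.map (fun p => (p.1.val, -p.2)) → γl l e F = 0) :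
    pairU n c F (word w) = 0 := by
  apply actE_word_eq_zero
  intro l e hl _ hw
  by_cases hu : (∅ : Finset V) ∪ l.toFinset = Finset.univ
  · rw [hu, Pi.single_eq_same]
    refine h l e hl (fun v => ?_) hw
    have : v ∈ (∅ : Finset V) ∪ l.toFinset := hu ▸ Finset.mem_univ v
    simpa using this
  · rw [Pi.single_eq_of_ne hu, map_zero]

lemma pairU_weight {κ : Multiset ℕ} {s : ℤ} {a : FreeAlgebra ℚ (Fin n × ℤ)} (ha : a ∈ Hgr n κ s)
    (F : Fr V) (h : κ ≠ Finset.univ.val.map c) : pairU n c F a = 0 := by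
  induction ha using Submodule.span_induction with
  | mem a ha =>
    obtain ⟨w, rfl, hw, -⟩ := ha
    apply pairU_word_eq_zero
    intro l e hl hm hlw
    refine absurd ?_ h
    have h1 : l.map c = w.map fun p => p.1.val := by
      simpa [Function.comp_def] using congrArg (List.map Prod.fst) hlw
    have h2 : (l : Multiset V) = Finset.univ.val := by
      rw [← Multiset.coe_nodup] at hl
      have : (⟨(l : Multiset V), hl⟩ : Finset V) = Finset.univ := by
        ext v; simpa using hm v
      exact congrArg Finset.val this
    rw [← hw, ← h1, ← h2, Multiset.map_coe]
  | zero => exact map_zero _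
  | add a b _ _ ha hb => rw [map_add, ha, hb, add_zero]
  | smul q a _ ha => rw [map_smul, ha, smul_zero]

/-- The denominator `∏ (x u - x w)` over pairs of adjacent colours. -/
def edges (c : V → ℕ) : Finset (V × V) := Finset.univ.filter fun p => c p.1 + 1 = c p.2

def den (c : V → ℕ) : Fr V := ∏ p ∈ edges c, (x p.1 - x p.2)

lemma edges_ne {p : V × V} (hp : p ∈ edges c) : p.1 ≠ p.2 := by
  rintro h
  simp only [edges, Finset.mem_filter, h] at hp
  omega

lemma den_ne_zero : den c ≠ 0 := Finset.prod_ne_zero_iff.mpr fun _ hp => x_sub_ne_zero (edges_ne hp)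

/-- Bounds on partial degrees of the numerator of an element of the shuffle algebra. -/
def InWindow (c : V → ℕ) (M : ℕ) (d : V →₀ ℕ) : Prop :=
  ∀ A : Finset V, ((edges c).filter fun p => p.1 ∈ A ∧ p.2 ∈ A).card ≤ ∑ v ∈ A, d v ∧
    ∑ v ∈ A, d v ≤ M * A.card + ((edges c).filter fun p => p.1 ∈ A ∨ p.2 ∈ A).card

/-- The rational function with a given numerator. -/
def frac (c : V → ℕ) : MvPolynomial V ℚ →ₗ[ℚ] Fr V where
  toFun f := (den c)⁻¹ * algebraMap _ (Fr V) f
  map_add' f g := by rw [map_add, mul_add]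
  map_smul' q f := by
    rw [MvPolynomial.smul_eq_C_mul, map_mul, algebraMap_C, Algebra.smul_def]
    simp only [RingHom.id_apply]
    ring

lemma frac_apply (f : MvPolynomial V ℚ) : frac c f = (den c)⁻¹ * algebraMap _ (Fr V) f := rfl

lemma sum_map_ite (l : List V) (hl : l.Nodup) (hm : ∀ v, v ∈ l) (f : V → ℤ) :
    (l.map f).sum = ∑ v, f v := by
  rw [← List.sum_toFinset f hl]
  congr 1; ext v; simp [hm v]

lemma sum_map_neg_snd {X : Type*} (w : List (X × ℤ)) :
    (w.map fun p => -p.2).sum = -(w.map Prod.snd).sum := by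
  induction w with
  | nil => rfl
  | cons p w ih => simp only [List.map_cons, List.sum_cons, ih]; ring

lemma pairU_first {f : MvPolynomial V ℚ} {M : ℕ} (hf : ∀ d ∈ f.support, InWindow c M d)
    (w w' : List (Fin n × ℤ)) (hw : 0 < (w.map Prod.snd).sum) :
    pairU n c (frac c f) (word (w ++ w')) = 0 := by
  apply pairU_word_eq_zero
  intro l e hl hm hlw
  obtain ⟨l1, l2, rfl, h1, -⟩ := (List.map_eq_append_iff.mp (hlw.trans (by rw [List.map_append])))
  set A : Finset V := l1.toFinset with hA
  set wt : V → ℤ := fun v => if v ∈ A then 1 else 0 with hwt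
  rw [List.nodup_append] at hl
  have hl' : (l1 ++ l2).Nodup := List.nodup_append.mpr hl
  have h2 : ∀ v ∈ l2, wt v = 0 := fun v hv => by
    simp only [hwt, hA, List.mem_toFinset]
    rw [if_neg]; intro h; exact hl.2.2 v h v hv rfl
  have h1' : ∀ v ∈ l1, wt v = 1 := fun v hv => by simp [hwt, hA, hv]
  have hpw : (l1 ++ l2).Pairwise fun a b => wt b ≤ wt a := by
    rw [List.pairwise_append]
    refine ⟨List.pairwise_of_forall_mem_list ?_, List.pairwise_of_forall_mem_list ?_, ?_⟩
    · intro a ha b hb; rw [h1' a ha, h1' b hb]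
    · intro a ha b hb; rw [h2 a ha, h2 b hb]
    · intro a ha b hb; rw [h1' a ha, h2 b hb]; norm_num
  have key : Ord wt (l1 ++ l2) (frac c f) 0 := by
    have hp := ord_poly (wt := wt) hl' hm f
      (δ := ((edges c).filter fun p => p.1 ∈ A ∧ p.2 ∈ A).card) (by
        intro d hd
        have := (hf d hd A).1
        simp only [hwt, ite_mul, one_mul, zero_mul, Finset.sum_ite_mem, Finset.univ_inter]
        exact_mod_cast this)
    refine (hp.prod_pole hl' hpw hm (edges c) fun p hp => edges_ne hp).mono ?_
    rw [Finset.card_filter]; push_cast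
    rw [← Finset.sum_sub_distrib]
    refine Finset.sum_nonneg fun p _ => ?_
    simp only [hwt]
    by_cases h3 : p.1 ∈ A <;> by_cases h4 : p.2 ∈ A <;> simp [h3, h4]
  apply key
  rw [List.map_append, List.sum_append, List.map_congr_left (g := fun v => e v)
    (fun v hv => by rw [h1' v hv, one_mul]), List.map_congr_left (l := l2) (g := fun v => 0)
    (fun v hv => by rw [h2 v hv, zero_mul])]
  have h3 : l1.map (fun v => e v) = w.map fun p => -p.2 := by
    simpa [Function.comp_def] using congrArg (List.map Prod.snd) h1
  rw [h3, sum_map_neg_snd]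
  simp [hw]

lemma pairU_last {f : MvPolynomial V ℚ} {M : ℕ} (hf : ∀ d ∈ f.support, InWindow c M d)
    (w w' : List (Fin n × ℤ)) (hw : (w'.map Prod.snd).sum < -(M * w'.length : ℤ)) :
    pairU n c (frac c f) (word (w ++ w')) = 0 := by
  apply pairU_word_eq_zero
  intro l e hl hm hlw
  obtain ⟨l1, l2, rfl, -, h1⟩ := (List.map_eq_append_iff.mp (hlw.trans (by rw [List.map_append])))
  set A : Finset V := l2.toFinset with hA
  set wt : V → ℤ := fun v => if v ∈ A then -1 else 0 with hwt
  rw [List.nodup_append] at hl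
  have hl' : (l1 ++ l2).Nodup := List.nodup_append.mpr hl
  have h2 : ∀ v ∈ l1, wt v = 0 := fun v hv => by
    simp only [hwt, hA, List.mem_toFinset]
    rw [if_neg]; intro h; exact hl.2.2 v hv v h rfl
  have h1' : ∀ v ∈ l2, wt v = -1 := fun v hv => by simp [hwt, hA, hv]
  have hpw : (l1 ++ l2).Pairwise fun a b => wt b ≤ wt a := by
    rw [List.pairwise_append]
    refine ⟨List.pairwise_of_forall_mem_list ?_, List.pairwise_of_forall_mem_list ?_, ?_⟩
    · intro a ha b hb; rw [h2 a ha, h2 b hb]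
    · intro a ha b hb; rw [h1' a ha, h1' b hb]
    · intro a ha b hb; rw [h2 a ha, h1' b hb]; norm_num
  have hcard : A.card = w'.length := by
    rw [hA, List.toFinset_card_of_nodup hl.2.1]
    simpa using congrArg List.length h1
  have key : Ord wt (l1 ++ l2) (frac c f) (-(M * w'.length : ℤ)) := by
    have hp := ord_poly (wt := wt) hl' hm f
      (δ := -(M * w'.length : ℤ) - ((edges c).filter fun p => p.1 ∈ A ∨ p.2 ∈ A).card) (by
        intro d hd
        have := (hf d hd A).2
        simp only [hwt, ite_mul, neg_mul, one_mul, zero_mul, Finset.sum_ite_mem,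
          Finset.univ_inter, Finset.sum_neg_distrib]
        rw [hcard] at this
        have h5 : (∑ v ∈ A, (d v : ℤ)) ≤ M * w'.length +
          ((edges c).filter fun p => p.1 ∈ A ∨ p.2 ∈ A).card := by exact_mod_cast this
        linarith)
    refine (hp.prod_pole hl' hpw hm (edges c) fun p hp => edges_ne hp).mono ?_
    rw [Finset.card_filter]; push_cast
    rw [sub_sub, ← Finset.sum_add_distrib, Finset.sum_eq_zero, sub_zero]
    intro p _
    simp only [hwt]
    by_cases h3 : p.1 ∈ A <;> by_cases h4 : p.2 ∈ A <;> simp [h3, h4]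
  apply key
  rw [List.map_append, List.sum_append, List.map_congr_left (g := fun v => -e v) (l := l2)
    (fun v hv => by rw [h1' v hv, neg_one_mul]), List.map_congr_left (l := l1) (g := fun v => 0)
    (fun v hv => by rw [h2 v hv, zero_mul])]
  have h3 : l2.map (fun v => -e v) = w'.map Prod.snd := by
    have := congrArg (List.map fun p => -p.2) h1
    simpa [Function.comp_def] using this
  rw [h3]
  simpa using hw

lemma pairU_mul_first {f : MvPolynomial V ℚ} {M : ℕ} (hf : ∀ d ∈ f.support, InWindow c M d)
    {κ : Multiset ℕ} {s : ℤ} (hs : 0 < s) {a : FreeAlgebra ℚ (Fin n × ℤ)} (ha : a ∈ Hgr n κ s)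
    (b : FreeAlgebra ℚ (Fin n × ℤ)) : pairU n c (frac c f) (a * b) = 0 := by
  have hb : b ∈ Submodule.span ℚ (Set.range (word (X := Fin n × ℤ))) := span_word ▸ trivial
  have := Submodule.mul_mem_mul ha hb
  rw [Hgr, Submodule.span_mul_span] at this
  clear ha
  generalize a * b = y at this ⊢
  induction this using Submodule.span_induction with
  | mem y hy =>
    obtain ⟨_, ⟨w, rfl, -, rfl⟩, _, ⟨w', rfl⟩, rfl⟩ := hy
    simp only [← word_append]
    exact pairU_first hf w w' hs
  | zero => exact map_zero _
  | add a b _ _ ha hb => rw [map_add, ha, hb, add_zero]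
  | smul q a _ ha => rw [map_smul, ha, smul_zero]

lemma pairU_mul_last {f : MvPolynomial V ℚ} {M : ℕ} (hf : ∀ d ∈ f.support, InWindow c M d)
    {κ : Multiset ℕ} {s : ℤ} (hs : s < -(M * κ.card : ℤ)) {a : FreeAlgebra ℚ (Fin n × ℤ)}
    (ha : a ∈ Hgr n κ s) (b : FreeAlgebra ℚ (Fin n × ℤ)) :
    pairU n c (frac c f) (b * a) = 0 := by
  have hb : b ∈ Submodule.span ℚ (Set.range (word (X := Fin n × ℤ))) := span_word ▸ trivial
  have := Submodule.mul_mem_mul hb ha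
  rw [Hgr, Submodule.span_mul_span] at this
  clear ha
  generalize b * a = y at this ⊢
  induction this using Submodule.span_induction with
  | mem y hy =>
    obtain ⟨_, ⟨w', rfl⟩, _, ⟨w, rfl, rfl, rfl⟩, rfl⟩ := hy
    simp only [← word_append]
    exact pairU_last hf w' w (by simpa using hs)
  | zero => exact map_zero _
  | add a b _ _ ha hb => rw [map_add, ha, hb, add_zero]
  | smul q a _ ha => rw [map_smul, ha, smul_zero]

end Fr
end WordAction

/-! ### Faithfulness of the action and the classical vanishing theorem -/

section Faithful
set_option linter.unusedSectionVars false
attribute [local instance] LieRing.ofAssociativeRing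

namespace Fr
variable {V : Type*}

/-- Permutation of variables. -/
def ren (σ : Equiv.Perm V) : Fr V →+* Fr V :=
  IsFractionRing.lift (A := MvPolynomial V ℚ)
    (g := (algebraMap (MvPolynomial V ℚ) (Fr V)).comp (MvPolynomial.rename σ).toRingHom)
    (by
      rw [RingHom.coe_comp]
      exact (IsFractionRing.injective _ _).comp (MvPolynomial.rename_injective (R := ℚ) σ σ.injective))

lemma ren_algebraMap (σ : Equiv.Perm V) (f : MvPolynomial V ℚ) :
    ren σ (algebraMap _ (Fr V) f) = algebraMap _ (Fr V) (MvPolynomial.rename σ f) := by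
  simp [ren]

lemma ren_x (σ : Equiv.Perm V) (v : V) : ren σ (x v) = x (σ v) := by
  rw [x, ren_algebraMap, MvPolynomial.rename_X, x]

/-- Coefficientwise application of a homomorphism to a Laurent series. -/
def laurentMap {F G : Type*} [Field F] [Field G] (f : F →+* G) :
    LaurentSeries F →+* LaurentSeries G where
  toFun s := HahnSeries.map s f
  map_one' := HahnSeries.map_one (f.toMonoidWithZeroHom)
  map_zero' := by ext; simp
  map_add' s t := by ext; simp
  map_mul' s t := HahnSeries.map_mul (f.toNonUnitalRingHom)

lemma coeff_laurentMap {F G : Type*} [Field F] [Field G] (f : F →+* G) (s : LaurentSeries F)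
    (r : ℤ) : (laurentMap f s).coeff r = f (s.coeff r) := rfl

lemma ringHom_ext_x {R : Type*} [Field R] {f g : Fr V →+* R} (h : ∀ v, f (x v) = g (x v)) :
    f = g := by
  apply IsFractionRing.ringHom_ext (A := MvPolynomial V ℚ)
  intro p
  have : f.comp (algebraMap (MvPolynomial V ℚ) (Fr V)) =
      g.comp (algebraMap (MvPolynomial V ℚ) (Fr V)) := by
    apply MvPolynomial.ringHom_ext
    · intro q
      exact RingHom.congr_fun (Subsingleton.elim
        ((f.comp (algebraMap (MvPolynomial V ℚ) (Fr V))).comp MvPolynomial.C)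
        ((g.comp (algebraMap (MvPolynomial V ℚ) (Fr V))).comp MvPolynomial.C)) q
    · exact h
  exact RingHom.congr_fun this p

variable [DecidableEq V]

lemma γ_ren (σ : Equiv.Perm V) (v : V) (r : ℤ) (F : Fr V) :
    γ (σ v) r (ren σ F) = ren σ (γ v r F) := by
  have : (expand (σ v)).comp (ren σ) = (laurentMap (ren σ)).comp (expand v) := by
    apply ringHom_ext_x
    intro u
    simp only [RingHom.comp_apply, ren_x]
    by_cases h : u = v
    · subst h
      rw [expand_x_self, expand_x_self]
      ext k
      rw [coeff_laurentMap, HahnSeries.coeff_single]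
      split_ifs <;> simp
    · rw [expand_x _ _ (fun h' => h (σ.injective h')), expand_x _ _ h, ← ren_x]
      exact (HahnSeries.map_C (x u) (ren σ)).symm
  have h2 := congrArg (fun s => HahnSeries.coeff s r) (RingHom.congr_fun this F)
  exact h2

variable [Fintype V] {c : V → ℕ} {n : ℕ}

/-- Two families related by a permutation of the variables. -/
def Rel (σ : Equiv.Perm V) (G G' : Finset V → Fr V) : Prop :=
  ∀ S : Finset V, G' (S.map σ.toEmbedding) = ren σ (G S)

lemma Rel.colorOp {σ : Equiv.Perm V} (hσ : ∀ v, c (σ v) = c v) {G G' : Finset V → Fr V}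
    (h : Rel σ G G') (i : ℕ) (r : ℤ) : Rel σ (colorOp c i r G) (colorOp c i r G') := by
  intro S
  rw [colorOp_apply, colorOp_apply, map_sum, Finset.sum_filter, Finset.sum_filter, ← Equiv.sum_comp σ]
  refine Finset.sum_congr rfl fun v _ => ?_
  rw [hσ]
  have h1 : σ v ∈ S.map σ.toEmbedding ↔ v ∈ S := by simp
  have h2 : insert (σ v) (S.map σ.toEmbedding) = (insert v S).map σ.toEmbedding := by
    rw [Finset.map_insert]; rfl
  simp only [h1, h2, h _, γ_ren]
  split_ifs <;> simp

lemma Rel.act {σ : Equiv.Perm V} (hσ : ∀ v, c (σ v) = c v) {G G' : Finset V → Fr V}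
    (h : Rel σ G G') (w : List (Fin n × ℤ)) :
    Rel σ (actE c n (word w) G) (actE c n (word w) G') := by
  induction w generalizing G G' with
  | nil => rw [word_nil, actE_one]; exact h
  | cons p w ih =>
    rw [word_cons, actE_mul_apply, actE_mul_apply, actE_ι]
    exact ih (h.colorOp hσ _ _)

lemma actE_single_mem (S : Finset V) {F : Fr V} (hF : F ∈ RatAlg (fun _ _ => True) S)
    (w : List (Fin n × ℤ)) : ∃ q : ℚ, actE c n (word w) (Pi.single S F) ∅ = algebraMap ℚ (Fr V) q := by
  apply mem_RatAlg_empty (E := fun _ _ => True)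
  have : ∀ G : Finset V → Fr V, (∀ S, G S ∈ RatAlg (fun _ _ => True) S) →
      ∀ S, actE c n (word w) G S ∈ RatAlg (fun _ _ => True) S := by
    induction w with
    | nil => intro G hG; rw [word_nil, actE_one]; exact hG
    | cons p w ih =>
      intro G hG
      rw [word_cons, actE_mul_apply, actE_ι]
      apply ih
      intro S
      rw [colorOp_apply]
      refine sum_mem fun v _ => ?_
      split_ifs with h
      · exact zero_mem _
      · have := γ_mem_RatAlg v (hG (insert v S)) (-p.2)
        rwa [Finset.erase_insert h] at this
  refine this _ (fun T => ?_) ∅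
  by_cases h : T = S
  · subst h; rwa [Pi.single_eq_same]
  · rw [Pi.single_eq_of_ne h]; exact zero_mem _

lemma colorOp_single (S : Finset V) (F : Fr V) (i : ℕ) (r : ℤ) :
    colorOp c i r (Pi.single S F) =
      ∑ v ∈ S with c v = i, Pi.single (S.erase v) (γ v (-r) F) := by
  ext T
  rw [colorOp_apply, Finset.sum_apply, Finset.sum_filter, Finset.sum_filter,
    ← Finset.sum_subset (Finset.subset_univ S)]
  · refine Finset.sum_congr rfl fun v hv => ?_
    split_ifs with h h1
    · rw [Pi.single_eq_of_ne]; rintro rfl; simp at h1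
    · by_cases h2 : T = S.erase v
      · rw [h2, Pi.single_eq_same, Finset.insert_erase hv, Pi.single_eq_same]
      · rw [Pi.single_eq_of_ne h2, Pi.single_eq_of_ne, map_zero]
        rintro rfl; exact h2 (by rw [Finset.erase_insert h1])
    · rfl
  · intro v _ hv
    split_ifs with h h1
    · rfl
    · rw [Pi.single_eq_of_ne, map_zero]
      rintro rfl; simp at hv
    · rfl

lemma eq_zero_of_act (hc : ∀ v, c v < n) (S : Finset V) (F : Fr V)
    (hF : F ∈ RatAlg (fun _ _ => True) S)
    (hs : ∀ σ : Equiv.Perm V, (∀ v, c (σ v) = c v) → (∀ v ∉ S, σ v = v) → ren σ F = F)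
    (h : ∀ w : List (Fin n × ℤ), actE c n (word w) (Pi.single S F) ∅ = 0) : F = 0 := by
  induction hk : S.card generalizing S F with
  | zero =>
    rw [Finset.card_eq_zero] at hk; subst hk
    simpa [word_nil, actE_one] using h []
  | succ k ih =>
    obtain ⟨v, hv⟩ : S.Nonempty := by rw [← Finset.card_pos]; omega
    apply eq_zero_of_γ v
    intro r
    have hFv := γ_mem_RatAlg v hF r
    refine ih (S.erase v) (γ v r F) hFv ?_ ?_
      (by rw [Finset.card_erase_of_mem hv, hk]; rfl)
    · intro σ hσ hf
      have hσv : σ v = v := hf v (by simp)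
      rw [← γ_ren, hσv, hs σ hσ fun u hu => hf u fun h => hu (Finset.mem_of_mem_erase h)]
    · intro w
      have h1 := h ((⟨c v, hc v⟩, -r) :: w)
      rw [word_cons, actE_mul_apply, actE_ι, colorOp_single, map_sum, Finset.sum_apply] at h1
      simp only [neg_neg] at h1
      rw [Finset.sum_congr rfl (g := fun _ => actE c n (word w) (Pi.single (S.erase v) (γ v r F)) ∅),
        Finset.sum_const, smul_eq_zero] at h1
      · refine h1.resolve_left (Finset.card_ne_zero_of_mem (a := v) ?_)
        simp [hv]
      · intro u hu
        rw [Finset.mem_filter] at hu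
        have hσ : ∀ z, c (Equiv.swap v u z) = c z := fun z => by
          rcases eq_or_ne z v with rfl | h1
          · rw [Equiv.swap_apply_left, hu.2]
          rcases eq_or_ne z u with rfl | h2
          · rw [Equiv.swap_apply_right, hu.2]
          · rw [Equiv.swap_apply_of_ne_of_ne h1 h2]
        have hSF : ren (Equiv.swap v u) F = F := hs _ hσ fun z hz =>
          Equiv.swap_apply_of_ne_of_ne (by rintro rfl; exact hz hv) (by rintro rfl; exact hz hu.1)
        have hSS : (S.erase v).map (Equiv.swap v u).toEmbedding = S.erase u := by
          ext z
          simp only [Finset.mem_map_equiv, Finset.mem_erase, Equiv.symm_swap]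
          rcases eq_or_ne z v with rfl | h1
          · rw [Equiv.swap_apply_left]; simp [hu.1, hv, eq_comm]
          rcases eq_or_ne z u with rfl | h2
          · rw [Equiv.swap_apply_right]; simp
          · rw [Equiv.swap_apply_of_ne_of_ne h1 h2]; simp [h1, h2]
        have hrel : Rel (Equiv.swap v u) (Pi.single (S.erase v) (γ v r F))
            (Pi.single (S.erase u) (γ u r F)) := by
          intro T
          by_cases hT : T = S.erase v
          · rw [hT, hSS, Pi.single_eq_same, Pi.single_eq_same, ← γ_ren, hSF,
              Equiv.swap_apply_left]
          · rw [Pi.single_eq_of_ne hT, Pi.single_eq_of_ne, map_zero]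
            rw [← hSS]
            exact fun h => hT (Finset.map_injective _ h)
        have h2 := hrel.act (n := n) hσ w ∅
        rw [Finset.map_empty] at h2
        obtain ⟨q, hq⟩ := actE_single_mem (c := c) (n := n) (S.erase v) hFv w
        rw [h2, hq, eq_ratCast, map_ratCast]

end Fr
end Faithful

section Vanishing
set_option linter.unusedSectionVars false
attribute [local instance] LieRing.ofAssociativeRing

lemma sub_aeval_mem_span {σ R : Type*} [CommRing R] (θ : σ → MvPolynomial σ R)
    (f : MvPolynomial σ R) :
    f - MvPolynomial.aeval θ f ∈ Ideal.span (Set.range fun u => MvPolynomial.X u - θ u) := by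
  rw [← Ideal.Quotient.eq]
  set I := Ideal.span (Set.range fun u => MvPolynomial.X u - θ u)
  have : (Ideal.Quotient.mk I) = (Ideal.Quotient.mk I).comp (MvPolynomial.aeval θ).toRingHom := by
    apply MvPolynomial.ringHom_ext
    · intro r; simp
    · intro u
      simp only [RingHom.comp_apply, AlgHom.toRingHom_eq_coe, RingHom.coe_coe,
        MvPolynomial.aeval_X]
      rw [Ideal.Quotient.eq]
      exact Ideal.subset_span ⟨u, rfl⟩
  exact RingHom.congr_fun this f

namespace Fr
variable {V : Type*} [DecidableEq V] [Fintype V] {c : V → ℕ} {n : ℕ}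

/-- The substitution identifying all variables in `A` with `p`. -/
def glue (p : V) (A : Finset V) (u : V) : MvPolynomial V ℚ :=
  if u ∈ A then MvPolynomial.X p else MvPolynomial.X u

variable (c) in
/-- The wheel conditions at `v = 1`. -/
def Wheel (f : MvPolynomial V ℚ) : Prop :=
  (∀ w p q, p ≠ q → c p = c q → Adj c w p → ¬ (c w = 0 ∧ c p = 1) →
    MvPolynomial.aeval (glue p {w, q}) f = 0) ∧
  (∀ w p q u, p ≠ q → p ≠ u → q ≠ u → c w = 0 → c p = 1 → c q = 1 → c u = 1 →
    MvPolynomial.aeval (glue p {w, q, u}) f = 0)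

lemma poly_mem_RatAlg (E : V → V → Prop) (f : MvPolynomial V ℚ) :
    algebraMap _ (Fr V) f ∈ RatAlg E Finset.univ := by
  induction f using MvPolynomial.induction_on with
  | C q => rw [algebraMap_C]; exact Subalgebra.algebraMap_mem _ q
  | add f g hf hg => rw [map_add]; exact add_mem hf hg
  | mul_X f v hf => rw [map_mul]; exact mul_mem hf (x_mem_RatAlg (Finset.mem_univ v))

lemma prod_inv_mul_mem_RatAlg (E : V → V → Prop) (P : Finset (V × V)) (h : ∀ p ∈ P, p.1 ≠ p.2)
    (hE : ∀ p ∈ P, E p.1 p.2) (f : MvPolynomial V ℚ) :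
    (∏ p ∈ P, (x p.1 - x p.2))⁻¹ * algebraMap _ (Fr V) f ∈ RatAlg E Finset.univ := by
  refine mul_mem ?_ (poly_mem_RatAlg E f)
  rw [← Finset.prod_inv_distrib]
  exact prod_mem fun p hp => pole_mem_RatAlg (Finset.mem_univ _) (Finset.mem_univ _) (h p hp)
    (hE p hp)

lemma frac_mem_RatAlg (f : MvPolynomial V ℚ) : frac c f ∈ RatAlg (Adj c) Finset.univ :=
  prod_inv_mul_mem_RatAlg (Adj c) (edges c) (fun _ hp => edges_ne hp) (fun _ hp =>
    Or.inl (Finset.mem_filter.mp hp).2) f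

/-- Multiplication by `x a - x b` cancels the corresponding pole. -/
lemma frac_mul_sub_mem (f : MvPolynomial V ℚ) {a b : V} (_hab : a ≠ b) :
    frac c (f * (MvPolynomial.X a - MvPolynomial.X b)) ∈ RatAlg (AdjX c a b) Finset.univ := by
  by_cases h : (a, b) ∈ edges c ∨ (b, a) ∈ edges c
  · have key : ∀ a b : V, (a, b) ∈ edges c → ∀ f,
        frac c (f * (MvPolynomial.X a - MvPolynomial.X b)) ∈ RatAlg (AdjX c a b) Finset.univ := by
      intro a b hm f
      rw [frac_apply, den, ← Finset.prod_erase_mul _ _ hm, map_mul, map_sub]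
      have hne := x_sub_ne_zero (edges_ne hm)
      have : ((∏ p ∈ (edges c).erase (a, b), (x p.1 - x p.2)) * (x a - x b))⁻¹ *
          (algebraMap _ (Fr V) f * (x a - x b)) =
          (∏ p ∈ (edges c).erase (a, b), (x p.1 - x p.2))⁻¹ * algebraMap _ (Fr V) f := by
        rw [mul_inv, mul_assoc, mul_comm (algebraMap _ (Fr V) f), inv_mul_cancel_left₀ hne]
      refine this ▸ prod_inv_mul_mem_RatAlg _ _ (fun p hp => edges_ne (Finset.mem_of_mem_erase hp))
        (fun p hp => ?_) f
      have h1 := (Finset.mem_filter.mp (Finset.mem_of_mem_erase hp)).2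
      have h2 := (Finset.mem_filter.mp hm).2
      refine ⟨Or.inl h1, fun h => Finset.ne_of_mem_erase hp (Prod.ext h.1 h.2), fun h => ?_⟩
      rw [h.1, h.2] at h1; simp only at h2; omega
    rcases h with h | h
    · exact key a b h f
    · rw [AdjX_symm, ← neg_sub (MvPolynomial.X b), mul_neg, map_neg]
      exact neg_mem (key b a h f)
  · rw [not_or] at h
    refine prod_inv_mul_mem_RatAlg _ _ (fun _ hp => edges_ne hp) (fun p hp => ?_) _
    exact ⟨Or.inl (Finset.mem_filter.mp hp).2, fun h' => h.1 (by convert hp using 1; ext <;> simp [h']),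
      fun h' => h.2 (by convert hp using 1; ext <;> simp [h'])⟩

lemma frac_mem_Good {f : MvPolynomial V ℚ} (hf : Wheel c f) : frac c f ∈ Good c Finset.univ := by
  have key : ∀ (w p : V) (A : Finset V), w ∈ A → p ∉ A → (∀ q ∈ A, q ≠ w → c q = c p) → Adj c w p →
      MvPolynomial.aeval (glue p A) f = 0 → ∀ W : Submodule ℚ (Fr V),
      (∀ q, q = p ∨ q ∈ A ∧ q ≠ w → Subalgebra.toSubmodule (RatAlg (AdjX c w q) Finset.univ) ≤ W) →
      frac c f ∈ W := by
    intro w p A hw hpA hA hwp hf0 W hW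
    have hwp' : w ≠ p := fun h => by subst h; exact hpA hw
    have h1 := sub_aeval_mem_span (glue p A) f
    rw [hf0, sub_zero] at h1
    have h2 : ∀ q, q = p ∨ q ∈ A ∧ q ≠ w → ∀ g, frac c (g * (MvPolynomial.X w - MvPolynomial.X q)) ∈ W := by
      intro q hq g
      refine hW q hq (frac_mul_sub_mem g ?_)
      rcases hq with rfl | hq
      exacts [hwp', hq.2.symm]
    have h3 : ∀ u g, frac c (g * (MvPolynomial.X u - glue p A u)) ∈ W := by
      intro u g
      rw [glue]
      split_ifs with hu
      · by_cases huw : u = w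
        · subst huw; exact h2 p (Or.inl rfl) g
        · have : g * (MvPolynomial.X u - MvPolynomial.X p) =
            g * (MvPolynomial.X w - MvPolynomial.X p) - g * (MvPolynomial.X w - MvPolynomial.X u) := by
            ring
          rw [this, map_sub]
          exact sub_mem (h2 p (Or.inl rfl) g) (h2 u (Or.inr ⟨hu, huw⟩) g)
      · rw [sub_self, mul_zero, map_zero]; exact zero_mem _
    clear hf hf0
    have h4 : ∀ g, frac c (g * f) ∈ W := by
      induction h1 using Submodule.span_induction with
      | mem y hy => obtain ⟨u, rfl⟩ := hy; exact h3 u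
      | zero => intro g; rw [mul_zero, map_zero]; exact zero_mem _
      | add a b _ _ ha hb => intro g; rw [mul_add, map_add]; exact add_mem (ha g) (hb g)
      | smul r a _ ha => intro g; rw [smul_eq_mul, ← mul_assoc]; exact ha _
    simpa using h4 1
  refine ⟨frac_mem_RatAlg f, ?_, ?_, ?_⟩
  · intro p _ q _ hpq
    have := frac_mul_sub_mem (c := c) f hpq
    rw [frac_apply, map_mul, map_sub] at this
    have h2 : (x p - x q) * frac c f = (den c)⁻¹ * (algebraMap _ (Fr V) f * (x p - x q)) := by
      rw [frac_apply]; ring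
    exact h2 ▸ this
  · intro w _ p _ q _ hpq hc hwp h
    have hwp' : w ≠ p := by rintro rfl; rcases hwp with h | h <;> omega
    have hwq' : w ≠ q := by rintro rfl; rw [Adj] at hwp; omega
    refine key w p {w, q} (by simp) (by simp [hwp'.symm, hpq]) ?_ hwp (hf.1 w p q hpq hc hwp h) _ ?_
    · intro z hz hzw
      simp only [Finset.mem_insert, Finset.mem_singleton, hzw, false_or] at hz
      rw [hz, hc]
    · rintro z (rfl | hz)
      · exact le_sup_left
      · have : z = q := by simpa [hz.2] using hz.1
        rw [this]; exact le_sup_right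
  · intro w _ p _ q _ u _ hpq hpu hqu hw hp hq hu
    have hwp' : w ≠ p := by rintro rfl; omega
    refine key w p {w, q, u} (by simp) (by simp [hwp'.symm, hpq, hpu]) ?_ (Or.inl (by omega))
      (hf.2 w p q u hpq hpu hqu hw hp hq hu) _ ?_
    · intro z hz hzw
      simp only [Finset.mem_insert, Finset.mem_singleton, hzw, false_or] at hz
      rcases hz with rfl | rfl <;> omega
    · rintro z (rfl | hz)
      · exact le_sup_left.trans le_sup_left
      · have : z = q ∨ z = u := by simpa [hz.2] using hz.1
        rcases this with rfl | rfl
        · exact le_sup_right.trans le_sup_left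
        · exact le_sup_right

lemma ren_den {σ : Equiv.Perm V} (hσ : ∀ v, c (σ v) = c v) : ren σ (den c) = den c := by
  rw [den, map_prod]
  refine Finset.prod_bij' (fun p _ => (σ p.1, σ p.2)) (fun p _ => (σ.symm p.1, σ.symm p.2))
    ?_ ?_ ?_ ?_ ?_
  · intro p hp; simpa [edges, hσ] using hp
  · intro p hp
    have h : ∀ v, c (σ.symm v) = c v := fun v => by rw [← hσ, Equiv.apply_symm_apply]
    simpa [edges, h] using hp
  · intro p _; simp
  · intro p _; simp
  · intro p _; simp [ren_x]

lemma ren_frac {σ : Equiv.Perm V} (hσ : ∀ v, c (σ v) = c v) {f : MvPolynomial V ℚ}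
    (hf : MvPolynomial.rename σ f = f) : ren σ (frac c f) = frac c f := by
  rw [frac_apply, map_mul, map_inv₀, ren_den hσ, ren_algebraMap, hf]

end Fr

/-- The weight of a root. -/
def rtWeight {n : ℕ} (β : Rt n) : Multiset ℕ := (β.1.1 :: rtail β.1.1 β.1.2.2 β.1.2.1 : List ℕ)

/-- Multisets of root-mode pairs of given weight whose modes are bounded in terms of `M`. -/
def pbwSet (n : ℕ) (κ : Multiset ℕ) (M : ℕ) : Set (Multiset (Rt n × ℕ)) :=
  {b | (∀ p ∈ b, p.2 ≤ M * (rtWeight p.1).card) ∧ (b.map fun p => rtWeight p.1).sum = κ}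

lemma rtWeight_card_pos {n : ℕ} (β : Rt n) : 0 < (rtWeight β).card := by simp [rtWeight]

/-- Modes concentrated on the top letter. -/
def topMode {n : ℕ} (p : Rt n × ℤ) : ℕ → ℤ := Pi.single p.1.1.1 p.2

lemma mem_rtail {t c d a : ℕ} (h : a ∈ rtail t c d) : t < a ∧ a ≤ t + d := by
  induction d with
  | zero => simp [rtail] at h
  | succ d ih =>
    rw [rtail, List.mem_append] at h
    rcases h with h | h
    · have := ih h; omega
    · split_ifs at h <;> simp at h <;> omega

lemma modeSum_topMode {n : ℕ} (p : Rt n × ℤ) :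
    modeSum p.1.1.1 p.1.1.2.2 p.1.1.2.1 (topMode p) = p.2 := by
  rw [modeSum, List.map_cons, List.sum_cons, topMode, Pi.single_eq_same]
  rw [List.map_congr_left (g := fun _ => 0)]
  · simp
  · intro a ha
    rw [Pi.single_eq_of_ne]
    have := (mem_rtail ha).1; omega

/-- Comparison of slopes. -/
def slopeLe {n : ℕ} (p q : Rt n × ℤ) : Bool :=
  decide (q.2 * (rtWeight p.1).card ≤ p.2 * (rtWeight q.1).card)

def slopeSort {n : ℕ} (b : Multiset (Rt n × ℤ)) : List (Rt n × ℤ) := b.toList.mergeSort slopeLe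

lemma coe_slopeSort {n : ℕ} (b : Multiset (Rt n × ℤ)) : (slopeSort b : Multiset _) = b := by
  rw [slopeSort, Multiset.coe_eq_coe.mpr (List.mergeSort_perm _ _), Multiset.coe_toList]

lemma pairwise_slopeSort {n : ℕ} (b : Multiset (Rt n × ℤ)) :
    (slopeSort b).Pairwise fun p q : Rt n × ℤ =>
      q.2 * ((rtWeight p.1).card : ℤ) ≤ p.2 * ((rtWeight q.1).card : ℤ) := by
  have := List.pairwise_mergeSort (le := slopeLe (n := n)) ?_ ?_ b.toList
  · exact this.imp fun h => by simpa [slopeLe] using h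
  · intro p q r h1 h2
    simp only [slopeLe, decide_eq_true_eq] at h1 h2 ⊢
    have hp := rtWeight_card_pos p.1
    have hq := rtWeight_card_pos q.1
    have hr := rtWeight_card_pos r.1
    zify at hp hq hr
    refine le_of_mul_le_mul_right (a := ((rtWeight q.1).card : ℤ)) ?_ hq
    nlinarith
  · intro p q
    simp only [slopeLe, Bool.or_eq_true, decide_eq_true_eq]
    exact le_total _ _

/-- The PBW vector attached to a root and a mode. -/
def pbwVec {n : ℕ} (p : Rt n × ℤ) : FreeAlgebra ℚ (Fin n × ℤ) :=
  rootLnc (genF n ℤ) p.1.1.1 p.1.1.2.2 p.1.1.2.1 (topMode p)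

lemma pbwVec_mem_Hgr {n : ℕ} (p : Rt n × ℤ) : pbwVec p ∈ Hgr n (rtWeight p.1) p.2 := by
  have := rootLnc_mem_Hgr (n := n) p.1.1.1 p.1.1.2.2 p.1.1.2.1 (topMode p)
  rwa [modeSum_topMode] at this

lemma prod_pbwVec_mem_Hgr {n : ℕ} (L : List (Rt n × ℤ)) :
    (L.map pbwVec).prod ∈ Hgr n (L.map fun p => rtWeight p.1).sum (L.map Prod.snd).sum := by
  induction L with
  | nil => exact one_mem_Hgr
  | cons p L ih =>
    simp only [List.map_cons, List.prod_cons, List.sum_cons]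
    exact mul_mem_Hgr (pbwVec_mem_Hgr p) ih

namespace Fr
variable {V : Type*} [DecidableEq V] [Fintype V] {c : V → ℕ} {n : ℕ}

/-- Elements of the window satisfying the classical wheel conditions are determined by finitely many
linear functionals indexed by PBW monomials. -/
theorem exists_window_functionals (hc : ∀ v, c v < n) :
    ∃ Λ : Multiset (Rt n × ℕ) → MvPolynomial V ℚ →ₗ[ℚ] ℚ, ∀ (M : ℕ) (f : MvPolynomial V ℚ),
      (∀ σ : Equiv.Perm V, (∀ v, c (σ v) = c v) → MvPolynomial.rename σ f = f) → Wheel c f →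
      (∀ d ∈ f.support, InWindow c M d) →
      (∀ b ∈ pbwSet n (Finset.univ.val.map c) M, Λ b f = 0) → f = 0 := by
  obtain ⟨ψ, hψ⟩ := LinearMap.exists_leftInverse_of_injective (Algebra.linearMap ℚ (Fr V))
    (LinearMap.ker_eq_bot.mpr (algebraMap ℚ (Fr V)).injective)
  set neg : Rt n × ℕ → Rt n × ℤ := fun p => (p.1, -(p.2 : ℤ)) with hneg
  have hlin : ∀ a, ∃ T : MvPolynomial V ℚ →ₗ[ℚ] Fr V, ∀ f, T f = pairU n c (frac c f) a := by
    intro a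
    refine ⟨(LinearMap.proj (R := ℚ) (φ := fun _ : Finset V => Fr V) ∅).comp
      ((actE c n a).comp ((LinearMap.single ℚ (fun _ : Finset V => Fr V) Finset.univ).comp (frac c))),
      fun f => rfl⟩
  choose T hT using hlin
  refine ⟨fun b => ψ.comp (T ((slopeSort (b.map neg)).map pbwVec).prod), ?_⟩
  intro M f hsym hwh hwin hΛ
  have hgood : Pi.single Finset.univ (frac c f) ∈ GoodFam c := by
    rw [mem_GoodFam]
    intro S
    by_cases hS : S = Finset.univ
    · subst hS; rw [Pi.single_eq_same]; exact frac_mem_Good hwh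
    · rw [Pi.single_eq_of_ne hS]; exact zero_mem _
  have hpair : pairU n c (frac c f) = 0 := by
    refine pairing_eq_zero hc hgood topMode modeSum_topMode slopeSort coe_slopeSort fun b => ?_
    change pairU n c (frac c f) ((slopeSort b).map pbwVec).prod = 0
    have hmem : ∀ p, p ∈ slopeSort b ↔ p ∈ b := fun p => by
      rw [← Multiset.mem_coe, coe_slopeSort]
    have hpw := pairwise_slopeSort b
    by_cases h1 : ∃ p ∈ b, 0 < p.2
    · obtain ⟨p, hp, hp0⟩ := h1
      rw [← hmem] at hp
      rcases hL : slopeSort b with _ | ⟨q, L⟩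
      · rw [hL] at hp; simp at hp
      · rw [hL] at hp hpw
        have hq : 0 < q.2 := by
          rcases List.mem_cons.mp hp with rfl | hp
          · exact hp0
          · have := (List.pairwise_cons.mp hpw).1 p hp
            have h1 := rtWeight_card_pos p.1
            have h2 := rtWeight_card_pos q.1
            zify at h1 h2
            by_contra h3
            nlinarith
        rw [List.map_cons, List.prod_cons]
        exact pairU_mul_first hwin hq (pbwVec_mem_Hgr q) _
    push Not at h1
    by_cases h2 : ∃ p ∈ b, p.2 < -(M * (rtWeight p.1).card : ℤ)
    · obtain ⟨p, hp, hp0⟩ := h2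
      rw [← hmem] at hp
      rcases List.eq_nil_or_concat (slopeSort b) with hL | ⟨L, q, hL⟩
      · rw [hL] at hp; simp at hp
      · rw [List.concat_eq_append] at hL
        rw [hL] at hp hpw ⊢
        have hq : q.2 < -(M * (rtWeight q.1).card : ℤ) := by
          rcases List.mem_append.mp hp with hp | hp
          · have := (List.pairwise_append.mp hpw).2.2 p hp q (by simp)
            have h1 := rtWeight_card_pos p.1
            have h2 := rtWeight_card_pos q.1
            zify at h1 h2
            by_contra h3
            nlinarith
          · rw [List.mem_singleton.mp hp] at hp0; exact hp0
        rw [List.map_append, List.prod_append]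
        simpa using pairU_mul_last hwin hq (pbwVec_mem_Hgr q) ((L.map pbwVec).prod)
    push Not at h2
    by_cases h3 : (b.map fun p => rtWeight p.1).sum = Finset.univ.val.map c
    · set b' : Multiset (Rt n × ℕ) := b.map fun p => (p.1, (-p.2).toNat) with hb'
      have hbb : b'.map neg = b := by
        rw [hb', Multiset.map_map]
        conv_rhs => rw [← Multiset.map_id b]
        refine Multiset.map_congr rfl fun p hp => ?_
        have := h1 p hp
        simp only [Function.comp_apply, hneg, id]
        refine Prod.ext rfl ?_
        change -(((-p.2).toNat : ℕ) : ℤ) = p.2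
        omega
      have := hΛ b' ⟨?_, ?_⟩
      · simp only [LinearMap.comp_apply, hT, hbb] at this
        obtain ⟨q, hq⟩ := pairing_const hgood ((slopeSort b).map pbwVec).prod
        change ψ (pairing n c (Pi.single Finset.univ (frac c f)) _) = 0 at this
        change pairing n c (Pi.single Finset.univ (frac c f)) _ = 0
        rw [hq] at this ⊢
        have h5 := LinearMap.congr_fun hψ q
        simp only [LinearMap.comp_apply, Algebra.linearMap_apply, LinearMap.id_apply] at h5
        rw [h5] at this
        rw [this, map_zero]
      · intro p hp
        obtain ⟨q, hq, rfl⟩ := Multiset.mem_map.mp hp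
        have h4 := h2 q hq
        simp only
        zify
        rw [Int.toNat_of_nonneg (by linarith [h1 q hq])]
        linarith
      · rw [hb', Multiset.map_map]; exact h3
    · refine pairU_weight (prod_pbwVec_mem_Hgr (slopeSort b)) _ ?_
      rw [← Multiset.sum_coe, ← Multiset.map_coe, coe_slopeSort]
      exact h3
  have h0 : frac c f = 0 := by
    refine eq_zero_of_act hc Finset.univ (frac c f) ?_ ?_ ?_
    · exact RatAlg_mono (Finset.Subset.refl _) (fun _ _ _ _ _ => trivial) (frac_mem_RatAlg (c := c) f)
    · intro σ hσ _
      exact ren_frac hσ (hsym σ hσ)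
    · intro w
      exact LinearMap.congr_fun hpair (word w)
  rw [frac_apply, mul_eq_zero] at h0
  refine IsFractionRing.injective (MvPolynomial V ℚ) (Fr V) ?_
  rw [h0.resolve_left (inv_ne_zero den_ne_zero), map_zero]

end Fr
end Vanishing

/-! ### Symmetrization and the shuffle product -/

section Symmetrization
variable {n : ℕ}

lemma cf_eq {k : Fin n → ℕ} (a : KK) :
    (cf n a : Fk n k) = algebraMap (Pk n k) (Fk n k) (MvPolynomial.C a) := by
  rw [cf, IsScalarTower.algebraMap_apply KK (Pk n k) (Fk n k), MvPolynomial.algebraMap_eq]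

lemma smul_eq_cf {k : Fin n → ℕ} (a : KK) (F : Fk n k) : a • F = cf n a * F := by
  rw [cf, Algebra.smul_def]

@[simp] lemma liftHom_algebraMap {k m : Fin n → ℕ} (f : Vars n k → Vars n m)
    (hf : Function.Injective f) (p : Pk n k) :
    liftHom n f hf (algebraMap _ _ p) = algebraMap (Pk n m) (Fk n m) (MvPolynomial.rename f p) := by
  rw [liftHom, IsFractionRing.lift_algebraMap]; rfl

@[simp] lemma liftHom_xvr {k m : Fin n → ℕ} (f : Vars n k → Vars n m)
    (hf : Function.Injective f) (u : Vars n k) : liftHom n f hf (xvr n u) = xvr n (f u) := by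
  rw [xvr, liftHom_algebraMap, MvPolynomial.rename_X, xvr]

@[simp] lemma liftHom_cf {k m : Fin n → ℕ} (f : Vars n k → Vars n m)
    (hf : Function.Injective f) (a : KK) : liftHom n f hf (cf n a) = cf n a := by
  rw [cf_eq, liftHom_algebraMap, MvPolynomial.rename_C, cf_eq]

@[simp] lemma liftHom_smul {k m : Fin n → ℕ} (f : Vars n k → Vars n m)
    (hf : Function.Injective f) (a : KK) (F : Fk n k) :
    liftHom n f hf (a • F) = a • liftHom n f hf F := by
  rw [smul_eq_cf, smul_eq_cf, map_mul, liftHom_cf]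

lemma Fk_hom_ext {k : Fin n → ℕ} {R : Type*} [CommRing R] {φ ψ : Fk n k →+* R}
    (h1 : ∀ a, φ (cf n a) = ψ (cf n a)) (h2 : ∀ u, φ (xvr n u) = ψ (xvr n u)) : φ = ψ := by
  refine IsLocalization.ringHom_ext (nonZeroDivisors (Pk n k)) ?_
  refine MvPolynomial.ringHom_ext (fun a => ?_) fun u => ?_
  · have := h1 a
    rw [cf_eq] at this
    exact this
  · exact h2 u

/-- Families of colourwise permutations. -/
abbrev PermFam (m : Fin n → ℕ) : Type := ∀ i, Equiv.Perm (Fin (m i))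

lemma permF_permF {m : Fin n → ℕ} (σ τ : PermFam m) (F : Fk n m) :
    permF n σ (permF n τ F) = permF n (σ * τ) F := by
  have : (permF n σ).comp (permF n τ) = permF n (σ * τ) :=
    Fk_hom_ext (fun a => by simp [permF]) fun u => by simp [permF, permVf]
  exact RingHom.congr_fun this F

@[simp] lemma permF_xvr {m : Fin n → ℕ} (σ : PermFam m) (u : Vars n m) :
    permF n σ (xvr n u) = xvr n (permVf n σ u) := by rw [permF, liftHom_xvr]

@[simp] lemma permF_cf {m : Fin n → ℕ} (σ : PermFam m) (a : KK) :
    permF n σ (cf n a) = cf n a := by rw [permF, liftHom_cf]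

@[simp] lemma permF_smul {m : Fin n → ℕ} (σ : PermFam m) (a : KK) (F : Fk n m) :
    permF n σ (a • F) = a • permF n σ F := by rw [permF, liftHom_smul]

@[simp] lemma permF_algebraMap {m : Fin n → ℕ} (σ : PermFam m) (p : Pk n m) :
    permF n σ (algebraMap _ _ p) =
      algebraMap (Pk n m) (Fk n m) (MvPolynomial.rename (permVf n σ) p) := by
  rw [permF, liftHom_algebraMap]

/-- Symmetrization over variables of each colour. -/
def Sy {m : Fin n → ℕ} : Fk n m →ₗ[KK] Fk n m where
  toFun F := ∑ σ : PermFam m, permF n σ F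
  map_add' F G := by simp [Finset.sum_add_distrib]
  map_smul' a F := by simp [Finset.smul_sum]

lemma Sy_apply {m : Fin n → ℕ} (F : Fk n m) : Sy F = ∑ σ : PermFam m, permF n σ F := rfl

lemma permF_Sy {m : Fin n → ℕ} (τ : PermFam m) (F : Fk n m) : permF n τ (Sy F) = Sy F := by
  rw [Sy_apply, map_sum]
  simp_rw [permF_permF]
  exact Fintype.sum_equiv (Equiv.mulLeft τ) _ _ fun _ => rfl

lemma Sy_permF {m : Fin n → ℕ} (τ : PermFam m) (F : Fk n m) : Sy (permF n τ F) = Sy F := by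
  rw [Sy_apply, Sy_apply]
  simp_rw [permF_permF]
  exact Fintype.sum_equiv (Equiv.mulRight τ) _ _ fun _ => rfl

/-- Block sum of families of permutations. -/
def blockPerm {k l : Fin n → ℕ} (ρ : PermFam k) (ρ' : PermFam l) : PermFam (k + l) := fun i =>
  (finSumFinEquiv (m := k i) (n := l i)).permCongr (Equiv.sumCongr (ρ i) (ρ' i))

lemma emb1f_eq {k l : Fin n → ℕ} (i : Fin n) (r : Fin (k i)) :
    emb1f n k l ⟨i, r⟩ = ⟨i, finSumFinEquiv (m := k i) (n := l i) (Sum.inl r)⟩ := rfl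

lemma emb2f_eq {k l : Fin n → ℕ} (i : Fin n) (r : Fin (l i)) :
    emb2f n k l ⟨i, r⟩ = ⟨i, finSumFinEquiv (m := k i) (n := l i) (Sum.inr r)⟩ := rfl

lemma blockPerm_emb1 {k l : Fin n → ℕ} (ρ : PermFam k) (ρ' : PermFam l) (u : Vars n k) :
    permVf n (blockPerm ρ ρ') (emb1f n k l u) = emb1f n k l (permVf n ρ u) := by
  obtain ⟨i, r⟩ := u
  have : blockPerm ρ ρ' i (finSumFinEquiv (m := k i) (n := l i) (Sum.inl r)) =
    finSumFinEquiv (m := k i) (n := l i) (Sum.inl (ρ i r)) := by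
    rw [blockPerm, Equiv.permCongr_apply, Equiv.symm_apply_apply]; rfl
  exact congrArg (Sigma.mk i) this

lemma blockPerm_emb2 {k l : Fin n → ℕ} (ρ : PermFam k) (ρ' : PermFam l) (u : Vars n l) :
    permVf n (blockPerm ρ ρ') (emb2f n k l u) = emb2f n k l (permVf n ρ' u) := by
  obtain ⟨i, r⟩ := u
  have : blockPerm ρ ρ' i (finSumFinEquiv (m := k i) (n := l i) (Sum.inr r)) =
    finSumFinEquiv (m := k i) (n := l i) (Sum.inr (ρ' i r)) := by
    rw [blockPerm, Equiv.permCongr_apply, Equiv.symm_apply_apply]; rfl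
  exact congrArg (Sigma.mk i) this

/-- The factor `ζ(x_a / x_b)`. -/
def zt (A : ℕ → ℕ → ℤ) (Dd : ℕ → ℕ) {k : Fin n → ℕ} (a b : Vars n k) : Fk n k :=
  (xvr n a - cf n (vpow (-((Dd (a.1.1 + 1) : ℤ) * A (a.1.1 + 1) (b.1.1 + 1)))) * xvr n b) /
    (xvr n a - xvr n b)

variable (A : ℕ → ℕ → ℤ) (Dd : ℕ → ℕ)

lemma permF_zt {m : Fin n → ℕ} (σ : PermFam m) (a b : Vars n m) :
    permF n σ (zt A Dd a b) = zt A Dd (permVf n σ a) (permVf n σ b) := by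
  simp [zt, permVf]

lemma zfac_eq (k l : Fin n → ℕ) :
    zfac n A Dd k l = ∏ a : Vars n k, ∏ b : Vars n l, zt A Dd (emb1f n k l a) (emb2f n k l b) := by
  rw [zfac]
  simp_rw [Fintype.prod_sigma]
  refine Finset.prod_congr rfl fun i _ => ?_
  rw [Finset.prod_comm]
  rfl

/-- The bijection of variables induced by a family of permutations. -/
def permVE {m : Fin n → ℕ} (σ : PermFam m) : Equiv.Perm (Vars n m) := Equiv.sigmaCongrRight σ

lemma permVE_apply {m : Fin n → ℕ} (σ : PermFam m) (u : Vars n m) :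
    permVE σ u = permVf n σ u := rfl

lemma permF_block_zfac {k l : Fin n → ℕ} (ρ : PermFam k) (ρ' : PermFam l) :
    permF n (blockPerm ρ ρ') (zfac n A Dd k l) = zfac n A Dd k l := by
  rw [zfac_eq]
  simp_rw [map_prod, permF_zt, blockPerm_emb1, blockPerm_emb2]
  rw [← Equiv.prod_comp (permVE ρ)
    (fun a => ∏ b : Vars n l, zt A Dd (emb1f n k l a) (emb2f n k l b))]
  refine Finset.prod_congr rfl fun a _ => ?_
  rw [← Equiv.prod_comp (permVE ρ')
    (fun b => zt A Dd (emb1f n k l (permVE ρ a)) (emb2f n k l b))]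
  rfl

lemma permF_block_emb1 {k l : Fin n → ℕ} (ρ : PermFam k) (ρ' : PermFam l) (F : Fk n k) :
    permF n (blockPerm ρ ρ') (emb1 n k l F) = emb1 n k l (permF n ρ F) := by
  have : (permF n (blockPerm ρ ρ')).comp (emb1 n k l) = (emb1 n k l).comp (permF n ρ) :=
    Fk_hom_ext (fun a => by simp [emb1]) fun u => by simp [emb1, blockPerm_emb1]
  exact RingHom.congr_fun this F

lemma permF_block_emb2 {k l : Fin n → ℕ} (ρ : PermFam k) (ρ' : PermFam l) (F : Fk n l) :
    permF n (blockPerm ρ ρ') (emb2 n k l F) = emb2 n k l (permF n ρ' F) := by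
  have : (permF n (blockPerm ρ ρ')).comp (emb2 n k l) = (emb2 n k l).comp (permF n ρ') :=
    Fk_hom_ext (fun a => by simp [emb2]) fun u => by simp [emb2, blockPerm_emb2]
  exact RingHom.congr_fun this F

lemma card_PermFam (k : Fin n → ℕ) : Fintype.card (PermFam k) = ∏ i, (k i).factorial := by
  simp [PermFam, Fintype.card_pi, Fintype.card_perm]

/-- The shuffle product of symmetrizations is the symmetrization of the twisted product. -/
lemma shufMul_Sy {k l : Fin n → ℕ} (F : Fk n k) (G : Fk n l) :
    shufMul n A Dd k l (Sy F) (Sy G) = Sy (emb1 n k l F * emb2 n k l G * zfac n A Dd k l) := by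
  rw [shufMul]
  have h1 : emb1 n k l (Sy F) * emb2 n k l (Sy G) * zfac n A Dd k l =
      ∑ ρ : PermFam k, ∑ ρ' : PermFam l,
        permF n (blockPerm ρ ρ') (emb1 n k l F * emb2 n k l G * zfac n A Dd k l) := by
    simp_rw [map_mul, permF_block_zfac, permF_block_emb1, permF_block_emb2, ← Finset.sum_mul,
      ← Finset.mul_sum]
    rw [← Finset.sum_mul, Sy_apply, Sy_apply, map_sum, map_sum]
  change _ • Sy _ = _
  rw [h1, map_sum]
  simp_rw [map_sum, Sy_permF]
  rw [Finset.sum_const, Finset.sum_const, Finset.card_univ, Finset.card_univ, card_PermFam,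
    card_PermFam, smul_smul, ← Nat.cast_smul_eq_nsmul KK, smul_smul, inv_mul_cancel₀, one_smul]
  have h : ∀ m : Fin n → ℕ, ∏ i, (m i).factorial ≠ 0 := fun m =>
    Finset.prod_ne_zero_iff.mpr fun i _ => Nat.factorial_ne_zero _
  exact_mod_cast mul_ne_zero (h k) (h l)

open Classical in
lemma bstar_of {k l : Fin n → ℕ} (F : Fk n k) (G : Fk n l) :
    bstar n A Dd (DirectSum.of (fun k => Fk n k) k F) (DirectSum.of (fun k => Fk n k) l G) =
      DirectSum.of (fun k => Fk n k) (k + l) (shufMul n A Dd k l F G) := by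
  have h0 : ∀ G : Fk n l, shufMul n A Dd k l 0 G = 0 := fun G => by simp [shufMul]
  have h1 : ∀ F : Fk n k, shufMul n A Dd k l F 0 = 0 := fun G => by simp [shufMul]
  rw [bstar]
  erw [DFinsupp.sum_single_index, DFinsupp.sum_single_index]
  · rw [h1, map_zero]
  · rw [DFinsupp.sum]
    refine Finset.sum_eq_zero fun j _ => ?_
    have : ∀ G : Fk n j, shufMul n A Dd k j 0 G = 0 := fun G => by simp [shufMul]
    rw [this, map_zero]

end Symmetrization

/-! ### Words and their images in the shuffle algebra -/

section Words
variable {n : ℕ} (A : ℕ → ℕ → ℤ) (Dd : ℕ → ℕ)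

/-- The word spelled by a list in a free algebra over `R`. -/
def wd (R : Type*) [CommRing R] {X : Type*} (w : List X) : FreeAlgebra R X :=
  (w.map (FreeAlgebra.ι R)).prod

lemma wd_append (R : Type*) [CommRing R] {X : Type*} (w w' : List X) :
    wd R (w ++ w') = wd R w * wd R w' := by simp [wd]

lemma basisFreeMonoid_apply (R : Type*) [CommRing R] {X : Type*} (w : List X) :
    FreeAlgebra.basisFreeMonoid R X (FreeMonoid.ofList w) = wd R w := by
  rw [FreeAlgebra.basisFreeMonoid, Module.Basis.map_apply]
  change (FreeAlgebra.equivMonoidAlgebraFreeMonoid (R := R) (X := X)).symm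
    (MonoidAlgebra.single (FreeMonoid.ofList w) 1) = _
  rw [AlgEquiv.symm_apply_eq, wd, map_list_prod, List.map_map]
  induction w with
  | nil => simp [MonoidAlgebra.one_def]
  | cons a w ih =>
    rw [List.map_cons, List.prod_cons, ← ih]
    simp [FreeAlgebra.equivMonoidAlgebraFreeMonoid, MonoidAlgebra.single_mul_single,
      FreeMonoid.ofList_cons]

lemma span_wd (R : Type*) [CommRing R] {X : Type*} :
    Submodule.span R (Set.range (wd R (X := X))) = ⊤ := by
  rw [← (FreeAlgebra.basisFreeMonoid R X).span_eq]
  congr 1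
  ext a
  constructor
  · rintro ⟨w, rfl⟩; exact ⟨_, basisFreeMonoid_apply R w⟩
  · rintro ⟨w, rfl⟩; exact ⟨w.toList, (basisFreeMonoid_apply R w.toList).symm⟩

/-- The linear map out of the free algebra with prescribed values on words. -/
def onWords (R : Type*) [CommRing R] {X E : Type*} [AddCommGroup E] [Module R E]
    (f : List X → E) : FreeAlgebra R X →ₗ[R] E :=
  (FreeAlgebra.basisFreeMonoid R X).constr R fun w => f w.toList

lemma onWords_wd (R : Type*) [CommRing R] {X E : Type*} [AddCommGroup E] [Module R E]
    (f : List X → E) (w : List X) : onWords R f (wd R w) = f w := by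
  rw [onWords, ← basisFreeMonoid_apply, Module.Basis.constr_basis]; rfl

variable {k l : Fin n → ℕ}

/-- The product of the factors `ζ` over the pairs of entries of a list. -/
def ztL : List (Vars n k) → Fk n k
  | [] => 1
  | a :: L => (L.map (zt A Dd a)).prod * ztL L

lemma ztL_append (L L' : List (Vars n k)) :
    ztL A Dd (L ++ L') = ztL A Dd L * ztL A Dd L' *
      (L.map fun a => (L'.map (zt A Dd a)).prod).prod := by
  induction L with
  | nil => simp [ztL]
  | cons a L ih => simp only [List.cons_append, ztL, ih, List.map_append, List.prod_append,
      List.map_cons, List.prod_cons]; ring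

lemma permF_ztL (σ : PermFam k) (L : List (Vars n k)) :
    permF n σ (ztL A Dd L) = ztL A Dd (L.map (permVf n σ)) := by
  induction L with
  | nil => simp [ztL]
  | cons a L ih =>
    simp only [List.map_cons, ztL, map_mul, ih, map_list_prod, List.map_map]
    congr 2
    exact List.map_congr_left fun b _ => permF_zt A Dd σ a b

/-- The unsymmetrized image of a word. -/
def term (L : List (Vars n k)) (r : Vars n k → ℤ) : Fk n k :=
  (L.map fun u => xvr n u ^ r u).prod * ztL A Dd L

/-- The word spelled by a list of variables with modes. -/
def vword (L : List (Vars n k)) (r : Vars n k → ℤ) : List (Fin n × ℤ) := L.map fun u => (u.1, r u)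

lemma exists_permVf {L L' : List (Vars n k)} (hL : L.Nodup) (hL1 : ∀ u, u ∈ L)
    (hL' : L'.Nodup) (hL1' : ∀ u, u ∈ L') (h : L.map Sigma.fst = L'.map Sigma.fst) :
    ∃ σ : PermFam k, L.map (permVf n σ) = L' := by
  have hlen : L.length = L'.length := by simpa using congrArg List.length h
  set e1 := hL.getEquivOfForallMemList L hL1
  set e2 := hL'.getEquivOfForallMemList L' hL1'
  set π : Vars n k ≃ Vars n k := e1.symm.trans ((finCongr hlen).trans e2) with hπ
  have hπL : ∀ (i : ℕ) (hi : i < L.length), π L[i] = L'[i]'(hlen ▸ hi) := by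
    intro i hi
    have : e1 ⟨i, hi⟩ = L[i] := rfl
    rw [hπ, Equiv.trans_apply, ← this, Equiv.symm_apply_apply]; rfl
  have hcol : ∀ u, (π u).1 = u.1 := by
    intro u
    obtain ⟨i, hi, rfl⟩ := List.getElem_of_mem (hL1 u)
    rw [hπL i hi]
    have := List.getElem_of_eq h (i := i) (by simpa using hi)
    simpa using this.symm
  have hsec : ∀ (i : Fin n) (r : Fin (k i)), ∃ s : Fin (k i), π ⟨i, r⟩ = ⟨i, s⟩ := by
    intro i r
    have := hcol ⟨i, r⟩
    rcases h : π ⟨i, r⟩ with ⟨j, s⟩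
    rw [h] at this
    simp only at this
    subst this
    exact ⟨s, rfl⟩
  choose f hf using hsec
  have hinj : ∀ i, Function.Injective (f i) := by
    intro i r s hrs
    have : π ⟨i, r⟩ = π ⟨i, s⟩ := by rw [hf, hf, hrs]
    simpa using π.injective this
  refine ⟨fun i => Equiv.ofBijective (f i) ⟨hinj i, Finite.injective_iff_surjective.mp (hinj i)⟩, ?_⟩
  refine List.ext_getElem (by simpa using hlen) fun i h1 h2 => ?_
  rw [List.getElem_map, ← hπL i (by simpa using h1)]
  exact (hf _ _).symm

/-- The image of a word in the component of weight `k`. -/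
def wordImage (k : Fin n → ℕ) (w : List (Fin n × ℤ)) : Fk n k :=
  open Classical in
  if h : ∃ p : List (Vars n k) × (Vars n k → ℤ), p.1.Nodup ∧ (∀ u, u ∈ p.1) ∧ vword p.1 p.2 = w then
    Sy (term A Dd h.choose.1 h.choose.2) else 0

lemma permF_term (σ : PermFam k) (L : List (Vars n k)) (r : Vars n k → ℤ) :
    permF n σ (term A Dd L r) = term A Dd (L.map (permVf n σ)) fun u => r ((permVE σ).symm u) := by
  rw [term, map_mul, permF_ztL, term, map_list_prod, List.map_map, List.map_map]
  congr 2
  refine List.map_congr_left fun u _ => ?_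
  have : (permVE σ).symm (permVf n σ u) = u := (permVE σ).symm_apply_apply u
  simp [this]

lemma Sy_term_eq {L L' : List (Vars n k)} {r r' : Vars n k → ℤ} (hL : L.Nodup) (hL1 : ∀ u, u ∈ L)
    (hL' : L'.Nodup) (hL1' : ∀ u, u ∈ L') (h : vword L r = vword L' r') :
    Sy (term A Dd L r) = Sy (term A Dd L' r') := by
  obtain ⟨σ, rfl⟩ := exists_permVf hL hL1 hL' hL1'
    (by simpa [vword, Function.comp_def] using congrArg (List.map Prod.fst) h)
  have hr : (fun u => r ((permVE σ).symm u)) = r' := by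
    funext u
    obtain ⟨u, rfl⟩ := (permVE σ).surjective u
    rw [Equiv.symm_apply_apply]
    rw [vword, vword, List.map_map] at h
    have := List.map_inj_left.mp h u (hL1 u)
    exact congrArg Prod.snd this
  rw [← Sy_permF σ, permF_term, hr]

lemma wordImage_vword {L : List (Vars n k)} {r : Vars n k → ℤ} (hL : L.Nodup) (hL1 : ∀ u, u ∈ L) :
    wordImage A Dd k (vword L r) = Sy (term A Dd L r) := by
  have h : ∃ p : List (Vars n k) × (Vars n k → ℤ), p.1.Nodup ∧ (∀ u, u ∈ p.1) ∧
    vword p.1 p.2 = vword L r := ⟨(L, r), hL, hL1, rfl⟩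
  rw [wordImage, dif_pos h]
  exact Sy_term_eq A Dd h.choose_spec.1 h.choose_spec.2.1 hL hL1 h.choose_spec.2.2

/-- The weight of a word. -/
def wt (w : List (Fin n × ℤ)) : Fin n → ℕ := fun i => (w.map Prod.fst).count i

lemma count_fst {L : List (Vars n k)} (hL : L.Nodup) (hL1 : ∀ u, u ∈ L) (i : Fin n) :
    (L.map Sigma.fst).count i = k i := by
  have hp : L.Perm (Finset.univ : Finset (Vars n k)).toList :=
    (List.perm_ext_iff_of_nodup hL (Finset.nodup_toList _)).mpr fun u => by simp [hL1]
  rw [(hp.map Sigma.fst).count_eq, ← Multiset.coe_count, ← Multiset.map_coe, Finset.coe_toList,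
    Multiset.count_map]
  have : (Finset.univ : Finset (Vars n k)).val.filter (fun a => i = a.1) =
    (Finset.univ.map (Function.Embedding.sigmaMk i) : Finset (Vars n k)).val := by
    rw [← Finset.filter_val]
    congr 1
    ext ⟨j, s⟩
    simp only [Finset.mem_filter, Finset.mem_univ, true_and, Finset.mem_map,
      Function.Embedding.sigmaMk_apply]
    constructor
    · rintro rfl; exact ⟨s, rfl⟩
    · rintro ⟨s', h⟩; exact (congrArg Sigma.fst h :)
  rw [this, Finset.card_val]
  simp

lemma exists_enum (cs : List (Fin n)) (hcs : ∀ i, cs.count i = k i) :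
    ∃ L : List (Vars n k), L.Nodup ∧ (∀ u, u ∈ L) ∧ L.map Sigma.fst = cs := by
  have h1 : cs.Perm ((Finset.univ : Finset (Vars n k)).toList.map Sigma.fst) := by
    rw [List.perm_iff_count]
    intro i
    rw [hcs, count_fst (Finset.nodup_toList _) (by simp)]
  have h2 := congrFun (congrFun (List.eq_map_comp_perm (Sigma.fst : Vars n k → Fin n)) cs)
    (Finset.univ : Finset (Vars n k)).toList
  rw [← h2] at h1
  obtain ⟨L, h3, h4⟩ := h1
  exact ⟨L, h4.nodup_iff.mpr (Finset.nodup_toList _), fun u => h4.mem_iff.mpr (by simp), h3.symm⟩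

lemma exists_map_eq {α β : Type*} [Inhabited β] [DecidableEq α] {L : List α} (hL : L.Nodup)
    {rs : List β} (h : rs.length = L.length) : ∃ r : α → β, L.map r = rs := by
  refine ⟨fun a => rs.getD (L.idxOf a) default, List.ext_getElem (by simp [h]) fun i h1 h2 => ?_⟩
  simp [hL.idxOf_getElem, h2]

lemma exists_vword (w : List (Fin n × ℤ)) (hw : wt w = k) :
    ∃ (L : List (Vars n k)) (r : Vars n k → ℤ), L.Nodup ∧ (∀ u, u ∈ L) ∧ vword L r = w := by
  obtain ⟨L, h1, h2, h3⟩ := exists_enum (k := k) (w.map Prod.fst) fun i => congrFun hw i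
  obtain ⟨r, hr⟩ := exists_map_eq h1 (rs := w.map Prod.snd)
    (by simpa using (congrArg List.length h3).symm)
  refine ⟨L, r, h1, h2, ?_⟩
  rw [vword, ← List.zip_map', h3, hr, List.zip_map']
  simp

lemma wt_vword {L : List (Vars n k)} (hL : L.Nodup) (hL1 : ∀ u, u ∈ L) (r : Vars n k → ℤ) :
    wt (vword L r) = k := by
  funext i
  rw [wt, vword, List.map_map]
  exact count_fst hL hL1 i

/-- The map from the free algebra to the shuffle algebra. -/
def freeImage : FA n →ₗ[KK] BigS n :=
  onWords KK fun w => DirectSum.of (fun k => Fk n k) (wt w) (wordImage A Dd (wt w) w)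

lemma freeImage_vword {L : List (Vars n k)} {r : Vars n k → ℤ} (hL : L.Nodup) (hL1 : ∀ u, u ∈ L) :
    freeImage A Dd (wd KK (vword L r)) = DirectSum.of (fun k => Fk n k) k (Sy (term A Dd L r)) := by
  rw [freeImage, onWords_wd, ← wordImage_vword A Dd hL hL1]
  have := wt_vword hL hL1 r
  generalize vword L r = w at this
  subst this
  rfl

end Words

/-! ### Representations of elements of the free algebra by rational functions -/

section Representations
variable {n : ℕ} (A : ℕ → ℕ → ℤ) (Dd : ℕ → ℕ) {k l : Fin n → ℕ}

/-- Pairs of a rational function and an element of the free algebra it represents, with variables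
in `S`. -/
def ShufRep (S : Finset (Vars n k)) : Submodule KK (Fk n k × FA n) :=
  Submodule.span KK {p | ∃ (L : List (Vars n k)) (r : Vars n k → ℤ), L.Nodup ∧ L.toFinset = S ∧
    p = (term A Dd L r, wd KK (vword L r))}

variable {A Dd}

lemma rep_term {L : List (Vars n k)} (hL : L.Nodup) (r : Vars n k → ℤ) :
    (term A Dd L r, wd KK (vword L r)) ∈ ShufRep A Dd L.toFinset :=
  Submodule.subset_span ⟨L, r, hL, rfl, rfl⟩

lemma term_congr {L : List (Vars n k)} {r r' : Vars n k → ℤ} (h : ∀ u ∈ L, r u = r' u) :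
    term A Dd L r = term A Dd L r' := by
  rw [term, term, List.map_congr_left fun u hu => by rw [h u hu]]

lemma vword_congr {L : List (Vars n k)} {r r' : Vars n k → ℤ} (h : ∀ u ∈ L, r u = r' u) :
    vword L r = vword L r' := List.map_congr_left fun u hu => by rw [h u hu]

lemma rep_mul {S S' : Finset (Vars n k)} (hSS : Disjoint S S') {t t' : Fk n k} {X X' : FA n}
    (h : (t, X) ∈ ShufRep A Dd S) (h' : (t', X') ∈ ShufRep A Dd S') :
    (t * t' * ∏ a ∈ S, ∏ b ∈ S', zt A Dd a b, X * X') ∈ ShufRep A Dd (S ∪ S') := by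
  set z := ∏ a ∈ S, ∏ b ∈ S', zt A Dd a b with hz
  suffices H : ∀ p ∈ ShufRep A Dd S, ∀ p' ∈ ShufRep A Dd S',
      (p.1 * p'.1 * z, p.2 * p'.2) ∈ ShufRep A Dd (S ∪ S') from H _ h _ h'
  intro p hp p' hp'
  induction hp using Submodule.span_induction with
  | zero => simpa only [Prod.fst_zero, Prod.snd_zero, zero_mul, mul_zero, Prod.mk_zero_zero] using
      (ShufRep A Dd (S ∪ S')).zero_mem
  | add p q _ _ hp hq => simpa [add_mul] using add_mem hp hq
  | smul c p _ hp => simpa [Algebra.smul_mul_assoc] using Submodule.smul_mem _ c hp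
  | mem p hp =>
    induction hp' using Submodule.span_induction with
    | zero => simpa only [Prod.fst_zero, Prod.snd_zero, zero_mul, mul_zero, Prod.mk_zero_zero] using
      (ShufRep A Dd (S ∪ S')).zero_mem
    | add p q _ _ hp hq => simpa [add_mul, mul_add] using add_mem hp hq
    | smul c p _ hp => simpa [Algebra.smul_mul_assoc] using Submodule.smul_mem _ c hp
    | mem p' hp' =>
      obtain ⟨L, r, hL, hLS, rfl⟩ := hp
      obtain ⟨L', r', hL', hLS', rfl⟩ := hp'
      subst hLS hLS'
      set r'' : Vars n k → ℤ := fun u => if u ∈ L then r u else r' u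
      have h1 : ∀ u ∈ L, r u = r'' u := fun u hu => by simp [r'', hu]
      have hd : List.Disjoint L L' := fun u hu hu' =>
        Finset.disjoint_left.mp hSS (List.mem_toFinset.mpr hu) (List.mem_toFinset.mpr hu')
      have h2 : ∀ u ∈ L', r' u = r'' u := fun u hu => by
        have : u ∉ L := fun h => hd h hu
        simp [r'', this]
      simp only
      rw [term_congr h1, term_congr h2, vword_congr h1, vword_congr h2, ← wd_append]
      have h3 : vword L r'' ++ vword L' r'' = vword (L ++ L') r'' := by simp [vword]
      have h4 : term A Dd L r'' * term A Dd L' r'' * z = term A Dd (L ++ L') r'' := by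
        rw [term, term, term, ztL_append, List.map_append, List.prod_append, hz,
          List.prod_toFinset _ hL]
        simp_rw [List.prod_toFinset _ hL']
        ring
      rw [h3, h4, ← List.toFinset_append]
      exact rep_term (List.nodup_append'.mpr ⟨hL, hL', hd⟩) r''

lemma rep_var (u : Vars n k) (r : ℤ) : (xvr n u ^ r, fg n u.1 r) ∈ ShufRep A Dd {u} := by
  have := rep_term (A := A) (Dd := Dd) (List.nodup_singleton u) fun _ => r
  simpa [term, ztL, vword, wd, fg] using this

lemma rep_induction {E : Type*} [AddCommGroup E] [Module KK E] {S : Finset (Vars n k)}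
    (f : FA n →ₗ[KK] E) (g : Fk n k →ₗ[KK] E)
    (H : ∀ (L : List (Vars n k)) (r : Vars n k → ℤ), L.Nodup → L.toFinset = S →
      f (wd KK (vword L r)) = g (term A Dd L r))
    {t : Fk n k} {X : FA n} (h : (t, X) ∈ ShufRep A Dd S) : f X = g t := by
  suffices H : ∀ p ∈ ShufRep A Dd S, f p.2 = g p.1 from H _ h
  intro p hp
  induction hp using Submodule.span_induction with
  | zero => simp only [Prod.fst_zero, Prod.snd_zero, map_zero]
  | add p q _ _ hp hq => simp only [Prod.fst_add, Prod.snd_add, map_add, hp, hq]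
  | smul c p _ hp => simp only [Prod.smul_fst, Prod.smul_snd, map_smul, hp]
  | mem p hp =>
    obtain ⟨L, r, hL, hLS, rfl⟩ := hp
    exact H L r hL hLS

lemma freeImage_of_rep {t : Fk n k} {X : FA n} (h : (t, X) ∈ ShufRep A Dd Finset.univ) :
    freeImage A Dd X = DirectSum.of (fun k => Fk n k) k (Sy t) := by
  refine rep_induction (freeImage A Dd) ((DirectSum.lof KK _ (fun k => Fk n k) k).comp Sy) ?_ h
  intro L r hL hLS
  exact freeImage_vword A Dd hL fun u => by
    rw [← List.mem_toFinset, hLS]; exact Finset.mem_univ u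

/-! ### The map is multiplicative -/

section Bilinear
open Classical

lemma shufMul_add_left (F F' : Fk n k) (G : Fk n l) :
    shufMul n A Dd k l (F + F') G = shufMul n A Dd k l F G + shufMul n A Dd k l F' G := by
  simp only [shufMul, map_add, add_mul, Finset.sum_add_distrib, smul_add]

lemma shufMul_add_right (F : Fk n k) (G G' : Fk n l) :
    shufMul n A Dd k l F (G + G') = shufMul n A Dd k l F G + shufMul n A Dd k l F G' := by
  simp only [shufMul, map_add, add_mul, mul_add, Finset.sum_add_distrib, smul_add]

lemma shufMul_smul_left (c : KK) (F : Fk n k) (G : Fk n l) :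
    shufMul n A Dd k l (c • F) G = c • shufMul n A Dd k l F G := by
  simp only [shufMul, emb1, liftHom_smul, smul_mul_assoc, permF_smul, ← Finset.smul_sum]
  rw [smul_comm]

lemma shufMul_smul_right (c : KK) (F : Fk n k) (G : Fk n l) :
    shufMul n A Dd k l F (c • G) = c • shufMul n A Dd k l F G := by
  simp only [shufMul, emb2, liftHom_smul, mul_smul_comm, smul_mul_assoc, permF_smul,
    ← Finset.smul_sum]
  rw [smul_comm]

/-- The shuffle product of homogeneous components as a bilinear map. -/
def shufBilinHom (A : ℕ → ℕ → ℤ) (Dd : ℕ → ℕ) (k l : Fin n → ℕ) :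
    Fk n k →ₗ[KK] Fk n l →ₗ[KK] BigS n :=
  LinearMap.mk₂ KK (fun F G => DirectSum.lof KK _ (fun k => Fk n k) (k + l)
      (shufMul n A Dd k l F G))
    (fun F F' G => by rw [shufMul_add_left, map_add])
    (fun c F G => by rw [shufMul_smul_left, map_smul])
    (fun F G G' => by rw [shufMul_add_right, map_add])
    (fun c F G => by rw [shufMul_smul_right, map_smul])

/-- The shuffle product as a bilinear map. -/
def shufBilin (A : ℕ → ℕ → ℤ) (Dd : ℕ → ℕ) : BigS n →ₗ[KK] BigS n →ₗ[KK] BigS n :=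
  DirectSum.toModule KK _ _ fun k => LinearMap.flip (DirectSum.toModule KK _ _ fun l =>
    LinearMap.flip (shufBilinHom A Dd k l))

lemma shufBilin_of (F : Fk n k) (G : Fk n l) :
    shufBilin A Dd (DirectSum.of (fun k => Fk n k) k F) (DirectSum.of (fun k => Fk n k) l G) =
      DirectSum.of (fun k => Fk n k) (k + l) (shufMul n A Dd k l F G) := by
  rw [← DirectSum.lof_eq_of KK, ← DirectSum.lof_eq_of KK, ← DirectSum.lof_eq_of KK, shufBilin,
    DirectSum.toModule_lof, LinearMap.flip_apply, DirectSum.toModule_lof]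
  rfl

lemma shufBilin_apply (x y : BigS n) : shufBilin A Dd x y = bstar n A Dd x y := by
  have hx : x = DFinsupp.sum x fun k xk => DirectSum.of (fun k => Fk n k) k xk :=
    (DFinsupp.sum_single (f := x)).symm
  have hy : y = DFinsupp.sum y fun k xk => DirectSum.of (fun k => Fk n k) k xk :=
    (DFinsupp.sum_single (f := y)).symm
  conv_lhs => rw [hx, hy]
  rw [bstar]
  simp only [DFinsupp.sum, map_sum, LinearMap.sum_apply, shufBilin_of]
  rw [Finset.sum_comm]

end Bilinear

lemma emb1f_ne_emb2f (u : Vars n k) (v : Vars n l) : emb1f n k l u ≠ emb2f n k l v := by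
  rcases u with ⟨i, r⟩
  rcases v with ⟨j, s⟩
  intro h
  obtain rfl : i = j := congrArg Sigma.fst h
  have := congrArg (fun u => u.2.1) h
  simp only [emb1f, emb2f] at this
  have := r.2
  omega

lemma mem_range_emb (u : Vars n (k + l)) :
    (∃ a, emb1f n k l a = u) ∨ ∃ b, emb2f n k l b = u := by
  obtain ⟨i, s⟩ := u
  obtain ⟨x, hx⟩ := (finSumFinEquiv (m := k i) (n := l i)).surjective s
  rcases x with a | b
  · exact Or.inl ⟨⟨i, a⟩, by rw [emb1f_eq, hx]⟩
  · exact Or.inr ⟨⟨i, b⟩, by rw [emb2f_eq, hx]⟩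

lemma liftHom_ztL {m : Fin n → ℕ} (f : Vars n k → Vars n m) (hf : Function.Injective f)
    (hc : ∀ u, (f u).1 = u.1) (L : List (Vars n k)) :
    liftHom n f hf (ztL A Dd L) = ztL A Dd (L.map f) := by
  induction L with
  | nil => simp [ztL]
  | cons a L ih =>
    simp only [List.map_cons, ztL, map_mul, ih, map_list_prod, List.map_map]
    congr 2
    exact List.map_congr_left fun b _ => by simp [zt, hc]

theorem freeImage_mul (X Y : FA n) :
    freeImage A Dd (X * Y) = bstar n A Dd (freeImage A Dd X) (freeImage A Dd Y) := by
  rw [← shufBilin_apply]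
  have hX : X ∈ Submodule.span KK (Set.range (wd KK (X := Fin n × ℤ))) := by
    rw [span_wd]; trivial
  have hY : Y ∈ Submodule.span KK (Set.range (wd KK (X := Fin n × ℤ))) := by
    rw [span_wd]; trivial
  induction hX using Submodule.span_induction with
  | zero => simp
  | add x y _ _ hx hy => simp [add_mul, hx, hy]
  | smul c x _ hx => simp [hx]
  | mem x hx =>
    induction hY using Submodule.span_induction with
    | zero => simp
    | add x y _ _ hx hy => simp [mul_add, hx, hy]
    | smul c x _ hx => simp [hx]
    | mem y hy =>
      obtain ⟨w, rfl⟩ := hx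
      obtain ⟨w', rfl⟩ := hy
      obtain ⟨k, hk⟩ : ∃ k, wt w = k := ⟨_, rfl⟩
      obtain ⟨l, hl⟩ : ∃ l, wt w' = l := ⟨_, rfl⟩
      obtain ⟨L, r, hL, hL1, rfl⟩ := exists_vword w hk
      obtain ⟨L', r', hL', hL1', rfl⟩ := exists_vword w' hl
      rw [freeImage_vword A Dd hL hL1, freeImage_vword A Dd hL' hL1', shufBilin_of, shufMul_Sy,
        ← wd_append]
      set r'' : Vars n (k + l) → ℤ :=
        Function.extend (emb1f n k l) r (Function.extend (emb2f n k l) r' 0) with hr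
      have e1 : ∀ u, r'' (emb1f n k l u) = r u := fun u => by
        rw [hr, (emb1f_inj n k l).extend_apply]
      have e2 : ∀ u, r'' (emb2f n k l u) = r' u := fun u => by
        rw [hr, Function.extend_apply', (emb2f_inj n k l).extend_apply]
        rintro ⟨a, ha⟩
        exact emb1f_ne_emb2f _ _ ha
      set L'' := L.map (emb1f n k l) ++ L'.map (emb2f n k l) with hL''
      have h1 : vword L r ++ vword L' r' = vword L'' r'' := by
        simp only [vword, hL'', List.map_append, List.map_map]
        congr 1
        · exact List.map_congr_left fun u _ => by simp only [Function.comp_apply, e1]; rfl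
        · exact List.map_congr_left fun u _ => by simp only [Function.comp_apply, e2]; rfl
      have h2 : term A Dd L'' r'' = emb1 n k l (term A Dd L r) * emb2 n k l (term A Dd L' r') *
          zfac n A Dd k l := by
        rw [term, term, term, hL'', ztL_append, emb1, emb2, map_mul, map_mul,
          liftHom_ztL _ (emb1f_inj n k l) (fun _ => rfl),
          liftHom_ztL _ (emb2f_inj n k l) (fun _ => rfl), zfac_eq,
          List.map_append, List.prod_append]
        have h3 : L.toFinset = Finset.univ := by ext u; simp [hL1]
        have h4 : L'.toFinset = Finset.univ := by ext u; simp [hL1']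
        rw [← h3, List.prod_toFinset _ hL, ← h4]
        simp_rw [List.prod_toFinset _ hL']
        simp only [List.map_map, Function.comp_def, e1, e2, map_list_prod, map_zpow₀, liftHom_xvr]
        ring
      rw [h1, freeImage_vword, h2]
      · rw [hL'', List.nodup_append']
        refine ⟨hL.map (emb1f_inj n k l), hL'.map (emb2f_inj n k l), ?_⟩
        intro u hu hu'
        obtain ⟨a, _, rfl⟩ := List.mem_map.mp hu
        obtain ⟨b, _, h⟩ := List.mem_map.mp hu'
        exact emb1f_ne_emb2f _ _ h.symm
      · intro u
        rw [hL'', List.mem_append]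
        rcases mem_range_emb u with ⟨a, rfl⟩ | ⟨b, rfl⟩
        · exact Or.inl (List.mem_map_of_mem (hL1 a))
        · exact Or.inr (List.mem_map_of_mem (hL1' b))

lemma freeImage_one : freeImage A Dd (1 : FA n) = DirectSum.of (fun k => Fk n k) 0 1 := by
  have h := freeImage_vword A Dd (k := (0 : Fin n → ℕ)) (L := []) (r := 0) List.nodup_nil
    (fun u => Fin.elim0 u.2)
  have h1 : wd KK (vword ([] : List (Vars n (0 : Fin n → ℕ))) 0) = 1 := rfl
  rw [h1] at h
  rw [h]
  congr 1
  rw [Sy_apply]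
  have : Fintype.card (PermFam (0 : Fin n → ℕ)) = 1 := by simp
  simp [term, ztL, this]

lemma freeImage_gen (i : Fin n) (r : ℤ) :
    freeImage A Dd (fg n i r) = DirectSum.of (fun k => Fk n k) (unitVec i)
      (xvr n (⟨i, ⟨0, by simp [unitVec]⟩⟩ : Vars n (unitVec i)) ^ r) := by
  set u : Vars n (unitVec i) := ⟨i, ⟨0, by simp [unitVec]⟩⟩
  have h1 : ∀ v : Vars n (unitVec i), v = u := by
    rintro ⟨j, s, hs⟩
    have : j = i := by by_contra h; simp [unitVec, h] at hs
    subst this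
    simp only [unitVec, if_true] at hs
    have : s = 0 := by omega
    subst this
    rfl
  have h2 := rep_var (A := A) (Dd := Dd) u r
  have h3 : ({u} : Finset (Vars n (unitVec i))) = Finset.univ := by ext v; simp [h1 v]
  rw [h3] at h2
  rw [freeImage_of_rep h2]
  congr 1
  rw [Sy_apply]
  have : Fintype.card (PermFam (unitVec i)) = 1 := by
    rw [card_PermFam]
    refine Finset.prod_eq_one fun j _ => ?_
    unfold unitVec; split_ifs <;> rfl
  have h4 : ∀ σ : PermFam (unitVec i), permF n σ (xvr n u ^ r) = xvr n u ^ r := fun σ => by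
    rw [map_zpow₀, permF_xvr, h1 (permVf n σ u)]
  simp [h4, this]

end Representations

/-! ### The Serre identities for the factors `ζ` -/

section SerreIdentities
variable {K : Type*} [Field K]

lemma serre_identity_two {u x y w : K} (hu : u ≠ 0)
    (f : K → K → K → K) (hf : ∀ p a b, f p a b = (a - p * b) / (a - b)) (g : K → K → K)
    (hg : ∀ x y, g x y = f (u⁻¹ ^ 2) x y * (f u w x * f u w y - (u + u⁻¹) * (f u x w * f u w y)
      + f u x w * f u y w)) : g x y + g y x = 0 := by
  have e : ∀ a b : K, (b - a)⁻¹ = -(a - b)⁻¹ := fun a b => by rw [← neg_sub, inv_neg]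
  simp only [hg, hf, div_eq_mul_inv]
  rw [e x y, e x w, e y w]
  generalize (x - y)⁻¹ = i1
  generalize (x - w)⁻¹ = i2
  generalize (y - w)⁻¹ = i3
  field_simp [hu]
  ring

lemma serre_identity_three {u x y z w : K} (hu : u ≠ 0)
    (f : K → K → K → K) (hf : ∀ p a b, f p a b = (a - p * b) / (a - b)) (g : K → K → K → K)
    (hg : ∀ x y z, g x y z = f (u⁻¹ ^ 2) x y * f (u⁻¹ ^ 2) x z * f (u⁻¹ ^ 2) y z *
      (f (u ^ 2) w x * f (u ^ 2) w y * f (u ^ 2) w z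
      - (u ^ 2 + 1 + u⁻¹ ^ 2) * (f (u ^ 2) x w * f (u ^ 2) w y * f (u ^ 2) w z)
      + (u ^ 2 + 1 + u⁻¹ ^ 2) * (f (u ^ 2) x w * f (u ^ 2) y w * f (u ^ 2) w z)
      - f (u ^ 2) x w * f (u ^ 2) y w * f (u ^ 2) z w)) :
    g x y z + g y x z + g z y x + g x z y + g y z x + g z x y = 0 := by
  have e : ∀ a b : K, (b - a)⁻¹ = -(a - b)⁻¹ := fun a b => by rw [← neg_sub, inv_neg]
  simp only [hg, hf, div_eq_mul_inv]
  rw [e x y, e x z, e y z, e x w, e y w, e z w]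
  generalize (x - y)⁻¹ = i1
  generalize (x - z)⁻¹ = i2
  generalize (y - z)⁻¹ = i3
  generalize (x - w)⁻¹ = j1
  generalize (y - w)⁻¹ = j2
  generalize (z - w)⁻¹ = j3
  field_simp [hu]
  ring

lemma sum_perm_two {M : Type*} [AddCommMonoid M] (f : Fin 2 → Fin 2 → M) :
    ∑ σ : Equiv.Perm (Fin 2), f (σ 0) (σ 1) = f 0 1 + f 1 0 := by
  have : (Finset.univ : Finset (Equiv.Perm (Fin 2))) = {1, Equiv.swap 0 1} := by decide
  rw [this, Finset.sum_pair (by decide)]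
  rfl

lemma sum_perm_three {M : Type*} [AddCommMonoid M] (f : Fin 3 → Fin 3 → Fin 3 → M) :
    ∑ σ : Equiv.Perm (Fin 3), f (σ 0) (σ 1) (σ 2) =
      f 0 1 2 + f 1 0 2 + f 2 1 0 + f 0 2 1 + f 1 2 0 + f 2 0 1 := by
  have : (Finset.univ : Finset (Equiv.Perm (Fin 3))) = {1, Equiv.swap 0 1, Equiv.swap 0 2,
    Equiv.swap 1 2, Equiv.swap 0 1 * Equiv.swap 1 2, Equiv.swap 1 2 * Equiv.swap 0 1} := by decide
  rw [this, Finset.sum_insert (by decide), Finset.sum_insert (by decide),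
    Finset.sum_insert (by decide), Finset.sum_insert (by decide), Finset.sum_pair (by decide)]
  simp only [← add_assoc]
  rfl

end SerreIdentities

lemma vpow_add (a b : ℤ) : vpow (a + b) = vpow a * vpow b :=
  zpow_add₀ RatFunc.X_ne_zero a b

lemma vpow_neg (a : ℤ) : vpow (-a) = (vpow a)⁻¹ := zpow_neg _ _

lemma vpow_ne_zero (a : ℤ) : vpow a ≠ 0 := zpow_ne_zero _ RatFunc.X_ne_zero

lemma vpow_mul_natCast (a : ℤ) (m : ℕ) : vpow (a * m) = vpow a ^ m := by
  rw [vpow, vpow, zpow_mul, zpow_natCast]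

lemma vpow_natCast_ne_one {m : ℕ} (hm : m ≠ 0) : vpow m ≠ 1 := by
  intro h
  rw [vpow, zpow_natCast, vv, ← RatFunc.algebraMap_X, ← map_pow,
    ← map_one (algebraMap (Polynomial ℚ) (RatFunc ℚ))] at h
  have := congrArg Polynomial.natDegree (RatFunc.algebraMap_injective ℚ h)
  simp at this
  exact hm this

lemma qInt_denom_ne {d : ℕ} (hd : d ≠ 0) : vpow d - (vpow d)⁻¹ ≠ 0 := by
  intro h
  rw [sub_eq_zero, ← mul_eq_one_iff_eq_inv₀ (vpow_ne_zero _), ← vpow_add] at h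
  have := vpow_natCast_ne_one (m := d + d) (by omega)
  exact this (by exact_mod_cast h)

lemma qInt_one {u : KK} (hu : u - u⁻¹ ≠ 0) : qInt u 1 = 1 := by
  rw [qInt]; simp [hu]

lemma qInt_two {u : KK} (h0 : u ≠ 0) (hu : u - u⁻¹ ≠ 0) : qInt u 2 = u + u⁻¹ := by
  rw [qInt, div_eq_iff hu, zpow_neg]
  norm_cast
  field_simp
  ring

lemma qInt_three {u : KK} (h0 : u ≠ 0) (hu : u - u⁻¹ ≠ 0) :
    qInt u 3 = u ^ 2 + 1 + u⁻¹ ^ 2 := by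
  rw [qInt, div_eq_iff hu, zpow_neg]
  norm_cast
  field_simp
  ring

section Relations
variable {n : ℕ} {A : ℕ → ℕ → ℤ} {Dd : ℕ → ℕ} {k : Fin n → ℕ}

/-- The word in `m` letters `z` with the letter `w` inserted at position `s`. -/
def insertedWord {α : Type*} {m : ℕ} (z : Fin m → α) (w : α) (s : ℕ) : List α :=
  (List.ofFn z).take s ++ w :: (List.ofFn z).drop s

lemma insertedWord_perm {α : Type*} {m : ℕ} (z : Fin m → α) (w : α) (s : ℕ) :
    (insertedWord z w s).Perm (w :: List.ofFn z) := by
  rw [insertedWord]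
  refine List.perm_middle.trans ?_
  rw [List.take_append_drop]

lemma map_insertedWord {α β : Type*} {m : ℕ} (g : α → β) (z : Fin m → α) (w : α) (s : ℕ) :
    (insertedWord z w s).map g = insertedWord (g ∘ z) (g w) s := by
  simp [insertedWord, List.map_take, List.map_drop, List.map_ofFn]

lemma serreElt_eq (i j : Fin n) (m : ℕ) (r : Fin m → ℤ) (t : ℤ) :
    serreElt n Dd i j m r t = ∑ σ : Equiv.Perm (Fin m), ∑ s ∈ Finset.range (m + 1),
      ((-1 : KK) ^ s * qBinom (vpow (Dd (i.1 + 1))) m s) •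
        wd KK (insertedWord (fun l => (i, r (σ l))) (j, t) s) := by
  rw [serreElt]
  refine Finset.sum_congr rfl fun σ _ => Finset.sum_congr rfl fun s _ => ?_
  rw [wd, map_insertedWord]
  rfl

lemma cf_hom (a : KK) : cf n (k := k) a = algebraMap KK (Fk n k) a := rfl

lemma xvr_injective : Function.Injective (xvr n (k := k)) := by
  intro a b h
  exact MvPolynomial.X_injective (IsFractionRing.injective (Pk n k) (Fk n k) h)

lemma serre_ztL {i j : Fin n} {m : ℕ} (hii : A (i.1 + 1) (i.1 + 1) = 2) (hd : Dd (i.1 + 1) ≠ 0)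
    (hm : m = (1 - A (i.1 + 1) (j.1 + 1)).toNat)
    (ha : A (i.1 + 1) (j.1 + 1) = 0 ∨ A (i.1 + 1) (j.1 + 1) = -1 ∨ A (i.1 + 1) (j.1 + 1) = -2)
    (hsym : (Dd (i.1 + 1) : ℤ) * A (i.1 + 1) (j.1 + 1) = Dd (j.1 + 1) * A (j.1 + 1) (i.1 + 1))
    (z : Fin m → Vars n k) (w : Vars n k) (hz : ∀ l, (z l).1 = i) (hw : w.1 = j)
    (hzw : ∀ l, z l ≠ w) :
    ∑ σ : Equiv.Perm (Fin m), ∑ s ∈ Finset.range (m + 1),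
      ((-1 : KK) ^ s * qBinom (vpow (Dd (i.1 + 1))) m s) •
        ztL A Dd (insertedWord (z ∘ σ) w s) = 0 := by
  set u := vpow (Dd (i.1 + 1)) with hu
  have hu0 : u ≠ 0 := vpow_ne_zero _
  have hq : u - u⁻¹ ≠ 0 := qInt_denom_ne hd
  set U : Fk n k := cf n u with hU
  have hU0 : U ≠ 0 := by rw [hU, cf_eq]; simpa using hu0
  set f : Fk n k → Fk n k → Fk n k → Fk n k := fun p a b => (a - p * b) / (a - b) with hf
  have hzz : ∀ l l', zt A Dd (z l) (z l') = f (U⁻¹ ^ 2) (xvr n (z l)) (xvr n (z l')) := by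
    intro l l'
    rw [zt, hz, hz, hii, vpow_neg, show (2 : ℤ) = ((2 : ℕ) : ℤ) from rfl, vpow_mul_natCast, ← hu, hU]
    simp only [hf, cf_hom, map_inv₀, map_pow, inv_pow]
  have hq1 : qFact u 0 = 1 := by simp [qFact]
  have hq2 : qFact u 1 = 1 := by simp [qFact, qInt_one hq]
  have hq3 : qFact u 2 = qInt u 2 := by simp [qFact, Finset.prod_range_succ, qInt_one hq]
  have hq4 : qFact u 3 = qInt u 2 * qInt u 3 := by
    simp [qFact, Finset.prod_range_succ, qInt_one hq]
  have hne : ∀ d : ℕ, d ≠ 0 → qInt u d ≠ 0 := by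
    intro d hd'
    rw [qInt]
    refine div_ne_zero ?_ hq
    have := qInt_denom_ne (d := Dd (i.1 + 1) * d) (by positivity)
    push_cast at this
    rwa [vpow_mul_natCast, ← hu, ← zpow_natCast, ← zpow_neg] at this
  have hzw' : ∀ l, zt A Dd (z l) w =
      f (cf n (vpow (-((Dd (i.1 + 1) : ℤ) * A (i.1 + 1) (j.1 + 1))))) (xvr n (z l)) (xvr n w) := by
    intro l; rw [zt, hz, hw]
  have hwz' : ∀ l, zt A Dd w (z l) =
      f (cf n (vpow (-((Dd (i.1 + 1) : ℤ) * A (i.1 + 1) (j.1 + 1))))) (xvr n w) (xvr n (z l)) := by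
    intro l; rw [zt, hz, hw, hsym]
  rcases ha with ha | ha | ha
  · rw [ha] at hm hzw' hwz'
    obtain rfl : m = 1 := hm
    have h1 := xvr_injective.ne (hzw 0)
    have h2 : ∀ a : Fk n k, cf n 1 * a = a := fun a => by simp [cf_eq]
    have hzw1 : zt A Dd (z 0) w = 1 := by
      rw [hzw', hf]; simp only [mul_zero, neg_zero, vpow, zpow_zero, h2]
      exact div_self (sub_ne_zero.mpr h1)
    have hwz1 : zt A Dd w (z 0) = 1 := by
      rw [hwz', hf]; simp only [mul_zero, neg_zero, vpow, zpow_zero, h2]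
      exact div_self (sub_ne_zero.mpr h1.symm)
    simp [Finset.sum_range_succ, insertedWord, ztL, qBinom, hq1, hq2, hzw1, hwz1]
  · rw [ha] at hm hzw' hwz'
    obtain rfl : m = 2 := hm
    have e : cf n (k := k) (vpow (-((Dd (i.1 + 1) : ℤ) * (-1)))) = U := by
      rw [hU, hu, mul_neg_one, neg_neg]
    rw [e] at hzw' hwz'
    have hb : qBinom u 2 1 = u + u⁻¹ := by simp [qBinom, hq2, hq3, qInt_two hu0 hq]
    have hb0 : qBinom u 2 0 = 1 := by simp [qBinom, hq1, hq3, hne]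
    have hb2 : qBinom u 2 2 = 1 := by simp [qBinom, hq1, hq3, hne]
    have hc : cf n (k := k) (u + u⁻¹) = U + U⁻¹ := by simp only [hU, cf_hom, map_add, map_inv₀]
    have key := serre_identity_two (x := xvr n (z 0)) (y := xvr n (z 1)) (w := xvr n w) hU0 f
      (fun _ _ _ => rfl) (fun x y => f (U⁻¹ ^ 2) x y * (f U (xvr n w) x * f U (xvr n w) y -
        (U + U⁻¹) * (f U x (xvr n w) * f U (xvr n w) y) + f U x (xvr n w) * f U y (xvr n w)))
      (fun _ _ => rfl)
    rw [← key, ← sum_perm_two fun a b => f (U⁻¹ ^ 2) (xvr n (z a)) (xvr n (z b)) *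
      (f U (xvr n w) (xvr n (z a)) * f U (xvr n w) (xvr n (z b)) -
        (U + U⁻¹) * (f U (xvr n (z a)) (xvr n w) * f U (xvr n w) (xvr n (z b))) +
        f U (xvr n (z a)) (xvr n w) * f U (xvr n (z b)) (xvr n w))]
    refine Finset.sum_congr rfl fun σ _ => ?_
    simp only [Finset.sum_range_succ, Finset.range_zero, Finset.sum_empty, hb, hb0, hb2,
      smul_eq_cf, insertedWord, List.ofFn_succ, List.ofFn_zero, List.take_succ_cons,
      List.take_zero, List.drop_succ_cons, List.drop_zero, List.nil_append, List.cons_append, ztL,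
      List.map_cons, List.map_nil, List.prod_cons, List.prod_nil, Function.comp_apply, hzz, hzw',
      hwz']
    simp only [cf_hom, map_mul, map_pow, map_neg, map_one] at hc ⊢
    simp only [hc, Fin.succ_zero_eq_one, zero_add]
    ring
  · rw [ha] at hm hzw' hwz'
    obtain rfl : m = 3 := hm
    have e : cf n (k := k) (vpow (-((Dd (i.1 + 1) : ℤ) * (-2)))) = U ^ 2 := by
      rw [hU, hu, mul_neg, neg_neg, show (2 : ℤ) = ((2 : ℕ) : ℤ) from rfl, vpow_mul_natCast]
      simp [cf_eq]
    rw [e] at hzw' hwz'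
    have hb : qBinom u 3 1 = u ^ 2 + 1 + u⁻¹ ^ 2 := by
      rw [qBinom, hq4, hq2, hq3, ← qInt_three hu0 hq]
      field_simp [hne]
    have hb' : qBinom u 3 2 = u ^ 2 + 1 + u⁻¹ ^ 2 := by
      rw [qBinom, hq4, hq3, hq2, ← qInt_three hu0 hq]
      field_simp [hne]
    have hb0 : qBinom u 3 0 = 1 := by simp [qBinom, hq1, hq4, hne]
    have hb2 : qBinom u 3 3 = 1 := by simp [qBinom, hq1, hq4, hne]
    have hc : cf n (k := k) (u ^ 2 + 1 + u⁻¹ ^ 2) = U ^ 2 + 1 + U⁻¹ ^ 2 := by simp only [hU, cf_hom, map_add, map_inv₀, map_pow, map_one]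
    set W := xvr n w
    have key := serre_identity_three (x := xvr n (z 0)) (y := xvr n (z 1)) (z := xvr n (z 2))
      (w := W) hU0 f (fun _ _ _ => rfl) (fun x y z => f (U⁻¹ ^ 2) x y * f (U⁻¹ ^ 2) x z *
      f (U⁻¹ ^ 2) y z * (f (U ^ 2) W x * f (U ^ 2) W y * f (U ^ 2) W z
      - (U ^ 2 + 1 + U⁻¹ ^ 2) * (f (U ^ 2) x W * f (U ^ 2) W y * f (U ^ 2) W z)
      + (U ^ 2 + 1 + U⁻¹ ^ 2) * (f (U ^ 2) x W * f (U ^ 2) y W * f (U ^ 2) W z)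
      - f (U ^ 2) x W * f (U ^ 2) y W * f (U ^ 2) z W)) (fun _ _ _ => rfl)
    rw [← key, ← sum_perm_three fun a b c => (fun x y z => f (U⁻¹ ^ 2) x y * f (U⁻¹ ^ 2) x z *
      f (U⁻¹ ^ 2) y z * (f (U ^ 2) W x * f (U ^ 2) W y * f (U ^ 2) W z
      - (U ^ 2 + 1 + U⁻¹ ^ 2) * (f (U ^ 2) x W * f (U ^ 2) W y * f (U ^ 2) W z)
      + (U ^ 2 + 1 + U⁻¹ ^ 2) * (f (U ^ 2) x W * f (U ^ 2) y W * f (U ^ 2) W z)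
      - f (U ^ 2) x W * f (U ^ 2) y W * f (U ^ 2) z W)) (xvr n (z a)) (xvr n (z b)) (xvr n (z c))]
    refine Finset.sum_congr rfl fun σ _ => ?_
    simp only [Finset.sum_range_succ, Finset.range_zero, Finset.sum_empty, hb, hb', hb0, hb2,
      smul_eq_cf, insertedWord, List.ofFn_succ, List.ofFn_zero, List.take_succ_cons,
      List.take_zero, List.drop_succ_cons, List.drop_zero, List.nil_append, List.cons_append, ztL,
      List.map_cons, List.map_nil, List.prod_cons, List.prod_nil, Function.comp_apply, hzz, hzw',
      hwz']
    simp only [cf_hom, map_mul, map_pow, map_neg, map_one] at hc ⊢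
    simp only [hc, Fin.succ_zero_eq_one, Fin.succ_one_eq_two, zero_add]
    ring

end Relations

/-! ### The homomorphism from the quantum loop algebra to the shuffle algebra -/

section Descent
variable {n : ℕ} {A : ℕ → ℕ → ℤ} {Dd : ℕ → ℕ} {k : Fin n → ℕ}

lemma freeImage_serreElt {i j : Fin n} (hij : i ≠ j) {m : ℕ} (hii : A (i.1 + 1) (i.1 + 1) = 2)
    (hd : Dd (i.1 + 1) ≠ 0) (hm : m = (1 - A (i.1 + 1) (j.1 + 1)).toNat)
    (ha : A (i.1 + 1) (j.1 + 1) = 0 ∨ A (i.1 + 1) (j.1 + 1) = -1 ∨ A (i.1 + 1) (j.1 + 1) = -2)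
    (hsym : (Dd (i.1 + 1) : ℤ) * A (i.1 + 1) (j.1 + 1) = Dd (j.1 + 1) * A (j.1 + 1) (i.1 + 1))
    (r : Fin m → ℤ) (t : ℤ) : freeImage A Dd (serreElt n Dd i j m r t) = 0 := by
  set w0 : List (Fin n × ℤ) := List.ofFn (fun l => (i, r l)) ++ [(j, t)] with hw0
  obtain ⟨k, hk⟩ : ∃ k, wt w0 = k := ⟨_, rfl⟩
  obtain ⟨L, R, hL, hL1, hLw⟩ := exists_vword w0 hk
  have hlen : L.length = m + 1 := by
    have := congrArg List.length hLw
    simpa [vword, hw0] using this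
  set z : Fin m → Vars n k := fun l => L[l.1]'(by omega) with hz
  set w : Vars n k := L[m]'(by omega) with hw
  have hget : ∀ (a : ℕ) (ha : a < L.length) (hb : a < w0.length), (L[a].1, R L[a]) = w0[a] := by
    intro a ha hb
    have := List.getElem_of_eq hLw (i := a) (by simpa [vword] using ha)
    simpa [vword] using this
  have hw0l : w0.length = m + 1 := by simp [hw0]
  have hzv : ∀ l, ((z l).1, R (z l)) = (i, r l) := fun l => by
    rw [hz, hget l.1 (by omega) (by omega)]
    simp [hw0]
  have hwv : (w.1, R w) = (j, t) := by
    rw [hw, hget m (by omega) (by omega)]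
    simp [hw0]
  have hzi : Function.Injective z := fun a b h => Fin.ext ((hL.getElem_inj_iff).mp h)
  have hzw : ∀ l, z l ≠ w := fun l h => hij (by
    rw [← (Prod.mk.inj (hzv l)).1, ← (Prod.mk.inj hwv).1, h])
  have hall : ∀ u, u ∈ w :: List.ofFn z := by
    intro u
    obtain ⟨a, ha, rfl⟩ := List.getElem_of_mem (hL1 u)
    rcases Nat.lt_or_ge a m with h | h
    · exact List.mem_cons_of_mem _ (List.mem_ofFn.mpr ⟨⟨a, h⟩, rfl⟩)
    · have : a = m := by omega
      subst this
      exact List.mem_cons_self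
  have hword : ∀ (σ : Equiv.Perm (Fin m)) (s : ℕ),
      (insertedWord (z ∘ σ) w s).Perm (w :: List.ofFn z) := fun σ s =>
    (insertedWord_perm _ _ _).trans (List.Perm.cons _ (Equiv.Perm.ofFn_comp_perm σ z))
  have hnd : (w :: List.ofFn z).Nodup := by
    rw [List.nodup_cons, List.nodup_ofFn]
    refine ⟨fun h => ?_, hzi⟩
    obtain ⟨l, h⟩ := List.mem_ofFn.mp h
    exact hzw l h
  have hterm : ∀ (σ : Equiv.Perm (Fin m)) (s : ℕ),
      freeImage A Dd (wd KK (insertedWord (fun l => (i, r (σ l))) (j, t) s)) =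
        DirectSum.lof KK _ (fun k => Fk n k) k (Sy ((∏ u, xvr n u ^ R u) *
          ztL A Dd (insertedWord (z ∘ σ) w s))) := by
    intro σ s
    have h1 : insertedWord (fun l => (i, r (σ l))) (j, t) s =
        vword (insertedWord (z ∘ σ) w s) R := by
      rw [vword, map_insertedWord, hwv]
      congr 1
      funext l
      exact (hzv (σ l)).symm
    have h2 : (insertedWord (z ∘ σ) w s).Nodup := (hword σ s).nodup_iff.mpr hnd
    have h3 : ∀ u, u ∈ insertedWord (z ∘ σ) w s := fun u => (hword σ s).mem_iff.mpr (hall u)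
    rw [h1, freeImage_vword A Dd h2 h3, DirectSum.lof_eq_of, term,
      ← List.prod_toFinset _ h2]
    congr 4
    ext u; simp [h3]
  rw [serreElt_eq, map_sum]
  simp_rw [map_sum, map_smul, hterm, ← map_smul, ← map_sum]
  rw [show (∑ σ : Equiv.Perm (Fin m), ∑ s ∈ Finset.range (m + 1),
      ((-1 : KK) ^ s * qBinom (vpow (Dd (i.1 + 1))) m s) •
        ((∏ u, xvr n u ^ R u) * ztL A Dd (insertedWord (z ∘ σ) w s))) =
      (∏ u, xvr n u ^ R u) * ∑ σ : Equiv.Perm (Fin m), ∑ s ∈ Finset.range (m + 1),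
      ((-1 : KK) ^ s * qBinom (vpow (Dd (i.1 + 1))) m s) •
        ztL A Dd (insertedWord (z ∘ σ) w s) by
    simp_rw [Finset.mul_sum, mul_smul_comm]]
  rw [serre_ztL hii hd hm ha hsym z w (fun l => (Prod.mk.inj (hzv l)).1) (Prod.mk.inj hwv).1 hzw,
    mul_zero, map_zero, map_zero]

lemma freeImage_pair {u w : Vars n k} (huw : u ≠ w) (hall : ∀ a, a = u ∨ a = w) (r s : ℤ) :
    freeImage A Dd (fg n u.1 r * fg n w.1 s) =
      DirectSum.lof KK _ (fun k => Fk n k) k (Sy (xvr n u ^ r * xvr n w ^ s * zt A Dd u w)) := by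
  have h := rep_mul (Finset.disjoint_singleton.mpr huw) (rep_var (A := A) (Dd := Dd) u r)
    (rep_var w s)
  rw [Finset.prod_singleton, Finset.prod_singleton] at h
  have h1 : ({u} ∪ {w} : Finset (Vars n k)) = Finset.univ := by ext a; simp [hall a]
  rw [h1] at h
  exact freeImage_of_rep h

lemma xvr_ne_zero (u : Vars n k) : xvr n u ≠ 0 := by
  rw [xvr, Ne, FaithfulSMul.algebraMap_eq_zero_iff]
  exact MvPolynomial.X_ne_zero u

lemma freeImage_loop {i j : Fin n}
    (hsym : (Dd (i.1 + 1) : ℤ) * A (i.1 + 1) (j.1 + 1) = Dd (j.1 + 1) * A (j.1 + 1) (i.1 + 1))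
    (r s : ℤ) :
    freeImage A Dd (fg n i (r + 1) * fg n j s
        - vpow ((Dd (i.1 + 1) : ℤ) * A (i.1 + 1) (j.1 + 1)) • (fg n i r * fg n j (s + 1))) =
      freeImage A Dd (vpow ((Dd (i.1 + 1) : ℤ) * A (i.1 + 1) (j.1 + 1)) •
        (fg n j s * fg n i (r + 1)) - fg n j (s + 1) * fg n i r) := by
  obtain ⟨k, hk⟩ : ∃ k : Fin n → ℕ, ∀ c, [i, j].count c = k c := ⟨_, fun _ => rfl⟩
  obtain ⟨L, hL, hL1, hL2⟩ := exists_enum [i, j] hk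
  obtain ⟨u, w, rfl⟩ := List.length_eq_two.mp
    (show L.length = 2 by simpa using congrArg List.length hL2)
  simp only [List.map_cons, List.map_nil, List.cons.injEq, and_true] at hL2
  obtain ⟨rfl, rfl⟩ := hL2
  have huw : u ≠ w := by simpa using hL
  have hall : ∀ a, a = u ∨ a = w := fun a => by simpa using hL1 a
  have h1 := fun r s => freeImage_pair (A := A) (Dd := Dd) huw hall r s
  have h2 := fun r s => freeImage_pair (A := A) (Dd := Dd) huw.symm
    (fun a => (hall a).symm) r s
  simp only [map_sub, map_smul, h1, h2]
  simp only [← map_smul, ← map_sub]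
  congr 2
  have hx := xvr_ne_zero u
  have hy := xvr_ne_zero w
  simp only [smul_eq_cf, zt, ← hsym, vpow_neg, cf_hom, map_inv₀, zpow_add₀ hx, zpow_add₀ hy,
    zpow_one]
  generalize xvr n u ^ r = X
  generalize xvr n w ^ s = Y
  have hq : algebraMap KK (Fk n k) (vpow ((Dd (u.1.1 + 1) : ℤ) * A (u.1.1 + 1) (w.1.1 + 1))) ≠ 0 := by
    simpa using vpow_ne_zero _
  generalize algebraMap KK (Fk n k) (vpow ((Dd (u.1.1 + 1) : ℤ) * A (u.1.1 + 1) (w.1.1 + 1))) = q at hq ⊢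
  have h3 : xvr n u - xvr n w ≠ 0 := sub_ne_zero.mpr (xvr_injective.ne huw)
  rw [show xvr n w - xvr n u = -(xvr n u - xvr n w) by ring]
  generalize xvr n u = x at *
  generalize xvr n w = y at *
  field_simp
  ring

/-- The congruence given by the kernel of `freeImage`. -/
def imageCon (A : ℕ → ℕ → ℤ) (Dd : ℕ → ℕ) : RingCon (FA n) where
  r a b := freeImage A Dd a = freeImage A Dd b
  iseqv := ⟨fun _ => rfl, fun h => h.symm, fun h h' => h.trans h'⟩
  add' h h' := by simp only [map_add, h, h']
  mul' h h' := by simp only [freeImage_mul, h, h']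

theorem exists_descent (H : ∀ a b, URel n A Dd a b → freeImage A Dd a = freeImage A Dd b) :
    ∃ Ψ : UA n A Dd →ₗ[KK] BigS n,
      ∀ a, Ψ (RingQuot.mkAlgHom KK (URel n A Dd) a) = freeImage A Dd a := by
  set φ := (RingQuot.mkAlgHom KK (URel n A Dd)).toLinearMap with hφ
  have hs : Function.Surjective φ := RingQuot.mkAlgHom_surjective KK _
  have hk : LinearMap.ker φ ≤ LinearMap.ker (freeImage A Dd) := by
    intro a ha
    set g : FA n →+* (imageCon (n := n) A Dd).Quotient := (imageCon A Dd).mk'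
    have hg : ∀ ⦃a b⦄, URel n A Dd a b → g a = g b := fun a b h =>
      (RingCon.eq (imageCon A Dd)).mpr (H a b h)
    have h1 : RingQuot.lift ⟨g, hg⟩ (RingQuot.mkRingHom (URel n A Dd) a) = g a :=
      RingQuot.lift_mkRingHom_apply _ _ _
    have h2 : RingQuot.mkRingHom (URel n A Dd) a = 0 := by
      rw [← RingQuot.mkAlgHom_coe KK]; exact ha
    rw [h2, map_zero] at h1
    have h3 : imageCon A Dd 0 a := (RingCon.eq (imageCon A Dd)).mp h1
    have h4 : freeImage A Dd 0 = freeImage A Dd a := h3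
    rw [LinearMap.mem_ker, ← h4, map_zero]
  refine ⟨((LinearMap.ker φ).liftQ (freeImage A Dd) hk).comp
    (φ.quotKerEquivOfSurjective hs).symm.toLinearMap, fun a => ?_⟩
  have : (φ.quotKerEquivOfSurjective hs).symm (φ a) = (LinearMap.ker φ).mkQ a := by
    rw [LinearEquiv.symm_apply_eq]; rfl
  change (LinearMap.ker φ).liftQ _ hk ((φ.quotKerEquivOfSurjective hs).symm (φ a)) = _
  rw [this]
  rfl

end Descent

section TypeC
variable {n : ℕ}

lemma aC_self (n i : ℕ) : aC n i i = 2 := by simp [aC]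

lemma dC_ne_zero (n i : ℕ) : dC n i ≠ 0 := by unfold dC; split_ifs <;> simp

lemma aC_cases {i j : ℕ} (hij : i ≠ j) : aC n i j = 0 ∨ aC n i j = -1 ∨ aC n i j = -2 := by
  unfold aC; rw [if_neg hij]; split_ifs <;> simp

lemma dC_mul_aC {i j : ℕ} (hi : i ≤ n) (hj : j ≤ n) :
    (dC n i : ℤ) * aC n i j = dC n j * aC n j i := by
  unfold aC dC; split_ifs <;> omega

lemma freeImage_relation (a b : FA n) (h : URel n (aC n) (dC n) a b) :
    freeImage (aC n) (dC n) a = freeImage (aC n) (dC n) b := by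
  rcases h with ⟨i, j, r, s⟩ | ⟨i, j, hij, r, t⟩
  · exact freeImage_loop (dC_mul_aC i.2 j.2) r s
  · rw [map_zero]
    exact freeImage_serreElt hij (aC_self _ _) (dC_ne_zero _ _) rfl
      (aC_cases fun h => hij (Fin.ext (by omega))) (dC_mul_aC i.2 j.2) r t

end TypeC

/-! ### Linear factors and partial degrees of polynomials -/

namespace MvPolynomial
variable {V R : Type*} [DecidableEq V] [Field R]

/-- The substitution `x_a ↦ x_b`. -/
def subst (a b : V) : MvPolynomial V R →ₐ[R] MvPolynomial V R :=
  aeval fun u => if u = a then X b else X u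

lemma X_sub_X_dvd_sub (a b : V) (p : MvPolynomial V R) :
    (X a - X b : MvPolynomial V R) ∣ p - subst a b p := by
  induction p using MvPolynomial.induction_on with
  | C r => simp [subst]
  | add p q hp hq => rw [map_add, add_sub_add_comm]; exact dvd_add hp hq
  | mul_X p u hp =>
    have : p * X u - subst a b (p * X u) =
        (p - subst a b p) * X u + subst a b p * (X u - subst a b (X u)) := by
      rw [map_mul]; ring
    rw [this]
    refine dvd_add (hp.mul_right _) (Dvd.dvd.mul_left ?_ _)
    by_cases hu : u = a
    · simp [subst, hu]
    · simp [subst, hu]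

lemma X_sub_X_dvd_iff {a b : V} {p : MvPolynomial V R} :
    (X a - X b : MvPolynomial V R) ∣ p ↔ subst a b p = 0 := by
  constructor
  · rintro ⟨q, rfl⟩
    have : subst a b (X a - X b : MvPolynomial V R) = 0 := by
      by_cases h : b = a <;> simp [subst, h]
    rw [map_mul, this, zero_mul]
  · intro h
    simpa [h] using X_sub_X_dvd_sub a b p

lemma X_sub_X_ne_zero {a b : V} (h : a ≠ b) : (X a - X b : MvPolynomial V R) ≠ 0 :=
  sub_ne_zero.mpr fun e => h (X_injective e)

lemma prime_X_sub_X {a b : V} (h : a ≠ b) : Prime (X a - X b : MvPolynomial V R) := by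
  refine ⟨X_sub_X_ne_zero h, fun hu => ?_, fun p q hpq => ?_⟩
  · have := X_sub_X_dvd_iff.mp (hu.dvd (a := 1))
    simp at this
  · rw [X_sub_X_dvd_iff, map_mul, mul_eq_zero] at hpq
    exact hpq.imp X_sub_X_dvd_iff.mpr X_sub_X_dvd_iff.mpr

lemma isRelPrime_X_sub_X {a b a' b' : V} (h : a ≠ b) (h' : a' ≠ b')
    (h1 : ¬ (a = a' ∧ b = b')) (h2 : ¬ (a = b' ∧ b = a')) :
    IsRelPrime (X a - X b : MvPolynomial V R) (X a' - X b') := by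
  rw [(prime_X_sub_X h).irreducible.isRelPrime_iff_not_dvd, X_sub_X_dvd_iff]
  intro e
  simp only [subst, map_sub, aeval_X, sub_eq_zero] at e
  split_ifs at e with e1 e2 e2
  · exact h' (e1.trans e2.symm)
  · exact h1 ⟨e1.symm, X_injective e⟩
  · exact h2 ⟨e2.symm, (X_injective e).symm⟩
  · exact h' (X_injective e)

/-- The substitution that scales the variables in `A` by a new variable. -/
def spread (A : Finset V) : MvPolynomial V R →ₐ[R] Polynomial (MvPolynomial V R) :=
  aeval fun u => Polynomial.C (X u) * Polynomial.X ^ (if u ∈ A then 1 else 0)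

lemma spread_X (A : Finset V) (u : V) : spread (R := R) A (X u) =
    Polynomial.C (X u) * Polynomial.X ^ (if u ∈ A then 1 else 0) := by simp [spread]

lemma spread_C (A : Finset V) (c : R) : spread A (C c) = Polynomial.C (C c) := by
  rw [← algebraMap_eq, AlgHom.commutes]; rfl

lemma spread_monomial (A : Finset V) (d : V →₀ ℕ) (a : R) :
    spread A (monomial d a) = Polynomial.monomial (∑ v ∈ A, d v) (monomial d a) := by
  have h1 : ∑ v ∈ A, d v = ∑ v ∈ d.support, (if v ∈ A then 1 else 0) * d v := by
    simp only [ite_mul, one_mul, zero_mul]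
    rw [Finset.sum_ite_mem, Finset.inter_comm]
    refine (Finset.sum_subset Finset.inter_subset_left fun x h1 h2 => ?_).symm
    by_contra h3
    exact h2 (Finset.mem_inter.mpr ⟨h1, Finsupp.mem_support_iff.mpr h3⟩)
  have h2 : spread (R := R) A (d.prod fun v e => X v ^ e) =
      Polynomial.C (d.prod fun v e => X v ^ e) * Polynomial.X ^ (∑ v ∈ A, d v) := by
    rw [Finsupp.prod, map_prod, map_prod, h1, ← Finset.prod_pow_eq_pow_sum,
      ← Finset.prod_mul_distrib]
    refine Finset.prod_congr rfl fun v _ => ?_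
    rw [map_pow, spread_X, mul_pow, map_pow, pow_mul]
  rw [monomial_eq, map_mul, spread_C, h2, ← mul_assoc, ← map_mul,
    Polynomial.C_mul_X_pow_eq_monomial]

lemma coeff_spread (A : Finset V) (p : MvPolynomial V R) (d : V →₀ ℕ) (m : ℕ) :
    coeff d ((spread A p).coeff m) = if ∑ v ∈ A, d v = m then coeff d p else 0 := by
  induction p using MvPolynomial.induction_on' with
  | monomial e a =>
    rw [spread_monomial, Polynomial.coeff_monomial]
    by_cases h : e = d
    · subst h; split_ifs <;> simp
    · split_ifs <;> simp [h]
  | add p q hp hq => rw [map_add, Polynomial.coeff_add, coeff_add, hp, hq, coeff_add]; split_ifs <;> simp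

lemma spread_ne_zero {A : Finset V} {p : MvPolynomial V R} (hp : p ≠ 0) : spread A p ≠ 0 := by
  intro h
  obtain ⟨d, hd⟩ := ne_zero_iff.mp hp
  have := coeff_spread A p d (∑ v ∈ A, d v)
  rw [h, if_pos rfl] at this
  exact hd (by simpa using this.symm)

/-- The largest partial degree in the variables in `A`. -/
def topDeg (A : Finset V) (p : MvPolynomial V R) : ℕ := (spread A p).natDegree

/-- The smallest partial degree in the variables in `A`. -/
def lowDeg (A : Finset V) (p : MvPolynomial V R) : ℕ := (spread A p).natTrailingDegree

lemma le_topDeg (A : Finset V) {p : MvPolynomial V R} {d : V →₀ ℕ} (hd : d ∈ p.support) :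
    ∑ v ∈ A, d v ≤ topDeg A p := by
  refine Polynomial.le_natDegree_of_ne_zero fun h => ?_
  have := coeff_spread A p d (∑ v ∈ A, d v)
  rw [h, if_pos rfl] at this
  exact mem_support_iff.mp hd (by simpa using this.symm)

lemma lowDeg_le (A : Finset V) {p : MvPolynomial V R} {d : V →₀ ℕ} (hd : d ∈ p.support) :
    lowDeg A p ≤ ∑ v ∈ A, d v := by
  refine Polynomial.natTrailingDegree_le_of_ne_zero fun h => ?_
  have := coeff_spread A p d (∑ v ∈ A, d v)
  rw [h, if_pos rfl] at this
  exact mem_support_iff.mp hd (by simpa using this.symm)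

lemma topDeg_mul (A : Finset V) {p q : MvPolynomial V R} (hp : p ≠ 0) (hq : q ≠ 0) :
    topDeg A (p * q) = topDeg A p + topDeg A q := by
  rw [topDeg, map_mul, Polynomial.natDegree_mul (spread_ne_zero hp) (spread_ne_zero hq)]; rfl

lemma lowDeg_mul (A : Finset V) {p q : MvPolynomial V R} (hp : p ≠ 0) (hq : q ≠ 0) :
    lowDeg A (p * q) = lowDeg A p + lowDeg A q := by
  rw [lowDeg, map_mul, Polynomial.natTrailingDegree_mul (spread_ne_zero hp) (spread_ne_zero hq)]; rfl

lemma topDeg_prod {ι : Type*} (A : Finset V) (s : Finset ι) (p : ι → MvPolynomial V R)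
    (hp : ∀ i ∈ s, p i ≠ 0) : topDeg A (∏ i ∈ s, p i) = ∑ i ∈ s, topDeg A (p i) := by
  classical
  induction s using Finset.induction_on with
  | empty => simp [topDeg]
  | insert a s ha ih =>
    rw [Finset.prod_insert ha, Finset.sum_insert ha, topDeg_mul A (hp a (by simp))
      (Finset.prod_ne_zero_iff.mpr fun i hi => hp i (by simp [hi])), ih fun i hi => hp i (by simp [hi])]

lemma lowDeg_prod {ι : Type*} (A : Finset V) (s : Finset ι) (p : ι → MvPolynomial V R)
    (hp : ∀ i ∈ s, p i ≠ 0) : lowDeg A (∏ i ∈ s, p i) = ∑ i ∈ s, lowDeg A (p i) := by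
  classical
  induction s using Finset.induction_on with
  | empty => simp [lowDeg]
  | insert a s ha ih =>
    rw [Finset.prod_insert ha, Finset.sum_insert ha, lowDeg_mul A (hp a (by simp))
      (Finset.prod_ne_zero_iff.mpr fun i hi => hp i (by simp [hi])), ih fun i hi => hp i (by simp [hi])]

lemma X_sub_C_mul_X_ne_zero {a b : V} (h : a ≠ b) (c : R) :
    (X a - C c * X b : MvPolynomial V R) ≠ 0 := by
  intro e
  have h1 : (X a : MvPolynomial V R) = C c * X b := sub_eq_zero.mp e
  have h2 := congrArg (aeval fun u => if u = a then (1 : R) else 0) h1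
  simp [Ne.symm h] at h2

lemma topDeg_linear (A : Finset V) {a b : V} (h : a ≠ b) {c : R} (hc : c ≠ 0) :
    topDeg A (X a - C c * X b : MvPolynomial V R) = if a ∈ A ∨ b ∈ A then 1 else 0 := by
  have hX : ∀ u : V, (X u : MvPolynomial V R) ≠ 0 := X_ne_zero
  have hC : (C c : MvPolynomial V R) ≠ 0 := by simpa using hc
  rw [topDeg, map_sub, map_mul, spread_C, spread_X, spread_X]
  by_cases h1 : a ∈ A <;> by_cases h2 : b ∈ A <;> simp only [h1, h2, if_true, if_false, pow_one,
    pow_zero, mul_one, or_true, true_or, or_self, ← mul_assoc, ← map_mul]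
  · rw [← sub_mul, ← map_sub, Polynomial.natDegree_C_mul_X _ (X_sub_C_mul_X_ne_zero h c)]
  · rw [Polynomial.natDegree_sub_C, Polynomial.natDegree_C_mul_X _ (hX a)]
  · rw [Polynomial.natDegree_sub, Polynomial.natDegree_sub_C,
      Polynomial.natDegree_C_mul_X _ (mul_ne_zero hC (hX b))]
  · rw [← map_sub, Polynomial.natDegree_C]

lemma lowDeg_linear (A : Finset V) {a b : V} (h : a ≠ b) {c : R} (hc : c ≠ 0) :
    lowDeg A (X a - C c * X b : MvPolynomial V R) = if a ∈ A ∧ b ∈ A then 1 else 0 := by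
  have hX : ∀ u : V, (X u : MvPolynomial V R) ≠ 0 := X_ne_zero
  have hC : (C c : MvPolynomial V R) ≠ 0 := by simpa using hc
  rw [lowDeg, map_sub, map_mul, spread_C, spread_X, spread_X]
  by_cases h1 : a ∈ A <;> by_cases h2 : b ∈ A <;> simp only [h1, h2, if_true, if_false, pow_one,
    pow_zero, mul_one, and_true, and_false, ← mul_assoc, ← map_mul]
  · rw [← sub_mul, ← map_sub, ← pow_one Polynomial.X, Polynomial.C_mul_X_pow_eq_monomial,
      Polynomial.natTrailingDegree_monomial (X_sub_C_mul_X_ne_zero h c)]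
  · refine Polynomial.natTrailingDegree_eq_zero_of_constantCoeff_ne_zero ?_
    simp [hX, hc]
  · refine Polynomial.natTrailingDegree_eq_zero_of_constantCoeff_ne_zero ?_
    simp [hX]
  · rw [← map_sub, Polynomial.natTrailingDegree_C]

lemma topDeg_sum_le {ι : Type*} (A : Finset V) (s : Finset ι) (p : ι → MvPolynomial V R) (m : ℕ)
    (hp : ∀ i ∈ s, topDeg A (p i) ≤ m) : topDeg A (∑ i ∈ s, p i) ≤ m := by
  rw [topDeg, map_sum]
  exact Polynomial.natDegree_sum_le_of_forall_le _ _ hp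

lemma le_lowDeg_iff {A : Finset V} {p : MvPolynomial V R} (hp : p ≠ 0) {m : ℕ} :
    m ≤ lowDeg A p ↔ ∀ i < m, (spread A p).coeff i = 0 := by
  constructor
  · intro h i hi
    exact Polynomial.coeff_eq_zero_of_lt_natTrailingDegree (lt_of_lt_of_le hi h)
  · intro h
    exact Polynomial.le_natTrailingDegree (spread_ne_zero hp) h

lemma le_lowDeg_sum {ι : Type*} (A : Finset V) (s : Finset ι) (p : ι → MvPolynomial V R) (m : ℕ)
    (h0 : ∀ i ∈ s, p i ≠ 0) (hp : ∀ i ∈ s, m ≤ lowDeg A (p i)) (hs : ∑ i ∈ s, p i ≠ 0) :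
    m ≤ lowDeg A (∑ i ∈ s, p i) := by
  rw [le_lowDeg_iff hs]
  intro j hj
  rw [map_sum, Polynomial.finsetSum_coeff]
  exact Finset.sum_eq_zero fun i hi => (le_lowDeg_iff (h0 i hi)).mp (hp i hi) j hj

end MvPolynomial

/-! ### Numerators of the images of words -/

section Numerators
set_option linter.unusedSectionVars false
variable {n : ℕ} {k : Fin n → ℕ}
open MvPolynomial

lemma ztL_eq_prod_aux (A : ℕ → ℕ → ℤ) (Dd : ℕ → ℕ) (pos : Vars n k → ℕ) (L : List (Vars n k))
    (hL : L.Pairwise fun a b => pos a < pos b) :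
    ztL A Dd L = ∏ p ∈ (L.toFinset ×ˢ L.toFinset).filter (fun p => pos p.1 < pos p.2),
      zt A Dd p.1 p.2 := by
  induction L with
  | nil => simp [ztL]
  | cons a L ih =>
    rw [List.pairwise_cons] at hL
    have hnd : L.Nodup := hL.2.imp fun {x y} hxy => by rintro rfl; exact lt_irrefl _ hxy
    have haL : a ∉ L := fun h => lt_irrefl _ (hL.1 a h)
    have hset : ((a :: L).toFinset ×ˢ (a :: L).toFinset).filter (fun p => pos p.1 < pos p.2) =
        (L.toFinset.map ⟨Prod.mk a, Prod.mk_right_injective a⟩) ∪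
          (L.toFinset ×ˢ L.toFinset).filter (fun p => pos p.1 < pos p.2) := by
      ext ⟨x, y⟩
      simp only [Finset.mem_filter, Finset.mem_product, List.mem_toFinset, List.mem_cons,
        Finset.mem_union, Finset.mem_map, Function.Embedding.coeFn_mk, Prod.mk.injEq]
      constructor
      · rintro ⟨⟨rfl | hx, rfl | hy⟩, h⟩
        · exact absurd h (lt_irrefl _)
        · exact Or.inl ⟨y, hy, rfl, rfl⟩
        · exact absurd h (hL.1 x hx).not_gt
        · exact Or.inr ⟨⟨hx, hy⟩, h⟩
      · rintro (⟨z, hz, rfl, rfl⟩ | ⟨⟨hx, hy⟩, h⟩)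
        · exact ⟨⟨Or.inl rfl, Or.inr hz⟩, hL.1 _ hz⟩
        · exact ⟨⟨Or.inr hx, Or.inr hy⟩, h⟩
    rw [hset, Finset.prod_union, ← ih hL.2, Finset.prod_map, ztL,
      ← List.prod_toFinset _ hnd]
    · rfl
    · rw [Finset.disjoint_left]
      rintro ⟨x, y⟩ h1 h2
      simp only [Finset.mem_map, Function.Embedding.coeFn_mk, Prod.mk.injEq, List.mem_toFinset,
        Finset.mem_filter, Finset.mem_product] at h1 h2
      obtain ⟨z, _, rfl, _⟩ := h1
      exact haL h2.1.1

lemma vpow_zero : vpow 0 = 1 := by simp [vpow]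

/-- The pairs of interacting variables in the order prescribed by `pos`. -/
def orderedPairs (pos : Vars n k → ℕ) : Finset (Vars n k × Vars n k) :=
  Finset.univ.filter fun p => pos p.1 < pos p.2 ∧ aC n (p.1.1.1 + 1) (p.2.1.1 + 1) ≠ 0

/-- The numerator of a product of factors `ζ`. -/
def zetaNum (pos : Vars n k → ℕ) : Pk n k :=
  ∏ p ∈ orderedPairs pos, (X p.1 -
    C (vpow (-((dC n (p.1.1.1 + 1) : ℤ) * aC n (p.1.1.1 + 1) (p.2.1.1 + 1)))) * X p.2)

/-- The denominator of a product of factors `ζ`. -/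
def zetaDen (pos : Vars n k → ℕ) : Pk n k := ∏ p ∈ orderedPairs pos, (X p.1 - X p.2)

lemma orderedPairs_ne {pos : Vars n k → ℕ} {p : Vars n k × Vars n k} (hp : p ∈ orderedPairs pos) :
    p.1 ≠ p.2 := by
  intro h
  simp [orderedPairs, h] at hp

lemma zetaDen_ne_zero (pos : Vars n k → ℕ) : zetaDen pos ≠ 0 :=
  Finset.prod_ne_zero_iff.mpr fun _ hp => X_sub_X_ne_zero (orderedPairs_ne hp)

lemma zetaNum_ne_zero (pos : Vars n k → ℕ) : zetaNum pos ≠ 0 :=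
  Finset.prod_ne_zero_iff.mpr fun _ hp => X_sub_C_mul_X_ne_zero (orderedPairs_ne hp) _

lemma algebraMap_Fk_ne_zero {p : Pk n k} (hp : p ≠ 0) : algebraMap (Pk n k) (Fk n k) p ≠ 0 :=
  fun h => hp ((IsFractionRing.injective (Pk n k) (Fk n k)) (by rw [h, map_zero]))

lemma ztL_mul_zetaDen (pos : Vars n k → ℕ) (L : List (Vars n k))
    (hL : L.Pairwise fun a b => pos a < pos b) (hL1 : ∀ u, u ∈ L) :
    ztL (aC n) (dC n) L * algebraMap _ _ (zetaDen pos) = algebraMap (Pk n k) (Fk n k) (zetaNum pos) := by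
  have hu : L.toFinset = Finset.univ := by ext u; simp [hL1 u]
  have hsub : ∏ p ∈ orderedPairs pos, zt (aC n) (dC n) p.1 p.2 = ∏ p ∈
      (L.toFinset ×ˢ L.toFinset).filter (fun p => pos p.1 < pos p.2), zt (aC n) (dC n) p.1 p.2 := by
    refine Finset.prod_subset (fun p hp => ?_) fun p hp hp' => ?_
    · simp only [orderedPairs, Finset.mem_filter] at hp
      simp [hu, hp.2.1]
    · simp only [hu, Finset.mem_filter, Finset.univ_product_univ, Finset.mem_univ,
        true_and] at hp
      simp only [orderedPairs, Finset.mem_filter, Finset.mem_univ, true_and, not_and, not_not] at hp'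
      have hne : p.1 ≠ p.2 := by intro h; rw [h] at hp; exact lt_irrefl _ hp
      rw [zt, hp' hp, mul_zero, neg_zero, vpow_zero, cf_eq, map_one, map_one, one_mul,
        div_self (sub_ne_zero.mpr (xvr_injective.ne hne))]
  rw [ztL_eq_prod_aux _ _ pos L hL, ← hsub, zetaDen, zetaNum, map_prod, map_prod,
    ← Finset.prod_mul_distrib]
  refine Finset.prod_congr rfl fun p hp => ?_
  have hne : xvr n p.1 - xvr n p.2 ≠ 0 := sub_ne_zero.mpr (xvr_injective.ne (orderedPairs_ne hp))
  rw [map_sub, map_sub, map_mul, ← cf_eq]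
  exact div_mul_cancel₀ _ hne

/-- The product of the Vandermonde determinants of all colours. -/
def vdm (k : Fin n → ℕ) : Pk n k :=
  ∏ i, (Matrix.vandermonde fun r : Fin (k i) => (X ⟨i, r⟩ : Pk n k)).det

/-- The colours, counted from the long root. -/
def col (u : Vars n k) : ℕ := n - 1 - u.1.1

lemma aC_ne_zero_of_lt {i j : Fin n} (h : i < j) : aC n (i.1 + 1) (j.1 + 1) ≠ 0 ↔ i.1 + 1 = j.1 := by
  have h' : i.1 < j.1 := h
  have := i.2; have := j.2
  unfold aC; split_ifs <;> constructor <;> intro h'' <;> omega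

lemma Dpoly_eq : Dpoly n (aC n) k = ∏ p ∈ Fr.edges (col (n := n) (k := k)), (X p.2 - X p.1) := by
  rw [Fr.edges, Finset.prod_filter, ← Finset.univ_product_univ, Finset.prod_product,
    Finset.prod_comm, Fintype.prod_sigma, Dpoly]
  refine Finset.prod_congr rfl fun i _ => ?_
  have : ∀ r : Fin (k i), (∏ x : Vars n k, if col x + 1 = col (⟨i, r⟩ : Vars n k) then
      (X ⟨i, r⟩ - X x : Pk n k) else 1) = ∏ j : Fin n, ∏ s : Fin (k j),
      if col (⟨j, s⟩ : Vars n k) + 1 = col (⟨i, r⟩ : Vars n k) then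
      (X ⟨i, r⟩ - X ⟨j, s⟩ : Pk n k) else 1 := fun r => Fintype.prod_sigma _
  simp_rw [this]
  rw [Finset.prod_comm]
  refine Finset.prod_congr rfl fun j _ => ?_
  have hi := i.2; have hj := j.2
  by_cases h : i < j ∧ aC n (i.1 + 1) (j.1 + 1) ≠ 0
  · rw [if_pos h]
    have h2 := (aC_ne_zero_of_lt h.1).mp h.2
    refine Finset.prod_congr rfl fun r _ => Finset.prod_congr rfl fun s _ => ?_
    rw [if_pos]
    simp only [col]; omega
  · rw [if_neg h]
    refine (Finset.prod_eq_one fun r _ => Finset.prod_eq_one fun s _ => ?_).symm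
    rw [if_neg]
    intro h3
    simp only [col] at h3
    have hlt : i < j := show i.1 < j.1 by omega
    exact h ⟨hlt, (aC_ne_zero_of_lt hlt).mpr (by omega)⟩

lemma Dpoly_ne_zero : Dpoly n (aC n) k ≠ 0 := by
  rw [Dpoly_eq]
  exact Finset.prod_ne_zero_iff.mpr fun p hp => X_sub_X_ne_zero (Fr.edges_ne hp).symm

lemma map_vandermonde {S S' : Type*} [CommRing S] [CommRing S'] {m : ℕ} (φ : S →+* S')
    (f : Fin m → S) : (Matrix.vandermonde f).map φ = Matrix.vandermonde fun r => φ (f r) := by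
  ext a b; simp [Matrix.vandermonde_apply]

lemma map_vdm_ne_zero {S : Type*} [CommRing S] [IsDomain S] (φ : Pk n k →+* S)
    (h : ∀ i (r s : Fin (k i)), φ (X ⟨i, r⟩) = φ (X ⟨i, s⟩) → r = s) : φ (vdm k) ≠ 0 := by
  rw [vdm, map_prod]
  refine Finset.prod_ne_zero_iff.mpr fun i _ => ?_
  rw [RingHom.map_det, RingHom.mapMatrix_apply, map_vandermonde,
    Matrix.det_vandermonde_ne_zero_iff]
  exact fun r s hrs => h i r s hrs

lemma vdm_ne_zero : vdm k ≠ 0 :=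
  map_vdm_ne_zero (RingHom.id _) fun i r s h => by simpa using X_injective h

lemma X_sub_X_dvd_vdm (i : Fin n) {r s : Fin (k i)} (h : r ≠ s) :
    (X ⟨i, r⟩ - X ⟨i, s⟩ : Pk n k) ∣ vdm k := by
  rw [X_sub_X_dvd_iff, vdm, map_prod]
  refine Finset.prod_eq_zero (Finset.mem_univ i) ?_
  rw [AlgHom.map_det, AlgHom.mapMatrix_apply, ← RingHom.coe_coe, map_vandermonde,
    Matrix.det_vandermonde_eq_zero_iff]
  exact ⟨r, s, by simp [subst, h.symm], h⟩

lemma zetaDen_dvd (pos : Vars n k → ℕ) : zetaDen pos ∣ Dpoly n (aC n) k * vdm k := by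
  refine Finset.prod_dvd_of_isRelPrime (fun p hp q hq hpq => ?_) fun p hp => ?_
  · refine isRelPrime_X_sub_X (orderedPairs_ne hp) (orderedPairs_ne hq)
      (fun h => hpq (Prod.ext h.1 h.2)) fun h => ?_
    have h1 := (Finset.mem_filter.mp hp).2.1
    have h2 := (Finset.mem_filter.mp hq).2.1
    rw [h.1, h.2] at h1
    exact lt_asymm h1 h2
  · obtain ⟨⟨i, r⟩, ⟨j, s⟩⟩ := p
    have h1 := (Finset.mem_filter.mp hp).2
    have hne := orderedPairs_ne hp
    dsimp only at h1 hne ⊢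
    have hi := i.2; have hj := j.2
    rcases lt_trichotomy i j with h | rfl | h
    · refine Dvd.dvd.mul_right ?_ _
      rw [Dpoly_eq]
      have h2 := (aC_ne_zero_of_lt h).mp h1.2
      refine Finset.dvd_prod_of_mem (fun p : Vars n k × Vars n k => (X p.2 - X p.1 : Pk n k))
        (a := (⟨j, s⟩, ⟨i, r⟩)) (Finset.mem_filter.mpr ⟨Finset.mem_univ _, ?_⟩)
      change n - 1 - j.1 + 1 = n - 1 - i.1
      omega
    · exact Dvd.dvd.mul_left (X_sub_X_dvd_vdm i fun h => hne (by rw [h])) _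
    · refine Dvd.dvd.mul_right ?_ _
      rw [Dpoly_eq]
      have h3 : aC n (j.1 + 1) (i.1 + 1) ≠ 0 := by
        intro h0
        have := dC_mul_aC (n := n) (i := i.1 + 1) (j := j.1 + 1) (by omega) (by omega)
        rw [h0, mul_zero] at this
        rcases mul_eq_zero.mp this with h4 | h4
        · exact dC_ne_zero n (i.1 + 1) (by exact_mod_cast h4)
        · exact h1.2 h4
      have h2 := (aC_ne_zero_of_lt h).mp h3
      rw [← neg_sub, neg_dvd]
      refine Finset.dvd_prod_of_mem (fun p : Vars n k × Vars n k => (X p.2 - X p.1 : Pk n k))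
        (a := (⟨i, r⟩, ⟨j, s⟩)) (Finset.mem_filter.mpr ⟨Finset.mem_univ _, ?_⟩)
      change n - 1 - i.1 + 1 = n - 1 - j.1
      omega

lemma topDeg_zetaDen (A : Finset (Vars n k)) (pos : Vars n k → ℕ) :
    topDeg A (zetaDen pos) = topDeg A (zetaNum pos) := by
  rw [zetaDen, zetaNum, topDeg_prod, topDeg_prod]
  · refine Finset.sum_congr rfl fun p hp => ?_
    have := topDeg_linear (R := KK) A (orderedPairs_ne hp) one_ne_zero
    rw [map_one, one_mul] at this
    rw [this, topDeg_linear A (orderedPairs_ne hp) (vpow_ne_zero _)]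
  · exact fun _ hp => X_sub_C_mul_X_ne_zero (orderedPairs_ne hp) _
  · exact fun _ hp => X_sub_X_ne_zero (orderedPairs_ne hp)

lemma lowDeg_zetaDen (A : Finset (Vars n k)) (pos : Vars n k → ℕ) :
    lowDeg A (zetaDen pos) = lowDeg A (zetaNum pos) := by
  rw [zetaDen, zetaNum, lowDeg_prod, lowDeg_prod]
  · refine Finset.sum_congr rfl fun p hp => ?_
    have := lowDeg_linear (R := KK) A (orderedPairs_ne hp) one_ne_zero
    rw [map_one, one_mul] at this
    rw [this, lowDeg_linear A (orderedPairs_ne hp) (vpow_ne_zero _)]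
  · exact fun _ hp => X_sub_C_mul_X_ne_zero (orderedPairs_ne hp) _
  · exact fun _ hp => X_sub_X_ne_zero (orderedPairs_ne hp)

section Wheel
variable {i j : Fin n} {m : ℕ} {hm : 0 < m} {s : Fin m → Fin (k i)} {r : Fin (k j)}

lemma wheelSub_center : wheelSub n (aC n) (dC n) i j m hm s r ⟨j, r⟩ =
    C (vpow ((dC n (i.1 + 1) : ℤ) * aC n (i.1 + 1) (j.1 + 1))) * X ⟨i, s ⟨0, hm⟩⟩ := by
  rw [wheelSub, if_pos rfl]

lemma wheelSub_chain (hij : i ≠ j) (hs : Function.Injective s) (t : Fin m) :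
    wheelSub n (aC n) (dC n) i j m hm s r ⟨i, s t⟩ =
      C (vpow ((dC n (i.1 + 1) : ℤ) * (-2 * (t.1 : ℤ)))) * X ⟨i, s ⟨0, hm⟩⟩ := by
  have hex : ∃ t' : Fin m, (⟨i, s t⟩ : Vars n k) = ⟨i, s t'⟩ := ⟨t, rfl⟩
  have hch : hex.choose = t := (hs (eq_of_heq (Sigma.mk.inj hex.choose_spec).2)).symm
  rw [wheelSub, if_neg (fun h => hij (congrArg Sigma.fst h)), dif_pos hex, hch]

lemma wheelSub_other {u : Vars n k} (h1 : u ≠ ⟨j, r⟩) (h2 : ∀ t, u ≠ ⟨i, s t⟩) :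
    wheelSub n (aC n) (dC n) i j m hm s r u = X u := by
  rw [wheelSub, if_neg h1, dif_neg (by push Not; exact h2)]

lemma C_vpow_mul {e e' e'' : ℤ} (h : e = e' + e'') (p : Pk n k) :
    C (vpow e) * p = C (vpow e') * (C (vpow e'') * p) := by
  rw [h, vpow_add, map_mul, mul_assoc]

lemma wheelSub_zetaNum (hij : i ≠ j) (hA : aC n (i.1 + 1) (j.1 + 1) < 0)
    (hm' : (m : ℤ) = 1 - aC n (i.1 + 1) (j.1 + 1)) (hs : Function.Injective s)
    {pos : Vars n k → ℕ} (hpos : Function.Injective pos) :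
    aeval (wheelSub n (aC n) (dC n) i j m hm s r) (zetaNum pos) = 0 := by
  by_contra hne
  set ω := wheelSub n (aC n) (dC n) i j m hm s r with hω
  have key : ∀ a b : Vars n k, aC n (a.1.1 + 1) (b.1.1 + 1) ≠ 0 →
      ω a = C (vpow (-((dC n (a.1.1 + 1) : ℤ) * aC n (a.1.1 + 1) (b.1.1 + 1)))) * ω b →
      pos b ≤ pos a := by
    intro a b h1 h2
    by_contra h3
    push Not at h3
    apply hne
    rw [zetaNum, map_prod]
    refine Finset.prod_eq_zero (i := (a, b)) ?_ ?_
    · simp [orderedPairs, h3, h1]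
    · simp only [map_sub, map_mul, aeval_X, aeval_C, algebraMap_eq, h2, sub_self]
  have hd := dC_mul_aC (n := n) (i := i.1 + 1) (j := j.1 + 1) i.2 j.2
  have hchain : ∀ t : ℕ, ∀ ht : t < m, pos ⟨i, s ⟨0, hm⟩⟩ ≤ pos ⟨i, s ⟨t, ht⟩⟩ := by
    intro t
    induction t with
    | zero => intro _; exact le_rfl
    | succ t ih =>
      intro ht
      refine (ih (by omega)).trans (key _ _ ?_ ?_)
      · simp [aC_self]
      · rw [hω, wheelSub_chain hij hs, wheelSub_chain hij hs]
        refine C_vpow_mul ?_ _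
        simp only [aC_self]
        push_cast; ring
  have h0 : pos ⟨j, r⟩ ≤ pos ⟨i, s ⟨0, hm⟩⟩ := by
    refine key _ _ hA.ne ?_
    rw [hω, wheelSub_chain hij hs, wheelSub_center]
    refine C_vpow_mul ?_ _
    simp
  have h1 : pos ⟨i, s ⟨m - 1, by omega⟩⟩ ≤ pos ⟨j, r⟩ := by
    refine key _ _ ?_ ?_
    · intro h0
      dsimp only at h0
      rw [h0, mul_zero] at hd
      rcases mul_eq_zero.mp hd with h4 | h4
      · exact dC_ne_zero n (i.1 + 1) (by exact_mod_cast h4)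
      · exact hA.ne h4
    · rw [hω, wheelSub_chain hij hs, wheelSub_center]
      refine C_vpow_mul ?_ _
      have h5 : ((m - 1 : ℕ) : ℤ) = - aC n (i.1 + 1) (j.1 + 1) := by omega
      simp only [h5]
      rw [← hd]; ring
  have h2 := hchain (m - 1) (by omega)
  have h3 : pos ⟨j, r⟩ = pos ⟨i, s ⟨0, hm⟩⟩ := le_antisymm h0 (h2.trans h1)
  exact hij (congrArg Sigma.fst (hpos h3)).symm

lemma wheelSub_vdm (hij : i ≠ j) (hs : Function.Injective s) :
    aeval (wheelSub n (aC n) (dC n) i j m hm s r) (vdm k) ≠ 0 := by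
  refine map_vdm_ne_zero (aeval (wheelSub n (aC n) (dC n) i j m hm s r)).toRingHom
    fun i' p q hpq => ?_
  simp only [AlgHom.toRingHom_eq_coe, RingHom.coe_coe, aeval_X] at hpq
  have hCX : ∀ (e : ℤ) (u u' : Vars n k), (C (vpow e) * X u : Pk n k) = X u' → u' = u := by
    intro e u u' h
    by_contra hne
    have := congrArg (aeval fun w => if w = u' then (1 : KK) else 0) h
    simp [Ne.symm hne] at this
  have hC2 : ∀ (e e' : ℤ) (u : Vars n k), (C (vpow e) * X u : Pk n k) = C (vpow e') * X u →
      e = e' := by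
    intro e e' u h
    have h1 := mul_right_cancel₀ (X_ne_zero u) h
    rw [C_inj] at h1
    by_contra hne
    have h2 : ∀ a b : ℤ, a < b → vpow a ≠ vpow b := by
      intro a b hab h
      have : vpow ((b - a).toNat : ℤ) = 1 := by
        rw [Int.toNat_of_nonneg (by omega), sub_eq_add_neg, vpow_add, vpow_neg, h,
          mul_inv_cancel₀ (vpow_ne_zero _)]
      exact vpow_natCast_ne_one (by omega) this
    rcases lt_or_gt_of_ne hne with h3 | h3
    · exact h2 _ _ h3 h1
    · exact h2 _ _ h3 h1.symm
  have hd : (dC n (i.1 + 1) : ℤ) ≠ 0 := by exact_mod_cast dC_ne_zero n (i.1 + 1)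
  by_cases hi' : i' = i
  · subst hi'
    have hj : ∀ p : Fin (k i'), (⟨i', p⟩ : Vars n k) ≠ ⟨j, r⟩ :=
      fun p h => hij (congrArg Sigma.fst h)
    have hoth : ∀ p : Fin (k i'), (∀ t, p ≠ s t) →
        wheelSub n (aC n) (dC n) i' j m hm s r ⟨i', p⟩ = X ⟨i', p⟩ := fun p hp =>
      wheelSub_other (hj p) fun t h => hp t (by simpa using h)
    by_cases hp : ∃ t, p = s t <;> by_cases hq : ∃ t, q = s t
    · obtain ⟨t, rfl⟩ := hp
      obtain ⟨t', rfl⟩ := hq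
      rw [wheelSub_chain hij hs, wheelSub_chain hij hs] at hpq
      have h1 := mul_left_cancel₀ hd (hC2 _ _ _ hpq)
      have : t = t' := Fin.ext (by omega)
      rw [this]
    · obtain ⟨t, rfl⟩ := hp
      push Not at hq
      rw [wheelSub_chain hij hs, hoth q hq] at hpq
      exact absurd (by simpa using hCX _ _ _ hpq) (hq ⟨0, hm⟩)
    · obtain ⟨t, rfl⟩ := hq
      push Not at hp
      rw [wheelSub_chain hij hs, hoth p hp] at hpq
      exact absurd (by simpa using hCX _ _ _ hpq.symm) (hp ⟨0, hm⟩)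
    · push Not at hp hq
      rw [hoth p hp, hoth q hq] at hpq
      simpa using X_injective hpq
  · have hoth : ∀ p : Fin (k i'), (⟨i', p⟩ : Vars n k) ≠ ⟨j, r⟩ →
        wheelSub n (aC n) (dC n) i j m hm s r ⟨i', p⟩ = X ⟨i', p⟩ := fun p hp =>
      wheelSub_other hp fun t h => hi' (congrArg Sigma.fst h)
    by_cases hp : (⟨i', p⟩ : Vars n k) = ⟨j, r⟩ <;> by_cases hq : (⟨i', q⟩ : Vars n k) = ⟨j, r⟩
    · simpa using hp.trans hq.symm
    · rw [hp, wheelSub_center, hoth q hq] at hpq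
      exact absurd (congrArg Sigma.fst (hCX _ _ _ hpq)) hi'
    · rw [hq, wheelSub_center, hoth p hp] at hpq
      exact absurd (congrArg Sigma.fst (hCX _ _ _ hpq.symm)) hi'
    · rw [hoth p hp, hoth q hq] at hpq
      simpa using X_injective hpq

end Wheel
end Numerators

/-! ### Images of words satisfy the pole and wheel conditions -/

section Image
set_option linter.unusedSectionVars false
variable {n : ℕ} {k : Fin n → ℕ}
open MvPolynomial

lemma topDeg_Dpoly (A : Finset (Vars n k)) : topDeg A (Dpoly n (aC n) k) =
    ((Fr.edges (col (n := n) (k := k))).filter fun p => p.1 ∈ A ∨ p.2 ∈ A).card := by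
  rw [Dpoly_eq, topDeg_prod, Finset.card_filter]
  · refine Finset.sum_congr rfl fun p hp => ?_
    have := topDeg_linear (R := KK) A (Fr.edges_ne hp).symm one_ne_zero
    rw [map_one, one_mul] at this
    rw [this]
    simp only [or_comm]
  · exact fun _ hp => X_sub_X_ne_zero (Fr.edges_ne hp).symm

lemma lowDeg_Dpoly (A : Finset (Vars n k)) : lowDeg A (Dpoly n (aC n) k) =
    ((Fr.edges (col (n := n) (k := k))).filter fun p => p.1 ∈ A ∧ p.2 ∈ A).card := by
  rw [Dpoly_eq, lowDeg_prod, Finset.card_filter]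
  · refine Finset.sum_congr rfl fun p hp => ?_
    have := lowDeg_linear (R := KK) A (Fr.edges_ne hp).symm one_ne_zero
    rw [map_one, one_mul] at this
    rw [this]
    simp only [and_comm]
  · exact fun _ hp => X_sub_X_ne_zero (Fr.edges_ne hp).symm

lemma rename_Dpoly (σ : PermFam k) :
    rename (permVf n σ) (Dpoly n (aC n) k) = Dpoly n (aC n) k := by
  rw [Dpoly_eq, map_prod]
  refine Finset.prod_equiv ((permVE σ).prodCongr (permVE σ)) (fun p => ?_) fun p _ => ?_
  · simp only [Fr.edges, Finset.mem_filter, Finset.mem_univ, true_and]; exact Iff.rfl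
  · simp [permVE_apply]

lemma rename_vdm (σ : PermFam k) : rename (permVf n σ) (vdm k) =
    (∏ i, ((Equiv.Perm.sign (σ i) : ℤ) : Pk n k)) * vdm k := by
  rw [vdm, map_prod, ← Finset.prod_mul_distrib]
  refine Finset.prod_congr rfl fun i _ => ?_
  rw [AlgHom.map_det, AlgHom.mapMatrix_apply, ← RingHom.coe_coe, map_vandermonde,
    ← Matrix.det_permute]
  congr 1
  ext r s
  simp [Matrix.vandermonde_apply, permVf]

/-- The bounds and zeros of the numerator of the image of a word. -/
lemma exists_term_numerator {M : ℕ} {L : List (Vars n k)} {r : Vars n k → ℕ} (hL : L.Nodup)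
    (hL1 : ∀ u, u ∈ L) (hr : ∀ u, r u ≤ M) :
    ∃ G : Pk n k, G ≠ 0 ∧ algebraMap (Pk n k) (Fk n k) G =
        term (aC n) (dC n) L (fun u => r u) * algebraMap _ _ (Dpoly n (aC n) k * vdm k) ∧
      (∀ A, topDeg A G ≤ M * A.card + topDeg A (Dpoly n (aC n) k * vdm k)) ∧
      (∀ A, lowDeg A (Dpoly n (aC n) k * vdm k) ≤ lowDeg A G) ∧
      ∀ (i j : Fin n), i ≠ j → aC n (i.1 + 1) (j.1 + 1) < 0 → ∀ (m : ℕ) (hm : 0 < m),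
        (m : ℤ) = 1 - aC n (i.1 + 1) (j.1 + 1) → ∀ s : Fin m → Fin (k i), Function.Injective s →
        ∀ t : Fin (k j), aeval (wheelSub n (aC n) (dC n) i j m hm s t) G = 0 := by
  obtain ⟨Q, hQ⟩ := zetaDen_dvd (fun u => L.idxOf u)
  set pos : Vars n k → ℕ := fun u => L.idxOf u with hpos
  have hinj : Function.Injective pos := fun a b h => (List.idxOf_inj (hL1 a)).mp h
  have hpw : L.Pairwise fun a b => pos a < pos b := by
    rw [List.pairwise_iff_getElem]
    intro i j hi hj hij
    simp only [hpos]
    rwa [hL.idxOf_getElem, hL.idxOf_getElem]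
  have hD0 : Dpoly n (aC n) k * vdm k ≠ 0 := mul_ne_zero Dpoly_ne_zero vdm_ne_zero
  have hQ0 : Q ≠ 0 := by rintro rfl; exact hD0 (by rw [hQ, mul_zero])
  set e : Vars n k →₀ ℕ := Finsupp.equivFunOnFinite.symm r with he
  have hm0 : (monomial e 1 : Pk n k) ≠ 0 := by simp
  refine ⟨monomial e 1 * (zetaNum pos * Q), mul_ne_zero hm0 (mul_ne_zero (zetaNum_ne_zero _) hQ0),
    ?_, fun A => ?_, fun A => ?_, fun i j hij hA m hm hm' s hs t => ?_⟩
  · rw [hQ, map_mul, map_mul, map_mul, ← ztL_mul_zetaDen pos L hpw hL1, term]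
    have : (L.map fun u => xvr n u ^ ((r u : ℕ) : ℤ)).prod =
        algebraMap (Pk n k) (Fk n k) (monomial e 1) := by
      have hu : L.toFinset = Finset.univ := by ext u; simp [hL1 u]
      rw [← List.prod_toFinset _ hL, hu, monomial_eq, map_one, one_mul,
        Finsupp.prod_fintype _ _ (by simp), map_prod]
      refine Finset.prod_congr rfl fun u _ => ?_
      rw [map_pow, zpow_natCast]; rfl
    rw [this]; ring
  · rw [topDeg_mul A hm0 (mul_ne_zero (zetaNum_ne_zero _) hQ0), topDeg_mul A (zetaNum_ne_zero _) hQ0,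
      hQ, topDeg_mul A (zetaDen_ne_zero _) hQ0, topDeg_zetaDen]
    refine Nat.add_le_add_right ?_ _
    rw [topDeg, spread_monomial, Polynomial.natDegree_monomial_eq _ (by simp)]
    refine (Finset.sum_le_sum fun u _ => hr u).trans ?_
    simp [mul_comm]
  · rw [lowDeg_mul A hm0 (mul_ne_zero (zetaNum_ne_zero _) hQ0), lowDeg_mul A (zetaNum_ne_zero _) hQ0,
      hQ, lowDeg_mul A (zetaDen_ne_zero _) hQ0, lowDeg_zetaDen]
    exact Nat.le_add_left _ _
  · rw [map_mul, map_mul, wheelSub_zetaNum hij hA hm' hs hinj, zero_mul, mul_zero]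

lemma vdm_eq_prod : vdm k = ∏ x ∈ (Finset.univ : Finset (Fin n)).sigma fun i =>
    (Finset.univ : Finset (Fin (k i))).sigma fun r => Finset.Ioi r,
      (X ⟨x.1, x.2.2⟩ - X ⟨x.1, x.2.1⟩ : Pk n k) := by
  rw [vdm, Finset.prod_sigma]
  refine Finset.prod_congr rfl fun i _ => ?_
  rw [Matrix.det_vandermonde, Finset.prod_sigma]

/-- A polynomial that changes sign under transpositions is divisible by the Vandermonde product. -/
lemma vdm_dvd {H : Pk n k} (h : ∀ i (r s : Fin (k i)), r ≠ s →
    rename (permVf n (Pi.mulSingle i (Equiv.swap r s) : PermFam k)) H = - H) : vdm k ∣ H := by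
  rw [vdm_eq_prod]
  refine Finset.prod_dvd_of_isRelPrime (fun x hx y hy hxy => ?_) fun x hx => ?_
  · obtain ⟨i, r, s⟩ := x
    obtain ⟨j, r', s'⟩ := y
    simp only [Finset.coe_sigma, Set.mem_sigma_iff, Finset.coe_univ, Set.mem_univ, true_and,
      Finset.coe_Ioi, Set.mem_Ioi] at hx hy
    refine isRelPrime_X_sub_X ?_ ?_ ?_ ?_
    · simpa using hx.ne'
    · simpa using hy.ne'
    · rintro ⟨h1, h2⟩
      obtain rfl : i = j := congrArg Sigma.fst h1
      simp only [Sigma.mk.injEq, heq_eq_eq, true_and] at h1 h2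
      subst h1 h2
      exact hxy rfl
    · rintro ⟨h1, h2⟩
      obtain rfl : i = j := congrArg Sigma.fst h1
      simp only [Sigma.mk.injEq, heq_eq_eq, true_and] at h1 h2
      subst h1 h2
      exact lt_asymm hx hy
  · obtain ⟨i, r, s⟩ := x
    simp only [Finset.mem_sigma, Finset.mem_univ, true_and, Finset.mem_Ioi] at hx
    rw [X_sub_X_dvd_iff]
    have h1 := congrArg (subst (⟨i, s⟩ : Vars n k) ⟨i, r⟩) (h i s r hx.ne')
    have h2 : (subst (R := KK) (⟨i, s⟩ : Vars n k) ⟨i, r⟩).comp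
        (rename (permVf n (Pi.mulSingle i (Equiv.swap s r) : PermFam k))) = subst ⟨i, s⟩ ⟨i, r⟩ := by
      refine algHom_ext fun u => ?_
      obtain ⟨j, t⟩ := u
      by_cases hj : j = i
      · subst hj
        simp only [AlgHom.comp_apply, rename_X, permVf, Pi.mulSingle_eq_same, subst, aeval_X,
          Sigma.mk.injEq, heq_eq_eq, true_and, Equiv.swap_apply_def]
        split_ifs <;> simp_all
      · simp [subst, permVf, hj]
    have h3 := AlgHom.congr_fun h2 H
    rw [AlgHom.comp_apply, h1, map_neg] at h3
    exact self_eq_neg.mp h3.symm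

/-- The part of the shuffle algebra with partial degrees bounded by those of the words with
modes between `0` and `M`. -/
def InX (M : ℕ) (F : Fk n k) : Prop :=
  ∃ f : Pk n k, symmQ n f ∧ wheelQ n (aC n) (dC n) f ∧
    (∀ d ∈ f.support, Fr.InWindow (col (n := n) (k := k)) M d) ∧
    F * algebraMap (Pk n k) (Fk n k) (Dpoly n (aC n) k) = algebraMap (Pk n k) (Fk n k) f

lemma inX_Sy_term {M : ℕ} {L : List (Vars n k)} {r : Vars n k → ℕ} (hL : L.Nodup)
    (hL1 : ∀ u, u ∈ L) (hr : ∀ u, r u ≤ M) :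
    InX M (Sy (term (aC n) (dC n) L fun u => r u)) := by
  set t := term (aC n) (dC n) L fun u => (r u : ℤ) with ht
  set D := Dpoly n (aC n) k with hD
  have hG : ∀ σ : PermFam k, _ := fun σ => exists_term_numerator (M := M)
    (L := L.map (permVf n σ)) (r := fun u => r ((permVE σ).symm u))
    (hL.map (permVf_inj n σ)) (fun u => List.mem_map.mpr ⟨(permVE σ).symm u, hL1 _, by
      rw [← permVE_apply, Equiv.apply_symm_apply]⟩) (fun u => hr _)
  choose G hG0 hG1 hG2 hG3 hG4 using hG
  have hG1' : ∀ σ, algebraMap (Pk n k) (Fk n k) (G σ) =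
      permF n σ t * algebraMap _ _ (D * vdm k) := by
    intro σ
    rw [hG1, ht, permF_term]
  set H := ∑ σ, G σ with hH
  have hHeq : algebraMap (Pk n k) (Fk n k) H = Sy t * algebraMap _ _ (D * vdm k) := by
    rw [hH, map_sum, Sy_apply, Finset.sum_mul]
    exact Finset.sum_congr rfl fun σ _ => hG1' σ
  have hinj : Function.Injective (algebraMap (Pk n k) (Fk n k)) :=
    IsFractionRing.injective (Pk n k) (Fk n k)
  have hren : ∀ (σ : PermFam k) (p : Pk n k), algebraMap (Pk n k) (Fk n k) (rename (permVf n σ) p) =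
      permF n σ (algebraMap _ _ p) := fun σ p => by simp [permF]
  obtain ⟨f, hf⟩ : vdm k ∣ H := by
    refine vdm_dvd fun i r' s' hrs => hinj ?_
    rw [hren, hHeq, map_mul, permF_Sy, ← hren, map_mul, rename_Dpoly, rename_vdm, map_neg, hHeq]
    have : ∏ j, ((Equiv.Perm.sign ((Pi.mulSingle i (Equiv.swap r' s') : PermFam k) j) : ℤ) : Pk n k)
        = -1 := by
      rw [Finset.prod_eq_single i]
      · simp [Equiv.Perm.sign_swap hrs]
      · intro j _ hj
        simp [Pi.mulSingle_eq_of_ne hj]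
      · simp
    rw [this, neg_one_mul, mul_neg, map_neg, mul_neg]
  have hfeq : Sy t * algebraMap (Pk n k) (Fk n k) D = algebraMap _ _ f := by
    have h0 := algebraMap_Fk_ne_zero (n := n) (k := k) vdm_ne_zero
    refine mul_right_cancel₀ h0 ?_
    rw [mul_assoc, ← map_mul, ← hHeq, hf, map_mul, mul_comm]
  refine ⟨f, fun σ => hinj ?_, ?_, ?_, hfeq⟩
  · rw [hren, ← hfeq, map_mul, permF_Sy, ← hren, rename_Dpoly]
  · intro i j hij hA s hs u
    have h1 : aeval (wheelSub n (aC n) (dC n) i j _ (by omega) s u) H = 0 := by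
      rw [hH, map_sum]
      exact Finset.sum_eq_zero fun σ _ => hG4 σ i j hij hA _ _ (by omega) s hs u
    rw [hf, map_mul] at h1
    exact (mul_eq_zero.mp h1).resolve_left (wheelSub_vdm hij hs)
  · intro d hd A
    have hf0 : f ≠ 0 := by rintro rfl; simp at hd
    have hH0 : H ≠ 0 := by rw [hf]; exact mul_ne_zero vdm_ne_zero hf0
    have h1 := topDeg_sum_le A Finset.univ G _ fun σ _ => hG2 σ A
    have h2 := le_lowDeg_sum A Finset.univ G _ (fun σ _ => hG0 σ) (fun σ _ => hG3 σ A) hH0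
    rw [← hH, hf, topDeg_mul A vdm_ne_zero hf0, topDeg_mul A Dpoly_ne_zero vdm_ne_zero,
      topDeg_Dpoly] at h1
    rw [← hH, hf, lowDeg_mul A vdm_ne_zero hf0, lowDeg_mul A Dpoly_ne_zero vdm_ne_zero,
      lowDeg_Dpoly] at h2
    have h3 := le_topDeg A hd
    have h4 := lowDeg_le A hd
    constructor <;> omega

lemma InX.add {M : ℕ} {F G : Fk n k} (hF : InX M F) (hG : InX M G) : InX M (F + G) := by
  obtain ⟨f, h1, h2, h3, h4⟩ := hF
  obtain ⟨g, h1', h2', h3', h4'⟩ := hG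
  refine ⟨f + g, fun σ => by rw [map_add, h1, h1'], fun i j hij hA s hs r => by
    rw [map_add, h2 i j hij hA s hs, h2' i j hij hA s hs, add_zero], fun d hd => ?_, by
    rw [add_mul, h4, h4', map_add]⟩
  rcases Finset.mem_union.mp (support_add hd) with h | h
  · exact h3 d h
  · exact h3' d h

lemma InX.smul {M : ℕ} {F : Fk n k} (c : KK) (hF : InX M F) : InX M (c • F) := by
  obtain ⟨f, h1, h2, h3, h4⟩ := hF
  refine ⟨c • f, fun σ => by rw [map_smul, h1], fun i j hij hA s hs r => by
    rw [map_smul, h2 i j hij hA s hs, smul_zero], fun d hd => h3 d (support_smul hd), ?_⟩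
  rw [smul_mul_assoc, h4, smul_eq_cf, cf_eq, ← map_mul, smul_eq_C_mul]

/-- The space of elements of bounded partial degree as a subspace. -/
def spaceX (k : Fin n → ℕ) (M : ℕ) : Submodule KK (Fk n k) where
  carrier := {F | InX M F}
  add_mem' := InX.add
  zero_mem' := ⟨0, fun _ => map_zero _, fun _ _ _ _ _ _ _ => map_zero _, by simp, by simp⟩
  smul_mem' := fun c _ h => InX.smul c h

lemma rename_xProd (σ : PermFam k) : rename (permVf n σ) (xProd n k) = xProd n k := by
  rw [xProd, map_prod]
  exact Fintype.prod_equiv (permVE σ) _ _ fun u => by simp [permVE_apply]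

lemma xProd_ne_zero : xProd n k ≠ 0 := Finset.prod_ne_zero_iff.mpr fun _ _ => X_ne_zero _

lemma Sy_mul_xProd (F : Fk n k) (m : ℤ) : Sy (F * algebraMap (Pk n k) (Fk n k) (xProd n k) ^ m) =
    Sy F * algebraMap (Pk n k) (Fk n k) (xProd n k) ^ m := by
  rw [Sy_apply, Sy_apply, Finset.sum_mul]
  refine Finset.sum_congr rfl fun σ _ => ?_
  rw [map_mul, map_zpow₀]
  congr 2
  simp [permF, rename_xProd]

lemma term_shift {A : ℕ → ℕ → ℤ} {Dd : ℕ → ℕ} {L : List (Vars n k)} (hL : L.Nodup)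
    (hL1 : ∀ u, u ∈ L) (r : Vars n k → ℤ) (m : ℤ) : term A Dd L (fun u => r u + m) =
      term A Dd L r * algebraMap (Pk n k) (Fk n k) (xProd n k) ^ m := by
  have hu : L.toFinset = Finset.univ := by ext u; simp [hL1 u]
  have : (L.map fun u => xvr n u ^ (r u + m)).prod = (L.map fun u => xvr n u ^ r u).prod *
      algebraMap (Pk n k) (Fk n k) (xProd n k) ^ m := by
    rw [← List.prod_toFinset _ hL, ← List.prod_toFinset _ hL, hu, xProd, map_prod,
      ← Finset.prod_zpow, ← Finset.prod_mul_distrib]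
    exact Finset.prod_congr rfl fun u _ => zpow_add₀ (xvr_ne_zero u) _ _
  rw [term, term, this]; ring

lemma inS_iff {F : Fk n k} : inS n (aC n) (dC n) F ↔
    ∃ m M : ℕ, InX M (F * algebraMap (Pk n k) (Fk n k) (xProd n k) ^ m) := by
  constructor
  · rintro ⟨f, m, h1, h2, h3⟩
    set e := Fintype.card (Vars n k × Vars n k) with he
    refine ⟨m + e, f.totalDegree + e, f * xProd n k ^ e, fun σ => ?_, fun i j hij hA s hs r => ?_,
      fun d hd A => ?_, ?_⟩
    · rw [map_mul, h1, map_pow, rename_xProd]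
    · rw [map_mul, h2 i j hij hA s hs, zero_mul]
    · have hx : xProd n k ^ e = monomial (Finsupp.equivFunOnFinite.symm fun _ => e) 1 := by
        rw [monomial_eq, map_one, one_mul, Finsupp.prod_fintype _ _ (by simp), xProd,
          ← Finset.prod_pow]
        rfl
      rw [hx, mul_comm, mem_support_iff, coeff_monomial_mul'] at hd
      split_ifs at hd with hle
      swap
      · exact absurd rfl hd
      rw [one_mul] at hd
      set g := Finsupp.equivFunOnFinite.symm (fun _ : Vars n k => e) with hg
      have hdu : ∀ u, e ≤ d u := fun u => hle u
      have hdeg : ∑ v ∈ A, (d - g) v ≤ f.totalDegree * A.card := by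
        rw [mul_comm, ← smul_eq_mul]
        refine Finset.sum_le_card_nsmul _ _ _ fun v _ => ?_
        have h5 := le_totalDegree (mem_support_iff.mpr hd)
        refine le_trans ?_ h5
        by_cases hv : v ∈ (d - g).support
        · exact Finset.single_le_sum (f := fun v => (d - g) v) (fun _ _ => Nat.zero_le _) hv
        · rw [Finsupp.notMem_support_iff.mp hv]; exact Nat.zero_le _
      have hsum : ∑ v ∈ A, d v = ∑ v ∈ A, (d - g) v + A.card * e := by
        rw [← smul_eq_mul, ← Finset.sum_const, ← Finset.sum_add_distrib]
        refine Finset.sum_congr rfl fun v _ => ?_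
        have : (d - g) v = d v - e := rfl
        rw [this, Nat.sub_add_cancel (hdu v)]
      constructor
      · rcases A.eq_empty_or_nonempty with rfl | hA
        · simp
        · have h6 : ((Fr.edges (col (n := n) (k := k))).filter fun p =>
              p.1 ∈ A ∧ p.2 ∈ A).card ≤ e := Finset.card_le_univ _
          have h7 : 1 * e ≤ A.card * e := Nat.mul_le_mul_right _ (Finset.card_pos.mpr hA)
          omega
      · rw [hsum, add_mul, mul_comm A.card e]
        omega
    · rw [map_mul, ← h3, map_mul, map_pow, map_pow, pow_add]; ring
  · rintro ⟨m, M, f, h1, h2, _, h4⟩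
    exact ⟨f, m, h1, h2, by rw [← h4, map_mul, map_pow]; ring⟩

end Image

/-! ### Leading coefficients of products along root words -/

section BlockFunctions
set_option linter.unusedSectionVars false
attribute [local instance] LieRing.ofAssociativeRing

/-- Twice the symmetrised Cartan matrix, with colours numbered from the long node. -/
def bil (i j : ℕ) : ℤ :=
  if i = j then (if i = 0 then 8 else 4)
  else if i + 1 = j ∨ j + 1 = i then (if i = 0 ∨ j = 0 then -4 else -2) else 0

namespace Fr
variable {V : Type*} [DecidableEq V]

/-- `F` is regular at `x_v = 0` with value `G`. -/
def Lead (v : V) (F G : Fr V) : Prop :=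
  ∃ p : PowerSeries (Fr V), expand v F = HahnSeries.ofPowerSeries ℤ _ p ∧
    PowerSeries.constantCoeff p = G

section Lead
variable {v : V} {F G F' G' : Fr V}

lemma Lead.mul (h : Lead v F G) (h' : Lead v F' G') : Lead v (F * F') (G * G') := by
  obtain ⟨p, h1, rfl⟩ := h
  obtain ⟨q, h2, rfl⟩ := h'
  exact ⟨p * q, by rw [map_mul, map_mul, h1, h2], by rw [map_mul]⟩

lemma Lead.add (h : Lead v F G) (h' : Lead v F' G') : Lead v (F + F') (G + G') := by
  obtain ⟨p, h1, rfl⟩ := h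
  obtain ⟨q, h2, rfl⟩ := h'
  exact ⟨p + q, by rw [map_add, map_add, h1, h2], by rw [map_add]⟩

lemma Lead.of_indep (h : F ∈ indep v) : Lead v F F :=
  ⟨PowerSeries.C F, by rw [HahnSeries.ofPowerSeries_C]; exact h, by simp⟩

lemma lead_x_self : Lead v (x v) 0 :=
  ⟨PowerSeries.X, by rw [HahnSeries.ofPowerSeries_X, expand_x_self], by simp⟩

lemma Lead.inv (h : Lead v F G) (hG : G ≠ 0) : Lead v F⁻¹ G⁻¹ := by
  obtain ⟨p, h1, rfl⟩ := h
  refine ⟨p⁻¹, ?_, by simp⟩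
  rw [map_inv₀, h1]
  refine inv_eq_of_mul_eq_one_right ?_
  rw [← map_mul, PowerSeries.mul_inv_cancel _ hG, map_one]

lemma Lead.neg (h : Lead v F G) : Lead v (-F) (-G) := by
  obtain ⟨p, h1, rfl⟩ := h
  exact ⟨-p, by rw [map_neg, map_neg, h1], by rw [map_neg]⟩

lemma Lead.sub (h : Lead v F G) (h' : Lead v F' G') : Lead v (F - F') (G - G') := by
  rw [sub_eq_add_neg, sub_eq_add_neg]; exact h.add h'.neg

lemma Lead.sum {ι : Type*} (s : Finset ι) {f g : ι → Fr V} (h : ∀ i ∈ s, Lead v (f i) (g i)) :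
    Lead v (∑ i ∈ s, f i) (∑ i ∈ s, g i) := by
  classical
  induction s using Finset.induction_on with
  | empty => exact Lead.of_indep (zero_mem _)
  | insert a s ha ih =>
    rw [Finset.sum_insert ha, Finset.sum_insert ha]
    exact (h a (by simp)).add (ih fun i hi => h i (Finset.mem_insert_of_mem hi))

lemma Lead.prod {ι : Type*} (s : Finset ι) {f g : ι → Fr V} (h : ∀ i ∈ s, Lead v (f i) (g i)) :
    Lead v (∏ i ∈ s, f i) (∏ i ∈ s, g i) := by
  classical
  induction s using Finset.induction_on with
  | empty => exact Lead.of_indep (one_mem _)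
  | insert a s ha ih =>
    rw [Finset.prod_insert ha, Finset.prod_insert ha]
    exact (h a (by simp)).mul (ih fun i hi => h i (Finset.mem_insert_of_mem hi))

lemma Lead.γ_zero (h : Lead v F G) : γ v 0 F = G := by
  obtain ⟨p, h1, rfl⟩ := h
  rw [γ_apply, h1, ← Nat.cast_zero, HahnSeries.ofPowerSeries_apply_coeff]
  simp

lemma γ_x_pow_mul (k : ℕ) (r : ℤ) (F : Fr V) : γ v r (x v ^ k * F) = γ v (r - k) F := by
  induction k generalizing r with
  | zero => simp
  | succ k ih =>
    rw [pow_succ', mul_assoc, γ_x_self_mul, ih]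
    congr 2; push_cast; ring

lemma algebraMap_mem_indep (q : ℚ) : algebraMap ℚ (Fr V) q ∈ indep v := by
  rw [eq_ratCast]; exact SubfieldClass.ratCast_mem (indep v) q

end Lead

variable (c rk : V → ℕ) (μ : ℕ → ℕ)

/-- The factor of `blockFn` attached to a variable. -/
def chi (S : Finset V) (A : V → ℚ) (l : V) : Fr V :=
  algebraMap ℚ _ (A l) + ∑ a ∈ S with rk a < rk l, algebraMap ℚ _ (bil (c a) (c l) : ℚ) *
    (x l * (x a - x l)⁻¹)

/-- The classical limit of an iterated `q`-bracket, with constant terms `A`. -/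
def blockFn (S : Finset V) (A : V → ℚ) : Fr V := ∏ l ∈ S, x l ^ μ (c l) * chi c rk S A l

/-- Constant terms after the removal of `v`. -/
def drop (v : V) (A : V → ℚ) (l : V) : ℚ := if rk v < rk l then A l - bil (c v) (c l) else A l

variable {c rk μ}

lemma lead_chi_self {S : Finset V} {A : V → ℚ} (v : V) :
    Lead v (chi c rk S A v) (algebraMap ℚ _ (A v)) := by
  rw [chi]
  have : Lead v (∑ a ∈ S with rk a < rk v, algebraMap ℚ (Fr V) (bil (c a) (c v) : ℚ) *
      (x v * (x a - x v)⁻¹)) (∑ a ∈ S with rk a < rk v, 0) := by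
    refine Lead.sum _ fun a ha => ?_
    have hav : a ≠ v := by rintro rfl; simp at ha
    have h1 : Lead v (x a - x v) (x a - 0) := (Lead.of_indep (x_mem_indep hav)).sub lead_x_self
    have h2 := (Lead.of_indep (algebraMap_mem_indep (v := v) (bil (c a) (c v) : ℚ))).mul
      (lead_x_self.mul (h1.inv (by simpa using x_ne_zero a)))
    simpa using h2
  simpa using (Lead.of_indep (algebraMap_mem_indep (v := v) (A v))).add this

lemma lead_chi {S : Finset V} {A : V → ℚ} {v l : V} (hv : v ∈ S) (hl : l ≠ v) :
    Lead v (chi c rk S A l) (chi c rk (S.erase v) (drop c rk v A) l) := by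
  have key : ∀ a ≠ v, rk a < rk l →
      Lead v (algebraMap ℚ (Fr V) (bil (c a) (c l) : ℚ) * (x l * (x a - x l)⁻¹))
        (algebraMap ℚ (Fr V) (bil (c a) (c l) : ℚ) * (x l * (x a - x l)⁻¹)) := fun a ha _ =>
    Lead.of_indep (mul_mem (algebraMap_mem_indep _) (mul_mem (x_mem_indep hl)
      (inv_mem (sub_mem (x_mem_indep ha) (x_mem_indep hl)))))
  by_cases h : rk v < rk l
  · have h1 : S.filter (fun a => rk a < rk l) =
        insert v ((S.erase v).filter fun a => rk a < rk l) := by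
      ext a; simp only [Finset.mem_filter, Finset.mem_insert, Finset.mem_erase]
      constructor
      · rintro ⟨h1, h2⟩; by_cases hav : a = v <;> simp [hav, h1, h2]
      · rintro (rfl | h1); exacts [⟨hv, h⟩, ⟨h1.1.2, h1.2⟩]
    rw [chi, chi, h1, Finset.sum_insert (by simp), drop, if_pos h]
    have h2 : Lead v (x l * (x v - x l)⁻¹) (-1) := by
      have := (Lead.of_indep (x_mem_indep hl)).mul
        ((lead_x_self.sub (Lead.of_indep (x_mem_indep hl))).inv
          (by simpa using x_ne_zero l))
      rwa [zero_sub, inv_neg, mul_neg, mul_inv_cancel₀ (x_ne_zero l)] at this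
    have h3 := (Lead.of_indep (algebraMap_mem_indep (v := v) (A l))).add
      (((Lead.of_indep (algebraMap_mem_indep (v := v) (bil (c v) (c l) : ℚ))).mul h2).add
      (Lead.sum ((S.erase v).filter fun a => rk a < rk l) fun a ha =>
        key a (by rintro rfl; simp at ha) (by simp at ha; exact ha.2)))
    convert h3 using 1
    rw [map_sub]; ring
  · have h1 : S.filter (fun a => rk a < rk l) = (S.erase v).filter fun a => rk a < rk l := by
      ext a; simp only [Finset.mem_filter, Finset.mem_erase]
      constructor
      · rintro ⟨h1, h2⟩; exact ⟨⟨by rintro rfl; exact h h2, h1⟩, h2⟩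
      · rintro ⟨h1, h2⟩; exact ⟨h1.2, h2⟩
    rw [chi, chi, h1, drop, if_neg h]
    exact (Lead.of_indep (algebraMap_mem_indep _)).add (Lead.sum _ fun a ha =>
        key a (by rintro rfl; simp at ha) (by simp at ha; exact ha.2))

lemma γ_blockFn {S : Finset V} {A : V → ℚ} {v : V} (hv : v ∈ S) :
    γ v (μ (c v)) (blockFn c rk μ S A) = A v • blockFn c rk μ (S.erase v) (drop c rk v A) := by
  rw [blockFn, ← Finset.mul_prod_erase S _ hv, mul_assoc, γ_x_pow_mul, sub_self, blockFn,
    Algebra.smul_def]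
  apply Lead.γ_zero
  refine (lead_chi_self v).mul (Lead.prod _ fun l hl => ?_)
  rw [Finset.mem_erase] at hl
  exact (Lead.of_indep (pow_mem (x_mem_indep hl.1) _)).mul (lead_chi hv hl.1)

variable (c rk) in
/-- Iterated leading coefficients of `blockFn` along a word of colours. -/
def leadVal : List ℕ → Finset V → (V → ℚ) → ℚ
  | [], S, _ => if S = ∅ then 1 else 0
  | i :: w, S, A => ∑ v ∈ S with c v = i, A v * leadVal w (S.erase v) (drop c rk v A)

lemma leadVal_congr (w : List ℕ) {S : Finset V} {A A' : V → ℚ} (h : ∀ v ∈ S, A v = A' v) :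
    leadVal c rk w S A = leadVal c rk w S A' := by
  induction w generalizing S A A' with
  | nil => rfl
  | cons i w ih =>
    rw [leadVal, leadVal]
    refine Finset.sum_congr rfl fun v hv => ?_
    rw [h v (Finset.mem_filter.mp hv).1, ih]
    intro l hl
    rw [drop, drop, h l (Finset.mem_of_mem_erase hl)]

variable [Fintype V] {n : ℕ}

/-- The free algebra element attached to a word of colours. -/
def colorWord (n : ℕ) (μ : ℕ → ℕ) (w : List ℕ) : FreeAlgebra ℚ (Fin n × ℤ) :=
  (w.map fun i => genF n ℤ i (-(μ i : ℤ))).prod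

lemma actE_genF_blockFn (hc : ∀ v, c v < n) (i : ℕ) (S : Finset V) (A : V → ℚ) :
    actE c n (genF n ℤ i (-(μ i : ℤ))) (Pi.single S (blockFn c rk μ S A)) =
      ∑ v ∈ S with c v = i,
        A v • Pi.single (S.erase v) (blockFn c rk μ (S.erase v) (drop c rk v A)) := by
  rw [actE_genF hc, colorOp_single]
  refine Finset.sum_congr rfl fun v hv => ?_
  rw [Finset.mem_filter] at hv
  rw [neg_neg, ← hv.2, γ_blockFn hv.1, Pi.single_smul]

lemma actE_colorWord (hc : ∀ v, c v < n) (w : List ℕ) (S : Finset V) (A : V → ℚ) :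
    actE c n (colorWord n μ w) (Pi.single S (blockFn c rk μ S A)) ∅ =
      algebraMap ℚ (Fr V) (leadVal c rk w S A) := by
  induction w generalizing S A with
  | nil =>
    rw [colorWord, List.map_nil, List.prod_nil, actE_one, leadVal, Module.End.one_apply]
    split_ifs with h
    · subst h; simp [blockFn]
    · rw [Pi.single_eq_of_ne (Ne.symm h), map_zero]
  | cons i w ih =>
    rw [colorWord, List.map_cons, List.prod_cons, actE_mul_apply, actE_genF_blockFn hc, map_sum,
      Finset.sum_apply, leadVal, map_sum]
    refine Finset.sum_congr rfl fun v _ => ?_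
    rw [map_smul, Pi.smul_apply, ← colorWord, ih, Algebra.smul_def, map_mul]

lemma actE_lnc_blockFn (hc : ∀ v, c v < n) (t : ℕ) (w : List ℕ) (hw : t ∉ w) (S : Finset V)
    (A : V → ℚ) (hA : ∀ v ∈ S, c v ≠ t → A v = 0) :
    actE c n (lnc (genF n ℤ t (-(μ t : ℤ))) (w.map fun i => genF n ℤ i (-(μ i : ℤ))))
        (Pi.single S (blockFn c rk μ S A)) =
      actE c n (colorWord n μ (t :: w)) (Pi.single S (blockFn c rk μ S A)) := by
  induction w using List.reverseRecOn with
  | nil => simp [lnc, colorWord]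
  | append_singleton w i ih =>
    simp only [List.mem_append, List.mem_singleton, not_or] at hw
    rw [List.map_append, lnc_append, ← List.cons_append, colorWord, List.map_append,
      List.prod_append, ← colorWord]
    simp only [List.map_cons, List.map_nil, lnc, List.foldl_cons, List.foldl_nil, List.prod_cons,
      List.prod_nil, mul_one]
    rw [LieRing.of_associative_ring_bracket, map_sub, LinearMap.sub_apply, actE_mul_apply,
      actE_mul_apply, actE_mul_apply, actE_genF_blockFn hc, Finset.sum_eq_zero, map_zero, sub_zero]
    · have := ih hw.1
      rw [lnc] at this
      rw [this]
    · intro v hv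
      rw [Finset.mem_filter] at hv
      rw [hA v hv.1 (by rw [hv.2]; exact Ne.symm hw.2), zero_smul]

end Fr
end BlockFunctions

/-! ### Values of root vectors on classical limits -/

section BlockValues
set_option linter.unusedSectionVars false
attribute [local instance] LieRing.ofAssociativeRing

lemma rtail_cons (t c d : ℕ) : rtail t c (d + 1) =
    (if 0 < c then [t + 1, t + 1] else [t + 1]) ++ rtail (t + 1) (c - 1) d := by
  induction d with
  | zero => simp [rtail]
  | succ d ih =>
    rw [rtail, ih, List.append_assoc, rtail]
    congr 2
    have : (d + 1 < c) ↔ (d < c - 1) := by omega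
    simp only [this]
    split_ifs <;> simp <;> omega

namespace Fr
variable {V : Type*} [DecidableEq V] {c rk : V → ℕ}

variable (c) in
/-- Constant terms for which the leading coefficient along the colours of the list is positive. -/
inductive Ok : (V → ℚ) → List V → Prop
  | nil (A : V → ℚ) : Ok A []
  | single (A : V → ℚ) (l : V) (L : List V) (h : c l ∉ L.map c) (hA : 0 < A l)
      (hL : Ok (fun u => A u - bil (c l) (c u)) L) : Ok A (l :: L)
  | double (A : V → ℚ) (l l' : V) (L : List V) (hl : c l = c l') (h : c l ∉ L.map c) (hA : 0 < A l)
      (hA' : A l' = bil (c l) (c l')) (hpos : 0 < A l')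
      (hL : Ok (fun u => A u - bil (c l) (c u) - bil (c l) (c u)) L) : Ok A (l :: l' :: L)

lemma leadVal_pos {A : V → ℚ} {L : List V} (h : Ok c A L) (hL : L.Nodup)
    (hrk : L.Pairwise fun a b => rk a < rk b) : 0 < leadVal c rk (L.map c) L.toFinset A := by
  induction h with
  | nil A => simp [leadVal]
  | single A l L h hA hok ih =>
    rw [List.nodup_cons] at hL
    rw [List.pairwise_cons] at hrk
    have h1 : (l :: L).toFinset.filter (fun v => c v = c l) = {l} := by
      ext u
      simp only [Finset.mem_filter, List.mem_toFinset, List.mem_cons, Finset.mem_singleton]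
      constructor
      · rintro ⟨rfl | hu, h2⟩
        · rfl
        · exact absurd (h2 ▸ List.mem_map_of_mem hu) h
      · rintro rfl; exact ⟨Or.inl rfl, rfl⟩
    have h2 : (l :: L).toFinset.erase l = L.toFinset := by
      rw [List.toFinset_cons, Finset.erase_insert (by simpa using hL.1)]
    rw [List.map_cons, leadVal, h1, Finset.sum_singleton, h2]
    refine mul_pos hA ?_
    rw [leadVal_congr (A' := fun u => A u - bil (c l) (c u))]
    · exact ih hL.2 hrk.2
    · intro u hu
      rw [drop, if_pos (hrk.1 u (by simpa using hu))]
  | double A l l' L hl h hA hA' hpos hok ih =>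
    rw [List.nodup_cons, List.nodup_cons] at hL
    rw [List.pairwise_cons, List.pairwise_cons] at hrk
    obtain ⟨hL1, hL2, hL3⟩ := hL
    obtain ⟨hr1, hr2, hr3⟩ := hrk
    have hll : l ≠ l' := fun h => hL1 (by simp [h])
    have hlL : l ∉ L := fun h => hL1 (by simp [h])
    have hlt : rk l < rk l' := hr1 l' (by simp)
    have h3 : ∀ u ∈ L, c u ≠ c l := fun u hu h2 => h (h2 ▸ List.mem_map_of_mem hu)
    have h1 : (l :: l' :: L).toFinset.filter (fun v => c v = c l) = {l, l'} := by
      ext u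
      simp only [Finset.mem_filter, List.mem_toFinset, List.mem_cons, Finset.mem_insert,
        Finset.mem_singleton]
      constructor
      · rintro ⟨rfl | rfl | hu, h2⟩
        exacts [Or.inl rfl, Or.inr rfl, absurd h2 (h3 u hu)]
      · rintro (rfl | rfl)
        exacts [⟨Or.inl rfl, rfl⟩, ⟨Or.inr (Or.inl rfl), hl.symm⟩]
    have e1 : (l :: l' :: L).toFinset.erase l = (l' :: L).toFinset := by
      rw [List.toFinset_cons, Finset.erase_insert (by simpa using hL1)]
    have e2 : (l :: l' :: L).toFinset.erase l' = (l :: L).toFinset := by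
      ext u; simp only [Finset.mem_erase, List.mem_toFinset, List.mem_cons]
      constructor
      · rintro ⟨h1, h2 | h2 | h2⟩ <;> simp_all
      · rintro (rfl | hu)
        · exact ⟨hll, Or.inl rfl⟩
        · exact ⟨by rintro rfl; exact hL2 hu, Or.inr (Or.inr hu)⟩
    have f1 : (l' :: L).toFinset.filter (fun v => c v = c l) = {l'} := by
      ext u
      simp only [Finset.mem_filter, List.mem_toFinset, List.mem_cons, Finset.mem_singleton]
      constructor
      · rintro ⟨rfl | hu, h2⟩
        exacts [rfl, absurd h2 (h3 u hu)]
      · rintro rfl; exact ⟨Or.inl rfl, hl.symm⟩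
    have f2 : (l :: L).toFinset.filter (fun v => c v = c l) = {l} := by
      ext u
      simp only [Finset.mem_filter, List.mem_toFinset, List.mem_cons, Finset.mem_singleton]
      constructor
      · rintro ⟨rfl | hu, h2⟩
        exacts [rfl, absurd h2 (h3 u hu)]
      · rintro rfl; exact ⟨Or.inl rfl, rfl⟩
    have g1 : (l' :: L).toFinset.erase l' = L.toFinset := by
      rw [List.toFinset_cons, Finset.erase_insert (by simpa using hL2)]
    have g2 : (l :: L).toFinset.erase l = L.toFinset := by
      rw [List.toFinset_cons, Finset.erase_insert (by simpa using hlL)]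
    rw [List.map_cons, List.map_cons, ← hl, leadVal, h1, Finset.sum_pair hll, e1, e2, leadVal,
      leadVal, f1, f2, Finset.sum_singleton, Finset.sum_singleton, g1, g2]
    have d1 : drop c rk l A l' = 0 := by rw [drop, if_pos hlt, hA', sub_self]
    have d2 : drop c rk l' A l = A l := by rw [drop, if_neg hlt.le.not_gt]
    rw [d1, d2, zero_mul, mul_zero, zero_add]
    refine mul_pos hpos (mul_pos hA ?_)
    rw [leadVal_congr (A' := fun u => A u - bil (c l) (c u) - bil (c l) (c u))]
    · exact ih hL3 hr3
    · intro u hu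
      rw [List.mem_toFinset] at hu
      rw [drop, if_pos (hr1 u (by simp [hu])), drop, if_pos (hr2 u hu), hl]

lemma ok_rtail {t a d : ℕ} {A : V → ℚ} {L : List V} (hL : L.map c = rtail t a d)
    (h1 : ∀ u ∈ L, c u = t + 1 → 0 < A u ∧ (0 < a → A u = 4))
    (h2 : ∀ u ∈ L, c u ≠ t + 1 → A u = 0) : Ok c A L := by
  induction d generalizing t a A L with
  | zero =>
    rw [rtail, List.map_eq_nil_iff] at hL
    subst hL; exact Ok.nil A
  | succ d ih =>
    rw [rtail_cons] at hL
    have hnot : ∀ {L' : List V}, L'.map c = rtail (t + 1) (a - 1) d → ∀ u ∈ L', t + 1 < c u :=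
      fun h u hu => (mem_rtail (h ▸ List.mem_map_of_mem hu)).1
    split_ifs at hL with ha
    · rcases L with _ | ⟨l, _ | ⟨l', L⟩⟩
      · simp at hL
      · simp at hL
      simp only [List.map_cons, List.cons_append, List.nil_append, List.cons.injEq] at hL
      obtain ⟨hl, hl', hL⟩ := hL
      have hn := hnot hL
      have hb : (bil (t + 1) (t + 1) : ℚ) = 4 := by simp [bil]
      obtain ⟨p1, p2⟩ := h1 l (by simp) hl
      obtain ⟨p3, p4⟩ := h1 l' (by simp) hl'
      refine Ok.double A l l' L (by rw [hl, hl']) ?_ p1 (by rw [p4 ha, hl, hl', hb]) p3 ?_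
      · rw [List.mem_map]; rintro ⟨u, hu, hu'⟩
        have := hn u hu; omega
      · refine ih hL ?_ ?_
        · intro u hu hcu
          rw [h2 u (by simp [hu]) (by omega), hl, hcu]
          have : (bil (t + 1) (t + 1 + 1) : ℚ) = -2 := by simp [bil]
          rw [this]; norm_num
        · intro u hu hcu
          have := hn u hu
          rw [h2 u (by simp [hu]) (by omega), hl]
          have : (bil (t + 1) (c u) : ℚ) = 0 := by
            rw [bil, if_neg (by omega), if_neg (by omega), Int.cast_zero]
          rw [this]; norm_num
    · rcases L with _ | ⟨l, L⟩
      · simp at hL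
      simp only [List.map_cons, List.cons_append, List.nil_append, List.cons.injEq] at hL
      obtain ⟨hl, hL⟩ := hL
      have hn := hnot hL
      refine Ok.single A l L ?_ (h1 l (by simp) hl).1 (ih hL ?_ ?_)
      · rw [List.mem_map]; rintro ⟨u, hu, hu'⟩
        have := hn u hu; omega
      · intro u hu hcu
        rw [h2 u (by simp [hu]) (by omega), hl, hcu]
        have : (bil (t + 1) (t + 1 + 1) : ℚ) = -2 := by simp [bil]
        rw [this]; exact ⟨by norm_num, by omega⟩
      · intro u hu hcu
        have := hn u hu
        rw [h2 u (by simp [hu]) (by omega), hl]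
        have : (bil (t + 1) (c u) : ℚ) = 0 := by
          rw [bil, if_neg (by omega), if_neg (by omega), Int.cast_zero]
        rw [this]; norm_num

variable (c) in
/-- The initial constant terms: `1` on letters of the top colour. -/
def topConst (t : ℕ) (u : V) : ℚ := if c u = t then 1 else 0

lemma ok_root {t a d : ℕ} (hta : t = 0 ∨ a = 0) {L : List V} (hL : L.map c = t :: rtail t a d) :
    Ok c (topConst c t) L := by
  rcases L with _ | ⟨l, L⟩
  · simp at hL
  rw [List.map_cons, List.cons.injEq] at hL
  obtain ⟨hl, hL⟩ := hL
  have hn : ∀ u ∈ L, t < c u := fun u hu => (mem_rtail (hL ▸ List.mem_map_of_mem hu)).1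
  refine Ok.single _ l L ?_ (by rw [topConst, if_pos hl]; norm_num) (ok_rtail hL ?_ ?_)
  · rw [List.mem_map]; rintro ⟨u, hu, hu'⟩
    have := hn u hu; omega
  · intro u hu hcu
    rw [topConst, if_neg (by omega), hl, hcu]
    rcases Nat.eq_zero_or_pos t with rfl | ht
    · simp [bil]
    · have : (bil t (t + 1) : ℚ) = -2 := by
        rw [bil, if_neg (by omega), if_pos (by omega), if_neg (by omega)]; norm_num
      rw [this]; exact ⟨by norm_num, by omega⟩
  · intro u hu hcu
    have := hn u hu
    rw [topConst, if_neg (by omega), hl]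
    have : (bil t (c u) : ℚ) = 0 := by
      rw [bil, if_neg (by omega), if_neg (by omega), Int.cast_zero]
    rw [this]; norm_num

variable [Fintype V] {n : ℕ}

lemma actE_rootLnc_pos (hc : ∀ v, c v < n) {t a d : ℕ} (hta : t = 0 ∨ a = 0) {L : List V}
    (hL : L.map c = t :: rtail t a d) (hnd : L.Nodup) (hrk : L.Pairwise fun a b => rk a < rk b)
    (μ : ℕ → ℕ) : ∃ q : ℚ, 0 < q ∧
      actE c n (rootLnc (genF n ℤ) t a d fun i => -(μ i : ℤ))
        (Pi.single L.toFinset (blockFn c rk μ L.toFinset (topConst c t))) ∅ =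
      algebraMap ℚ (Fr V) q := by
  refine ⟨_, leadVal_pos (rk := rk) (ok_root hta hL) hnd hrk, ?_⟩
  rw [rootLnc, actE_lnc_blockFn hc, actE_colorWord hc, hL]
  · intro h; have := (mem_rtail h).1; omega
  · intro v _ hv; rw [topConst, if_neg hv]

lemma ord_blockFn (S : Finset V) (μ : ℕ → ℕ) (A : V → ℚ) {l : List V} (hl : l.Nodup)
    (hS : ∀ v ∈ S, v ∈ l) :
    Ord (fun _ => 1) l (blockFn c rk μ S A) (∑ v ∈ S, (μ (c v) : ℤ)) := by
  have hw : l.Pairwise fun _ _ => (1 : ℤ) ≤ 1 := List.pairwise_of_forall fun _ _ => le_rfl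
  have key : ∀ T : Finset V, T ⊆ S → Ord (fun _ => 1) l
      (∏ u ∈ T, x u ^ μ (c u) * chi c rk S A u) (∑ v ∈ T, (μ (c v) : ℤ)) := by
    intro T hT
    induction T using Finset.induction_on with
    | empty => simpa using ord_one hl
    | insert u T hu ih =>
      rw [Finset.insert_subset_iff] at hT
      rw [Finset.prod_insert hu, Finset.sum_insert hu, mul_assoc]
      have ih := ih hT.2
      set F := ∏ u ∈ T, x u ^ μ (c u) * chi c rk S A u
      set δ := ∑ v ∈ T, (μ (c v) : ℤ)
      have h2 : Ord (fun _ => 1) l (chi c rk S A u * F) δ := by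
        rw [chi, add_mul, Finset.sum_mul]
        refine Ord.add ?_ (ord_sum _ _ fun a ha => ?_)
        · rw [← Algebra.smul_def]; exact ih.smul _
        · rw [mul_assoc, ← Algebra.smul_def]
          refine Ord.smul _ ?_
          rw [Finset.mem_filter] at ha
          rw [mul_assoc]
          have := (ih.pole hl hw (hS a ha.1) (hS u hT.1) (by rintro rfl; simp at ha)).x_mul hl
            (hS u hT.1)
          exact this.mono (by simp)
      exact (h2.pow_mul hl (hS u hT.1) _).mono (by simp [add_comm])
  exact key S subset_rfl

lemma actE_Hgr_eq_zero {κ : Multiset ℕ} {s : ℤ} {a : FreeAlgebra ℚ (Fin n × ℤ)}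
    (ha : a ∈ Hgr n κ s) (S : Finset V) (F : Fr V)
    (h : κ ≠ S.val.map c ∨ ∃ δ : ℤ, (∀ l : List V, l.Nodup → l.toFinset = S →
      Ord (fun _ => 1) l F δ) ∧ -s < δ) :
    actE c n a (Pi.single S F) ∅ = 0 := by
  induction ha using Submodule.span_induction with
  | mem a ha =>
    obtain ⟨w, rfl, hw, hs⟩ := ha
    apply actE_word_eq_zero
    intro l e hl _ hlw
    rw [Finset.empty_union]
    by_cases hlS : l.toFinset = S
    · rw [hlS, Pi.single_eq_same]
      rcases h with h | ⟨δ, hδ, hsδ⟩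
      · refine absurd ?_ h
        have h1 : l.map c = w.map fun p => p.1.val := by
          simpa [Function.comp_def] using congrArg (List.map Prod.fst) hlw
        rw [← hw, ← h1, ← hlS, List.toFinset_val, hl.dedup, Multiset.map_coe]
      · apply hδ l hl hlS
        have h3 : l.map (fun v => e v) = w.map fun p => -p.2 := by
          simpa [Function.comp_def] using congrArg (List.map Prod.snd) hlw
        simp only [one_mul]
        rw [h3, sum_map_neg_snd, hs]
        exact hsδ
    · rw [Pi.single_eq_of_ne hlS, map_zero]
  | zero => rw [map_zero]; rfl
  | add a b _ _ ha hb => rw [map_add, LinearMap.add_apply, Pi.add_apply, ha, hb, add_zero]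
  | smul q a _ ha => rw [map_smul, LinearMap.smul_apply, Pi.smul_apply, ha, smul_zero]

end Fr
end BlockValues

/-! ### Action on products over blocks of variables -/

section BlockProducts
set_option linter.unusedSectionVars false
attribute [local instance] LieRing.ofAssociativeRing

namespace Fr
variable {V : Type*} [DecidableEq V] {ι : Type*} [Fintype ι] [DecidableEq ι]

/-- The product of families attached to the blocks of a partition of the variables. -/
def blockProd (blk : V → ι) (G : ι → Finset V → Fr V) (S : Finset V) : Fr V :=
  ∏ B, G B (S.filter fun v => blk v = B)

/-- Families supported on a block. -/
def LocFam (blk : V → ι) (B : ι) : Submodule ℚ (Finset V → Fr V) where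
  carrier := {G | ∀ S, G S ∈ RatAlg (fun _ _ => True) S ∧ ∀ v ∈ S, blk v ≠ B → G S = 0}
  add_mem' hG hH S := ⟨add_mem (hG S).1 (hH S).1, fun v hv h => by
    rw [Pi.add_apply, (hG S).2 v hv h, (hH S).2 v hv h, add_zero]⟩
  zero_mem' S := ⟨zero_mem _, fun _ _ _ => rfl⟩
  smul_mem' q G hG S := ⟨Subalgebra.smul_mem _ (hG S).1 q, fun v hv h => by
    rw [Pi.smul_apply, (hG S).2 v hv h, smul_zero]⟩

variable {blk : V → ι}

lemma blockProd_update (G : ι → Finset V → Fr V) (B : ι) (X : Finset V → Fr V) (S : Finset V) :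
    blockProd blk (Function.update G B X) S = X (S.filter fun v => blk v = B) *
      ∏ B' ∈ Finset.univ.erase B, G B' (S.filter fun v => blk v = B') := by
  rw [blockProd, ← Finset.mul_prod_erase _ _ (Finset.mem_univ B), Function.update_self]
  congr 1
  refine Finset.prod_congr rfl fun B' hB' => ?_
  rw [Function.update_of_ne (Finset.ne_of_mem_erase hB')]

lemma blockProd_update_sub (G : ι → Finset V → Fr V) (B : ι) (X Y : Finset V → Fr V) :
    blockProd blk (Function.update G B (X - Y)) =
      blockProd blk (Function.update G B X) - blockProd blk (Function.update G B Y) := by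
  funext S
  rw [Pi.sub_apply, blockProd_update, blockProd_update, blockProd_update, Pi.sub_apply, sub_mul]

lemma blockProd_update_neg (G : ι → Finset V → Fr V) (B : ι) (X : Finset V → Fr V) :
    blockProd blk (Function.update G B (-X)) = -blockProd blk (Function.update G B X) := by
  funext S
  rw [Pi.neg_apply, blockProd_update, blockProd_update, Pi.neg_apply, neg_mul]

/-- Endomorphisms acting as derivations on products over blocks. -/
def IsDer (blk : V → ι) (f : Module.End ℚ (Finset V → Fr V)) : Prop :=
  (∀ B, Pres (LocFam blk B) f) ∧ ∀ G : ι → Finset V → Fr V, (∀ B, G B ∈ LocFam blk B) →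
    f (blockProd blk G) = ∑ B, blockProd blk (Function.update G B (f (G B)))

lemma update_mem_LocFam {G : ι → Finset V → Fr V} (hG : ∀ B, G B ∈ LocFam blk B) {B : ι}
    {X : Finset V → Fr V} (hX : X ∈ LocFam blk B) (B' : ι) :
    Function.update G B X B' ∈ LocFam blk B' := by
  by_cases h : B' = B
  · subst h; rwa [Function.update_self]
  · rw [Function.update_of_ne h]; exact hG B'

lemma IsDer.neg {f : Module.End ℚ (Finset V → Fr V)} (hf : IsDer blk f) : IsDer blk (-f) := by
  refine ⟨fun B X hX => neg_mem (hf.1 B X hX), fun G hG => ?_⟩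
  rw [LinearMap.neg_apply, hf.2 G hG, ← Finset.sum_neg_distrib]
  refine Finset.sum_congr rfl fun B _ => ?_
  rw [LinearMap.neg_apply, blockProd_update_neg]

lemma IsDer.mul_apply {f g : Module.End ℚ (Finset V → Fr V)} (hf : IsDer blk f)
    (hg : IsDer blk g) {G : ι → Finset V → Fr V} (hG : ∀ B, G B ∈ LocFam blk B) :
    f (g (blockProd blk G)) = ∑ B, blockProd blk (Function.update G B (f (g (G B)))) +
      ∑ B, ∑ B' ∈ Finset.univ.erase B,
        blockProd blk (Function.update (Function.update G B (g (G B))) B' (f (G B'))) := by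
  rw [hg.2 G hG, map_sum, ← Finset.sum_add_distrib]
  refine Finset.sum_congr rfl fun B _ => ?_
  rw [hf.2 _ (update_mem_LocFam hG (hg.1 B _ (hG B))),
    ← Finset.add_sum_erase _ _ (Finset.mem_univ B), Function.update_self, Function.update_idem]
  congr 1
  refine Finset.sum_congr rfl fun B' hB' => ?_
  rw [Function.update_of_ne (Finset.ne_of_mem_erase hB')]

lemma IsDer.lie {f g : Module.End ℚ (Finset V → Fr V)} (hf : IsDer blk f) (hg : IsDer blk g) :
    IsDer blk ⁅f, g⁆ := by
  refine ⟨fun B => Pres.lie (hf.1 B) (hg.1 B), fun G hG => ?_⟩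
  rw [lie_end_apply, hf.mul_apply hg hG, hg.mul_apply hf hG]
  have : ∑ B, ∑ B' ∈ Finset.univ.erase B,
        blockProd blk (Function.update (Function.update G B (g (G B))) B' (f (G B'))) =
      ∑ B, ∑ B' ∈ Finset.univ.erase B,
        blockProd blk (Function.update (Function.update G B (f (G B))) B' (g (G B'))) := by
    rw [Finset.sum_comm' (s' := fun B => Finset.univ.erase B) (t' := Finset.univ)]
    · refine Finset.sum_congr rfl fun B _ => Finset.sum_congr rfl fun B' hB' => ?_
      rw [Function.update_comm (Finset.ne_of_mem_erase hB')]
    · intro B B'; simp [eq_comm]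
  rw [this, add_sub_add_right_eq_sub, ← Finset.sum_sub_distrib]
  refine Finset.sum_congr rfl fun B _ => ?_
  rw [lie_end_apply, blockProd_update_sub]

variable [Fintype V] {c : V → ℕ} {n : ℕ}

lemma isDer_colorOp (i : ℕ) (r : ℤ) : IsDer blk (colorOp c i r) := by
  constructor
  · intro B G hG S
    rw [colorOp_apply]
    constructor
    · refine sum_mem fun v _ => ?_
      split_ifs with h
      · exact zero_mem _
      · have := γ_mem_RatAlg v (hG (insert v S)).1 (-r)
        rwa [Finset.erase_insert h] at this
    · intro u hu huB
      refine Finset.sum_eq_zero fun v _ => ?_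
      split_ifs with h
      · rfl
      · rw [(hG (insert v S)).2 u (Finset.mem_insert_of_mem hu) huB, map_zero]
  · intro G hG
    funext S
    rw [colorOp_apply, Finset.sum_apply]
    simp only [blockProd_update, colorOp_apply, Finset.sum_mul]
    rw [Finset.sum_comm]
    refine Finset.sum_congr rfl fun v _ => ?_
    rw [Finset.sum_eq_single (blk v)]
    · split_ifs with h h1 h1
      · rw [zero_mul]
      · exact absurd (by simp [h]) h1
      · exact absurd (Finset.mem_filter.mp h1).1 h
      · rw [blockProd, ← Finset.mul_prod_erase _ _ (Finset.mem_univ (blk v)), Finset.filter_insert,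
          if_pos rfl, mul_comm, mul_comm (γ v _ _), ← γ_mul_of_indep]
        · congr 2
          refine Finset.prod_congr rfl fun B hB => ?_
          rw [Finset.filter_insert, if_neg (Finset.ne_of_mem_erase hB).symm]
        · refine prod_mem fun B hB => ?_
          exact RatAlg_le_indep (by simp [h]) (hG B _).1
    · intro B _ hB
      split_ifs with h1
      · rw [zero_mul]
      · rw [(hG B _).2 v (Finset.mem_insert_self _ _) (Ne.symm hB), map_zero, zero_mul]
    · intro h; exact absurd (Finset.mem_univ _) h

lemma isDer_actE_lnc (hc : ∀ v, c v < n) {a : FreeAlgebra ℚ (Fin n × ℤ)}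
    (ha : IsDer blk (actE c n a)) (l : List ℕ) (m : ℕ → ℤ) :
    IsDer blk (actE c n (lnc a (l.map fun i => genF n ℤ i (m i)))) := by
  induction l generalizing a with
  | nil => exact ha
  | cons i l ih =>
    rw [List.map_cons, lnc, List.foldl_cons]
    refine ih ?_
    rw [actE_lie]
    refine (ha.lie ?_).neg
    rw [actE_genF hc]; exact isDer_colorOp _ _

lemma isDer_rootLnc (hc : ∀ v, c v < n) (t a d : ℕ) (m : ℕ → ℤ) :
    IsDer blk (actE c n (rootLnc (genF n ℤ) t a d m)) := by
  refine isDer_actE_lnc hc ?_ _ _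
  rw [actE_genF hc]; exact isDer_colorOp _ _

/-- Sum over the matchings of a list with a set of blocks. -/
def matchSum {X R : Type*} [CommRing R] (ev : X → ι → R) : List X → Finset ι → R
  | [], Z => if Z = ∅ then 1 else 0
  | p :: ps, Z => ∑ B ∈ Z, ev p B * matchSum ev ps (Z.erase B)

lemma matchSum_eq_zero {X R : Type*} [CommRing R] (ev : X → ι → R) (ps : List X) (Z : Finset ι)
    (h : ps.length < Z.card) : matchSum ev ps Z = 0 := by
  induction ps generalizing Z with
  | nil => rw [matchSum, if_neg]; rintro rfl; simp at h
  | cons p ps ih =>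
    rw [matchSum]
    refine Finset.sum_eq_zero fun B hB => ?_
    rw [ih _ (by rw [Finset.card_erase_of_mem hB]; simp at h; omega), mul_zero]

lemma matchSum_map {X R R' : Type*} [CommRing R] [CommRing R'] (g : R →+* R') (ev : X → ι → R)
    (ps : List X) (Z : Finset ι) :
    matchSum (fun p B => g (ev p B)) ps Z = g (matchSum ev ps Z) := by
  induction ps generalizing Z with
  | nil => rw [matchSum, matchSum]; split_ifs <;> simp
  | cons p ps ih =>
    rw [matchSum, matchSum, map_sum]
    exact Finset.sum_congr rfl fun B _ => by rw [map_mul, ih]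

lemma matchSum_sign {X : Type*} [DecidableEq X] (deg : X → ℕ) (lab : ι → X) (ev : X → ι → ℚ)
    (hpos : ∀ p B, p = lab B → 0 < ev p B)
    (hlt : ∀ p B, p ≠ lab B → ev p B ≠ 0 → deg (lab B) < deg p) (ps : List X) (Z : Finset ι)
    (hd : (ps.map deg).sum ≤ ∑ B ∈ Z, deg (lab B)) :
    ((ps : Multiset X) = Z.val.map lab → 0 < matchSum ev ps Z) ∧
      ((ps : Multiset X) ≠ Z.val.map lab → matchSum ev ps Z = 0) := by
  induction ps generalizing Z with
  | nil =>
    rw [matchSum]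
    constructor
    · intro h
      rw [if_pos]; · norm_num
      rw [← Finset.val_eq_zero, ← Multiset.map_eq_zero (f := lab), ← h]; rfl
    · intro h
      rw [if_neg]; rintro rfl; exact h rfl
  | cons p ps ih =>
    rw [List.map_cons, List.sum_cons] at hd
    have hZ : ∀ B ∈ Z, Z.val.map lab = lab B ::ₘ (Z.erase B).val.map lab := fun B hB => by
      rw [Finset.erase_val, ← Multiset.map_cons, Multiset.cons_erase hB]
    have hs : ∀ B ∈ Z, ∑ B ∈ Z, deg (lab B) = deg (lab B) + ∑ B ∈ Z.erase B, deg (lab B) :=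
      fun B hB => (Finset.add_sum_erase _ _ hB).symm
    have hne : ∀ B ∈ Z, p ≠ lab B → ev p B * matchSum ev ps (Z.erase B) = 0 := by
      intro B hB hp
      by_cases he : ev p B = 0
      · rw [he, zero_mul]
      have h1 := hlt p B hp he
      have h2 := hs B hB
      rw [(ih (Z.erase B) (by omega)).2, mul_zero]
      intro h
      have : (ps.map deg).sum = ∑ B ∈ Z.erase B, deg (lab B) := by
        rw [← Multiset.sum_coe, ← Multiset.map_coe, h, Multiset.map_map]; rfl
      omega
    rw [matchSum]
    constructor
    · intro h
      have hterm : ∀ B ∈ Z, p = lab B → 0 < ev p B * matchSum ev ps (Z.erase B) := by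
        intro B hB hp
        refine mul_pos (hpos p B hp) ((ih (Z.erase B) ?_).1 ?_)
        · have := hs B hB; rw [← hp] at this; omega
        · rw [hZ B hB, ← hp, ← Multiset.cons_coe, Multiset.cons_inj_right] at h; exact h
      have hp : p ∈ Z.val.map lab := by rw [← h]; simp
      obtain ⟨B, hB, hBp⟩ := Multiset.mem_map.mp hp
      refine Finset.sum_pos' (fun B hB => ?_) ⟨B, hB, hterm B hB hBp.symm⟩
      by_cases h1 : p = lab B
      · exact (hterm B hB h1).le
      · exact (hne B hB h1).ge
    · intro h
      refine Finset.sum_eq_zero fun B hB => ?_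
      by_cases hp : p = lab B
      · rw [(ih (Z.erase B) ?_).2, mul_zero]
        · intro h1; apply h
          rw [hZ B hB, ← hp, ← h1]; rfl
        · have := hs B hB; rw [← hp] at this; omega
      · exact hne B hB hp

lemma actE_prod_blockProd {X : Type*} (E : X → FreeAlgebra ℚ (Fin n × ℤ))
    (hE : ∀ p, IsDer blk (actE c n (E p))) (T : ι → Finset V → Fr V)
    (hT : ∀ B, T B ∅ = 0) (ps : List X) (Z : Finset ι) (hZ : ps.length ≤ Z.card)
    (G : ι → Finset V → Fr V) (hG : ∀ B, G B ∈ LocFam blk B) (hGT : ∀ B ∈ Z, G B = T B) :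
    actE c n (ps.map E).prod (blockProd blk G) ∅ =
      (∏ B ∈ Zᶜ, G B ∅) * matchSum (fun p B => actE c n (E p) (T B) ∅) ps Z := by
  induction ps generalizing Z G with
  | nil =>
    rw [List.map_nil, List.prod_nil, actE_one, matchSum, Module.End.one_apply, blockProd]
    simp only [Finset.filter_empty]
    split_ifs with h
    · subst h; simp
    · obtain ⟨B, hB⟩ := Finset.nonempty_iff_ne_empty.mpr h
      rw [mul_zero]
      exact Finset.prod_eq_zero (Finset.mem_univ B) (by rw [hGT B hB, hT])
  | cons p ps ih =>
    rw [List.length_cons] at hZ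
    rw [List.map_cons, List.prod_cons, actE_mul_apply, (hE p).2 G hG, map_sum, Finset.sum_apply,
      matchSum, Finset.mul_sum, ← Finset.sum_subset (Finset.subset_univ Z)]
    · refine Finset.sum_congr rfl fun B hB => ?_
      rw [ih (Z.erase B) (by rw [Finset.card_erase_of_mem hB]; omega) _
        (update_mem_LocFam hG ((hE p).1 B _ (hG B))), Finset.compl_erase,
        Finset.prod_insert (by simp [hB]), Function.update_self, hGT B hB]
      · rw [Finset.prod_congr rfl (g := fun B' => G B' ∅)]
        · ring
        · intro B' hB'
          rw [Function.update_of_ne]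
          rintro rfl; simp [hB] at hB'
      · intro B' hB'
        rw [Finset.mem_erase] at hB'
        rw [Function.update_of_ne hB'.1, hGT B' hB'.2]
    · intro B _ hB
      rw [ih Z (by omega) _ (update_mem_LocFam hG ((hE p).1 B _ (hG B))),
        matchSum_eq_zero _ _ _ (by omega), mul_zero]
      intro B' hB'
      rw [Function.update_of_ne (by rintro rfl; exact hB hB'), hGT B' hB']

end Fr
end BlockProducts

/-! ### Independence of block functions -/

section RootModes

lemma exists_modes_rtail (t a d M r : ℕ) (h : r ≤ M * (t :: rtail t a d).length) :
    ∃ μ : ℕ → ℕ, (∀ i, μ i ≤ M) ∧ ((t :: rtail t a d).map μ).sum = r := by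
  induction d generalizing r with
  | zero => exact ⟨fun _ => r, fun _ => by simpa [rtail] using h, by simp [rtail]⟩
  | succ d ih =>
    have key : ∀ x r', x ≤ M → r' ≤ M * (t :: rtail t a d).length →
        r' + (if d < a then 2 * x else x) = r →
        ∃ μ : ℕ → ℕ, (∀ i, μ i ≤ M) ∧ ((t :: rtail t a (d + 1)).map μ).sum = r := by
      intro x r' hx hr' hrr
      obtain ⟨μ, hμ, hs⟩ := ih r' hr'
      refine ⟨Function.update μ (t + d + 1) x, fun i => ?_, ?_⟩
      · by_cases hi : i = t + d + 1
        · subst hi; rwa [Function.update_self]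
        · rw [Function.update_of_ne hi]; exact hμ i
      · have hm : (t :: rtail t a d).map (Function.update μ (t + d + 1) x) =
            (t :: rtail t a d).map μ := by
          refine List.map_congr_left fun i hi => Function.update_of_ne ?_ _ _
          rcases List.mem_cons.mp hi with rfl | hi
          · omega
          · have := mem_rtail hi; omega
        rw [rtail, ← List.cons_append, List.map_append, List.sum_append, hm, hs, ← hrr]
        split_ifs <;> simp
        ring
    rw [rtail] at h
    split_ifs at h key with hd
    · simp only [List.length_cons, List.length_append, List.length_nil] at h key
      by_cases hM : r / 2 ≤ M
      · rcases Nat.eq_zero_or_pos M with rfl | hM0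
        · exact key 0 r le_rfl (by omega) (by omega)
        · refine key (r / 2) (r % 2) hM ?_ (by omega)
          have : 1 * 1 ≤ M * ((rtail t a d).length + 1) := Nat.mul_le_mul hM0 (by omega)
          omega
      · refine key M (r - 2 * M) le_rfl ?_ (by omega)
        have : M * ((rtail t a d).length + 1 + 2) = M * ((rtail t a d).length + 1) + 2 * M := by ring
        have h' : r ≤ M * ((rtail t a d).length + 1 + 2) := by
          convert h using 2
        omega
    · simp only [List.length_cons, List.length_append, List.length_nil] at h key
      by_cases hM : r ≤ M
      · exact key r 0 hM (Nat.zero_le _) (by omega)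
      · refine key M (r - M) le_rfl ?_ (by omega)
        have : M * ((rtail t a d).length + 1 + 1) = M * ((rtail t a d).length + 1) + M := by ring
        have h' : r ≤ M * ((rtail t a d).length + 1 + 1) := by
          convert h using 2
        omega

/-- The word of simple roots along a root. -/
def rootWord {n : ℕ} (β : Rt n) : List ℕ := β.1.1 :: rtail β.1.1 β.1.2.2 β.1.2.1

lemma exists_modes {n : ℕ} (p : Rt n × ℕ) : ∃ μ : ℕ → ℕ,
    ((rootWord p.1).map μ).sum = p.2 ∧ ∀ M, p.2 ≤ M * (rootWord p.1).length → ∀ i, μ i ≤ M := by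
  have h0 : 0 < (rootWord p.1).length := by simp [rootWord]
  obtain ⟨μ, h1, h2⟩ := exists_modes_rtail p.1.1.1 p.1.1.2.2 p.1.1.2.1
    ((p.2 + (rootWord p.1).length - 1) / (rootWord p.1).length) p.2 (by
      have := Nat.lt_div_mul_add (a := p.2 + (rootWord p.1).length - 1) h0
      change p.2 ≤ _ * (rootWord p.1).length
      omega)
  refine ⟨μ, h2, fun M hM i => (h1 i).trans (Nat.lt_succ_iff.mp ?_)⟩
  rw [Nat.div_lt_iff_lt_mul h0, Nat.succ_mul]
  omega

/-- A distribution of the mode of a root among its letters. -/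
def modes {n : ℕ} (p : Rt n × ℕ) : ℕ → ℕ := (exists_modes p).choose

lemma sum_modes {n : ℕ} (p : Rt n × ℕ) : ((rootWord p.1).map (modes p)).sum = p.2 :=
  (exists_modes p).choose_spec.1

lemma modes_le {n M : ℕ} {p : Rt n × ℕ} (h : p.2 ≤ M * (rtWeight p.1).card) (i : ℕ) :
    modes p i ≤ M := (exists_modes p).choose_spec.2 M h i

lemma count_rtail_last {t a d u : ℕ} : u ∈ t :: rtail t a d ↔ t ≤ u ∧ u ≤ t + d := by
  induction d with
  | zero => simp [rtail]; omega
  | succ d ih =>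
    rw [rtail, ← List.cons_append, List.mem_append, ih]
    split_ifs <;> simp <;> omega

lemma length_rtail (t a d : ℕ) : (rtail t a d).length = d + min a d := by
  induction d with
  | zero => simp [rtail]
  | succ d ih =>
    rw [rtail, List.length_append, ih]
    split_ifs <;> simp <;> omega

lemma rtWeight_injective {n : ℕ} : Function.Injective (rtWeight (n := n)) := by
  rintro ⟨⟨t, d, a⟩, h1, h2, h3⟩ ⟨⟨t', d', a'⟩, h1', h2', h3'⟩ h
  simp only [rtWeight] at h h1 h2 h1' h2'
  have hm : ∀ u, (t ≤ u ∧ u ≤ t + d) ↔ (t' ≤ u ∧ u ≤ t' + d') := fun u => by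
    rw [← count_rtail_last (a := a), ← count_rtail_last (a := a'), ← Multiset.mem_coe, h,
      Multiset.mem_coe]
  have hl := congrArg Multiset.card h
  simp only [Multiset.coe_card, List.length_cons, length_rtail] at hl
  have e1 := hm t; have e2 := hm t'; have e3 := hm (t + d); have e4 := hm (t' + d')
  obtain rfl : t = t' := by omega
  obtain rfl : d = d' := by omega
  obtain rfl : a = a' := by omega
  rfl

/-- The iterated commutator dual to a block function. -/
def rootElt {n : ℕ} (p : Rt n × ℕ) : FreeAlgebra ℚ (Fin n × ℤ) :=
  letI : LieRing (FreeAlgebra ℚ (Fin n × ℤ)) := LieRing.ofAssociativeRing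
  rootLnc (genF n ℤ) p.1.1.1 p.1.1.2.2 p.1.1.2.1 fun i => -(modes p i : ℤ)

lemma rootElt_mem_Hgr {n : ℕ} (p : Rt n × ℕ) : rootElt p ∈ Hgr n (rtWeight p.1) (-(p.2 : ℤ)) := by
  have h := rootLnc_mem_Hgr (n := n) p.1.1.1 p.1.1.2.2 p.1.1.2.1 fun i => -(modes p i : ℤ)
  have h2 : modeSum p.1.1.1 p.1.1.2.2 p.1.1.2.1 (fun i => -(modes p i : ℤ)) = -(p.2 : ℤ) := by
    conv_rhs => rw [← sum_modes p]
    rw [modeSum, rootWord]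
    generalize p.1.1.1 :: rtail p.1.1.1 p.1.1.2.2 p.1.1.2.1 = l
    induction l with
    | nil => rfl
    | cons a l ih => simp only [List.map_cons, List.sum_cons, ih]; push_cast; ring
  rw [h2] at h
  exact h

end RootModes

section Layouts
set_option linter.unusedSectionVars false

/-- A distribution of the variables among the letters of a list of roots. -/
structure Layout {V : Type*} {n : ℕ} (c rk : V → ℕ) (zs : List ((Rt n × ℕ) × List V)) : Prop where
  word : ∀ z ∈ zs, z.2.map c = rootWord z.1.1
  sorted : (zs.map Prod.snd).flatten.Pairwise fun a b => rk a < rk b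
  full : ∀ v, v ∈ (zs.map Prod.snd).flatten

lemma exists_zip_words {V : Type*} {n : ℕ} {c : V → ℕ} (ps : List (Rt n × ℕ)) (L : List V)
    (h : L.map c = (ps.map fun p => rootWord p.1).flatten) :
    ∃ zs : List ((Rt n × ℕ) × List V), zs.map Prod.fst = ps ∧ (zs.map Prod.snd).flatten = L ∧
      ∀ z ∈ zs, z.2.map c = rootWord z.1.1 := by
  induction ps generalizing L with
  | nil => exact ⟨[], rfl, by simpa using h.symm, by simp⟩
  | cons p ps ih =>
    rw [List.map_cons, List.flatten_cons] at h
    obtain ⟨L1, L2, rfl, h1, h2⟩ := List.map_eq_append_iff.mp h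
    obtain ⟨zs, e1, e2, e3⟩ := ih L2 h2
    refine ⟨(p, L1) :: zs, by simp [e1], by simp [e2], ?_⟩
    rintro z (_ | ⟨_, hz⟩)
    · exact h1
    · exact e3 z hz

namespace Fr
variable {V : Type*} [DecidableEq V] [Fintype V] {c rk : V → ℕ} {n : ℕ}

variable (c rk) in
/-- The product of the block functions of a layout. -/
def layoutFn (zs : List ((Rt n × ℕ) × List V)) : Fr V :=
  (zs.map fun z => blockFn c rk (modes z.1) z.2.toFinset (topConst c z.1.1.1.1)).prod

lemma blockFn_mem_RatAlg (μ : ℕ → ℕ) (S : Finset V) (A : V → ℚ) :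
    blockFn c rk μ S A ∈ RatAlg (fun _ _ => True) S := by
  refine prod_mem fun l hl => mul_mem (pow_mem (x_mem_RatAlg hl) _) (add_mem (algebraMap_mem _ _) ?_)
  refine sum_mem fun a ha => mul_mem (algebraMap_mem _ _) (mul_mem (x_mem_RatAlg hl) ?_)
  rw [Finset.mem_filter] at ha
  refine Algebra.subset_adjoin (Or.inr ⟨a, ha.1, l, hl, ?_, trivial, rfl⟩)
  rintro rfl; omega

lemma layout_pairing (hc : ∀ v, c v < n) {zs : List ((Rt n × ℕ) × List V)}
    (hz : Layout c rk zs) (qs : List (Rt n × ℕ)) (hl : qs.length ≤ zs.length) :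
    ∃ q : ℚ, actE c n (qs.map rootElt).prod (Pi.single Finset.univ (layoutFn c rk zs)) ∅ =
        algebraMap ℚ (Fr V) q ∧ (qs.length < zs.length → q = 0) ∧
      ((qs.map Prod.snd).sum ≤ (zs.map fun z => z.1.2).sum →
        (Multiset.ofList qs = Multiset.ofList (zs.map Prod.fst) → 0 < q) ∧
        (Multiset.ofList qs ≠ Multiset.ofList (zs.map Prod.fst) → q = 0)) := by
  have hblk : ∀ v, ∃ i : Fin zs.length, v ∈ zs[i].2 := by
    intro v
    obtain ⟨l, hl, hv⟩ := List.mem_flatten.mp (hz.full v)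
    obtain ⟨z, hz', rfl⟩ := List.mem_map.mp hl
    obtain ⟨i, hi, rfl⟩ := List.mem_iff_getElem.mp hz'
    exact ⟨⟨i, hi⟩, hv⟩
  choose blk hblk using hblk
  obtain ⟨hp1, hp2⟩ := List.pairwise_flatten.mp hz.sorted
  rw [List.pairwise_map] at hp2
  have huniq : ∀ (i : Fin zs.length) v, v ∈ zs[i].2 → blk v = i := by
    intro i v hv
    by_contra hne
    rcases lt_or_gt_of_ne hne with h | h
    · have := List.pairwise_iff_getElem.mp hp2 _ _ (blk v).2 i.2 h v (hblk v) v hv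
      omega
    · have := List.pairwise_iff_getElem.mp hp2 _ _ i.2 (blk v).2 h v hv v (hblk v)
      omega
  have hmem : ∀ (i : Fin zs.length) v, blk v = i → v ∈ zs[i].2 := by
    rintro i v rfl; exact hblk v
  have hpw : ∀ i : Fin zs.length, zs[i].2.Pairwise fun a b => rk a < rk b := fun i =>
    hp1 _ (List.mem_map.mpr ⟨zs[i], List.getElem_mem _, rfl⟩)
  have hnd : ∀ i : Fin zs.length, zs[i].2.Nodup := fun i =>
    (hpw i).imp fun h => by rintro rfl; omega
  have hw : ∀ i : Fin zs.length, zs[i].2.map c = rootWord zs[i].1.1 := fun i =>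
    hz.word _ (List.getElem_mem _)
  have hwt : ∀ i : Fin zs.length, zs[i].2.toFinset.val.map c = rtWeight zs[i].1.1 := fun i => by
    rw [List.toFinset_val, (hnd i).dedup, Multiset.map_coe, hw]; rfl
  have hne : ∀ i : Fin zs.length, zs[i].2.toFinset ≠ ∅ := fun i h => by
    have h1 := hwt i
    rw [h, Finset.empty_val, Multiset.map_zero] at h1
    have := rtWeight_card_pos zs[i].1.1
    rw [← h1] at this
    simp at this
  set f : Fin zs.length → Fr V := fun i =>
    blockFn c rk (modes zs[i].1) zs[i].2.toFinset (topConst c zs[i].1.1.1.1) with hf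
  set T : Fin zs.length → Finset V → Fr V := fun i => Pi.single zs[i].2.toFinset (f i) with hT
  have hE : ∀ p : Rt n × ℕ, IsDer blk (actE c n (rootElt p)) := fun p => isDer_rootLnc hc _ _ _ _
  have hloc : ∀ i, T i ∈ LocFam blk i := by
    intro i S
    by_cases hS : S = zs[i].2.toFinset
    · subst hS
      refine ⟨by rw [hT]; simp only [Pi.single_eq_same]; exact blockFn_mem_RatAlg _ _ _, fun v hv h => ?_⟩
      exact absurd (huniq i v (List.mem_toFinset.mp hv)) h
    · simp only [hT, Pi.single_eq_of_ne hS]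
      exact ⟨zero_mem _, fun _ _ _ => trivial⟩
  have hprod : blockProd blk T = Pi.single Finset.univ (layoutFn c rk zs) := by
    funext S
    rw [blockProd]
    by_cases hS : S = Finset.univ
    · subst hS
      rw [Pi.single_eq_same, layoutFn, ← Fin.prod_univ_getElem]
      simp only [List.getElem_map, hT, hf]
      rw [← (finCongr (List.length_map (as := zs) _)).prod_comp]
      refine Finset.prod_congr rfl fun i _ => ?_
      have : (Finset.univ.filter fun v => blk v = finCongr (List.length_map _) i) =
          zs[(finCongr (List.length_map (as := zs) _) i)].2.toFinset := by
        ext v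
        simp only [Finset.mem_filter, Finset.mem_univ, true_and, List.mem_toFinset]
        exact ⟨hmem _ v, huniq _ v⟩
      rw [this, Pi.single_eq_same]
      rfl
    · rw [Pi.single_eq_of_ne hS]
      obtain ⟨v, hv⟩ : ∃ v, v ∉ S := by
        by_contra! h
        exact hS (Finset.eq_univ_iff_forall.mpr h)
      refine Finset.prod_eq_zero (Finset.mem_univ (blk v)) (Pi.single_eq_of_ne (fun h => hv ?_) _)
      have : v ∈ zs[blk v].2.toFinset := List.mem_toFinset.mpr (hblk v)
      rw [← h] at this
      exact (Finset.mem_filter.mp this).1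
  have hev : ∀ p i, ∃ q : ℚ, actE c n (rootElt p) (T i) ∅ = algebraMap ℚ (Fr V) q := fun p i =>
    mem_RatAlg_empty (((hE p).1 i _ (hloc i)) ∅).1
  choose ev hev using hev
  have hmain := actE_prod_blockProd rootElt hE T (fun i => Pi.single_eq_of_ne (hne i).symm _) qs
    Finset.univ (by simpa using hl) T hloc (fun _ _ => rfl)
  simp only [hev] at hmain
  rw [hprod, matchSum_map, Finset.compl_univ, Finset.prod_empty, one_mul] at hmain
  refine ⟨_, hmain, fun h => matchSum_eq_zero _ _ _ (by simpa using h), fun h => ?_⟩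
  have hlab : (Finset.univ.val.map fun i : Fin zs.length => zs[i].1) =
      Multiset.ofList (zs.map Prod.fst) := by
    rw [Fin.univ_val_map, Multiset.coe_eq_coe]
    refine List.Perm.of_eq (List.ext_getElem (by simp) fun i h1 h2 => by simp)
  rw [← hlab]
  classical
  refine matchSum_sign Prod.snd _ ev ?_ ?_ qs Finset.univ ?_
  · rintro p i rfl
    obtain ⟨q, hq, h1⟩ := actE_rootLnc_pos (n := n) (rk := rk) hc zs[i].1.1.2.2.2
      (hw i) (hnd i) (hpw i) (modes zs[i].1)
    have h2 := (hev zs[i].1 i).symm.trans h1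
    rwa [(algebraMap ℚ (Fr V)).injective h2]
  · intro p i hpi h0
    by_contra! hle
    have hz0 : actE c n (rootElt p) (T i) ∅ = 0 := by
      refine actE_Hgr_eq_zero (rootElt_mem_Hgr p) _ _ ?_
      rw [hwt]
      by_cases hβ : rtWeight p.1 = rtWeight zs[i].1.1
      · refine Or.inr ⟨zs[i].1.2, fun l hl hlS => ?_, ?_⟩
        · convert ord_blockFn (c := c) (rk := rk) zs[i].2.toFinset (modes zs[i].1)
            (topConst c zs[i].1.1.1.1) hl (fun v hv => by rw [← hlS] at hv; simpa using hv) using 1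
          rw [← Nat.cast_sum]
          congr 1
          rw [← sum_modes zs[i].1, ← hw i, List.map_map, ← List.sum_toFinset _ (hnd i)]
          rfl
        · have : p.2 ≠ zs[i].1.2 := fun h => hpi (Prod.ext (rtWeight_injective hβ) h)
          omega
      · exact Or.inl hβ
    rw [hev] at hz0
    exact h0 ((algebraMap ℚ (Fr V)).injective (by rw [hz0, map_zero]))
  · refine h.trans (le_of_eq ?_)
    rw [← Fin.sum_univ_getElem, ← (finCongr (List.length_map (as := zs) _)).sum_comp]
    exact Finset.sum_congr rfl fun i _ => by simp

lemma actE_single_ren {σ : Equiv.Perm V} (hσ : ∀ v, c (σ v) = c v) (F : Fr V)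
    (a : FreeAlgebra ℚ (Fin n × ℤ)) :
    actE c n a (Pi.single Finset.univ (ren σ F)) ∅ =
      ren σ (actE c n a (Pi.single Finset.univ F) ∅) := by
  have hr : Rel σ (Pi.single Finset.univ F) (Pi.single Finset.univ (ren σ F)) := by
    intro S
    by_cases h : S = Finset.univ
    · subst h; simp
    · rw [Pi.single_eq_of_ne h, map_zero, Pi.single_eq_of_ne]
      intro h1
      refine h (Finset.eq_univ_iff_forall.mpr fun v => ?_)
      have : σ v ∈ S.map σ.toEmbedding := by rw [h1]; exact Finset.mem_univ _
      simpa using this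
  have ha : a ∈ Submodule.span ℚ (Set.range word) := by rw [span_word]; trivial
  induction ha using Submodule.span_induction with
  | mem a ha =>
    obtain ⟨w, rfl⟩ := ha
    have := Rel.act hσ hr w ∅
    rwa [Finset.map_empty] at this
  | zero => simp
  | add a b _ _ h1 h2 => simp only [map_add, LinearMap.add_apply, Pi.add_apply, h1, h2]
  | smul q a _ h1 =>
    simp only [map_smul, LinearMap.smul_apply, Pi.smul_apply, h1, map_rat_smul]

lemma layoutFn_independent (hc : ∀ v, c v < n) {J : Type*} [Fintype J] [Nonempty J]
    (π : J → Equiv.Perm V) (hπ : ∀ j v, c (π j v) = c v) (s : Finset (Multiset (Rt n × ℕ)))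
    (zs : Multiset (Rt n × ℕ) → List ((Rt n × ℕ) × List V)) (rk : Multiset (Rt n × ℕ) → V → ℕ)
    (hzs : ∀ b ∈ s, Layout c (rk b) (zs b) ∧ Multiset.ofList ((zs b).map Prod.fst) = b)
    (q : Multiset (Rt n × ℕ) → ℚ)
    (h : ∑ b ∈ s, q b • ∑ j, ren (π j) (layoutFn c (rk b) (zs b)) = 0) : ∀ b ∈ s, q b = 0 := by
  classical
  by_contra! hne
  obtain ⟨b0, hb0, hmin⟩ := Finset.exists_min_image (s.filter fun b => q b ≠ 0)
    (fun b => toLex (Multiset.card b, (b.map Prod.snd).sum)) (by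
      obtain ⟨b, hb, hq⟩ := hne
      exact ⟨b, Finset.mem_filter.mpr ⟨hb, hq⟩⟩)
  rw [Finset.mem_filter] at hb0
  have hdeg : ∀ b ∈ s, ((zs b).map fun z => z.1.2).sum = (b.map Prod.snd).sum := fun b hb => by
    conv_rhs => rw [← (hzs b hb).2, Multiset.map_coe, Multiset.sum_coe, List.map_map]
    rfl
  have hlen : ∀ b ∈ s, (zs b).length = Multiset.card b := fun b hb => by
    conv_rhs => rw [← (hzs b hb).2, Multiset.coe_card, List.length_map]
  have hd0 : (b0.toList.map Prod.snd).sum = (b0.map Prod.snd).sum := by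
    rw [← Multiset.sum_coe, ← Multiset.map_coe, Multiset.coe_toList]
  set a := (b0.toList.map rootElt).prod with ha
  have hval : ∀ b ∈ s, q b ≠ 0 → ∃ y : ℚ,
      actE c n a (Pi.single Finset.univ (layoutFn c (rk b) (zs b))) ∅ = algebraMap ℚ (Fr V) y ∧
      (b = b0 → 0 < y) ∧ (b ≠ b0 → y = 0) := by
    intro b hb hqb
    have hm := hmin b (Finset.mem_filter.mpr ⟨hb, hqb⟩)
    rw [Prod.Lex.toLex_le_toLex] at hm
    obtain ⟨y, h1, h2, h3⟩ := layout_pairing hc (hzs b hb).1 b0.toList (by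
      rw [Multiset.length_toList, hlen b hb]; omega)
    rw [Multiset.length_toList, hlen b hb] at h2
    rw [hd0, hdeg b hb, (hzs b hb).2, Multiset.coe_toList] at h3
    refine ⟨y, h1, ?_, fun hbb => ?_⟩
    · rintro rfl; exact (h3 le_rfl).1 rfl
    · rcases hm with hm | hm
      · exact h2 hm
      · exact (h3 hm.2).2 hbb.symm
  have key := congrArg (fun F => actE c n a (Pi.single Finset.univ F) ∅) h
  simp only [Pi.single_zero, map_zero] at key
  have hlin : ∀ F : Fr V, actE c n a (Pi.single Finset.univ F) ∅ =
      ((LinearMap.proj ∅ ∘ₗ actE c n a) ∘ₗ LinearMap.single ℚ (fun _ => Fr V) Finset.univ) F :=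
    fun F => rfl
  rw [hlin, map_sum, Finset.sum_eq_single_of_mem b0 hb0.1] at key
  · obtain ⟨y, h1, h2, -⟩ := hval b0 hb0.1 hb0.2
    rw [map_smul, map_sum, Finset.sum_congr rfl (g := fun _ => algebraMap ℚ (Fr V) y),
      Finset.sum_const, Pi.zero_apply, smul_eq_zero] at key
    · rcases key with key | key
      · exact hb0.2 key
      · rw [smul_eq_zero, map_eq_zero] at key
        rcases key with key | key
        · simp at key
        · exact (h2 rfl).ne' key
    · intro j _
      rw [← hlin, actE_single_ren (hπ j), h1, eq_ratCast, map_ratCast]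
  · intro b hb hbb
    by_cases hqb : q b = 0
    · rw [hqb, zero_smul, map_zero]
    obtain ⟨y, h1, -, h3⟩ := hval b hb hqb
    rw [map_smul, map_sum, Finset.sum_eq_zero, smul_zero]
    intro j _
    rw [← hlin, actE_single_ren (hπ j), h1, h3 hbb, map_zero, map_zero]

end Fr
end Layouts

/-! ### Specialization of rational functions -/

section Specialization
variable {D F₁ F₂ : Type*} [CommRing D] [Field F₁] [Field F₂]

/-- Pairs of fractions with a common numerator and a common denominator over `D`, the latter having
nonzero image in the second field. -/
def specRing (α : D →+* F₁) (β : D →+* F₂) : Subring (F₁ × F₂) where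
  carrier := {p | ∃ P Q, β Q ≠ 0 ∧ p.1 * α Q = α P ∧ p.2 * β Q = β P}
  mul_mem' := by
    rintro ⟨a, b⟩ ⟨a', b'⟩ ⟨P, Q, h1, h2, h3⟩ ⟨P', Q', h1', h2', h3'⟩
    refine ⟨P * P', Q * Q', by rw [map_mul]; exact mul_ne_zero h1 h1', ?_, ?_⟩
    · simp only [Prod.mk_mul_mk, map_mul, ← h2, ← h2']; ring
    · simp only [Prod.mk_mul_mk, map_mul, ← h3, ← h3']; ring
  one_mem' := ⟨1, 1, by simp, by simp, by simp⟩
  add_mem' := by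
    rintro ⟨a, b⟩ ⟨a', b'⟩ ⟨P, Q, h1, h2, h3⟩ ⟨P', Q', h1', h2', h3'⟩
    refine ⟨P * Q' + P' * Q, Q * Q', by rw [map_mul]; exact mul_ne_zero h1 h1', ?_, ?_⟩
    · simp only [Prod.mk_add_mk, map_mul, map_add, ← h2, ← h2']; ring
    · simp only [Prod.mk_add_mk, map_mul, map_add, ← h3, ← h3']; ring
  zero_mem' := ⟨0, 1, by simp, by simp, by simp⟩
  neg_mem' := by
    rintro ⟨a, b⟩ ⟨P, Q, h1, h2, h3⟩
    exact ⟨-P, Q, h1, by simp [← h2], by simp [← h3]⟩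

variable {α : D →+* F₁} {β : D →+* F₂}

lemma specRing_base (d : D) : (α d, β d) ∈ specRing α β := ⟨d, 1, by simp, by simp, by simp⟩

lemma specRing_inv {a : F₁} {b : F₂} (h : (a, b) ∈ specRing α β) (hb : b ≠ 0) (ha : a ≠ 0) :
    (a⁻¹, b⁻¹) ∈ specRing α β := by
  obtain ⟨P, Q, h1, h2, h3⟩ := h
  dsimp only at h2 h3
  refine ⟨Q, P, by rw [← h3]; exact mul_ne_zero hb h1, ?_, ?_⟩
  · rw [← h2]; dsimp only; rw [inv_mul_cancel_left₀ ha]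
  · rw [← h3]; dsimp only; rw [inv_mul_cancel_left₀ hb]

lemma specRing_zero {b : F₂} (hα : Function.Injective α) (h : ((0 : F₁), b) ∈ specRing α β) :
    b = 0 := by
  obtain ⟨P, Q, h1, h2, h3⟩ := h
  rw [zero_mul] at h2
  have : P = 0 := hα (by rw [map_zero]; exact h2.symm)
  rw [this, map_zero] at h3
  exact (mul_eq_zero.mp h3).resolve_right h1

lemma specRing_ne_zero (hα : Function.Injective α) {a : F₁} {b : F₂}
    (h : (a, b) ∈ specRing α β) (hb : b ≠ 0) : a ≠ 0 := by
  rintro rfl; exact hb (specRing_zero hα h)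

lemma specRing_map {f : F₁ →+* F₁} {g : F₂ →+* F₂} {φ : D →+* D} (hf : ∀ d, f (α d) = α (φ d))
    (hg : ∀ d, g (β d) = β (φ d)) {a : F₁} {b : F₂} (h : (a, b) ∈ specRing α β) :
    (f a, g b) ∈ specRing α β := by
  obtain ⟨P, Q, h1, h2, h3⟩ := h
  refine ⟨φ P, φ Q, ?_, ?_, ?_⟩
  · rw [← hg]; exact (map_ne_zero g).mpr h1
  · rw [← hf, ← hf, ← h2, map_mul]
  · rw [← hg, ← hg, ← h3, map_mul]

open Polynomial in
/-- A finite family of rational functions, not all zero, can be rescaled so as to have a nonzero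
reduction at `v = 1`. -/
lemma exists_scaling {ι : Type*} (s : Finset ι) (a : ι → KK) (h : ∃ i ∈ s, a i ≠ 0) :
    ∃ (z : KK) (p : ι → ℚ[X]), z ≠ 0 ∧ (∀ i ∈ s, z * a i = algebraMap ℚ[X] KK (p i)) ∧
      ∃ i ∈ s, (p i).eval 1 ≠ 0 := by
  obtain ⟨⟨d, hd⟩, hint⟩ := IsLocalization.exist_integer_multiples (nonZeroDivisors ℚ[X]) s a
  have hp : ∀ i, ∃ p : ℚ[X], i ∈ s → algebraMap ℚ[X] KK d * a i = algebraMap ℚ[X] KK p := fun i => by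
    by_cases hi : i ∈ s
    · obtain ⟨p, hp⟩ := hint i hi
      exact ⟨p, fun _ => by rw [hp, ← Algebra.smul_def]⟩
    · exact ⟨0, fun h => absurd h hi⟩
  choose p hp using hp
  have hd0 : algebraMap ℚ[X] KK d ≠ 0 :=
    (map_ne_zero_iff _ (IsFractionRing.injective ℚ[X] KK)).mpr (nonZeroDivisors.ne_zero hd)
  suffices H : ∀ (N : ℕ) (z : KK) (p : ι → ℚ[X]), z ≠ 0 →
      (∀ i ∈ s, z * a i = algebraMap ℚ[X] KK (p i)) → (∃ i ∈ s, p i ≠ 0 ∧ (p i).natDegree ≤ N) →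
      ∃ (z : KK) (p : ι → ℚ[X]), z ≠ 0 ∧ (∀ i ∈ s, z * a i = algebraMap ℚ[X] KK (p i)) ∧
        ∃ i ∈ s, (p i).eval 1 ≠ 0 by
    obtain ⟨i, hi, hai⟩ := h
    refine H (p i).natDegree _ p hd0 (fun i hi => hp i hi) ⟨i, hi, fun h0 => ?_, le_rfl⟩
    have := hp i hi
    rw [h0, map_zero] at this
    exact mul_ne_zero hd0 hai this
  intro N
  induction N with
  | zero =>
    rintro z p hz hzp ⟨i, hi, h0, hN⟩
    refine ⟨z, p, hz, hzp, i, hi, ?_⟩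
    rw [Polynomial.eq_C_of_natDegree_le_zero hN] at h0 ⊢
    rw [eval_C]
    exact fun h1 => h0 (by rw [h1, C_0])
  | succ N ih =>
    rintro z p hz hzp ⟨i, hi, h0, hN⟩
    by_cases hall : ∃ i ∈ s, (p i).eval 1 ≠ 0
    · exact ⟨z, p, hz, hzp, hall⟩
    push Not at hall
    have hX : algebraMap ℚ[X] KK (X - C 1) ≠ 0 :=
      (map_ne_zero_iff _ (IsFractionRing.injective ℚ[X] KK)).mpr (X_sub_C_ne_zero 1)
    have hdiv : ∀ i ∈ s, (X - C 1) * (p i /ₘ (X - C 1)) = p i := fun i hi =>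
      mul_divByMonic_eq_iff_isRoot.mpr (hall i hi)
    refine ih (z * (algebraMap ℚ[X] KK (X - C 1))⁻¹) (fun i => p i /ₘ (X - C 1))
      (mul_ne_zero hz (inv_ne_zero hX)) (fun i hi => ?_) ⟨i, hi, fun h1 => ?_, ?_⟩
    · have := hzp i hi
      rw [← hdiv i hi, map_mul] at this
      rw [mul_right_comm, this, mul_comm, inv_mul_cancel_left₀ hX]
    · have := hdiv i hi
      rw [h1, mul_zero] at this
      exact h0 this.symm
    · rw [natDegree_divByMonic _ (monic_X_sub_C 1), natDegree_X_sub_C]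
      omega

end Specialization

section SpecShuffle
open Polynomial
variable {n : ℕ} {k : Fin n → ℕ}

lemma algebraMap_poly_injective : Function.Injective (algebraMap ℚ[X] KK) :=
  IsFractionRing.injective ℚ[X] KK

/-- Numerators over `ℚ[v]` viewed over `ℚ(v)`. -/
def genMap (k : Fin n → ℕ) : MvPolynomial (Vars n k) ℚ[X] →+* Fk n k :=
  (algebraMap (Pk n k) (Fk n k)).comp (MvPolynomial.map (algebraMap ℚ[X] KK))

/-- Numerators over `ℚ[v]` evaluated at `v = 1`. -/
def clsMap (k : Fin n → ℕ) : MvPolynomial (Vars n k) ℚ[X] →+* Fr (Vars n k) :=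
  (algebraMap (MvPolynomial (Vars n k) ℚ) (Fr (Vars n k))).comp
    (MvPolynomial.map (Polynomial.evalRingHom 1))

lemma genMap_injective : Function.Injective (genMap k) :=
  (IsFractionRing.injective _ _).comp (MvPolynomial.map_injective _ algebraMap_poly_injective)

variable (k) in
/-- Pairs of a rational function over `ℚ(v)` and its limit at `v = 1`. -/
def Spec : Subring (Fk n k × Fr (Vars n k)) := specRing (genMap k) (clsMap k)

lemma spec_x (u : Vars n k) : (xvr n u, Fr.x u) ∈ Spec k := by
  have := specRing_base (α := genMap k) (β := clsMap k) (MvPolynomial.X u)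
  simp only [genMap, clsMap, RingHom.comp_apply, MvPolynomial.map_X] at this
  exact this

lemma spec_poly (p : ℚ[X]) :
    (cf n (algebraMap ℚ[X] KK p), algebraMap ℚ (Fr (Vars n k)) (p.eval 1)) ∈ Spec k := by
  have := specRing_base (α := genMap k) (β := clsMap k) (MvPolynomial.C p)
  simp only [genMap, clsMap, RingHom.comp_apply, MvPolynomial.map_C, Fr.algebraMap_C] at this
  rw [cf_eq]
  exact this

lemma spec_inv {a : Fk n k} {b : Fr (Vars n k)} (h : (a, b) ∈ Spec k) (hb : b ≠ 0) :
    (a⁻¹, b⁻¹) ∈ Spec k := specRing_inv h hb (specRing_ne_zero genMap_injective h hb)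

lemma spec_div {a a' : Fk n k} {b b' : Fr (Vars n k)} (h : (a, b) ∈ Spec k)
    (h' : (a', b') ∈ Spec k) (hb : b' ≠ 0) : (a / a', b / b') ∈ Spec k := by
  rw [div_eq_mul_inv, div_eq_mul_inv]
  exact mul_mem h (spec_inv h' hb)

lemma spec_zero {b : Fr (Vars n k)} (h : (0, b) ∈ Spec k) : b = 0 :=
  specRing_zero genMap_injective h

lemma spec_perm (σ : PermFam k) {a : Fk n k} {b : Fr (Vars n k)} (h : (a, b) ∈ Spec k) :
    (permF n σ a, Fr.ren (permVE σ) b) ∈ Spec k := by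
  refine specRing_map (φ := (MvPolynomial.rename (permVf n σ)).toRingHom) (fun d => ?_)
    (fun d => ?_) h
  · simp only [genMap, RingHom.comp_apply, permF_algebraMap, AlgHom.toRingHom_eq_coe, RingHom.coe_coe]
    rw [MvPolynomial.map_rename]
  · simp only [clsMap, RingHom.comp_apply, Fr.ren_algebraMap, AlgHom.toRingHom_eq_coe, RingHom.coe_coe]
    rw [MvPolynomial.map_rename]
    rfl

lemma spec_sum {ι : Type*} (s : Finset ι) {f : ι → Fk n k} {g : ι → Fr (Vars n k)}
    (h : ∀ i ∈ s, (f i, g i) ∈ Spec k) : (∑ i ∈ s, f i, ∑ i ∈ s, g i) ∈ Spec k := by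
  have := sum_mem h
  rwa [← prod_mk_sum] at this

lemma spec_prod_one {ι : Type*} (s : Finset ι) {f : ι → Fk n k} 
    (h : ∀ i ∈ s, (f i, 1) ∈ Spec k) : (∏ i ∈ s, f i, 1) ∈ Spec k := by
  classical
  induction s using Finset.induction_on with
  | empty => exact one_mem _
  | insert i s hi ih =>
    rw [Finset.prod_insert hi]
    convert mul_mem (h i (Finset.mem_insert_self _ _)) (ih fun j hj => h j (Finset.mem_insert_of_mem hj))
      using 1
    rw [Prod.mk_mul_mk, one_mul]

variable (n k) in
/-- The parameter `v - 1`. -/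
def hpar : Fk n k := cf n (vv - 1)

lemma vv_eq : vv = algebraMap ℚ[X] KK X := by rw [vv, RatFunc.algebraMap_X]

lemma hpar_ne_zero : hpar n k ≠ 0 := by
  rw [hpar, cf, map_ne_zero_iff _ (algebraMap KK (Fk n k)).injective, vv_eq, sub_ne_zero,
    ← map_one (algebraMap ℚ[X] KK)]
  exact algebraMap_poly_injective.ne (by simpa using X_ne_C (1 : ℚ))

lemma spec_hpar : (hpar n k, 0) ∈ Spec k := by
  have := spec_poly (n := n) (k := k) (X - 1)
  simpa [hpar, vv_eq] using this

lemma cf_mul (a b : KK) : cf n (a * b) = (cf n a * cf n b : Fk n k) := by rw [cf, map_mul]; rfl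
lemma cf_sub (a b : KK) : cf n (a - b) = (cf n a - cf n b : Fk n k) := by rw [cf, map_sub]; rfl
lemma cf_one : cf n 1 = (1 : Fk n k) := by rw [cf, map_one]

lemma spec_vpow_sub_one (m : ℤ) : ((hpar n k)⁻¹ * cf n (vpow m - 1), (m : Fr (Vars n k))) ∈ Spec k ∧
    (cf n (vpow m), 1) ∈ Spec k := by
  have hv : (cf n vv, 1) ∈ Spec k := by
    have := spec_poly (n := n) (k := k) X
    simpa [vv_eq] using this
  have hv0 : (cf n vv : Fk n k) ≠ 0 := specRing_ne_zero genMap_injective hv one_ne_zero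
  have hvi : (cf n vv⁻¹, 1) ∈ Spec k := by
    have := spec_inv hv one_ne_zero
    rw [inv_one] at this
    convert this using 2
    rw [cf, map_inv₀]; rfl
  have hstep : ∀ m, (cf n (vpow (m + 1)) : Fk n k) = cf n vv * cf n (vpow m) := fun m => by
    rw [vpow_add, cf_mul, mul_comm, vpow, zpow_one, vpow]
  have hstep' : ∀ m, (cf n (vpow (m - 1)) : Fk n k) = cf n vv⁻¹ * cf n (vpow m) := fun m => by
    rw [sub_eq_add_neg, vpow_add, cf_mul, mul_comm]
    congr 2
    rw [vpow, zpow_neg_one]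
  induction m using Int.induction_on with
  | zero => exact ⟨by simp [vpow_zero, cf]; exact (Spec k).zero_mem, by
      rw [vpow_zero, cf_one]; exact one_mem (Spec k)⟩
  | succ m ih =>
    obtain ⟨h1, h2⟩ := ih
    refine ⟨?_, ?_⟩
    · convert add_mem (mul_mem hv h1) (one_mem (Spec k)) using 1
      rw [Prod.mk_mul_mk, Prod.one_eq_mk, Prod.mk_add_mk, cf_sub, hstep, cf_sub]
      congr 1
      · have h0 := hpar_ne_zero (n := n) (k := k)
        rw [show (1 : Fk n k) = (hpar n k)⁻¹ * hpar n k from (inv_mul_cancel₀ h0).symm, hpar, cf_sub,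
          cf_one]
        ring
      · push_cast; ring
    · rw [hstep]
      simpa using mul_mem hv h2
  | pred m ih =>
    obtain ⟨h1, h2⟩ := ih
    refine ⟨?_, ?_⟩
    · convert sub_mem (mul_mem hvi h1) hvi using 1
      rw [Prod.mk_mul_mk, Prod.mk_sub_mk, cf_sub, hstep', cf_sub]
      congr 1
      · have h0 := hpar_ne_zero (n := n) (k := k)
        have h3 := inv_mul_cancel₀ h0
        have hv1 : hpar n k = cf n vv - 1 := by rw [hpar, cf_sub, cf_one]
        rw [cf_one]
        have h2 : (cf n vv⁻¹ * cf n vv : Fk n k) = 1 := by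
          rw [← cf_mul, inv_mul_cancel₀, cf_one]
          rw [vv_eq]; simp [RatFunc.X_ne_zero]
        linear_combination (hpar n k)⁻¹ * h2 + (hpar n k)⁻¹ * cf n vv⁻¹ * hv1 - cf n vv⁻¹ * h3
      · push_cast; ring
    · rw [hstep']
      simpa using mul_mem hvi h2

end SpecShuffle

/-! ### Quantum root vectors -/

section QuantumBracket
variable {B B' : Type*} [Ring B] [Algebra KK B] [Ring B'] [Algebra KK B']

/-- Iterated `q`-brackets of `X`, of weight `prev`, with the generators coloured by a word. -/
def qbr (g : ℕ → B) : List ℕ → B → List ℕ → B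
  | _, X, [] => X
  | prev, X, i :: w => qbr g (i :: prev)
      (X * g i - vpow (prev.map fun a => bil a i / 2).sum • (g i * X)) w

/-- Quantum root vectors. -/
def qRoot {n : ℕ} (g : ℕ → ℕ → B) (p : Rt n × ℕ) : B :=
  qbr (fun i => g i (modes p i)) [p.1.1.1] (g p.1.1.1 (modes p p.1.1.1))
    (rtail p.1.1.1 p.1.1.2.2 p.1.1.2.1)

/-- Products of quantum root vectors. -/
def qProd {n : ℕ} (g : ℕ → ℕ → B) (b : Multiset (Rt n × ℕ)) : B := (b.toList.map (qRoot g)).prod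

lemma map_qbr (f : B →ₐ[KK] B') (g : ℕ → B) (prev : List ℕ) (X : B) (w : List ℕ) :
    f (qbr g prev X w) = qbr (fun i => f (g i)) prev (f X) w := by
  induction w generalizing prev X with
  | nil => rfl
  | cons i w ih => rw [qbr, qbr, ih, map_sub, map_mul, map_smul, map_mul]

lemma map_qProd {n : ℕ} (f : B →ₐ[KK] B') (g : ℕ → ℕ → B) (b : Multiset (Rt n × ℕ)) :
    f (qProd g b) = qProd (fun i r => f (g i r)) b := by
  rw [qProd, map_list_prod, List.map_map, qProd]
  congr 2
  funext p
  exact map_qbr f _ _ _ _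

end QuantumBracket

section QuantumShuffle
variable {n : ℕ} {k : Fin n → ℕ}

lemma half_bil_col (u w : Vars n k) :
    (dC n (u.1.1 + 1) : ℤ) * aC n (u.1.1 + 1) (w.1.1 + 1) = bil (col u) (col w) / 2 := by
  have := u.1.2; have := w.1.2
  unfold dC aC bil col
  split_ifs <;> omega

lemma bil_comm (i j : ℕ) : bil i j = bil j i := by
  unfold bil; split_ifs <;> omega

lemma bil_even (i j : ℕ) : bil i j = 2 * (bil i j / 2) := by
  unfold bil; split_ifs <;> norm_num

/-- The generators of the free algebra, with reversed colours and shifted modes. -/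
def genS (n N : ℕ) (i r : ℕ) : FA n := if h : i < n then fg n ⟨n - 1 - i, by omega⟩ (r - N) else 0

lemma genS_col (N : ℕ) (u : Vars n k) (r : ℕ) : genS n N (col u) r = fg n u.1 (r - N) := by
  have := u.1.2
  rw [genS, dif_pos (by unfold col; omega)]
  congr 1
  ext
  simp only [col]
  omega

lemma spec_ratio {a l : Vars n k} (h : a ≠ l) :
    (xvr n l / (xvr n a - xvr n l), Fr.x l * (Fr.x a - Fr.x l)⁻¹) ∈ Spec k := by
  rw [← div_eq_mul_inv]
  exact spec_div (spec_x l) (sub_mem (spec_x a) (spec_x l)) (Fr.x_sub_ne_zero h)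

lemma xvr_sub_ne_zero {a l : Vars n k} (h : a ≠ l) : (xvr n a - xvr n l : Fk n k) ≠ 0 :=
  specRing_ne_zero genMap_injective (sub_mem (spec_x a) (spec_x l)) (Fr.x_sub_ne_zero h)

lemma zt_eq {a l : Vars n k} (h : a ≠ l) : zt (aC n) (dC n) a l =
    1 + cf n (1 - vpow (-(bil (col a) (col l) / 2))) * (xvr n l / (xvr n a - xvr n l)) := by
  have := xvr_sub_ne_zero h
  rw [zt, half_bil_col, cf_sub, cf_one]
  field_simp
  ring

lemma zt_swap {a l : Vars n k} (h : a ≠ l) :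
    cf n (vpow (bil (col a) (col l) / 2)) * zt (aC n) (dC n) l a =
    1 + cf n (1 - vpow (bil (col a) (col l) / 2)) * (xvr n l / (xvr n a - xvr n l)) := by
  have h1 := xvr_sub_ne_zero h
  have h2 := xvr_sub_ne_zero h.symm
  have h3 : (cf n (vpow (bil (col a) (col l) / 2)) * cf n (vpow (-(bil (col a) (col l) / 2))) : Fk n k)
      = 1 := by rw [← cf_mul, ← vpow_add, add_neg_cancel, vpow_zero, cf_one]
  rw [zt, half_bil_col, cf_sub, cf_one, bil_comm (col l), ← neg_sub (xvr n a), div_neg, mul_neg,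
    ← mul_div_assoc, mul_sub, ← mul_assoc, h3]
  field_simp
  ring

lemma spec_zt {a l : Vars n k} (h : a ≠ l) : (zt (aC n) (dC n) a l, 1) ∈ Spec k := by
  rw [zt_eq h]
  have h1 := sub_mem (one_mem (Spec k)) (spec_vpow_sub_one (-(bil (col a) (col l) / 2))).2
  have h2 := add_mem (one_mem (Spec k)) (mul_mem h1 (spec_ratio h))
  simp only [Prod.one_eq_mk, Prod.mk_sub_mk, Prod.mk_mul_mk, Prod.mk_add_mk, sub_self, zero_mul,
    add_zero] at h2
  rwa [cf_sub, cf_one]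

lemma spec_bracket (S : Finset (Vars n k)) {l : Vars n k} (hl : l ∉ S) :
    ((hpar n k)⁻¹ * (∏ a ∈ S, zt (aC n) (dC n) a l -
        cf n (vpow (∑ a ∈ S, bil (col a) (col l) / 2)) * ∏ a ∈ S, zt (aC n) (dC n) l a),
      ∑ a ∈ S, algebraMap ℚ (Fr (Vars n k)) (bil (col a) (col l) : ℚ) *
        (Fr.x l * (Fr.x a - Fr.x l)⁻¹)) ∈ Spec k := by
  induction S using Finset.induction_on with
  | empty =>
    rw [Finset.prod_empty, Finset.prod_empty, Finset.sum_empty, Finset.sum_empty, vpow_zero, cf_one,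
      mul_one, sub_self, mul_zero]
    exact (Spec k).zero_mem
  | insert a S ha ih =>
    have hal : a ≠ l := fun h => hl (h ▸ Finset.mem_insert_self _ _)
    have hlS : l ∉ S := fun h => hl (Finset.mem_insert_of_mem h)
    have ih := ih hlS
    set m := bil (col a) (col l) / 2 with hm
    have hQ : (cf n (vpow (∑ a ∈ S, bil (col a) (col l) / 2)) * ∏ a ∈ S, zt (aC n) (dC n) l a, 1) ∈
        Spec k := by
      have := mul_mem (spec_vpow_sub_one (n := n) (k := k) (∑ a ∈ S, bil (col a) (col l) / 2)).2
        (spec_prod_one S (f := fun a => zt (aC n) (dC n) l a) fun b hb =>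
          spec_zt fun h => hlS (h ▸ hb))
      rwa [Prod.mk_mul_mk, one_mul] at this
    have h1 := mul_mem (spec_zt hal) ih
    have h2 := mul_mem (mul_mem (sub_mem (spec_vpow_sub_one (n := n) (k := k) m).1
      (spec_vpow_sub_one (-m)).1) (spec_ratio hal)) hQ
    convert add_mem h2 h1 using 1
    rw [Finset.prod_insert ha, Finset.prod_insert ha, Finset.sum_insert ha, Finset.sum_insert ha,
      vpow_add, cf_mul]
    simp only [Prod.mk_sub_mk, Prod.mk_mul_mk, Prod.mk_add_mk]
    refine Prod.ext ?_ ?_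
    · have h3 := zt_eq hal
      have h4 := zt_swap hal
      rw [← hm] at h3 h4
      simp only [cf_sub] at h3 h4 ⊢
      linear_combination (hpar n k)⁻¹ * (cf n (vpow (∑ a ∈ S, bil (col a) (col l) / 2)) *
        ∏ a ∈ S, zt (aC n) (dC n) l a) * (h3 - h4)
    · have h3 : (bil (col a) (col l) : ℚ) = m + m := by
        rw [bil_even, ← hm]; push_cast; ring
      simp only [h3, map_add, map_intCast, Int.cast_neg, one_mul, mul_one]
      ring

/-- An element of the free algebra is represented by a rational function whose renormalization
has a given limit at `v = 1`. -/
def Degen (N : ℕ) (S : Finset (Vars n k)) (M : ℕ) (X : FA n) (g : Fr (Vars n k)) : Prop :=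
  ∃ t : Fk n k, (t * ∏ u ∈ S, xvr n u ^ (-(N : ℤ)), X) ∈ ShufRep (aC n) (dC n) S ∧
    ((hpar n k)⁻¹ ^ M * t, g) ∈ Spec k

lemma Degen.gen (N : ℕ) (u : Vars n k) (r : ℕ) :
    Degen N {u} 0 (genS n N (col u) r) (Fr.x u ^ r) := by
  refine ⟨xvr n u ^ r, ?_, ?_⟩
  · rw [genS_col, Finset.prod_singleton, ← zpow_natCast, ← zpow_add₀ (xvr_ne_zero u),
      ← sub_eq_add_neg]
    exact rep_var u _
  · rw [pow_zero, one_mul]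
    exact pow_mem (spec_x u) r

lemma Degen.mul {N M M' : ℕ} {S S' : Finset (Vars n k)} (hSS : Disjoint S S') {X X' : FA n}
    {g g' : Fr (Vars n k)} (h : Degen N S M X g) (h' : Degen N S' M' X' g') :
    Degen N (S ∪ S') (M + M') (X * X') (g * g') := by
  obtain ⟨t, h1, h2⟩ := h
  obtain ⟨t', h1', h2'⟩ := h'
  refine ⟨t * t' * ∏ a ∈ S, ∏ b ∈ S', zt (aC n) (dC n) a b, ?_, ?_⟩
  · convert rep_mul hSS h1 h1' using 2
    rw [Finset.prod_union hSS]
    ring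
  · have h3 := spec_prod_one S (f := fun a => ∏ b ∈ S', zt (aC n) (dC n) a b) fun a ha =>
      spec_prod_one S' fun b hb => spec_zt fun h => Finset.disjoint_left.mp hSS ha (h ▸ hb)
    convert mul_mem (mul_mem h2 h2') h3 using 1
    rw [Prod.mk_mul_mk, Prod.mk_mul_mk, mul_one, pow_add]
    congr 1
    ring

lemma Degen.bracket {N M : ℕ} {S : Finset (Vars n k)} {l : Vars n k} (hl : l ∉ S) {X : FA n}
    {g : Fr (Vars n k)} (h : Degen N S M X g) (r : ℕ) :
    Degen N (insert l S) (M + 1) (X * genS n N (col l) r -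
      vpow (∑ a ∈ S, bil (col a) (col l) / 2) • (genS n N (col l) r * X))
      (g * (Fr.x l ^ r * ∑ a ∈ S, algebraMap ℚ (Fr (Vars n k)) (bil (col a) (col l) : ℚ) *
        (Fr.x l * (Fr.x a - Fr.x l)⁻¹))) := by
  obtain ⟨t, h1, h2⟩ := h
  obtain ⟨t', h1', h2'⟩ := Degen.gen (k := k) N l r
  rw [pow_zero, one_mul] at h2'
  have hd : Disjoint S {l} := Finset.disjoint_singleton_right.mpr hl
  have hA := rep_mul hd h1 h1'
  have hB := rep_mul hd.symm h1' h1
  rw [Finset.union_comm] at hB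
  rw [Finset.insert_eq, Finset.union_comm]
  refine ⟨t * t' * (∏ a ∈ S, zt (aC n) (dC n) a l -
    cf n (vpow (∑ a ∈ S, bil (col a) (col l) / 2)) * ∏ a ∈ S, zt (aC n) (dC n) l a), ?_, ?_⟩
  · convert sub_mem hA (Submodule.smul_mem _ (vpow (∑ a ∈ S, bil (col a) (col l) / 2)) hB) using 1
    rw [Prod.smul_mk, Prod.mk_sub_mk, smul_eq_cf, Finset.prod_union hd]
    simp only [Finset.prod_singleton]
    congr 1
    ring
  · convert mul_mem (mul_mem h2 h2') (spec_bracket S hl) using 1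
    rw [Prod.mk_mul_mk, Prod.mk_mul_mk, pow_succ]
    congr 1 <;> ring

section Blocks
variable {rk : Vars n k → ℕ} {μ : ℕ → ℕ} {A : Vars n k → ℚ}

lemma blockFn_insert {S : Finset (Vars n k)} {l : Vars n k} (hl : ∀ a ∈ S, rk a < rk l)
    (hA : A l = 0) : Fr.blockFn col rk μ (insert l S) A = Fr.blockFn col rk μ S A *
      (Fr.x l ^ μ (col l) * ∑ a ∈ S, algebraMap ℚ (Fr (Vars n k)) (bil (col a) (col l) : ℚ) *
        (Fr.x l * (Fr.x a - Fr.x l)⁻¹)) := by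
  have hlS : l ∉ S := fun h => lt_irrefl _ (hl l h)
  rw [Fr.blockFn, Finset.prod_insert hlS, mul_comm, Fr.blockFn]
  congr 1
  · refine Finset.prod_congr rfl fun a ha => ?_
    rw [Fr.chi, Fr.chi, Finset.filter_insert, if_neg (hl a ha).not_gt]
  · rw [Fr.chi, hA, map_zero, zero_add, Finset.filter_insert, if_neg (lt_irrefl _),
      Finset.filter_true_of_mem hl]

lemma Degen.qbr {N : ℕ} (w prev : List (Vars n k)) (M : ℕ) (X : FA n)
    (hw : (prev.reverse ++ w).Pairwise fun a b => rk a < rk b) (hA : ∀ a ∈ w, A a = 0)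
    (h : Degen N prev.toFinset M X (Fr.blockFn col rk μ prev.toFinset A)) :
    ∃ M', Degen N (prev.reverse ++ w).toFinset M'
      (_root_.qbr (fun i => genS n N i (μ i)) (prev.map col) X (w.map col))
      (Fr.blockFn col rk μ (prev.reverse ++ w).toFinset A) := by
  induction w generalizing prev M X with
  | nil =>
    refine ⟨M, ?_⟩
    rw [List.append_nil, List.toFinset_reverse]
    exact h
  | cons l w ih =>
    have h1 : prev.reverse ++ l :: w = (l :: prev).reverse ++ w := by simp
    have h2 : ∀ a ∈ prev.toFinset, rk a < rk l := fun a ha =>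
      (List.pairwise_append.mp hw).2.2 a (by simpa using ha) l List.mem_cons_self
    have hnd : prev.Nodup := by
      have := (List.pairwise_append.mp hw).1
      exact List.nodup_reverse.mp (this.imp fun h => ne_of_apply_ne rk h.ne)
    rw [h1] at hw ⊢
    refine ih (l :: prev) (M + 1) _ hw (fun a ha => hA a (List.mem_cons_of_mem _ ha)) ?_
    rw [List.toFinset_cons, blockFn_insert h2 (hA l List.mem_cons_self), List.map_map,
      ← List.sum_toFinset _ hnd]
    exact Degen.bracket (fun h => lt_irrefl _ (h2 l h)) h _

lemma Degen.qRoot {N : ℕ} (p : Rt n × ℕ) {L : List (Vars n k)} (hL : L.map col = rootWord p.1)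
    (hs : L.Pairwise fun a b => rk a < rk b) :
    ∃ M, Degen N L.toFinset M (_root_.qRoot (genS n N) p)
      (Fr.blockFn col rk (modes p) L.toFinset (Fr.topConst col p.1.1.1)) := by
  obtain _ | ⟨l, w⟩ := L
  · simp [rootWord] at hL
  rw [rootWord, List.map_cons, List.cons.injEq] at hL
  obtain ⟨hl, hw⟩ := hL
  have hA : ∀ a ∈ w, Fr.topConst col p.1.1.1 a = 0 := fun a ha => by
    have := mem_rtail (hw ▸ List.mem_map_of_mem (f := col) ha)
    rw [Fr.topConst, if_neg]
    omega
  have h0 : Fr.blockFn col rk (modes p) ({l} : Finset (Vars n k)) (Fr.topConst col p.1.1.1) =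
      Fr.x l ^ modes p (col l) := by
    rw [Fr.blockFn, Finset.prod_singleton, Fr.chi, Finset.filter_singleton, if_neg (lt_irrefl _),
      Fr.topConst, if_pos hl, map_one, Finset.sum_empty, add_zero, mul_one]
  have h := Degen.qbr (N := N) (μ := modes p) (rk := rk) (A := Fr.topConst col p.1.1.1) w [l] 0
    (genS n N (col l) (modes p (col l))) (by simpa using hs) hA
    (h0.symm ▸ Degen.gen N l (modes p (col l)))
  rw [hw] at h
  simpa only [List.map_cons, List.map_nil, hl, List.reverse_singleton, List.singleton_append,
    _root_.qRoot] using h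

end Blocks

lemma Degen.prod {N : ℕ} {rk : Vars n k → ℕ} (zs : List ((Rt n × ℕ) × List (Vars n k)))
    (hw : ∀ z ∈ zs, z.2.map col = rootWord z.1.1)
    (hs : (zs.map Prod.snd).flatten.Pairwise fun a b => rk a < rk b) :
    ∃ M, Degen N (zs.map Prod.snd).flatten.toFinset M
      ((zs.map Prod.fst).map (_root_.qRoot (genS n N))).prod (Fr.layoutFn col rk zs) := by
  induction zs with
  | nil =>
    refine ⟨0, 1, ?_, ?_⟩
    · have := rep_term (A := aC n) (Dd := dC n) (List.nodup_nil (α := Vars n k)) fun _ => 0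
      simpa [term, ztL, vword, wd] using this
    · rw [pow_zero, one_mul]
      exact one_mem _
  | cons z zs ih =>
    rw [List.map_cons, List.flatten_cons] at hs ⊢
    obtain ⟨h1, h2, h3⟩ := List.pairwise_append.mp hs
    obtain ⟨M, hM⟩ := ih (fun z hz => hw z (List.mem_cons_of_mem _ hz)) h2
    obtain ⟨M', hM'⟩ := Degen.qRoot (N := N) z.1 (hw z List.mem_cons_self) h1
    refine ⟨M' + M, ?_⟩
    rw [List.toFinset_append]
    refine Degen.mul (Finset.disjoint_left.mpr fun a ha hb => ?_) hM' hM
    exact lt_irrefl _ (h3 a (List.mem_toFinset.mp ha) a (List.mem_toFinset.mp hb))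

lemma exists_list_map_eq {α β : Type*} (f : α → β) (s : Multiset α) (cs : List β)
    (h : s.map f = cs) : ∃ L : List α, (L : Multiset α) = s ∧ L.map f = cs := by
  induction cs generalizing s with
  | nil => exact ⟨[], by simpa [eq_comm] using h, rfl⟩
  | cons c cs ih =>
    obtain ⟨a, ha, rfl⟩ := Multiset.mem_map.mp (h ▸ Multiset.mem_coe.mpr List.mem_cons_self)
    obtain ⟨s', rfl⟩ := Multiset.exists_cons_of_mem ha
    rw [Multiset.map_cons, ← Multiset.cons_coe, Multiset.cons_inj_right] at h
    obtain ⟨L, rfl, hL⟩ := ih s' h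
    exact ⟨a :: L, rfl, by rw [List.map_cons, hL]⟩

/-- Products of quantum root vectors of a given weight are represented by rational functions which
degenerate to the classical ones. -/
lemma exists_degeneration (N : ℕ) (b : Multiset (Rt n × ℕ))
    (hb : (b.map fun p => rtWeight p.1).sum = (Finset.univ : Finset (Vars n k)).val.map col) :
    ∃ (zs : List ((Rt n × ℕ) × List (Vars n k))) (rk : Vars n k → ℕ) (M : ℕ) (t : Fk n k),
      Layout col rk zs ∧ Multiset.ofList (zs.map Prod.fst) = b ∧
      ((hpar n k)⁻¹ ^ M * t, Fr.layoutFn col rk zs) ∈ Spec k ∧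
      freeImage (aC n) (dC n) (qProd (genS n N) b) = DirectSum.of (fun k => Fk n k) k
          (Sy t * algebraMap (Pk n k) (Fk n k) (xProd n k) ^ (-(N : ℤ))) := by
  obtain ⟨L, hL, hc⟩ := exists_list_map_eq col (Finset.univ : Finset (Vars n k)).val
    (b.toList.map fun p => rootWord p.1).flatten (by
      rw [← hb]
      conv_lhs => rw [← Multiset.coe_toList b]
      rw [Multiset.map_coe, Multiset.sum_coe]
      induction b.toList with
      | nil => rfl
      | cons p l ih =>
        rw [List.map_cons, List.sum_cons, ih, List.map_cons, List.flatten_cons, ← Multiset.coe_add]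
        rfl)
  have hnd : L.Nodup := by
    rw [← Multiset.coe_nodup, hL]
    exact Finset.univ.nodup
  have hfull : ∀ u, u ∈ L := fun u => by
    rw [← Multiset.mem_coe, hL]
    exact Finset.mem_univ u
  obtain ⟨zs, h1, h2, h3⟩ := exists_zip_words b.toList L hc
  have hlay : Layout col (fun u => L.idxOf u) zs := by
    refine ⟨h3, ?_, fun v => h2 ▸ hfull v⟩
    rw [h2, List.pairwise_iff_getElem]
    intro i j hi hj hij
    rwa [hnd.idxOf_getElem, hnd.idxOf_getElem]
  obtain ⟨M, t, hM, ht⟩ := Degen.prod (N := N) zs h3 hlay.sorted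
  refine ⟨zs, _, M, t, hlay, by rw [h1, Multiset.coe_toList], ht, ?_⟩
  rw [h2, h1, show L.toFinset = Finset.univ by ext u; simp [hfull u]] at hM
  rw [qProd, freeImage_of_rep hM, ← Sy_mul_xProd, xProd, map_prod, Finset.prod_zpow]
  rfl

lemma col_lt (u : Vars n k) : col u < n := by
  have := u.1.2
  unfold col
  omega

/-- Products of quantum root vectors are linearly independent in the shuffle algebra. -/
lemma qProd_independent (N : ℕ) (s : Finset (Multiset (Rt n × ℕ)))
    (hs : ∀ b ∈ s, (b.map fun p => rtWeight p.1).sum = (Finset.univ : Finset (Vars n k)).val.map col)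
    (a : Multiset (Rt n × ℕ) → KK)
    (h : ∑ b ∈ s, a b • freeImage (aC n) (dC n) (qProd (genS n N) b) = 0) : ∀ b ∈ s, a b = 0 := by
  have H : ∀ b, ∃ (zs : List ((Rt n × ℕ) × List (Vars n k))) (rk : Vars n k → ℕ) (M : ℕ) (t : Fk n k),
      b ∈ s → Layout col rk zs ∧ Multiset.ofList (zs.map Prod.fst) = b ∧
      ((hpar n k)⁻¹ ^ M * t, Fr.layoutFn col rk zs) ∈ Spec k ∧
      freeImage (aC n) (dC n) (qProd (genS n N) b) = DirectSum.of (fun k => Fk n k) k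
          (Sy t * algebraMap (Pk n k) (Fk n k) (xProd n k) ^ (-(N : ℤ))) := fun b => by
    by_cases hb : b ∈ s
    · obtain ⟨zs, rk, M, t, H⟩ := exists_degeneration N b (hs b hb)
      exact ⟨zs, rk, M, t, fun _ => H⟩
    · exact ⟨[], 0, 0, 0, fun h => absurd h hb⟩
  choose zs rk M t H using H
  have h0 : ∑ b ∈ s, a b • Sy (t b) = 0 := by
    have h1 : DirectSum.lof KK _ (fun k => Fk n k) k (∑ b ∈ s, a b • (Sy (t b) *
        algebraMap (Pk n k) (Fk n k) (xProd n k) ^ (-(N : ℤ)))) = 0 := by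
      rw [map_sum, ← h]
      refine Finset.sum_congr rfl fun b hb => ?_
      rw [map_smul, (H b hb).2.2.2]
      rfl
    have h2 := DirectSum.of_injective (β := fun k => Fk n k) k (h1.trans (map_zero _).symm)
    simp only [← smul_mul_assoc, ← Finset.sum_mul] at h2
    refine (mul_eq_zero.mp h2).resolve_right (zpow_ne_zero _ ?_)
    exact algebraMap_Fk_ne_zero xProd_ne_zero
  by_contra! hne
  have hv1 : vv - 1 ≠ 0 := fun h => hpar_ne_zero (n := n) (k := k) (by rw [hpar, h, cf, map_zero])
  obtain ⟨z, p, hz, hzp, b0, hb0, hpb⟩ := exists_scaling s (fun b => a b * (vv - 1) ^ M b) (by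
    obtain ⟨b, hb, hab⟩ := hne
    exact ⟨b, hb, mul_ne_zero hab (pow_ne_zero _ hv1)⟩)
  refine hpb (Fr.layoutFn_independent (V := Vars n k) (c := col) col_lt (J := PermFam k)
    (fun σ => permVE σ) (fun _ _ => rfl) s zs rk (fun b hb => ⟨(H b hb).1, (H b hb).2.1⟩)
    (fun b => (p b).eval 1) ?_ b0 hb0)
  refine spec_zero (k := k) ?_
  have h3 := spec_sum s (f := fun b => cf n (algebraMap (Polynomial ℚ) KK (p b)) *
      ∑ σ, permF n σ ((hpar n k)⁻¹ ^ M b * t b)) (g := fun b => algebraMap ℚ (Fr (Vars n k))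
      ((p b).eval 1) * ∑ σ, Fr.ren (permVE σ) (Fr.layoutFn col (rk b) (zs b))) fun b hb =>
    mul_mem (spec_poly (n := n) (k := k) (p b))
      (spec_sum Finset.univ fun σ _ => spec_perm σ (H b hb).2.2.1)
  convert h3 using 2
  · symm
    have h4 : ∑ b ∈ s, z • a b • Sy (t b) = 0 := by rw [← Finset.smul_sum, h0, smul_zero]
    rw [← h4]
    refine Finset.sum_congr rfl fun b hb => ?_
    have h5 : ∀ σ : PermFam k, permF n σ ((hpar n k)⁻¹ ^ M b * t b) =
        (hpar n k)⁻¹ ^ M b * permF n σ (t b) := fun σ => by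
      rw [map_mul, map_pow, map_inv₀, hpar, permF_cf]
    rw [← hzp b hb, Finset.sum_congr rfl fun σ _ => h5 σ, ← Finset.mul_sum,
      ← Sy_apply, smul_eq_cf, smul_eq_cf, cf_mul, cf_mul]
    have h6 : (cf n ((vv - 1) ^ M b) : Fk n k) * (hpar n k)⁻¹ ^ M b = 1 := by
      rw [cf, map_pow, ← cf, ← hpar, ← mul_pow, mul_inv_cancel₀ hpar_ne_zero, one_pow]
    linear_combination (cf n z * (cf n (a b) * Sy (t b))) * h6
  · refine Finset.sum_congr rfl fun b _ => ?_
    rw [Algebra.smul_def]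

end QuantumShuffle

/-! ### The space of shuffle elements of bounded degree is spanned by quantum PBW monomials -/

section Spanning
set_option linter.unusedSectionVars false
variable {n : ℕ} {k : Fin n → ℕ}
open MvPolynomial

lemma exists_permFam_eq (σ : Equiv.Perm (Vars n k)) (h : ∀ u, col (σ u) = col u) :
    ∃ τ : PermFam k, ∀ u, permVf n τ u = σ u := by
  obtain ⟨τ, hτ⟩ := exists_permVf (L := Finset.univ.toList) (L' := Finset.univ.toList.map σ)
    (Finset.nodup_toList _) (fun u => Finset.mem_toList.mpr (Finset.mem_univ u))
    ((Finset.nodup_toList _).map σ.injective) (fun u => List.mem_map.mpr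
      ⟨σ.symm u, Finset.mem_toList.mpr (Finset.mem_univ _), σ.apply_symm_apply u⟩) (by
      rw [List.map_map]
      refine List.map_congr_left fun u _ => Fin.ext ?_
      have h1 := h u
      have h2 := u.1.2
      have h3 := (σ u).1.2
      simp only [col] at h1
      simp only [Function.comp_apply]
      omega)
  exact ⟨τ, fun u => List.map_inj_left.mp hτ u (Finset.mem_toList.mpr (Finset.mem_univ u))⟩

lemma wheel_reduction {f : Pk n k} (hf : wheelQ n (aC n) (dC n) f) {z : KK}
    {p : (Vars n k →₀ ℕ) → Polynomial ℚ}
    (hp : ∀ d ∈ f.support, z * coeff d f = algebraMap (Polynomial ℚ) KK (p d))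
    {i j : Fin n} (hij : i ≠ j) {m : ℕ} (hm : m = (1 - aC n (i.1 + 1) (j.1 + 1)).toNat) (hm0 : 0 < m)
    (hA : aC n (i.1 + 1) (j.1 + 1) < 0) {s : Fin m → Fin (k i)} (hs : Function.Injective s)
    (r : Fin (k j)) (θ : Vars n k → Vars n k) (h1 : θ ⟨j, r⟩ = ⟨i, s ⟨0, hm0⟩⟩)
    (h2 : ∀ t, θ ⟨i, s t⟩ = ⟨i, s ⟨0, hm0⟩⟩)
    (h3 : ∀ u, u ≠ ⟨j, r⟩ → (∀ t, u ≠ ⟨i, s t⟩) → θ u = u) :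
    aeval (fun u => (X (θ u) : MvPolynomial (Vars n k) ℚ))
      (∑ d ∈ f.support, monomial d ((p d).eval 1)) = 0 := by
  subst hm
  have hθ : ∀ u, (algebraMap (Pk n k) (Fk n k)
      (wheelSub n (aC n) (dC n) i j _ hm0 s r u), Fr.x (θ u)) ∈ Spec k := by
    intro u
    have hx : ∀ (e : ℤ) (w : Vars n k),
        (algebraMap (Pk n k) (Fk n k) (C (vpow e) * X w), Fr.x w) ∈ Spec k := fun e w => by
      have := mul_mem (spec_vpow_sub_one (n := n) (k := k) e).2 (spec_x w)
      rw [Prod.mk_mul_mk, one_mul] at this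
      rw [map_mul, ← cf_eq]
      exact this
    by_cases hu : u = ⟨j, r⟩
    · rw [hu, wheelSub_center, h1]; exact hx _ _
    · by_cases hu' : ∃ t, u = ⟨i, s t⟩
      · obtain ⟨t, rfl⟩ := hu'
        rw [wheelSub_chain hij hs, h2]; exact hx _ _
      · push Not at hu'
        rw [wheelSub_other hu hu', h3 u hu hu']; exact spec_x u
  have hmem : ((∑ d ∈ f.support, cf n (algebraMap (Polynomial ℚ) KK (p d)) * ∏ u, algebraMap (Pk n k) (Fk n k)
      (wheelSub n (aC n) (dC n) i j _ hm0 s r u) ^ d u : Fk n k),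
      ∑ d ∈ f.support, algebraMap ℚ (Fr (Vars n k)) ((p d).eval 1) * ∏ u, Fr.x (θ u) ^ d u) ∈ Spec k := by
    refine spec_sum _ fun d _ => ?_
    have : ((∏ u, algebraMap (Pk n k) (Fk n k) (wheelSub n (aC n) (dC n) i j _ hm0 s r u) ^ d u : Fk n k),
        ∏ u, Fr.x (θ u) ^ d u) =
        ∏ u, (algebraMap (Pk n k) (Fk n k) (wheelSub n (aC n) (dC n) i j _ hm0 s r u), Fr.x (θ u)) ^ d u := by
      ext <;> simp [Prod.fst_prod, Prod.snd_prod]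
    rw [← Prod.mk_mul_mk, this]
    exact mul_mem (spec_poly _) (prod_mem fun u _ => pow_mem (hθ u) _)
  have hzero : (∑ d ∈ f.support, cf n (algebraMap (Polynomial ℚ) KK (p d)) * ∏ u, algebraMap (Pk n k) (Fk n k)
      (wheelSub n (aC n) (dC n) i j _ hm0 s r u) ^ d u : Fk n k) = 0 := by
    have h0 := hf i j hij hA s hs r
    rw [aeval_def, eval₂_eq'] at h0
    rw [← mul_zero (cf n z : Fk n k), ← map_zero (algebraMap (Pk n k) (Fk n k)), ← h0, map_sum,
      Finset.mul_sum]
    refine Finset.sum_congr rfl fun d hd => ?_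
    rw [← hp d hd, cf_mul, map_mul, map_prod, mul_assoc, cf_eq (coeff d f)]
    exact congrArg _ (congrArg _ (Finset.prod_congr rfl fun u _ => (map_pow _ _ _).symm))
  rw [hzero] at hmem
  refine IsFractionRing.injective (MvPolynomial (Vars n k) ℚ) (Fr (Vars n k)) ?_
  rw [map_zero, ← spec_zero hmem, map_sum, map_sum]
  refine Finset.sum_congr rfl fun d _ => ?_
  rw [aeval_monomial, map_mul, Finsupp.prod_fintype _ _ (by simp), map_prod]
  exact congrArg₂ _ (Fr.algebraMap_C _) (Finset.prod_congr rfl fun u _ => map_pow _ _ _)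

lemma wheel_specialization {f : Pk n k} (hf : wheelQ n (aC n) (dC n) f) {z : KK}
    {p : (Vars n k →₀ ℕ) → Polynomial ℚ}
    (hp : ∀ d ∈ f.support, z * coeff d f = algebraMap (Polynomial ℚ) KK (p d)) :
    Fr.Wheel (col (n := n) (k := k)) (∑ d ∈ f.support, monomial d ((p d).eval 1)) := by
  constructor
  · rintro ⟨j, r⟩ ⟨i, a⟩ ⟨i', b⟩ hab hcol hadj hno
    have h1 := i.2
    have h2 := j.2
    have h3 := i'.2
    simp only [col, Fr.Adj] at hcol hadj hno
    obtain rfl : i = i' := Fin.ext (by omega)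
    have hA : aC n (i.1 + 1) (j.1 + 1) = -1 := by
      unfold aC; split_ifs <;> omega
    have hij : i ≠ j := fun h => by rw [h] at hadj; omega
    have hab' : a ≠ b := fun h => hab (by rw [h])
    have := wheel_reduction hf hp hij (m := 2) (by rw [hA]; rfl) two_pos (by omega)
      (s := ![a, b]) (by
        intro x y hxy
        fin_cases x <;> fin_cases y <;> simp [hab', hab'.symm] at hxy ⊢) r
      (fun u => if u ∈ ({⟨j, r⟩, ⟨i, b⟩} : Finset (Vars n k)) then ⟨i, a⟩ else u) (by simp)
      (fun t => by fin_cases t <;> first | exact ite_self _ | simp) (fun u hu hu' => by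
        have := hu' 1
        simp_all)
    rw [← this]
    congr 2
    funext u
    rw [Fr.glue]
    split_ifs <;> rfl
  · rintro ⟨j, r⟩ ⟨i, a⟩ ⟨i', b⟩ ⟨i'', c⟩ hab hac hbc hc0 hc1 hc2 hc3
    have h1 := i.2
    have h2 := j.2
    have h3 := i'.2
    have h4 := i''.2
    simp only [col] at hc0 hc1 hc2 hc3
    obtain rfl : i = i' := Fin.ext (by omega)
    obtain rfl : i = i'' := Fin.ext (by omega)
    have hA : aC n (i.1 + 1) (j.1 + 1) = -2 := by
      unfold aC; split_ifs <;> omega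
    have hij : i ≠ j := fun h => by rw [h] at hc1; omega
    have hab' : a ≠ b := fun h => hab (by rw [h])
    have hac' : a ≠ c := fun h => hac (by rw [h])
    have hbc' : b ≠ c := fun h => hbc (by rw [h])
    have := wheel_reduction hf hp hij (m := 3) (by rw [hA]; rfl) three_pos (by omega)
      (s := ![a, b, c]) (by
        intro x y hxy
        fin_cases x <;> fin_cases y <;>
          simp [hab', hab'.symm, hac', hac'.symm, hbc', hbc'.symm] at hxy ⊢) r
      (fun u => if u ∈ ({⟨j, r⟩, ⟨i, b⟩, ⟨i, c⟩} : Finset (Vars n k)) then ⟨i, a⟩ else u) (by simp)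
      (fun t => by fin_cases t <;> first | exact ite_self _ | simp) (fun u hu hu' => by
        have h1 := hu' 1
        have h2 := hu' 2
        simp_all)
    rw [← this]
    congr 2
    funext u
    rw [Fr.glue]
    split_ifs <;> rfl

lemma exists_functionals (n : ℕ) (k : Fin n → ℕ) :
    ∃ Λ : Multiset (Rt n × ℕ) → Pk n k →ₗ[KK] KK, ∀ (M : ℕ) (f : Pk n k), symmQ n f →
      wheelQ n (aC n) (dC n) f → (∀ d ∈ f.support, Fr.InWindow col M d) →
      (∀ b ∈ pbwSet n (Finset.univ.val.map (col (n := n) (k := k))) M, Λ b f = 0) → f = 0 := by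
  obtain ⟨Λ, hΛ⟩ := Fr.exists_window_functionals (V := Vars n k) (c := col) col_lt
  refine ⟨fun b => (basisMonomials (Vars n k) KK).constr KK
    fun d => algebraMap (Polynomial ℚ) KK (Polynomial.C (Λ b (monomial d 1))), fun M f hsym hwh hwin h0 => ?_⟩
  by_contra hne
  obtain ⟨z, p, hz, hp, d0, hd0, hp0⟩ := exists_scaling f.support (fun d => coeff d f) (by
    obtain ⟨d, hd⟩ := support_nonempty.mpr hne
    exact ⟨d, hd, mem_support_iff.mp hd⟩)
  set g : MvPolynomial (Vars n k) ℚ := ∑ d ∈ f.support, monomial d ((p d).eval 1) with hg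
  have hcoeff : ∀ d, coeff d g = if d ∈ f.support then (p d).eval 1 else 0 := fun d => by
    rw [hg, coeff_sum]
    simp [coeff_monomial]
  have hsupp : ∀ d ∈ g.support, d ∈ f.support := fun d hd => by
    by_contra h
    rw [mem_support_iff, hcoeff, if_neg h] at hd
    exact hd rfl
  have hg0 : g = 0 := by
    refine hΛ M g (fun σ hσ => ?_) ⟨?_, ?_⟩ (fun d hd => hwin d (hsupp d hd)) fun b hb => ?_
    · obtain ⟨τ, hτ⟩ := exists_permFam_eq σ hσ
      have hστ : (σ : Vars n k → Vars n k) = permVf n τ := funext fun u => (hτ u).symm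
      set F : MvPolynomial (Vars n k) (Polynomial ℚ) := ∑ d ∈ f.support, monomial d (p d) with hF
      have hFm : map (algebraMap (Polynomial ℚ) KK) F = C z * f := by
        rw [hF, map_sum]
        conv_rhs => rw [f.as_sum, Finset.mul_sum]
        refine Finset.sum_congr rfl fun d hd => ?_
        rw [map_monomial, ← hp d hd, C_mul_monomial]
      have hFs : rename σ F = F := by
        refine map_injective _ algebraMap_poly_injective ?_
        rw [map_rename, hFm, map_mul, rename_C, hστ, hsym τ]
      have hFg : map (Polynomial.evalRingHom 1) F = g := by
        rw [hF, map_sum]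
        exact Finset.sum_congr rfl fun d _ => map_monomial _ _ _
      rw [← hFg, ← map_rename, hFs]
    · exact (wheel_specialization hwh hp).1
    · exact (wheel_specialization hwh hp).2
    · have h5 := h0 b hb
      rw [f.as_sum, map_sum] at h5
      have h6 : ∑ d ∈ f.support, p d * Polynomial.C (Λ b (monomial d 1)) = 0 := by
        refine algebraMap_poly_injective ?_
        rw [map_zero, ← mul_zero z, ← h5, map_sum, Finset.mul_sum]
        refine Finset.sum_congr rfl fun d hd => ?_
        rw [map_mul, ← hp d hd, ← mul_one (coeff d f), ← smul_eq_mul (coeff d f) 1, ← smul_monomial,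
          map_smul, smul_eq_mul, smul_eq_mul, mul_one, mul_assoc]
        have h9 := (basisMonomials (Vars n k) KK).constr_basis KK
          (fun d => algebraMap (Polynomial ℚ) KK (Polynomial.C (Λ b (monomial d 1)))) d
        rw [coe_basisMonomials] at h9
        exact congrArg _ (congrArg _ h9.symm)
      have h7 := congrArg (Polynomial.eval 1) h6
      rw [Polynomial.eval_finsetSum, Polynomial.eval_zero] at h7
      rw [← h7, hg, map_sum]
      refine Finset.sum_congr rfl fun d _ => ?_
      rw [Polynomial.eval_mul, Polynomial.eval_C, ← smul_eq_mul, ← map_smul, smul_monomial,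
        smul_eq_mul, mul_one]
  apply hp0
  have := hcoeff d0
  rw [hg0, coeff_zero, if_pos hd0] at this
  exact this.symm

end Spanning

section WordSpan
variable {B : Type*} [Ring B] [Algebra KK B] {n : ℕ}

/-- The span of the products of generators with a given multiset of letters. -/
def wordSpan (g : ℕ → ℕ → B) (c : Multiset (ℕ × ℕ)) : Submodule KK B :=
  Submodule.span KK {x | ∃ l : List (ℕ × ℕ), (l : Multiset (ℕ × ℕ)) = c ∧
    x = (l.map fun a => g a.1 a.2).prod}

lemma wordSpan_mul {g : ℕ → ℕ → B} {c c' : Multiset (ℕ × ℕ)} {x y : B} (hx : x ∈ wordSpan g c)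
    (hy : y ∈ wordSpan g c') : x * y ∈ wordSpan g (c + c') := by
  have h := Submodule.mul_mem_mul hx hy
  rw [wordSpan, wordSpan, Submodule.span_mul_span] at h
  refine Submodule.span_mono ?_ h
  rintro _ ⟨_, ⟨l, rfl, rfl⟩, _, ⟨l', rfl, rfl⟩, rfl⟩
  exact ⟨l ++ l', (Multiset.coe_add _ _).symm, by simp⟩

lemma wordSpan_gen (g : ℕ → ℕ → B) (i r : ℕ) : g i r ∈ wordSpan g {(i, r)} :=
  Submodule.subset_span ⟨[(i, r)], rfl, by simp⟩

lemma qbr_mem_wordSpan {g : ℕ → ℕ → B} (m : ℕ → ℕ) (prev : List ℕ) {X : B} {c : Multiset (ℕ × ℕ)}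
    (hX : X ∈ wordSpan g c) (w : List ℕ) : qbr (fun i => g i (m i)) prev X w ∈
      wordSpan g (c + ((w.map fun i => (i, m i) : List (ℕ × ℕ)) : Multiset (ℕ × ℕ))) := by
  induction w generalizing prev X c with
  | nil => simpa [qbr] using hX
  | cons i w ih =>
    have h1 : X * g i (m i) - vpow (prev.map fun a => bil a i / 2).sum • (g i (m i) * X) ∈
        wordSpan g (c + {(i, m i)}) := by
      refine sub_mem (wordSpan_mul hX (wordSpan_gen g _ _)) (Submodule.smul_mem _ _ ?_)
      rw [add_comm]
      exact wordSpan_mul (wordSpan_gen g _ _) hX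
    have h2 := ih (i :: prev) h1
    rw [add_assoc, Multiset.singleton_add, Multiset.cons_coe] at h2
    exact h2

/-- The letters of a root vector. -/
def letters (p : Rt n × ℕ) : Multiset (ℕ × ℕ) := ((rootWord p.1).map fun i => (i, modes p i) : List _)

lemma qProd_mem_wordSpan (g : ℕ → ℕ → B) (b : Multiset (Rt n × ℕ)) :
    qProd g b ∈ wordSpan g (b.map letters).sum := by
  have h : ∀ l : List (Rt n × ℕ), (l.map (qRoot g)).prod ∈ wordSpan g (l.map letters).sum := by
    intro l
    induction l with
    | nil => exact Submodule.subset_span ⟨[], rfl, rfl⟩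
    | cons p l ih =>
      rw [List.map_cons, List.map_cons, List.prod_cons, List.sum_cons]
      refine wordSpan_mul ?_ ih
      have := qbr_mem_wordSpan (modes p) [p.1.1.1] (wordSpan_gen g p.1.1.1 (modes p p.1.1.1))
        (rtail p.1.1.1 p.1.1.2.2 p.1.1.2.1)
      rwa [Multiset.singleton_add, Multiset.cons_coe] at this
  have := h b.toList
  rwa [← Multiset.sum_coe, ← Multiset.map_coe, Multiset.coe_toList] at this

lemma map_fst_letters (b : Multiset (Rt n × ℕ)) :
    (b.map letters).sum.map Prod.fst = (b.map fun p => rtWeight p.1).sum := by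
  rw [← Multiset.coe_mapAddMonoidHom, map_multiset_sum, Multiset.map_map]
  congr 1
  refine Multiset.map_congr rfl fun p _ => ?_
  simp [letters, rtWeight, rootWord, Function.comp_def]

lemma mem_sum_letters {a : ℕ × ℕ} {b : Multiset (Rt n × ℕ)} (h : a ∈ (b.map letters).sum) :
    ∃ p ∈ b, a ∈ letters p := by
  induction b using Multiset.induction with
  | empty => simp at h
  | cons p b ih =>
    rw [Multiset.map_cons, Multiset.sum_cons, Multiset.mem_add] at h
    rcases h with h | h
    · exact ⟨p, Multiset.mem_cons_self _ _, h⟩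
    · obtain ⟨q, hq, h⟩ := ih h
      exact ⟨q, Multiset.mem_cons_of_mem hq, h⟩

end WordSpan

section Spanning
set_option linter.unusedSectionVars false
variable {n : ℕ} {k : Fin n → ℕ}
open MvPolynomial

lemma exists_genS_word {N : ℕ} {l : List (ℕ × ℕ)}
    (hl : (l : Multiset (ℕ × ℕ)).map Prod.fst = (Finset.univ : Finset (Vars n k)).val.map col) :
    ∃ (L : List (Vars n k)) (r : Vars n k → ℕ), L.Nodup ∧ (∀ u, u ∈ L) ∧
      L.map (fun u => (col u, r u)) = l ∧
      (l.map fun a => genS n N a.1 a.2).prod = wd KK (vword L fun u => (r u : ℤ) - N) := by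
  obtain ⟨L, hL, hc⟩ := exists_list_map_eq col (Finset.univ : Finset (Vars n k)).val
    (l.map Prod.fst) (by rw [← hl]; rfl)
  have hnd : L.Nodup := by
    rw [← Multiset.coe_nodup, hL]
    exact Finset.univ.nodup
  obtain ⟨r, hr⟩ := exists_map_eq hnd (rs := l.map Prod.snd)
    (by simpa using (congrArg List.length hc).symm)
  have hlL : L.map (fun u => (col u, r u)) = l := by
    rw [← List.zip_map', hc, hr, List.zip_map']
    simp
  refine ⟨L, r, hnd, fun u => ?_, hlL, ?_⟩
  · rw [← Multiset.mem_coe, hL]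
    exact Finset.mem_univ u
  · rw [← hlL, List.map_map, wd, vword, List.map_map]
    congr 1
    exact List.map_congr_left fun u _ => genS_col N u (r u)

lemma freeImage_wordSpan {N M : ℕ} {c : Multiset (ℕ × ℕ)}
    (hc : c.map Prod.fst = (Finset.univ : Finset (Vars n k)).val.map col) (hM : ∀ a ∈ c, a.2 ≤ M)
    {x : FA n} (hx : x ∈ wordSpan (genS n N) c) :
    ∃ F : Fk n k, InX M (F * algebraMap (Pk n k) (Fk n k) (xProd n k) ^ N) ∧
      freeImage (aC n) (dC n) x = DirectSum.of (fun k => Fk n k) k F := by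
  induction hx using Submodule.span_induction with
  | mem x h =>
    obtain ⟨l, rfl, rfl⟩ := h
    obtain ⟨L, r, h1, h2, h3, h4⟩ := exists_genS_word (N := N) hc
    refine ⟨_, ?_, by rw [h4, freeImage_vword _ _ h1 h2]⟩
    rw [← zpow_natCast, ← Sy_mul_xProd, ← term_shift h1 h2]
    simp only [sub_add_cancel]
    exact inX_Sy_term h1 h2 fun u => hM (col u, r u) (by
      rw [Multiset.mem_coe, ← h3]
      exact List.mem_map_of_mem (h2 u))
  | zero => exact ⟨0, by rw [zero_mul]; exact (spaceX k M).zero_mem, by rw [map_zero, map_zero]⟩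
  | add x y _ _ hx hy =>
    obtain ⟨F, h1, h2⟩ := hx
    obtain ⟨G, h3, h4⟩ := hy
    exact ⟨F + G, by rw [add_mul]; exact h1.add h3, by rw [map_add, map_add, h2, h4]⟩
  | smul a x _ hx =>
    obtain ⟨F, h1, h2⟩ := hx
    exact ⟨a • F, by rw [smul_mul_assoc]; exact h1.smul a, by
      rw [map_smul, h2]; exact ((DirectSum.lof KK _ (fun k => Fk n k) k).map_smul a F).symm⟩

lemma pbwSet_finite (n : ℕ) (κ : Multiset ℕ) (M : ℕ) : (pbwSet n κ M).Finite := by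
  have hR : Finite (Rt n) := by
    refine Finite.of_injective (β := Fin n × Fin n × Fin n)
      (fun p => (⟨p.1.1, by have := p.2.1; omega⟩, ⟨p.1.2.1, by have := p.2.1; omega⟩,
        ⟨p.1.2.2, by have := p.2.1; have := p.2.2.1; omega⟩)) fun p q h => ?_
    simp only [Prod.mk.injEq, Fin.mk.injEq] at h
    exact Subtype.ext (Prod.ext h.1 (Prod.ext h.2.1 h.2.2))
  have hS : {p : Rt n × ℕ | p.2 ≤ M * κ.card}.Finite :=
    (Set.finite_univ.prod (Set.finite_Iic (M * κ.card))).subset fun p hp => ⟨trivial, hp⟩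
  classical
  refine (Set.finite_Iic (κ.card • hS.toFinset.val)).subset fun b hb => ?_
  have hle : ∀ p ∈ b, rtWeight p.1 ≤ κ := fun p hp => by
    rw [← hb.2]
    exact Multiset.single_le_sum (fun _ _ => Multiset.zero_le _) _
      (Multiset.mem_map_of_mem (fun p : Rt n × ℕ => rtWeight p.1) hp)
  have hcard : b.card ≤ κ.card := by
    rw [← hb.2]
    clear hb hle
    induction b using Multiset.induction with
    | empty => simp
    | cons p b ih =>
      have := rtWeight_card_pos p.1
      rw [Multiset.card_cons, Multiset.map_cons, Multiset.sum_cons, Multiset.card_add]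
      omega
  refine Multiset.le_iff_count.mpr fun p => ?_
  by_cases hp : p ∈ b
  · rw [Multiset.count_nsmul, Multiset.count_eq_one_of_mem hS.toFinset.nodup, mul_one]
    · exact (Multiset.count_le_card _ _).trans hcard
    · exact hS.mem_toFinset.mpr ((hb.1 p hp).trans (Nat.mul_le_mul_left _
        (Multiset.card_le_card (hle p hp))))
  · rw [Multiset.count_eq_zero_of_notMem hp]; exact Nat.zero_le _

lemma exists_preimage {N M : ℕ} {F : Fk n k}
    (hF : InX M (F * algebraMap (Pk n k) (Fk n k) (xProd n k) ^ N)) :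
    ∃ x : FA n, freeImage (aC n) (dC n) x = DirectSum.of (fun k => Fk n k) k F := by
  obtain ⟨Λ, hΛ⟩ := exists_functionals n k
  set κ := (Finset.univ : Finset (Vars n k)).val.map col with hκ
  set S := (pbwSet_finite n κ M).toFinset with hS
  have hG : ∀ b : S, ∃ G : Fk n k, InX M (G * algebraMap (Pk n k) (Fk n k) (xProd n k) ^ N) ∧
      freeImage (aC n) (dC n) (qProd (genS n N) b.1) = DirectSum.of (fun k => Fk n k) k G := by
    rintro ⟨b, hb⟩
    have hb := (pbwSet_finite n κ M).mem_toFinset.mp hb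
    refine freeImage_wordSpan ?_ ?_ (qProd_mem_wordSpan _ b)
    · rw [map_fst_letters, hb.2]
    · intro a ha
      obtain ⟨p, hp, ha⟩ := mem_sum_letters ha
      obtain ⟨i, -, rfl⟩ := List.mem_map.mp (Multiset.mem_coe.mp ha)
      exact modes_le (hb.1 p hp) i
  choose G hG1 hG2 using hG
  have hnum := hG1
  choose g hg1 hg2 hg3 hg4 using hnum
  have hX0 : algebraMap (Pk n k) (Fk n k) (xProd n k) ^ N ≠ 0 :=
    pow_ne_zero _ (algebraMap_Fk_ne_zero xProd_ne_zero)
  have hD0 : algebraMap (Pk n k) (Fk n k) (Dpoly n (aC n) k) ≠ 0 :=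
    algebraMap_Fk_ne_zero Dpoly_ne_zero
  obtain ⟨f, hf1, hf2, hf3, hf4⟩ := id hF
  have key : ∀ (e : KK) (a : S → KK), (∀ b : S, e * Λ b.1 f = ∑ b', a b' * Λ b.1 (g b')) →
      e • F = ∑ b, a b • G b := by
    intro e a h
    have hmem : InX M ((e • F - ∑ b, a b • G b) * algebraMap (Pk n k) (Fk n k) (xProd n k) ^ N) := by
      rw [sub_mul, smul_mul_assoc, Finset.sum_mul]
      refine (spaceX k M).sub_mem ((spaceX k M).smul_mem _ hF) ((spaceX k M).sum_mem fun b _ => ?_)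
      rw [smul_mul_assoc]
      exact (spaceX k M).smul_mem _ (hG1 b)
    obtain ⟨q, hq1, hq2, hq3, hq4⟩ := hmem
    have hq : q = e • f - ∑ b, a b • g b := by
      refine IsFractionRing.injective (Pk n k) (Fk n k) ?_
      have hsm : ∀ (c : KK) (x : Pk n k), algebraMap (Pk n k) (Fk n k) (c • x) =
          c • algebraMap (Pk n k) (Fk n k) x := fun c x => by
        rw [smul_eq_C_mul, map_mul, ← cf_eq, ← smul_eq_cf]
      simp only [← hq4, map_sub, map_sum, hsm, ← hf4, ← hg4, sub_mul, Finset.sum_mul,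
        smul_mul_assoc]
    have hq0 : q = 0 := by
      refine hΛ M q hq1 hq2 hq3 fun b hb => ?_
      have := h ⟨b, (pbwSet_finite n κ M).mem_toFinset.mpr hb⟩
      simp only at this
      rw [hq, map_sub, map_sum, map_smul, smul_eq_mul, this, sub_eq_zero]
      exact Finset.sum_congr rfl fun b' _ => by rw [map_smul, smul_eq_mul]
    rw [hq0, map_zero] at hq4
    have := (mul_eq_zero.mp ((mul_eq_zero.mp hq4).resolve_right hD0)).resolve_right hX0
    exact sub_eq_zero.mp this
  set A : Matrix S S KK := fun b b' => Λ b.1 (g b') with hA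
  have hinj : Function.Injective A.mulVecLin := by
    rw [← LinearMap.ker_eq_bot, LinearMap.ker_eq_bot']
    intro a ha
    have h0 := key 0 a fun b => by
      rw [zero_mul]
      have := congrFun ha b
      simp only [Matrix.mulVecLin_apply, Matrix.mulVec, dotProduct, Pi.zero_apply] at this
      rw [← this]
      exact Finset.sum_congr rfl fun b' _ => mul_comm _ _
    rw [zero_smul] at h0
    classical
    have h1 := qProd_independent N S (fun b hb => ((pbwSet_finite n κ M).mem_toFinset.mp hb).2)
      (fun b => if hb : b ∈ S then a ⟨b, hb⟩ else 0) (by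
        rw [← Finset.sum_coe_sort S, ← map_zero (DirectSum.of (fun k => Fk n k) k), h0, map_sum]
        refine Finset.sum_congr rfl fun b _ => ?_
        rw [dif_pos b.2, hG2]
        exact ((DirectSum.lof KK _ (fun k => Fk n k) k).map_smul _ _).symm)
    funext b
    have := h1 b.1 b.2
    rwa [dif_pos b.2] at this
  obtain ⟨a, ha⟩ := (LinearMap.injective_iff_surjective.mp hinj) fun b => Λ b.1 f
  have h1 := key 1 a fun b => by
    have := congrFun ha b
    simp only [Matrix.mulVecLin_apply, Matrix.mulVec, dotProduct] at this
    rw [one_mul, ← this]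
    exact Finset.sum_congr rfl fun b' _ => mul_comm _ _
  refine ⟨∑ b, a b • qProd (genS n N) b.1, ?_⟩
  rw [← one_smul KK F, h1, map_sum, map_sum]
  refine Finset.sum_congr rfl fun b _ => ?_
  rw [map_smul, hG2]
  exact ((DirectSum.lof KK _ (fun k => Fk n k) k).map_smul _ _).symm

end Spanning

section SpecPair
open Polynomial
variable {T : Type*} {δ : T → Multiset ℕ × ℕ}

/-- Pairs of a rational function and its value at `v = 1`. -/
def atOne : Subring (KK × ℚ) := specRing (algebraMap ℚ[X] KK) (evalRingHom 1)

lemma vpow_atOne (e : ℤ) : (vpow e, (1 : ℚ)) ∈ atOne := by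
  have h : (vv, (1 : ℚ)) ∈ atOne := by
    have := specRing_base (α := algebraMap ℚ[X] KK) (β := evalRingHom (1 : ℚ)) X
    rwa [coe_evalRingHom, eval_X, ← vv_eq] at this
  have hp : ∀ m : ℕ, (vv ^ m, (1 : ℚ)) ∈ atOne := fun m => by
    have := pow_mem h m
    rwa [Prod.pow_mk, one_pow] at this
  obtain ⟨m, rfl | rfl⟩ := e.eq_nat_or_neg
  · exact_mod_cast hp m
  · rw [vpow_neg, ← inv_one (G := ℚ)]
    exact specRing_inv (by exact_mod_cast hp m) one_ne_zero (vpow_ne_zero _)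

lemma qFact_atOne {d m : ℕ} (hd : d ≠ 0) (hm : m ≤ 3) :
    (qFact (vpow d) m, (m.factorial : ℚ)) ∈ atOne := by
  have h : ∀ k < 3, (qInt (vpow d) (k + 1), ((k + 1 : ℕ) : ℚ)) ∈ atOne := by
    have hv := vpow_atOne d
    have hi := vpow_atOne (-d)
    rw [vpow_neg] at hi
    intro k hk
    have h0 := vpow_ne_zero d
    have h1 := qInt_denom_ne hd
    interval_cases k
    · rw [qInt_one h1]; exact (by norm_num : ((1 : KK), ((0 + 1 : ℕ) : ℚ)) = 1) ▸ one_mem atOne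
    · rw [qInt_two h0 h1]
      have := add_mem hv hi
      rw [Prod.mk_add_mk] at this
      norm_num at this ⊢
      exact this
    · rw [qInt_three h0 h1]
      have := add_mem (add_mem (mul_mem hv hv) (one_mem _)) (mul_mem hi hi)
      rw [Prod.mk_mul_mk, Prod.mk_mul_mk, ← Prod.mk_one_one, Prod.mk_add_mk, Prod.mk_add_mk] at this
      norm_num [sq] at this ⊢
      exact this
  have := prod_mem (t := Finset.range m) fun k hk => h k ((Finset.mem_range.mp hk).trans_le hm)
  rwa [← prod_mk_prod, ← Nat.cast_prod, Finset.prod_range_add_one_eq_factorial] at this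

/-- Pairs of homogeneous elements, the second one being the value of the first one at `v = 1`. -/
def specPair (δ : T → Multiset ℕ × ℕ) (d : Multiset ℕ × ℕ) :
    AddSubgroup (FreeAlgebra KK T × FreeAlgebra ℚ T) :=
  AddSubgroup.closure {p | ∃ (w : List T) (q : KK × ℚ), q ∈ atOne ∧ (w.map δ).sum = d ∧
    p = (q.1 • wd KK w, q.2 • wd ℚ w)}

lemma specPair_wd (δ : T → Multiset ℕ × ℕ) {w : List T} {d : Multiset ℕ × ℕ} {a : KK} {b : ℚ}
    (h : (a, b) ∈ atOne) (hw : (w.map δ).sum = d) : (a • wd KK w, b • wd ℚ w) ∈ specPair δ d :=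
  AddSubgroup.subset_closure ⟨w, _, h, hw, rfl⟩

lemma specPair_mul {d d' : Multiset ℕ × ℕ} {p p' : FreeAlgebra KK T × FreeAlgebra ℚ T}
    (hp : p ∈ specPair δ d) (hp' : p' ∈ specPair δ d') : p * p' ∈ specPair δ (d + d') := by
  induction hp using AddSubgroup.closure_induction with
  | mem p h =>
    obtain ⟨w, q, hq, hw, rfl⟩ := h
    induction hp' using AddSubgroup.closure_induction with
    | mem p' h =>
      obtain ⟨w', q', hq', hw', rfl⟩ := h
      have := specPair_wd δ (mul_mem hq hq') (w := w ++ w') (d := d + d') (by simp [hw, hw'])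
      rwa [Prod.mk_mul_mk, smul_mul_smul_comm, smul_mul_smul_comm, ← wd_append, ← wd_append]
    | zero => rw [mul_zero]; exact zero_mem _
    | add x y _ _ hx hy => rw [mul_add]; exact add_mem hx hy
    | neg x _ hx => rw [mul_neg]; exact neg_mem hx
  | zero => rw [zero_mul]; exact zero_mem _
  | add x y _ _ hx hy => rw [add_mul]; exact add_mem hx hy
  | neg x _ hx => rw [neg_mul]; exact neg_mem hx

lemma specPair_vpow_smul {d : Multiset ℕ × ℕ} (e : ℤ) {x : FreeAlgebra KK T} {y : FreeAlgebra ℚ T}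
    (h : (x, y) ∈ specPair δ d) : (vpow e • x, y) ∈ specPair δ d := by
  have := specPair_mul (specPair_wd δ (w := []) (vpow_atOne e) rfl) h
  rw [List.map_nil, List.sum_nil, zero_add] at this
  simpa [wd] using this

lemma specPair_ι (u : T) : (FreeAlgebra.ι KK u, FreeAlgebra.ι ℚ u) ∈ specPair δ (δ u) := by
  simpa [wd] using specPair_wd δ (w := [u]) (one_mem atOne) (d := δ u) (by simp)

end SpecPair

section Specialized
open Polynomial
variable {n : ℕ}

/-- The colour and the mode of a letter. -/
def colorMode (u : Fin n × ℕ) : Multiset ℕ × ℕ := ({u.1.1}, u.2)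

lemma colorMode_sum (w : List (Fin n × ℕ)) : (w.map colorMode).sum.1.card = w.length ∧
    ∀ u ∈ w, u.2 ≤ (w.map colorMode).sum.2 := by
  induction w with
  | nil => simp
  | cons a w ih =>
    simp only [List.map_cons, List.sum_cons, Prod.fst_add, Prod.snd_add, Multiset.card_add, colorMode,
      Multiset.card_singleton, List.length_cons, List.mem_cons, forall_eq_or_imp]
    exact ⟨by rw [ih.1, add_comm], by omega, fun u hu => (ih.2 u hu).trans (by omega)⟩

lemma colorMode_finite (d : Multiset ℕ × ℕ) :
    {w : List (Fin n × ℕ) | (w.map colorMode).sum = d}.Finite := by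
  refine ((List.finite_length_eq (Fin n × Fin (d.2 + 1)) d.1.card).image
    (List.map fun u => (u.1, u.2.1))).subset fun w hw => ?_
  obtain rfl : _ = d := hw
  refine ⟨w.map fun u => (u.1, Fin.ofNat _ u.2), ?_, ?_⟩
  · simp [(colorMode_sum w).1]
  · rw [List.map_map]
    refine (List.map_congr_left fun u hu => ?_).trans (List.map_id w)
    have := (colorMode_sum w).2 u hu
    exact Prod.ext rfl (Nat.mod_eq_of_lt (Nat.lt_succ_of_le this))

/-- The generators of the free algebra over `ℚ(v)`, with arbitrary colours. -/
def genK (n i r : ℕ) : FreeAlgebra KK (Fin n × ℕ) :=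
  if h : i < n then FreeAlgebra.ι KK (⟨i, h⟩, r) else 0

lemma specPair_gen (i r : ℕ) : (genK n i r, genF n ℕ i r) ∈ specPair colorMode ({i}, r) := by
  by_cases h : i < n
  · rw [genK, genF, dif_pos h, dif_pos h]
    exact specPair_ι (δ := colorMode) ((⟨i, h⟩ : Fin n), r)
  · rw [genK, genF, dif_neg h, dif_neg h]
    exact zero_mem _

attribute [local instance] LieRing.ofAssociativeRing

lemma specPair_qbr (m : ℕ → ℕ) (w prev : List ℕ) {X : FreeAlgebra KK (Fin n × ℕ)}
    {x : FreeAlgebra ℚ (Fin n × ℕ)} {d : Multiset ℕ × ℕ} (h : (X, x) ∈ specPair colorMode d) :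
    ∃ d', (qbr (fun i => genK n i (m i)) prev X w,
      lnc x (w.map fun i => genF n ℕ i (m i))) ∈ specPair colorMode d' := by
  induction w generalizing prev X x d with
  | nil => exact ⟨d, h⟩
  | cons i w ih =>
    refine ih (i :: prev) (d := d + ({i}, m i)) ?_
    have h1 := specPair_mul h (specPair_gen i (m i))
    have h2 := specPair_mul (specPair_gen (n := n) i (m i)) h
    rw [add_comm] at h2
    exact sub_mem h1 (specPair_vpow_smul _ h2)

lemma specPair_qProd (b : Multiset (Rt n × ℕ)) : ∃ d, (qProd (genK n) b,
    (b.toList.map fun p => rootLnc (genF n ℕ) p.1.1.1 p.1.1.2.2 p.1.1.2.1 (modes p)).prod) ∈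
      specPair colorMode d := by
  rw [qProd]
  induction b.toList with
  | nil => exact ⟨0, by simpa [wd] using specPair_wd colorMode (w := []) (one_mem atOne) (d := 0) rfl⟩
  | cons p l ih =>
    obtain ⟨d, hd⟩ := ih
    obtain ⟨d', hd'⟩ := specPair_qbr (modes p) (rtail p.1.1.1 p.1.1.2.2 p.1.1.2.1) [p.1.1.1]
      (specPair_gen (n := n) p.1.1.1 (modes p p.1.1.1))
    exact ⟨d' + d, specPair_mul hd' hd⟩

end Specialized

section Reduction
open Polynomial
variable {n : ℕ}

lemma exists_reduction (Θ : FreeAlgebra KK (Fin n × ℕ) →ₗ[KK] KK) {w₀ : List (Fin n × ℕ)}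
    (h₀ : Θ (wd KK w₀) ≠ 0) : ∃ φ : FreeAlgebra ℚ (Fin n × ℕ) →ₗ[ℚ] ℚ, φ ≠ 0 ∧
      ∀ d x y, (x, y) ∈ specPair colorMode d → Θ x = 0 → φ y = 0 := by
  classical
  set d₀ := (w₀.map colorMode).sum with hd₀
  have hW : ∀ w : List (Fin n × ℕ), w ∈ (colorMode_finite d₀).toFinset ↔ (w.map colorMode).sum = d₀ :=
    fun w => (colorMode_finite d₀).mem_toFinset
  obtain ⟨z, p, hz, hp, w, hw, hw0⟩ := exists_scaling (colorMode_finite d₀).toFinset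
    (fun w => Θ (wd KK w)) ⟨w₀, (hW w₀).mpr rfl, h₀⟩
  set φ := onWords ℚ fun w : List (Fin n × ℕ) =>
    if (w.map colorMode).sum = d₀ then (p w).eval 1 else 0 with hφ
  refine ⟨φ, fun h => hw0 ?_, fun d x y hxy hx => ?_⟩
  · have := LinearMap.congr_fun h (wd ℚ w)
    rwa [hφ, onWords_wd, if_pos ((hW w).mp hw)] at this
  · by_cases hd : d = d₀
    · have key : ∀ q ∈ specPair (T := Fin n × ℕ) colorMode d, (z * Θ q.1, φ q.2) ∈ atOne := by
        intro q hq
        induction hq using AddSubgroup.closure_induction with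
        | mem q h =>
          obtain ⟨w, c, hc, hw, rfl⟩ := h
          have := mul_mem hc (specRing_base (α := algebraMap ℚ[X] KK) (β := evalRingHom (1 : ℚ)) (p w))
          rw [← hp w ((hW w).mpr (hw.trans hd)), coe_evalRingHom] at this
          rw [map_smul, map_smul, hφ, onWords_wd, if_pos (hw.trans hd), smul_eq_mul, smul_eq_mul,
            mul_left_comm]
          exact this
        | zero =>
          rw [Prod.fst_zero, Prod.snd_zero, map_zero, map_zero, mul_zero]; exact zero_mem atOne
        | add q q' _ _ h h' =>
          rw [Prod.fst_add, Prod.snd_add, map_add, map_add, mul_add]; exact add_mem h h'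
        | neg q _ h => rw [Prod.fst_neg, Prod.snd_neg, map_neg, map_neg, mul_neg]; exact neg_mem h
      have := key _ hxy
      rw [hx, mul_zero] at this
      exact specRing_zero algebraMap_poly_injective this
    · have key : ∀ q ∈ specPair (T := Fin n × ℕ) colorMode d, φ q.2 = 0 := by
        intro q hq
        induction hq using AddSubgroup.closure_induction with
        | mem q h =>
          obtain ⟨w, c, hc, hw, rfl⟩ := h
          rw [map_smul, hφ, onWords_wd, if_neg (hw ▸ hd), smul_zero]
        | zero => rw [Prod.snd_zero, map_zero]
        | add q q' _ _ h h' => rw [Prod.snd_add, map_add, h, h', add_zero]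
        | neg q _ h => rw [Prod.snd_neg, map_neg, h, neg_zero]
      exact key (x, y) hxy

end Reduction

section NestedBrackets
attribute [local instance] LieRing.ofAssociativeRing
variable {Q : Type*} [Ring Q] [Algebra ℚ Q]

/-- The classical Serre element of degree `m`, symmetrized. -/
def symSerre {m : ℕ} (e : Fin m → Q) (y : Q) : Q :=
  ∑ σ : Equiv.Perm (Fin m), ∑ s ∈ Finset.range (m + 1),
    ((-1 : ℚ) ^ s * (m.factorial / (s.factorial * (m - s).factorial))) •
      (insertedWord (fun l => e (σ l)) y s).prod

lemma symSerre_one (e : Fin 1 → Q) (y : Q) : symSerre e y = ⁅y, e 0⁆ := by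
  simp [symSerre, Finset.sum_range_succ, insertedWord, LieRing.of_associative_ring_bracket,
    sub_eq_add_neg]

lemma symSerre_two (e : Fin 2 → Q) (y : Q) (h : e 0 * e 1 = e 1 * e 0) :
    symSerre e y = (2 : ℚ) • ⁅⁅y, e 0⁆, e 1⁆ := by
  have := sum_perm_two fun p q => y * (e p * e q) - (2 : ℚ) • (e p * (y * e q)) + e p * (e q * y)
  refine Eq.trans (Finset.sum_congr rfl fun σ _ => ?_) (this.trans ?_)
  · simp [Finset.sum_range_succ, insertedWord, sub_eq_add_neg, Nat.factorial, mul_assoc]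
  · have h' : ∀ x, e 1 * (e 0 * x) = e 0 * (e 1 * x) := fun x => by rw [← mul_assoc, ← h, mul_assoc]
    simp only [LieRing.of_associative_ring_bracket, sub_mul, mul_sub, mul_assoc, ← h, h', smul_sub]
    module

lemma symSerre_three (e : Fin 3 → Q) (y : Q) (h : ∀ a b, e a * e b = e b * e a) :
    symSerre e y = (6 : ℚ) • ⁅⁅⁅y, e 0⁆, e 1⁆, e 2⁆ := by
  have := sum_perm_three fun p q r => y * (e p * (e q * e r)) - (3 : ℚ) • (e p * (y * (e q * e r))) +
    (3 : ℚ) • (e p * (e q * (y * e r))) - e p * (e q * (e r * y))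
  refine Eq.trans (Finset.sum_congr rfl fun σ _ => ?_) (this.trans ?_)
  · simp [Finset.sum_range_succ, insertedWord, sub_eq_add_neg, Nat.factorial, mul_assoc]
    module
  · have h' : ∀ a b x, e a * (e b * x) = e b * (e a * x) := fun a b x => by
      rw [← mul_assoc, h, mul_assoc]
    simp only [LieRing.of_associative_ring_bracket, sub_mul, mul_sub, mul_assoc, h 1 0, h 2 0, h 2 1,
      h' 1 0, h' 2 0, h' 2 1, smul_sub]
    module

end NestedBrackets

section SpecializedRelations
variable {n : ℕ}

/-- The words in shifted generators, inside the quantum algebra. -/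
def toUA (n N : ℕ) : FreeAlgebra KK (Fin n × ℕ) →ₐ[KK] UA n (aC n) (dC n) :=
  FreeAlgebra.lift KK fun u => RingQuot.mkAlgHom KK _ (genS n N u.1 u.2)

lemma toUA_genK (N i r : ℕ) : toUA n N (genK n i r) = RingQuot.mkAlgHom KK _ (genS n N i r) := by
  by_cases h : i < n
  · rw [genK, dif_pos h, toUA, FreeAlgebra.lift_ι_apply]
  · rw [genK, genS, dif_neg h, dif_neg h, map_zero, map_zero]

lemma toUA_ι (N : ℕ) (u : Fin n × ℕ) :
    toUA n N (FreeAlgebra.ι KK u) = RingQuot.mkAlgHom KK _ (fg n u.1.rev (u.2 - N)) := by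
  rw [toUA, FreeAlgebra.lift_ι_apply, genS, dif_pos u.1.2]
  congr 2
  exact Fin.ext (by simp only [Fin.val_rev]; omega)

lemma toUA_loop (N : ℕ) (u w : Fin n × ℕ) : ∃ e : ℤ, toUA n N
    (FreeAlgebra.ι KK (u.1, u.2 + 1) * FreeAlgebra.ι KK w -
        vpow e • (FreeAlgebra.ι KK u * FreeAlgebra.ι KK (w.1, w.2 + 1)) -
      (vpow e • (FreeAlgebra.ι KK w * FreeAlgebra.ι KK (u.1, u.2 + 1)) -
        FreeAlgebra.ι KK (w.1, w.2 + 1) * FreeAlgebra.ι KK u)) = 0 := by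
  refine ⟨(dC n (u.1.rev.1 + 1) : ℤ) * aC n (u.1.rev.1 + 1) (w.1.rev.1 + 1), ?_⟩
  have := RingQuot.mkAlgHom_rel KK
    (URel.loop (A := aC n) (Dd := dC n) u.1.rev w.1.rev ((u.2 : ℤ) - N) ((w.2 : ℤ) - N))
  simp only [map_sub, map_mul, map_smul, toUA_ι] at this ⊢
  rw [← sub_eq_zero.mpr this]
  push_cast
  simp only [add_sub_right_comm]

lemma toUA_wd (N : ℕ) (w : List (Fin n × ℕ)) : toUA n N (wd KK w) =
    RingQuot.mkAlgHom KK _ (wd KK (w.map fun u => (u.1.rev, (u.2 : ℤ) - N))) := by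
  simp only [wd, map_list_prod, List.map_map]
  congr 1
  exact List.map_congr_left fun u _ => toUA_ι N u

lemma toUA_serre (N : ℕ) {i j : Fin n} (hij : i ≠ j) {m : ℕ}
    (hm : m = (1 - aC n (i.rev.1 + 1) (j.rev.1 + 1)).toNat) (r : Fin m → ℕ) (t : ℕ) :
    toUA n N (∑ σ : Equiv.Perm (Fin m), ∑ s ∈ Finset.range (m + 1),
      ((-1 : KK) ^ s * qBinom (vpow (dC n (i.rev.1 + 1))) m s) •
        wd KK (insertedWord (fun l => (i, r (σ l))) (j, t) s)) = 0 := by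
  subst hm
  have := RingQuot.mkAlgHom_rel KK (URel.serre (A := aC n) (Dd := dC n) i.rev j.rev
    (fun h => hij (Fin.rev_injective h)) (fun l => (r l : ℤ) - N) ((t : ℤ) - N))
  rw [serreElt_eq] at this
  simp only [map_sum, map_smul, map_zero, toUA_wd, map_insertedWord] at this ⊢
  exact this

/-- The congruence of a functional: the largest two-sided ideal in its kernel. -/
def nullCon {F : Type*} [Ring F] [Algebra ℚ F] (φ : F →ₗ[ℚ] ℚ) : RingCon F where
  r x y := ∀ a b, φ (a * x * b) = φ (a * y * b)
  iseqv := ⟨fun _ _ _ => rfl, fun h a b => (h a b).symm, fun h h' a b => (h a b).trans (h' a b)⟩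
  add' h h' a b := by simp only [mul_add, add_mul, map_add, h a b, h' a b]
  mul' {w x y z} h h' a b := by
    rw [← mul_assoc, mul_assoc (a * w), h, ← mul_assoc (a * x), mul_assoc a x, ← mul_assoc a,
      h' (a * x), ← mul_assoc]

lemma nullCon_mk_eq_zero {F : Type*} [Ring F] [Algebra ℚ F] {φ : F →ₗ[ℚ] ℚ} {y : F} :
    (nullCon φ).mk' y = 0 ↔ ∀ a b, φ (a * y * b) = 0 := by
  have h : (nullCon φ).mk' y = (nullCon φ).mk' 0 ↔ ∀ a b, φ (a * y * b) = φ (a * 0 * b) :=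
    RingCon.eq _
  simpa using h

lemma wd_mul_mul_eq_zero {T : Type*} {φ : FreeAlgebra ℚ T →ₗ[ℚ] ℚ} {y : FreeAlgebra ℚ T}
    (h : ∀ w w', φ (wd ℚ w * y * wd ℚ w') = 0) (a b : FreeAlgebra ℚ T) : φ (a * y * b) = 0 := by
  have ha : a ∈ Submodule.span ℚ (Set.range (wd ℚ)) := span_wd ℚ ▸ Submodule.mem_top
  have hb : b ∈ Submodule.span ℚ (Set.range (wd ℚ)) := span_wd ℚ ▸ Submodule.mem_top
  induction ha using Submodule.span_induction with
  | mem a ha =>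
    obtain ⟨w, rfl⟩ := ha
    induction hb using Submodule.span_induction with
    | mem b hb => obtain ⟨w', rfl⟩ := hb; exact h w w'
    | zero => rw [mul_zero, map_zero]
    | add x z _ _ hx hz => rw [mul_add, map_add, hx, hz, add_zero]
    | smul q x _ hx => rw [mul_smul_comm, map_smul, hx, smul_zero]
  | zero => rw [zero_mul, zero_mul, map_zero]
  | add x z _ _ hx hz => rw [add_mul, add_mul, map_add, hx, hz, add_zero]
  | smul q x _ hx => rw [smul_mul_assoc, smul_mul_assoc, map_smul, hx, smul_zero]

section Functional
attribute [local instance] LieRing.ofAssociativeRing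
variable {N : ℕ} {φ : FreeAlgebra ℚ (Fin n × ℕ) →ₗ[ℚ] ℚ} (H : ∀ d x y,
    (x, y) ∈ specPair colorMode d → ∀ w w', (toUA n N x = 0 → φ (wd ℚ w * y * wd ℚ w') = 0))
include H

lemma quot_eq_zero {d : Multiset ℕ × ℕ} {x : FreeAlgebra KK (Fin n × ℕ)}
    {y : FreeAlgebra ℚ (Fin n × ℕ)} (h : (x, y) ∈ specPair colorMode d) (hx : toUA n N x = 0) :
    (nullCon φ).mk' y = 0 :=
  nullCon_mk_eq_zero.mpr (wd_mul_mul_eq_zero fun w w' => H d x y h w w' hx)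

lemma quot_loop_one (i j r s : ℕ) :
    ⁅(nullCon φ).mk' (genF n ℕ i (r + 1)), (nullCon φ).mk' (genF n ℕ j s)⁆ =
      ⁅(nullCon φ).mk' (genF n ℕ i r), (nullCon φ).mk' (genF n ℕ j (s + 1))⁆ := by
  by_cases hi : i < n
  swap
  · simp only [genF, dif_neg hi, map_zero, zero_lie]
  by_cases hj : j < n
  swap
  · simp only [genF, dif_neg hj, map_zero, lie_zero]
  obtain ⟨e, he⟩ := toUA_loop N ((⟨i, hi⟩ : Fin n), r) ((⟨j, hj⟩ : Fin n), s)
  have hm : ∀ a b a' b' : ℕ, a' + b' = a + b → ∀ i j : Fin n,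
      (FreeAlgebra.ι KK (i, a') * FreeAlgebra.ι KK (j, b'),
        FreeAlgebra.ι ℚ (i, a') * FreeAlgebra.ι ℚ (j, b')) ∈
          specPair colorMode ({i.1} + {j.1}, a + b) := fun a b a' b' h i j => by
    have := specPair_mul (specPair_ι (δ := colorMode) (i, a')) (specPair_ι (δ := colorMode) (j, b'))
    rw [← h]
    exact this
  have h1 := hm (r + 1) s (r + 1) s rfl ⟨i, hi⟩ ⟨j, hj⟩
  have h2 := hm (r + 1) s r (s + 1) (by omega) ⟨i, hi⟩ ⟨j, hj⟩
  have h3 := hm (r + 1) s s (r + 1) (by omega) ⟨j, hj⟩ ⟨i, hi⟩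
  have h4 := hm (r + 1) s (s + 1) r (by omega) ⟨j, hj⟩ ⟨i, hi⟩
  rw [add_comm ({((⟨j, hj⟩ : Fin n) : ℕ)} : Multiset ℕ)] at h3 h4
  have := quot_eq_zero (y := _ * _ - _ * _ - (_ * _ - _ * _)) H
    (sub_mem (sub_mem h1 (specPair_vpow_smul e h2)) (sub_mem (specPair_vpow_smul e h3) h4)) he
  rw [LieRing.of_associative_ring_bracket, LieRing.of_associative_ring_bracket, genF, genF, genF, genF,
    dif_pos hi, dif_pos hi, dif_pos hj, dif_pos hj]
  simp only [map_sub, map_mul] at this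
  rw [← sub_eq_zero, ← this]
  abel

lemma quot_loop (i j r s u : ℕ) :
    ⁅(nullCon φ).mk' (genF n ℕ i (r + u)), (nullCon φ).mk' (genF n ℕ j s)⁆ =
      ⁅(nullCon φ).mk' (genF n ℕ i r), (nullCon φ).mk' (genF n ℕ j (s + u))⁆ := by
  induction u generalizing s with
  | zero => rfl
  | succ u ih => rw [← add_assoc, quot_loop_one H, ih, add_assoc, add_comm 1]

lemma quot_same (i r s : ℕ) :
    ⁅(nullCon φ).mk' (genF n ℕ i r), (nullCon φ).mk' (genF n ℕ i s)⁆ = 0 := by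
  have h1 := quot_loop H i i 0 s r
  have h2 := quot_loop H i i 0 r s
  rw [zero_add] at h1 h2
  have h3 : ⁅(nullCon φ).mk' (genF n ℕ i r), (nullCon φ).mk' (genF n ℕ i s)⁆ =
      -⁅(nullCon φ).mk' (genF n ℕ i r), (nullCon φ).mk' (genF n ℕ i s)⁆ := by
    conv_lhs => rw [h1, add_comm, ← h2, ← lie_skew]
  have h4 : (2 : ℚ) • ⁅(nullCon φ).mk' (genF n ℕ i r), (nullCon φ).mk' (genF n ℕ i s)⁆ = 0 := by
    rw [two_smul]
    nth_rw 1 [h3]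
    exact neg_add_cancel _
  exact (smul_eq_zero.mp h4).resolve_left two_ne_zero

lemma quot_serre {i j m : ℕ} (hi : i < n) (hj : j < n) (hij : i ≠ j)
    (hm : 1 - aC n (n - i) (n - j) = m) (h3 : m ≤ 3) (r : Fin m → ℕ) (t : ℕ) :
    symSerre (fun l => (nullCon φ).mk' (genF n ℕ i (r l))) ((nullCon φ).mk' (genF n ℕ j t)) = 0 := by
  set i' : Fin n := ⟨i, hi⟩
  set j' : Fin n := ⟨j, hj⟩
  have hrev : ∀ a : Fin n, a.rev.1 + 1 = n - a.1 := fun a => by rw [Fin.val_rev]; omega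
  have h0 := toUA_serre N (i := i') (j := j') (fun h => hij (congrArg Fin.val h)) (m := m)
    (by rw [hrev, hrev, show (i' : ℕ) = i from rfl, show (j' : ℕ) = j from rfl, hm]; rfl) r t
  have hspec : (∑ σ : Equiv.Perm (Fin m), ∑ s ∈ Finset.range (m + 1),
      ((-1 : KK) ^ s * qBinom (vpow (dC n (i'.rev.1 + 1))) m s) •
        wd KK (insertedWord (fun l => (i', r (σ l))) (j', t) s),
      ∑ σ : Equiv.Perm (Fin m), ∑ s ∈ Finset.range (m + 1),
      ((-1 : ℚ) ^ s * (m.factorial / (s.factorial * (m - s).factorial))) •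
        wd ℚ (insertedWord (fun l => (i', r (σ l))) (j', t) s)) ∈
      specPair colorMode (((j', t) :: List.ofFn fun l => (i', r l)).map colorMode).sum := by
    simp only [prod_mk_sum]
    refine sum_mem fun σ _ => sum_mem fun s hs => specPair_wd colorMode ?_ ?_
    · have hs := Finset.mem_range.mp hs
      have hd := dC_ne_zero n (i'.rev.1 + 1)
      have hz : ∀ m : ℕ, (m.factorial : ℚ) ≠ 0 := fun m => by exact_mod_cast m.factorial_ne_zero
      have h1 := mul_mem (qFact_atOne hd (m := s) (by omega)) (qFact_atOne hd (m := m - s) (by omega))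
      have h2 := specRing_inv h1 (mul_ne_zero (hz _) (hz _))
        (specRing_ne_zero algebraMap_poly_injective h1 (mul_ne_zero (hz _) (hz _)))
      have h4 := mul_mem (pow_mem (neg_mem (one_mem atOne)) s) (mul_mem (qFact_atOne hd h3) h2)
      convert h4 using 1
      exact Prod.ext (by simp only [qBinom, div_eq_mul_inv]; rfl) (by simp only [div_eq_mul_inv]; rfl)
    · refine ((insertedWord_perm _ _ s).map _).sum_eq.trans ?_
      simp only [List.map_cons, List.sum_cons, List.map_ofFn, List.sum_ofFn]
      exact congrArg _ (Equiv.sum_comp σ fun l => colorMode (i', r l))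
  have := quot_eq_zero H hspec h0
  rw [map_sum] at this
  rw [symSerre, ← this]
  refine Finset.sum_congr rfl fun σ _ => ?_
  rw [map_sum]
  refine Finset.sum_congr rfl fun s _ => ?_
  refine Eq.trans ?_ (map_smul ((nullCon φ).mkₐ ℚ) _ (wd ℚ _)).symm
  congr 1
  rw [wd, map_list_prod, List.map_map, map_insertedWord]
  simp only [genF, dif_pos hi, dif_pos hj]
  rfl

end Functional
end SpecializedRelations

section Spanning
variable {n : ℕ}

section Functional
attribute [local instance] LieRing.ofAssociativeRing
variable {N : ℕ} {φ : FreeAlgebra ℚ (Fin n × ℕ) →ₗ[ℚ] ℚ} (H : ∀ d x y,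
    (x, y) ∈ specPair colorMode d → ∀ w w', (toUA n N x = 0 → φ (wd ℚ w * y * wd ℚ w') = 0))
include H

lemma quot_far {i j : ℕ} (h : i + 2 ≤ j) (r s : ℕ) :
    ⁅(nullCon φ).mk' (genF n ℕ i r), (nullCon φ).mk' (genF n ℕ j s)⁆ = 0 := by
  by_cases hj : j < n
  swap
  · rw [genF_of_le j (not_lt.mp hj), map_zero, lie_zero]
  have := quot_serre H (i := j) (j := i) (m := 1) hj (by omega) (by omega)
    (by unfold aC; split_ifs <;> omega) (by omega) (fun _ => s) r
  rwa [symSerre_one] at this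

lemma quot_serre_two {i j : ℕ} (h : i + 1 = j ∨ j + 1 = i ∧ 0 < j) (r s t : ℕ) :
    ⁅⁅(nullCon φ).mk' (genF n ℕ j t), (nullCon φ).mk' (genF n ℕ i r)⁆,
      (nullCon φ).mk' (genF n ℕ i s)⁆ = 0 := by
  by_cases hj : j < n
  swap
  · rw [genF_of_le j (not_lt.mp hj), map_zero, zero_lie, zero_lie]
  by_cases hi : i < n
  swap
  · simp only [genF_of_le i (not_lt.mp hi), map_zero, lie_zero]
  have := quot_serre H (i := i) (j := j) (m := 2) hi hj (by omega)
    (by unfold aC; split_ifs <;> omega) (by omega) ![r, s] t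
  rw [symSerre_two _ _ (sub_eq_zero.mp ((LieRing.of_associative_ring_bracket _ _).symm.trans
    (quot_same H i _ _)))] at this
  exact (smul_eq_zero.mp this).resolve_left two_ne_zero

lemma quot_serre_three (r s u t : ℕ) :
    ⁅⁅⁅(nullCon φ).mk' (genF n ℕ 0 t), (nullCon φ).mk' (genF n ℕ 1 r)⁆,
      (nullCon φ).mk' (genF n ℕ 1 s)⁆, (nullCon φ).mk' (genF n ℕ 1 u)⁆ = 0 := by
  by_cases hi : 1 < n
  swap
  · simp only [genF_of_le 1 (not_lt.mp hi), map_zero, lie_zero]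
  have := quot_serre H (i := 1) (j := 0) (m := 3) hi (by omega) (by omega)
    (by unfold aC; split_ifs <;> omega) le_rfl ![r, s, u] t
  rw [symSerre_three _ _ fun a b => sub_eq_zero.mp
    ((LieRing.of_associative_ring_bracket _ _).symm.trans (quot_same H 1 _ _))] at this
  exact (smul_eq_zero.mp this).resolve_left (by norm_num)

lemma functional_eq_zero_of_specPair (hφ : ∀ b : Multiset (Rt n × ℕ), φ (b.toList.map fun p =>
    rootLnc (genF n ℕ) p.1.1.1 p.1.1.2.2 p.1.1.2.1 (modes p)).prod = 0) : φ = 0 := by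
  refine functional_eq_zero (genF n ℕ) (fun c h r => genF_of_le c h r) (adjoin_genF n ℕ) φ
    ?_ ?_ ?_ ?_ ?_ ?_ modes sum_modes Multiset.toList Multiset.coe_toList hφ
  · intro i j r s u
    refine nullCon_mk_eq_zero.mp ?_
    simpa only [map_sub, map_mul, LieRing.of_associative_ring_bracket, sub_eq_zero (b := _ - _)]
      using quot_loop H i j r s u
  · intro i r s
    refine nullCon_mk_eq_zero.mp ?_
    simpa only [map_sub, map_mul, LieRing.of_associative_ring_bracket] using quot_same H i r s
  · intro i j r s h
    refine nullCon_mk_eq_zero.mp ?_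
    simpa only [map_sub, map_mul, LieRing.of_associative_ring_bracket] using quot_far H h r s
  · intro i t r s
    refine nullCon_mk_eq_zero.mp ?_
    simpa only [map_sub, map_mul, LieRing.of_associative_ring_bracket] using
      quot_serre_two H (Or.inl rfl) r s t
  · intro i t r s
    refine nullCon_mk_eq_zero.mp ?_
    simpa only [map_sub, map_mul, LieRing.of_associative_ring_bracket] using
      quot_serre_two H (Or.inr ⟨rfl, by omega⟩) r s t
  · intro t r s u
    refine nullCon_mk_eq_zero.mp ?_
    simpa only [map_sub, map_mul, LieRing.of_associative_ring_bracket] using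
      quot_serre_three H r s u t

end Functional

/-- The span of the ordered products of quantum root vectors with modes at least `-N`. -/
def rootSpan (n N : ℕ) : Submodule KK (UA n (aC n) (dC n)) :=
  Submodule.span KK (Set.range fun b : Multiset (Rt n × ℕ) => RingQuot.mkAlgHom KK _ (qProd (genS n N) b))

lemma toUA_mem_rootSpan (N : ℕ) (x : FreeAlgebra KK (Fin n × ℕ)) : toUA n N x ∈ rootSpan n N := by
  have hx : x ∈ Submodule.span KK (Set.range (wd KK)) := span_wd KK ▸ Submodule.mem_top
  suffices h : ∀ w, toUA n N (wd KK w) ∈ rootSpan n N from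
    (Submodule.span_le (p := (rootSpan n N).comap (toUA n N).toLinearMap)).mpr
      (by rintro _ ⟨w, rfl⟩; exact h w) hx
  intro w
  by_contra hw
  obtain ⟨Φ, hΦ, hker⟩ := Submodule.exists_le_ker_of_notMem hw
  obtain ⟨φ, hφ, hred⟩ := exists_reduction (Φ ∘ₗ (toUA n N).toLinearMap) (w₀ := w) hΦ
  refine hφ (functional_eq_zero_of_specPair (N := N) (fun d x y h w w' hx => ?_) fun b => ?_)
  · have hw : ∀ w : List (Fin n × ℕ), (wd KK w, wd ℚ w) ∈ specPair colorMode (w.map colorMode).sum :=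
      fun w => by simpa using specPair_wd colorMode (one_mem atOne) (w := w) rfl
    refine hred _ _ _ (specPair_mul (specPair_mul (hw w) h) (hw w')) ?_
    show Φ (toUA n N (wd KK w * x * wd KK w')) = 0
    rw [map_mul (toUA n N), map_mul (toUA n N), hx, mul_zero, zero_mul, map_zero]
  · obtain ⟨d, hd⟩ := specPair_qProd b
    refine hred _ _ _ hd ?_
    have hb : toUA n N (qProd (genK n) b) ∈ rootSpan n N :=
      Submodule.subset_span ⟨b, by simp only [map_qProd, toUA_genK]⟩
    exact hker hb

end Spanning

section Injectivity
variable {n : ℕ}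

lemma toUA_surjective_eventually (x : FA n) : ∃ N₀ : ℕ, ∀ N, N₀ ≤ N →
    RingQuot.mkAlgHom KK (URel n (aC n) (dC n)) x ∈ (toUA n N).range := by
  induction x using FreeAlgebra.induction with
  | grade0 r => exact ⟨0, fun N _ => by rw [AlgHom.commutes]; exact algebraMap_mem _ r⟩
  | grade1 u =>
    refine ⟨(-u.2).toNat, fun N hN => ⟨FreeAlgebra.ι KK (u.1.rev, (u.2 + N).toNat), ?_⟩⟩
    rw [AlgHom.toRingHom_eq_coe, AlgHom.coe_toRingHom, toUA_ι, Fin.rev_rev, fg]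
    congr 3
    omega
  | mul a b ha hb =>
    obtain ⟨N, hN⟩ := ha
    obtain ⟨M, hM⟩ := hb
    exact ⟨max N M, fun K hK => by
      rw [map_mul]; exact mul_mem (hN K (by omega)) (hM K (by omega))⟩
  | add a b ha hb =>
    obtain ⟨N, hN⟩ := ha
    obtain ⟨M, hM⟩ := hb
    exact ⟨max N M, fun K hK => by
      rw [map_add]; exact add_mem (hN K (by omega)) (hM K (by omega))⟩

lemma lt_of_mem_sum_rtWeight {b : Multiset (Rt n × ℕ)} {i : ℕ}
    (h : i ∈ (b.map fun p => rtWeight p.1).sum) : i < n := by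
  rw [← map_fst_letters, Multiset.mem_map] at h
  obtain ⟨a, ha, rfl⟩ := h
  obtain ⟨p, -, hp⟩ := mem_sum_letters ha
  rw [letters, Multiset.mem_coe, List.mem_map] at hp
  obtain ⟨j, hj, rfl⟩ := hp
  have h1 := p.1.2.1
  rcases List.mem_cons.mp hj with h | h
  · dsimp only; omega
  · have := mem_rtail h; dsimp only; omega

lemma exists_map_col_eq {κ : Multiset ℕ} (h : ∀ i ∈ κ, i < n) :
    ∃ k : Fin n → ℕ, κ = (Finset.univ : Finset (Vars n k)).val.map col := by
  induction κ using Quotient.inductionOn with | _ l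
  obtain ⟨l', rfl⟩ : ∃ l' : List (Fin n), l'.map (fun i => n - 1 - i.1) = l := by
    refine ⟨l.attach.map fun i => ⟨n - 1 - i.1, by have := h i.1 i.2; omega⟩, ?_⟩
    conv_rhs => rw [← List.attach_map_subtype_val l]
    rw [List.map_map]
    refine List.map_congr_left fun i _ => ?_
    have := h i.1 i.2
    show n - 1 - (n - 1 - i.1) = i.1
    omega
  obtain ⟨L, h1, h2, h3⟩ := exists_enum (k := fun i => l'.count i) l' fun i => rfl
  refine ⟨fun i => l'.count i, ?_⟩
  have : (Finset.univ : Finset (Vars n fun i => l'.count i)).val = L :=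
    (Multiset.Nodup.ext Finset.univ.nodup (Multiset.coe_nodup.mpr h1)).mpr fun u => by simp [h2 u]
  rw [this, Multiset.map_coe]
  refine congrArg _ ?_
  conv_lhs => rw [← h3]
  rw [List.map_map]
  rfl

lemma exists_freeImage_qProd (N : ℕ) {k : Fin n → ℕ} {b : Multiset (Rt n × ℕ)}
    (hb : (b.map fun p => rtWeight p.1).sum = (Finset.univ : Finset (Vars n k)).val.map col) :
    ∃ F, freeImage (aC n) (dC n) (qProd (genS n N) b) = DirectSum.of (fun k => Fk n k) k F := by
  obtain ⟨M, hM⟩ := ((b.map letters).sum.map Prod.snd).toFinset.bddAbove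
  obtain ⟨F, -, h⟩ := freeImage_wordSpan (M := M) ((map_fst_letters b).trans hb)
    (fun a ha => hM (by simpa using ⟨a.1, ha⟩)) (qProd_mem_wordSpan (genS n N) b)
  exact ⟨F, h⟩

lemma qProd_coeff_eq_zero (N : ℕ) (s : Finset (Multiset (Rt n × ℕ)))
    (a : Multiset (Rt n × ℕ) → KK)
    (h : ∑ b ∈ s, a b • freeImage (aC n) (dC n) (qProd (genS n N) b) = 0) : ∀ b ∈ s, a b = 0 := by
  classical
  have hk : ∀ b : Multiset (Rt n × ℕ), ∃ k : Fin n → ℕ, (b.map fun p => rtWeight p.1).sum =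
      (Finset.univ : Finset (Vars n k)).val.map col := fun b =>
    exists_map_col_eq fun i hi => lt_of_mem_sum_rtWeight hi
  choose κ hκ using hk
  choose F hF using fun b => exists_freeImage_qProd N (hκ b)
  intro b hb
  refine qProd_independent N (k := κ b) (s.filter fun b' => κ b' = κ b)
    (fun b' hb' => (Finset.mem_filter.mp hb').2 ▸ hκ b') a ?_ b (Finset.mem_filter.mpr ⟨hb, rfl⟩)
  set P := (DirectSum.lof KK (Fin n → ℕ) (fun k => Fk n k) (κ b)).comp
    (DirectSum.component KK (Fin n → ℕ) (fun k => Fk n k) (κ b)) with hP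
  have hof : ∀ k G, P (DirectSum.of (fun k => Fk n k) k G) =
      if k = κ b then DirectSum.of (fun k => Fk n k) k G else 0 := fun k G => by
    rw [hP, LinearMap.comp_apply, ← DirectSum.lof_eq_of KK, DirectSum.component.of]
    split_ifs with hk
    · subst hk; rfl
    · exact map_zero _
  have hcomp := congrArg P h
  simp only [map_sum, map_smul, hF, hof, map_zero] at hcomp
  rw [← hcomp, Finset.sum_filter]
  refine Finset.sum_congr rfl fun b' _ => ?_
  rw [hF]
  split_ifs
  · rfl
  · rw [smul_zero]

lemma mk_eq_zero_of_freeImage {x : FA n} (hx : freeImage (aC n) (dC n) x = 0) :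
    RingQuot.mkAlgHom KK (URel n (aC n) (dC n)) x = 0 := by
  obtain ⟨Ψ, hΨ⟩ := exists_descent (freeImage_relation (n := n))
  obtain ⟨N, hN⟩ := toUA_surjective_eventually x
  obtain ⟨y, hy⟩ := hN N le_rfl
  have hm : RingQuot.mkAlgHom KK (URel n (aC n) (dC n)) x ∈ rootSpan n N :=
    hy ▸ toUA_mem_rootSpan N y
  obtain ⟨c, hc⟩ := Finsupp.mem_span_range_iff_exists_finsupp.mp hm
  have h0 : ∑ b ∈ c.support, c b • freeImage (aC n) (dC n) (qProd (genS n N) b) = 0 := by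
    simp only [← hΨ, ← map_smul, ← map_sum]
    rw [map_sum]
    simp only [map_smul]
    exact (congrArg Ψ hc).trans ((hΨ x).trans hx)
  have : c = 0 := by
    ext b
    by_contra hb
    exact hb (qProd_coeff_eq_zero N _ c h0 b (Finsupp.mem_support_iff.mpr hb))
  rw [← hc, this, Finsupp.sum_zero_index]

end Injectivity

section Range
variable {n : ℕ}

lemma inS_zero {k : Fin n → ℕ} : inS n (aC n) (dC n) (0 : Fk n k) :=
  ⟨0, 0, fun _ => map_zero _, fun _ _ _ _ _ _ _ => map_zero _, by rw [zero_mul, map_zero]⟩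

/-- The shuffle algebra as a subspace of the direct sum of function fields. -/
def shuffleSpace (n : ℕ) : Submodule KK (BigS n) where
  carrier := {x | ∀ k : Fin n → ℕ, inS n (aC n) (dC n) (x k)}
  zero_mem' := fun _ => inS_zero
  add_mem' {x y} hx hy k := by
    obtain ⟨f, m, h1, h2, h3⟩ := hx k
    obtain ⟨g, m', h1', h2', h3'⟩ := hy k
    refine ⟨f * xProd n k ^ m' + g * xProd n k ^ m, m + m', fun σ => ?_,
      fun i j hij hA s hs r => ?_, ?_⟩
    · rw [map_add, map_mul, map_mul, map_pow, map_pow, rename_xProd, h1, h1']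
    · rw [map_add, map_mul, map_mul, h2 i j hij hA s hs, h2' i j hij hA s hs, zero_mul, zero_mul,
        add_zero]
    · rw [map_add, map_mul _ f, map_mul _ g, ← h3, ← h3', DirectSum.add_apply]
      simp only [map_mul, map_pow]
      ring
  smul_mem' c x hx k := by
    obtain ⟨f, m, h1, h2, h3⟩ := hx k
    refine ⟨c • f, m, fun σ => by rw [map_smul, h1], fun i j hij hA s hs r => by
      rw [map_smul, h2 i j hij hA s hs, smul_zero], ?_⟩
    rw [DirectSum.smul_apply, smul_mul_assoc, h3, smul_eq_cf, cf_eq, ← map_mul,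
      MvPolynomial.smul_eq_C_mul]

lemma inS_Sy_term {k : Fin n → ℕ} {L : List (Vars n k)} (hL : L.Nodup) (hL1 : ∀ u, u ∈ L)
    (r : Vars n k → ℤ) : inS n (aC n) (dC n) (Sy (term (aC n) (dC n) L r)) := by
  obtain ⟨m, hm⟩ := (Finset.univ.image fun u => (-r u).toNat).bddAbove
  have h0 : ∀ u, 0 ≤ r u + m := fun u => by
    have := hm (Finset.mem_coe.mpr (Finset.mem_image_of_mem (fun u => (-r u).toNat)
      (Finset.mem_univ u)))
    omega
  obtain ⟨M, hM⟩ := (Finset.univ.image fun u => (r u + m).toNat).bddAbove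
  refine inS_iff.mpr ⟨m, M, ?_⟩
  have h := inX_Sy_term hL hL1 (r := fun u => (r u + m).toNat) (M := M) fun u =>
    hM (Finset.mem_coe.mpr (Finset.mem_image_of_mem (fun u => (r u + m).toNat) (Finset.mem_univ u)))
  simp only [Int.toNat_of_nonneg (h0 _)] at h
  rwa [term_shift hL hL1, Sy_mul_xProd, zpow_natCast] at h

lemma of_mem_shuffleSpace {k : Fin n → ℕ} {F : Fk n k} (hF : inS n (aC n) (dC n) F) :
    DirectSum.of (fun k => Fk n k) k F ∈ shuffleSpace n := fun l => by
  by_cases h : k = l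
  · subst h; rwa [DirectSum.of_eq_same]
  · rw [DirectSum.of_eq_of_ne _ _ _ (Ne.symm h)]; exact inS_zero

lemma range_freeImage : LinearMap.range (freeImage (aC n) (dC n)) = shuffleSpace n := by
  refine le_antisymm ?_ fun x hx => ?_
  · rw [LinearMap.range_eq_map, ← span_wd KK, Submodule.map_span_le]
    rintro _ ⟨w, rfl⟩
    obtain ⟨L, r, hL, hL1, hr⟩ := exists_vword w rfl
    rw [← hr, freeImage_vword _ _ hL hL1]
    exact of_mem_shuffleSpace (inS_Sy_term hL hL1 r)
  · classical
    rw [← DirectSum.sum_support_of x]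
    refine sum_mem fun k _ => ?_
    obtain ⟨m, M, h⟩ := inS_iff.mp (hx k)
    obtain ⟨y, hy⟩ := exists_preimage h
    exact ⟨y, hy⟩

end Range

/-- **Shuffle algebra realization of `U_v^>(Lsp_{2n})` (type `C_n`)**: the assignment
`e_{i,r} ↦ x_{i,1}^r ∈ S_{1_i}` extends to a well-defined `ℚ(v)`-algebra homomorphism
`Ψ : U_v^>(Lsp_{2n}) → S` which is an isomorphism onto the shuffle algebra `S` — i.e. a
`ℚ(v)`-linear map intertwining the multiplication with the shuffle product `⋆`, sending `1`
to `1`, injective, and with image exactly `S = ⨁_k S_k` (the set of elements all of whose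
components satisfy the pole and wheel conditions). -/
theorem shuffle_isomorphism_typeC (n : ℕ) (hn : 2 ≤ n) :
    ∃ Ψ : UA n (aC n) (dC n) →ₗ[KK] BigS n,
      (∀ a b : UA n (aC n) (dC n), Ψ (a * b) = bstar n (aC n) (dC n) (Ψ a) (Ψ b)) ∧
      Ψ 1 = DirectSum.of (fun k => Fk n k) 0 1 ∧
      (∀ (i : Fin n) (r : ℤ),
        Ψ (ug n (aC n) (dC n) i r) =
          DirectSum.of (fun k => Fk n k) (unitVec i)
            (xvr n (⟨i, ⟨0, by simp [unitVec]⟩⟩ : Vars n (unitVec i)) ^ r)) ∧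
      Function.Injective Ψ ∧
      Set.range Ψ = {x : BigS n | ∀ k : Fin n → ℕ, inS n (aC n) (dC n) (x k)} := by
  obtain ⟨Ψ, hΨ⟩ := exists_descent (freeImage_relation (n := n))
  have hsurj := RingQuot.mkAlgHom_surjective KK (URel n (aC n) (dC n))
  refine ⟨Ψ, fun a b => ?_, ?_, fun i r => ?_, ?_, ?_⟩
  · obtain ⟨x, rfl⟩ := hsurj a
    obtain ⟨y, rfl⟩ := hsurj b
    rw [← map_mul, hΨ, hΨ, hΨ, freeImage_mul]
  · rw [← map_one (RingQuot.mkAlgHom KK (URel n (aC n) (dC n))), hΨ, freeImage_one]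
  · rw [ug, hΨ, freeImage_gen]
  · refine (injective_iff_map_eq_zero Ψ).mpr fun a ha => ?_
    obtain ⟨x, rfl⟩ := hsurj a
    exact mk_eq_zero_of_freeImage ((hΨ x).symm.trans ha)
  · refine Eq.trans ?_ (congrArg (fun S : Submodule KK (BigS n) => (S : Set (BigS n)))
      (range_freeImage (n := n)))
    ext y
    constructor
    · rintro ⟨a, rfl⟩
      obtain ⟨x, rfl⟩ := hsurj a
      exact ⟨x, (hΨ x).symm⟩
    · rintro ⟨x, rfl⟩
      exact ⟨_, hΨ x⟩
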